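/- Let q ≥ 7 be a prime power with q ≠ 9, and let G be a finite group satisfying the two-prime hypothesis with normal subgroups N ≤ M such that M/N ≅ PSL_2(q) and the centralizer of M/N in G/N is trivial. Let B_1 be the union, over all M-invariant irreducible characters θ of N, of cd(G|θ) \ cd(G/N). Then |B_1| ≤ 4. -/

import Mathlib

open CategoryTheory

/-- The set of degrees of the complex irreducible characters of `G`. -/
def charDegrees (G : Type) [Group G] : Set ℕ :=
  {n | ∃ V : FDRep ℂ G, Simple V ∧ Module.finrank ℂ V = n}

/-- `G` satisfies the two-prime hypothesis: for any distinct irreducible character degrees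
`a`, `b`, the gcd `gcd a b` has at most two prime divisors counted with multiplicity. -/
def TwoPrimeHypothesis (G : Type) [Group G] : Prop :=
  ∀ a ∈ charDegrees G, ∀ b ∈ charDegrees G, a ≠ b →
    (Nat.gcd a b).primeFactorsList.length ≤ 2

/-- A character `θ` of a subgroup `N ⊴ G` is `M`-invariant if it is fixed by conjugation by
every element of `M`. -/
def IsMInvariant {G : Type} [Group G] {N : Subgroup G} (M : Subgroup G)
    (θ : FDRep ℂ N) : Prop :=
  ∀ m ∈ M, ∀ x : N, ∀ hx : m * (x : G) * m⁻¹ ∈ N,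
    θ.character ⟨m * (x : G) * m⁻¹, hx⟩ = θ.character x

/-- `cd(G|θ)`: the set of degrees of irreducible characters of `G` whose restriction to `N`
contains `θ` as a constituent (detected by a nonzero inner product of characters). -/
def charDegreesOver (G : Type) [Group G] (N : Subgroup G) (θ : FDRep ℂ N) : Set ℕ :=
  {n | ∃ V : FDRep ℂ G, Simple V ∧ Module.finrank ℂ V = n ∧
    (∑ᶠ x : N, V.character (x : G) * θ.character x⁻¹) ≠ 0}

/-- `PSL₂(F)`: the quotient of `SL₂(F)` by its center. -/
abbrev PSL2 (F : Type) [Field F] : Type :=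
  Matrix.SpecialLinearGroup (Fin 2) F ⧸
    Subgroup.center (Matrix.SpecialLinearGroup (Fin 2) F)


namespace B1

open Module

section basics

variable {G : Type} [Group G] {V W : Type} [AddCommGroup V] [Module ℂ V]
  [AddCommGroup W] [Module ℂ W]

/-- invariant subspace -/
def Inv (ρ : Representation ℂ G V) (p : Submodule ℂ V) : Prop := ∀ g, ∀ v ∈ p, ρ g v ∈ p

/-- irreducible representation -/
def Irr (ρ : Representation ℂ G V) : Prop :=
  Nontrivial V ∧ ∀ p : Submodule ℂ V, Inv ρ p → p = ⊥ ∨ p = ⊤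

/-- intertwining map -/
def IsMap (ρ : Representation ℂ G V) (σ : Representation ℂ G W) (f : V →ₗ[ℂ] W) : Prop :=
  ∀ g v, f (ρ g v) = σ g (f v)

/-- restriction to an invariant subspace -/
def res (ρ : Representation ℂ G V) (p : Submodule ℂ V) (hp : Inv ρ p) : Representation ℂ G p where
  toFun g := (ρ g).restrict (hp g)
  map_one' := by ext; simp
  map_mul' a b := by ext; simp

@[simp] theorem res_coe (ρ : Representation ℂ G V) (p : Submodule ℂ V) (hp : Inv ρ p) (g : G)
    (v : p) : ((res ρ p hp g v : p) : V) = ρ g v := rfl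

/-- minimal invariant subspace -/
def MinInv (ρ : Representation ℂ G V) (p : Submodule ℂ V) : Prop :=
  p ≠ ⊥ ∧ Inv ρ p ∧ ∀ r, r ≤ p → Inv ρ r → r = ⊥ ∨ r = p

theorem rho_inv_rho (ρ : Representation ℂ G V) (g : G) (v : V) : ρ g⁻¹ (ρ g v) = v := by
  rw [← Module.End.mul_apply, ← map_mul]; simp

theorem rho_rho_inv (ρ : Representation ℂ G V) (g : G) (v : V) : ρ g (ρ g⁻¹ v) = v := by
  rw [← Module.End.mul_apply, ← map_mul]; simp

theorem rho_mul (ρ : Representation ℂ G V) (g h : G) (v : V) : ρ (g * h) v = ρ g (ρ h v) := by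
  rw [← Module.End.mul_apply, ← map_mul]

theorem rho_inj (ρ : Representation ℂ G V) (g : G) : Function.Injective (ρ g) :=
  Function.LeftInverse.injective (g := ρ g⁻¹) (rho_inv_rho ρ g)

theorem IsMap.ker {ρ : Representation ℂ G V} {σ : Representation ℂ G W} {f : V →ₗ[ℂ] W}
    (h : IsMap ρ σ f) : Inv ρ (LinearMap.ker f) := by
  intro g v hv
  rw [LinearMap.mem_ker] at *
  rw [h, hv, map_zero]

theorem IsMap.range {ρ : Representation ℂ G V} {σ : Representation ℂ G W} {f : V →ₗ[ℂ] W}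
    (h : IsMap ρ σ f) : Inv σ (LinearMap.range f) := by
  rintro g _ ⟨v, rfl⟩
  exact ⟨ρ g v, h g v⟩

theorem IsMap.comp {U : Type} [AddCommGroup U] [Module ℂ U] {τ : Representation ℂ G U}
    {ρ : Representation ℂ G V} {σ : Representation ℂ G W}
    {f : V →ₗ[ℂ] W} {e : U →ₗ[ℂ] V} (h : IsMap ρ σ f) (h' : IsMap τ ρ e) :
    IsMap τ σ (f ∘ₗ e) := by
  intro g v
  simp [h' g v, h g (e v)]

theorem IsMap.subtype (ρ : Representation ℂ G V) (p : Submodule ℂ V) (hp : Inv ρ p) :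
    IsMap (res ρ p hp) ρ p.subtype := fun _ _ => rfl

theorem IsMap.sub {ρ : Representation ℂ G V} {σ : Representation ℂ G W} {f e : V →ₗ[ℂ] W}
    (h : IsMap ρ σ f) (h' : IsMap ρ σ e) : IsMap ρ σ (f - e) := by
  intro g v; simp [h g v, h' g v]

theorem IsMap.id (ρ : Representation ℂ G V) : IsMap ρ ρ LinearMap.id := fun _ _ => rfl

theorem IsMap.symm {ρ : Representation ℂ G V} {σ : Representation ℂ G W} {f : V ≃ₗ[ℂ] W}
    (h : IsMap ρ σ f.toLinearMap) : IsMap σ ρ f.symm.toLinearMap := by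
  intro g v
  apply f.injective
  have := h g (f.symm v)
  simp at this ⊢
  exact this.symm

theorem irr_res {ρ : Representation ℂ G V} {p : Submodule ℂ V} (h : MinInv ρ p) :
    Irr (res ρ p h.2.1) := by
  refine ⟨Submodule.nontrivial_iff_ne_bot.2 h.1, fun r hr => ?_⟩
  have h1 : Inv ρ (r.map p.subtype) := by
    rintro g _ ⟨v, hv, rfl⟩
    exact ⟨_, hr g v hv, rfl⟩
  rcases h.2.2 (r.map p.subtype) (Submodule.map_subtype_le p r) h1 with h2 | h2
  · left
    rw [eq_bot_iff]
    intro v hv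
    have h3 : (v : V) ∈ r.map p.subtype := ⟨v, hv, rfl⟩
    rw [h2] at h3
    simpa using h3
  · right
    rw [eq_top_iff]
    intro v _
    have : (v : V) ∈ r.map p.subtype := by rw [h2]; exact v.2
    obtain ⟨w, hw, hwv⟩ := this
    have : w = v := Subtype.ext hwv
    rwa [← this]

theorem minInv_of_irr_res {ρ : Representation ℂ G V} {p : Submodule ℂ V} (hp : Inv ρ p)
    (h : Irr (res ρ p hp)) : MinInv ρ p := by
  have := h.1
  refine ⟨Submodule.nontrivial_iff_ne_bot.1 h.1, hp, fun r hr hI => ?_⟩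
  rcases h.2 (r.comap p.subtype) (fun g v hv => hI g _ hv) with h1 | h1
  · left
    rw [eq_bot_iff]
    intro v hv
    have : (⟨v, hr hv⟩ : p) ∈ r.comap p.subtype := hv
    rw [h1] at this
    simpa using this
  · right
    refine le_antisymm hr fun v hv => ?_
    have : (⟨v, hv⟩ : p) ∈ r.comap p.subtype := by rw [h1]; trivial
    exact this

theorem Irr.map_bij {ρ : Representation ℂ G V} {σ : Representation ℂ G W} {f : V →ₗ[ℂ] W}
    (hρ : Irr ρ) (hσ : Irr σ) (h : IsMap ρ σ f) (h0 : f ≠ 0) : Function.Bijective f := by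
  constructor
  · rcases hρ.2 _ h.ker with h1 | h1
    · exact LinearMap.ker_eq_bot.1 h1
    · exact absurd (LinearMap.ker_eq_top.1 h1) h0
  · rcases hσ.2 _ h.range with h1 | h1
    · exact absurd (LinearMap.range_eq_bot.1 h1) h0
    · exact LinearMap.range_eq_top.1 h1

theorem Irr.map_inj {ρ : Representation ℂ G V} {σ : Representation ℂ G W} {f : V →ₗ[ℂ] W}
    (hρ : Irr ρ) (h : IsMap ρ σ f) (h0 : f ≠ 0) : Function.Injective f := by
  rcases hρ.2 _ h.ker with h1 | h1
  · exact LinearMap.ker_eq_bot.1 h1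
  · exact absurd (LinearMap.ker_eq_top.1 h1) h0

theorem Irr.map_surj {ρ : Representation ℂ G V} {σ : Representation ℂ G W} {f : V →ₗ[ℂ] W}
    (hσ : Irr σ) (h : IsMap ρ σ f) (h0 : f ≠ 0) : Function.Surjective f := by
  rcases hσ.2 _ h.range with h1 | h1
  · exact absurd (LinearMap.range_eq_bot.1 h1) h0
  · exact LinearMap.range_eq_top.1 h1

theorem Irr.equiv {ρ : Representation ℂ G V} {σ : Representation ℂ G W} (e : V ≃ₗ[ℂ] W)
    (h : IsMap ρ σ e.toLinearMap) (hρ : Irr ρ) : Irr σ := by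
  have := hρ.1
  refine ⟨e.symm.toEquiv.nontrivial, fun p hp => ?_⟩
  rcases hρ.2 (p.comap e.toLinearMap) (fun g v hv => by
    have := hp g _ hv
    rw [← h g v] at this
    exact this) with h1 | h1
  · left
    rw [eq_bot_iff]
    intro v hv
    have : e.symm v ∈ p.comap e.toLinearMap := by simpa using hv
    rw [h1] at this
    simpa using this
  · right
    rw [eq_top_iff]
    intro v _
    have : e.symm v ∈ p.comap e.toLinearMap := by rw [h1]; trivial
    simpa using this

theorem Irr.schur [FiniteDimensional ℂ V] {ρ : Representation ℂ G V} (hρ : Irr ρ)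
    {f : V →ₗ[ℂ] V} (h : IsMap ρ ρ f) : ∃ c : ℂ, f = c • LinearMap.id := by
  have := hρ.1
  obtain ⟨c, hc⟩ := Module.End.exists_eigenvalue (f : Module.End ℂ V)
  refine ⟨c, ?_⟩
  by_contra hne
  have hm : IsMap ρ ρ (f - c • LinearMap.id) := by
    intro g v; simp [h g v]
  have hi := hρ.map_inj hm (sub_ne_zero.2 hne)
  obtain ⟨v, hv⟩ := hc.exists_hasEigenvector
  have h1 : (f - c • (LinearMap.id : V →ₗ[ℂ] V)) v = 0 := by
    have := hv.apply_eq_smul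
    simp [this]
  exact hv.2 (hi (by rw [h1, map_zero]))

theorem Irr.schur2 [FiniteDimensional ℂ V] {ρ : Representation ℂ G V}
    {σ : Representation ℂ G W} (hρ : Irr ρ) (hσ : Irr σ)
    {f e : V →ₗ[ℂ] W} (hf : IsMap ρ σ f) (he : IsMap ρ σ e) (h0 : f ≠ 0) :
    ∃ c : ℂ, e = c • f := by
  let F := LinearEquiv.ofBijective f (hρ.map_bij hσ hf h0)
  have hF : IsMap ρ σ F.toLinearMap := hf
  obtain ⟨c, hc⟩ := hρ.schur (hF.symm.comp he)
  refine ⟨c, ?_⟩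
  ext v
  have := LinearMap.congr_fun hc v
  simp at this
  have h2 := congrArg F this
  simp at h2
  rw [h2]; simp [F]

theorem exists_minInv [FiniteDimensional ℂ V] (ρ : Representation ℂ G V) (p : Submodule ℂ V)
    (hp : Inv ρ p) (h0 : p ≠ ⊥) : ∃ r ≤ p, MinInv ρ r := by
  induction h : finrank ℂ p using Nat.strong_induction_on generalizing p with
  | _ n ih =>
    by_cases hm : MinInv ρ p
    · exact ⟨p, le_rfl, hm⟩
    · simp only [MinInv, not_and, not_forall, not_or] at hm
      obtain ⟨r, hr, hI, h1, h2⟩ := hm h0 hp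
      have hlt : finrank ℂ r < finrank ℂ p := Submodule.finrank_lt_finrank_of_lt (lt_of_le_of_ne hr h2)
      obtain ⟨s, hs, hms⟩ := ih _ (h ▸ hlt) r hI h1 rfl
      exact ⟨s, hs.trans hr, hms⟩

theorem inv_top (ρ : Representation ℂ G V) : Inv ρ ⊤ := fun _ _ _ => trivial

/-- averaging a linear map -/
noncomputable def avg [Fintype G] (ρ : Representation ℂ G V) (σ : Representation ℂ G W)
    (f : V →ₗ[ℂ] W) : V →ₗ[ℂ] W := ((Fintype.card G : ℂ)⁻¹) • ∑ g : G, σ g ∘ₗ f ∘ₗ ρ g⁻¹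

theorem avg_isMap [Fintype G] (ρ : Representation ℂ G V) (σ : Representation ℂ G W)
    (f : V →ₗ[ℂ] W) : IsMap ρ σ (avg ρ σ f) := by
  intro g v
  simp only [avg, LinearMap.smul_apply, LinearMap.sum_apply, LinearMap.comp_apply, map_smul, map_sum]
  congr 1
  refine Fintype.sum_equiv (Equiv.mulLeft g⁻¹) _ _ fun x => ?_
  simp only [Equiv.coe_mulLeft, ← rho_mul, mul_inv_rev, inv_inv, mul_inv_cancel_left]

theorem maschke [Finite G] (ρ : Representation ℂ G V) (p : Submodule ℂ V) (hp : Inv ρ p) :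
    ∃ f : V →ₗ[ℂ] V, IsMap ρ ρ f ∧ (∀ v, f v ∈ p) ∧ ∀ v ∈ p, f v = v := by
  have := Fintype.ofFinite G
  obtain ⟨e, he⟩ := LinearMap.exists_leftInverse_of_injective p.subtype (by simp)
  refine ⟨avg ρ ρ (p.subtype ∘ₗ e), avg_isMap _ _ _, fun v => ?_, fun v hv => ?_⟩
  · simp only [avg, LinearMap.smul_apply, LinearMap.sum_apply, LinearMap.comp_apply]
    exact p.smul_mem _ (p.sum_mem fun g _ => hp g _ (e _).2)
  · simp only [avg, LinearMap.smul_apply, LinearMap.sum_apply, LinearMap.comp_apply]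
    have h1 : ∀ g : G, ρ g (p.subtype (e (ρ g⁻¹ v))) = v := by
      intro g
      have := LinearMap.congr_fun he ⟨ρ g⁻¹ v, hp _ _ hv⟩
      simp only [LinearMap.comp_apply, Submodule.subtype_apply, LinearMap.id_apply] at this
      rw [this]
      exact rho_rho_inv ρ g v
    rw [Finset.sum_congr rfl fun g _ => h1 g]
    simp [← Nat.cast_smul_eq_nsmul ℂ, smul_smul]

theorem irr_of_end [Finite G] [Nontrivial V] (ρ : Representation ℂ G V)
    (h : ∀ f : V →ₗ[ℂ] V, IsMap ρ ρ f → ∃ c : ℂ, f = c • LinearMap.id) : Irr ρ := by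
  refine ⟨inferInstance, fun p hp => ?_⟩
  obtain ⟨f, hf, h1, h2⟩ := maschke ρ p hp
  obtain ⟨c, rfl⟩ := h f hf
  by_cases hc : c = 0
  · left
    rw [eq_bot_iff]
    intro v hv
    have := h2 v hv
    simp [hc] at this
    simp [← this]
  · right
    rw [eq_top_iff]
    intro v _
    have := p.smul_mem c⁻¹ (h1 v)
    simpa [smul_smul, hc] using this

end basics

section bridge

variable {G : Type} [Group G] [Finite G]

theorem simple_iff_irr (V : FDRep ℂ G) : Simple V ↔ Irr V.ρ := by
  have h0 : (Nat.card G : ℂ) ≠ 0 := by exact_mod_cast Nat.card_pos.ne'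
  have : NeZero (Nat.card G : ℂ) := ⟨h0⟩
  rw [FDRep.simple_iff_end_is_rank_one,
    ← LinearEquiv.finrank_eq (Representation.linHom.invariantsEquivFDRepHom V V)]
  have key : ∀ f : V →ₗ[ℂ] V, f ∈ Representation.invariants (Representation.linHom V.ρ V.ρ) ↔
      IsMap V.ρ V.ρ f := by
    intro f
    rw [Representation.mem_invariants]
    refine forall_congr' fun g => ?_
    rw [Representation.linHom_apply]
    constructor
    · intro h v
      have := LinearMap.congr_fun h (V.ρ g v)
      simp only [LinearMap.comp_apply, rho_inv_rho] at this
      exact this.symm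
    · intro h
      ext v
      have := h (V.ρ g⁻¹ v)
      rw [rho_rho_inv] at this
      simp only [LinearMap.comp_apply]
      exact this.symm
  constructor
  · intro h
    have hnt : Nontrivial V := by
      by_contra hn
      rw [not_nontrivial_iff_subsingleton] at hn
      have : Subsingleton (V →ₗ[ℂ] V) := inferInstance
      rw [finrank_zero_of_subsingleton] at h
      exact absurd h (by norm_num)
    refine irr_of_end _ fun f hf => ?_
    have hid : LinearMap.id ∈ Representation.invariants (Representation.linHom V.ρ V.ρ) :=
      (key _).2 (IsMap.id _)
    have hne : (⟨LinearMap.id, hid⟩ : Representation.invariants (Representation.linHom V.ρ V.ρ)) ≠ 0 := by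
      intro h
      obtain ⟨v, hv⟩ := exists_ne (0 : V)
      exact hv (LinearMap.congr_fun (congrArg Subtype.val h) v)
    obtain ⟨c, hc⟩ := (finrank_eq_one_iff_of_nonzero' _ hne).1 h ⟨f, (key f).2 hf⟩
    exact ⟨c, (congrArg Subtype.val hc).symm⟩
  · intro h
    have := h.1
    have hid : LinearMap.id ∈ Representation.invariants (Representation.linHom V.ρ V.ρ) :=
      (key _).2 (IsMap.id _)
    have hne : (⟨LinearMap.id, hid⟩ : Representation.invariants (Representation.linHom V.ρ V.ρ)) ≠ 0 := by
      intro h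
      obtain ⟨v, hv⟩ := exists_ne (0 : V)
      exact hv (LinearMap.congr_fun (congrArg Subtype.val h) v)
    refine (finrank_eq_one_iff_of_nonzero' _ hne).2 fun w => ?_
    obtain ⟨c, hc⟩ := h.schur ((key _).1 w.2)
    exact ⟨c, Subtype.ext hc.symm⟩

theorem mem_charDegrees {V : Type} [AddCommGroup V] [Module ℂ V] [FiniteDimensional ℂ V]
    (ρ : Representation ℂ G V) (h : Irr ρ) : finrank ℂ V ∈ charDegrees G :=
  ⟨FDRep.of ρ, (simple_iff_irr _).2 h, rfl⟩

theorem exists_map_of_sum_ne {V W : Type} [AddCommGroup V] [Module ℂ V] [FiniteDimensional ℂ V]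
    [AddCommGroup W] [Module ℂ W] [FiniteDimensional ℂ W]
    (ρ : Representation ℂ G V) (σ : Representation ℂ G W)
    (h : (∑ᶠ g : G, σ.character g * ρ.character g⁻¹) ≠ 0) : ∃ f : V →ₗ[ℂ] W, IsMap ρ σ f ∧ f ≠ 0 := by
  have := Fintype.ofFinite G
  have h0 : (Nat.card G : ℂ) ≠ 0 := by exact_mod_cast Nat.card_pos.ne'
  have := invertibleOfNonzero h0
  rw [finsum_eq_sum_of_fintype] at h
  have h1 := Representation.card_inv_mul_sum_char_mul_char_eq_finrank ρ σ
  have h2 : finrank ℂ (Representation.IntertwiningMap ρ σ) ≠ 0 := by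
    intro h3
    rw [h3] at h1
    simp [h0] at h1
    exact h h1
  have h3 : Nontrivial (Representation.IntertwiningMap ρ σ) := by
    by_contra hn
    rw [not_nontrivial_iff_subsingleton] at hn
    exact h2 (finrank_zero_of_subsingleton)
  obtain ⟨f, hf⟩ := exists_ne (0 : Representation.IntertwiningMap ρ σ)
  refine ⟨f.toLinearMap, fun g v => ?_, ?_⟩
  · exact LinearMap.congr_fun (f.2 g) v
  · intro h
    apply hf
    ext v
    exact LinearMap.congr_fun h v

theorem sum_ne_of_exists_map {V W : Type} [AddCommGroup V] [Module ℂ V] [FiniteDimensional ℂ V]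
    [AddCommGroup W] [Module ℂ W] [FiniteDimensional ℂ W]
    (ρ : Representation ℂ G V) (σ : Representation ℂ G W) (f : V →ₗ[ℂ] W) (hf : IsMap ρ σ f)
    (hf0 : f ≠ 0) : (∑ᶠ g : G, σ.character g * ρ.character g⁻¹) ≠ 0 := by
  have := Fintype.ofFinite G
  have h0 : (Nat.card G : ℂ) ≠ 0 := by exact_mod_cast Nat.card_pos.ne'
  have := invertibleOfNonzero h0
  rw [finsum_eq_sum_of_fintype]
  have h1 := Representation.card_inv_mul_sum_char_mul_char_eq_finrank ρ σ
  intro h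
  rw [h, mul_zero] at h1
  have h2 : finrank ℂ (Representation.IntertwiningMap ρ σ) = 0 := by exact_mod_cast h1.symm
  have h3 : Subsingleton (Representation.IntertwiningMap ρ σ) := by
    rwa [finrank_zero_iff] at h2
  let F : Representation.IntertwiningMap ρ σ := ⟨f, fun g => LinearMap.ext fun v => hf g v⟩
  have : F = 0 := Subsingleton.elim _ _
  exact hf0 (congrArg Representation.IntertwiningMap.toLinearMap this)

end bridge

end B1

namespace B1

open Module

section decomp

variable {G : Type} [Group G]

theorem sum_finrank {V : Type} [AddCommGroup V] [Module ℂ V] [FiniteDimensional ℂ V]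
    {ι : Type} [Fintype ι] (π : ι → V →ₗ[ℂ] V) (hs : ∑ i, π i = LinearMap.id)
    (hi : ∀ i, π i ∘ₗ π i = π i) : ∑ i, finrank ℂ (LinearMap.range (π i)) = finrank ℂ V := by
  have h1 : ∀ i, LinearMap.trace ℂ V (π i) = (finrank ℂ (LinearMap.range (π i)) : ℂ) := by
    intro i
    refine LinearMap.IsProj.trace (p := LinearMap.range (π i)) ⟨fun v => ⟨v, rfl⟩, ?_⟩
    rintro _ ⟨v, rfl⟩
    exact LinearMap.congr_fun (hi i) v
  have h2 : LinearMap.trace ℂ V (∑ i, π i) = (finrank ℂ V : ℂ) := by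
    rw [hs]; exact LinearMap.trace_id ℂ V
  rw [map_sum, Finset.sum_congr rfl fun i _ => h1 i] at h2
  exact_mod_cast h2

/-- complete reducibility, in terms of projections -/
theorem decomp [Finite G] : ∀ (n : ℕ) (V : Type) [AddCommGroup V] [Module ℂ V]
    [FiniteDimensional ℂ V] (ρ : Representation ℂ G V), finrank ℂ V = n →
    ∃ (ι : Type) (_ : Fintype ι) (π : ι → V →ₗ[ℂ] V), (∀ i, IsMap ρ ρ (π i)) ∧
      (∑ i, π i = LinearMap.id) ∧ (∀ i j, i ≠ j → π i ∘ₗ π j = 0) ∧ (∀ i, π i ∘ₗ π i = π i) ∧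
      ∀ i, MinInv ρ (LinearMap.range (π i)) := by
  intro n
  induction n using Nat.strong_induction_on with
  | _ n ih =>
  intro V _ _ _ ρ hn
  by_cases htriv : Subsingleton V
  · refine ⟨Empty, inferInstance, Empty.elim, fun i => i.elim, ?_, fun i => i.elim,
      fun i => i.elim, fun i => i.elim⟩
    ext v
    exact Subsingleton.elim _ _
  have hnt : Nontrivial V := not_subsingleton_iff_nontrivial.1 htriv
  obtain ⟨p, -, hp⟩ := exists_minInv ρ ⊤ (inv_top ρ) top_ne_bot
  obtain ⟨e, he, h1, h2⟩ := maschke ρ p hp.2.1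
  have hee : ∀ v, e (e v) = e v := fun v => h2 _ (h1 v)
  have hrange : LinearMap.range e = p := by
    apply le_antisymm
    · rintro _ ⟨v, rfl⟩; exact h1 v
    · intro v hv; exact ⟨v, h2 v hv⟩
  let K := LinearMap.ker e
  have hK : Inv ρ K := he.ker
  have hKlt : finrank ℂ K < n := by
    have := LinearMap.finrank_range_add_finrank_ker e
    have h3 : 0 < finrank ℂ (LinearMap.range e) := by
      rw [hrange]
      have := (irr_res hp).1
      exact finrank_pos
    change finrank ℂ (LinearMap.ker e) < n
    omega
  obtain ⟨ι, hι, π, a1, a2, a3, a4, a5⟩ := ih _ hKlt K (res ρ K hK) rfl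
  let c : V →ₗ[ℂ] K := LinearMap.codRestrict K (LinearMap.id - e) (fun v => by
    simp [K, hee])
  have hcK : ∀ v : K, c v = v := by
    intro v
    apply Subtype.ext
    have : e v = 0 := v.2
    simp [c, this]
  have hce : ∀ v, c (e v) = 0 := by
    intro v
    apply Subtype.ext
    simp [c, hee]
  have heK : ∀ v : K, e v = 0 := fun v => v.2
  have hcmap : IsMap ρ (res ρ K hK) c := by
    intro g v
    apply Subtype.ext
    simp [c, he g v]
  let PP : Option ι → V →ₗ[ℂ] V := fun o => o.elim e (fun i => K.subtype ∘ₗ π i ∘ₗ c)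
  refine ⟨Option ι, inferInstance, PP, ?_, ?_, ?_, ?_, ?_⟩
  · rintro (_ | i)
    · exact he
    · exact (IsMap.subtype ρ K hK).comp ((a1 i).comp hcmap)
  · rw [Fintype.sum_option]
    ext v
    have := LinearMap.congr_fun a2 (c v)
    simp only [LinearMap.sum_apply, LinearMap.id_apply] at this
    simp only [PP, Option.elim, LinearMap.add_apply, LinearMap.sum_apply, LinearMap.comp_apply,
      LinearMap.id_apply]
    rw [← map_sum, this]
    simp [c]
  · rintro (_ | i) (_ | j) hij
    · exact absurd rfl hij
    · ext v; simp [PP, heK]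
    · ext v; simp [PP, hce]
    · ext v
      have := LinearMap.congr_fun (a3 i j (by simpa using hij)) (c v)
      simp [PP, hcK] at this ⊢
      exact this
  · rintro (_ | i)
    · ext v; simp [PP, hee]
    · ext v
      have := LinearMap.congr_fun (a4 i) (c v)
      simp only [LinearMap.comp_apply] at this
      simp [PP, hcK, this]
  · rintro (_ | i)
    · change MinInv ρ (LinearMap.range e)
      rw [hrange]; exact hp
    · have hr : LinearMap.range (PP (some i)) = (LinearMap.range (π i)).map K.subtype := by
        apply le_antisymm
        · rintro _ ⟨v, rfl⟩
          exact ⟨π i (c v), ⟨_, rfl⟩, rfl⟩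
        · rintro _ ⟨_, ⟨v, rfl⟩, rfl⟩
          exact ⟨v, by simp [PP, hcK]⟩
      rw [hr]
      refine ⟨?_, ?_, ?_⟩
      · intro h
        apply (a5 i).1
        rw [eq_bot_iff]
        intro v hv
        have h3 : (v : V) ∈ (LinearMap.range (π i)).map K.subtype := ⟨v, hv, rfl⟩
        rw [h] at h3
        simpa using h3
      · rintro g _ ⟨v, hv, rfl⟩
        exact ⟨_, (a5 i).2.1 g v hv, rfl⟩
      · intro r hr hI
        rcases (a5 i).2.2 (r.comap K.subtype) (by
          intro v hv
          obtain ⟨w, hw, hwv⟩ := hr hv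
          have : w = v := Subtype.ext hwv
          rwa [← this]) (fun g v hv => hI g _ hv) with h | h
        · left
          rw [eq_bot_iff]
          intro v hv
          obtain ⟨w, hw, rfl⟩ := hr hv
          have : w ∈ r.comap K.subtype := hv
          rw [h] at this
          simpa using this
        · right
          apply le_antisymm hr
          rintro _ ⟨w, hw, rfl⟩
          rw [← h] at hw
          exact hw

theorem section_map [Finite G] {V W : Type} [AddCommGroup V] [Module ℂ V]
    [AddCommGroup W] [Module ℂ W] {ρ : Representation ℂ G V} {σ : Representation ℂ G W}
    (hσ : Irr σ) {f : V →ₗ[ℂ] W} (hf : IsMap ρ σ f) (h0 : f ≠ 0) :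
    ∃ e : W →ₗ[ℂ] V, IsMap σ ρ e ∧ f ∘ₗ e = LinearMap.id := by
  have := Fintype.ofFinite G
  obtain ⟨s, hs⟩ := LinearMap.exists_rightInverse_of_surjective f
    (LinearMap.range_eq_top.2 (hσ.map_surj hf h0))
  refine ⟨avg σ ρ s, avg_isMap _ _ _, ?_⟩
  ext v
  simp only [avg, LinearMap.comp_apply, LinearMap.smul_apply, LinearMap.sum_apply, map_smul,
    map_sum, LinearMap.id_apply]
  have h1 : ∀ g : G, f (ρ g (s (σ g⁻¹ v))) = v := by
    intro g
    rw [hf]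
    have := LinearMap.congr_fun hs (σ g⁻¹ v)
    simp only [LinearMap.comp_apply, LinearMap.id_apply] at this
    rw [this, rho_rho_inv]
  rw [Finset.sum_congr rfl fun g _ => h1 g]
  simp [← Nat.cast_smul_eq_nsmul ℂ, smul_smul]

theorem section_ne {V W : Type} [AddCommGroup V] [Module ℂ V]
    [AddCommGroup W] [Module ℂ W] [Nontrivial W]
    {f : V →ₗ[ℂ] W} {e : W →ₗ[ℂ] V} (h : f ∘ₗ e = LinearMap.id) : e ≠ 0 := by
  rintro rfl
  obtain ⟨w, hw⟩ := exists_ne (0 : W)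
  exact hw (by simpa using (LinearMap.congr_fun h w).symm)

/-- projection onto the image of an irreducible -/
theorem retract_map [Finite G] {V W : Type} [AddCommGroup V] [Module ℂ V]
    [AddCommGroup W] [Module ℂ W] {ρ : Representation ℂ G V} {σ : Representation ℂ G W}
    (hσ : Irr σ) {f : W →ₗ[ℂ] V} (hf : IsMap σ ρ f) (h0 : f ≠ 0) :
    ∃ e : V →ₗ[ℂ] W, IsMap ρ σ e ∧ e ∘ₗ f = LinearMap.id := by
  have := Fintype.ofFinite G
  obtain ⟨s, hs⟩ := LinearMap.exists_leftInverse_of_injective f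
    (LinearMap.ker_eq_bot.2 (hσ.map_inj hf h0))
  refine ⟨avg ρ σ s, avg_isMap _ _ _, ?_⟩
  ext v
  simp only [avg, LinearMap.comp_apply, LinearMap.smul_apply, LinearMap.sum_apply,
    LinearMap.id_apply]
  have h1 : ∀ g : G, σ g (s (ρ g⁻¹ (f v))) = v := by
    intro g
    rw [← hf]
    have := LinearMap.congr_fun hs (σ g⁻¹ v)
    simp only [LinearMap.comp_apply, LinearMap.id_apply] at this
    rw [this, rho_rho_inv]
  rw [Finset.sum_congr rfl fun g _ => h1 g]
  simp [← Nat.cast_smul_eq_nsmul ℂ, smul_smul]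

theorem minInv_range {V W : Type} [AddCommGroup V] [Module ℂ V]
    [AddCommGroup W] [Module ℂ W] {ρ : Representation ℂ G V} {σ : Representation ℂ G W}
    (hσ : Irr σ) {f : W →ₗ[ℂ] V} (hf : IsMap σ ρ f) (h0 : f ≠ 0) :
    MinInv ρ (LinearMap.range f) := by
  refine ⟨fun h => h0 (LinearMap.range_eq_bot.1 h), hf.range, fun r hr hI => ?_⟩
  rcases hσ.2 (r.comap f) (fun g v hv => by
    have := hI g _ hv
    rw [← hf] at this
    exact this) with h | h
  · left
    rw [eq_bot_iff]
    intro v hv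
    obtain ⟨w, rfl⟩ := hr hv
    have : w ∈ r.comap f := hv
    rw [h] at this
    have : w = 0 := by simpa using this
    simp [this]
  · right
    apply le_antisymm hr
    rintro _ ⟨w, rfl⟩
    have : w ∈ r.comap f := by rw [h]; trivial
    exact this

end decomp

section clifford

variable {G : Type} [Group G] (M : Subgroup G)
  {V W : Type} [AddCommGroup V] [Module ℂ V] [AddCommGroup W] [Module ℂ W]

/-- restriction of a representation to a subgroup -/
abbrev rs (ρ : Representation ℂ G V) : Representation ℂ M V := ρ.comp M.subtype

/-- `ρ` lies over `σ` -/
def Over (ρ : Representation ℂ G V) (σ : Representation ℂ M W) : Prop :=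
  ∃ f : W →ₗ[ℂ] V, IsMap σ (rs M ρ) f ∧ f ≠ 0

variable {M}

theorem minInv_map [M.Normal] {ρ : Representation ℂ G V} {p : Submodule ℂ V}
    (hp : MinInv (rs M ρ) p) (g : G) : MinInv (rs M ρ) (p.map (ρ g)) := by
  have hconj : ∀ (r : Submodule ℂ V) (g : G), Inv (rs M ρ) r → Inv (rs M ρ) (r.map (ρ g)) := by
    rintro r g hr m _ ⟨v, hv, rfl⟩
    refine ⟨ρ (g⁻¹ * m * g) v, hr ⟨g⁻¹ * m * g, ?_⟩ v hv, ?_⟩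
    · have := Subgroup.Normal.conj_mem (H := M) inferInstance m m.2 g⁻¹
      simpa using this
    · change ρ g (ρ _ v) = ρ m (ρ g v)
      rw [← rho_mul, ← rho_mul]
      congr 2
      group
  have hgg : ∀ (r : Submodule ℂ V) (g : G), (r.map (ρ g⁻¹)).map (ρ g) = r := by
    intro r g
    ext v
    constructor
    · rintro ⟨_, ⟨w, hw, rfl⟩, rfl⟩
      rw [rho_rho_inv]; exact hw
    · intro hv
      exact ⟨_, ⟨v, hv, rfl⟩, rho_rho_inv ρ g v⟩
  refine ⟨fun h => hp.1 ?_, hconj p g hp.2.1, fun r hr hI => ?_⟩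
  · rw [eq_bot_iff]
    intro v hv
    have : ρ g v ∈ p.map (ρ g) := ⟨v, hv, rfl⟩
    rw [h] at this
    exact (Submodule.mem_bot ℂ).2 (rho_inj ρ g (by simpa using this))
  · rcases hp.2.2 (r.map (ρ g⁻¹)) (by
      rintro _ ⟨v, hv, rfl⟩
      obtain ⟨w, hw, rfl⟩ := hr hv
      rw [rho_inv_rho]; exact hw) (hconj r g⁻¹ hI) with h | h
    · left
      rw [← hgg r g, h, Submodule.map_bot]
    · right
      rw [← hgg r g, h]

theorem finrank_map_rho [FiniteDimensional ℂ V] (ρ : Representation ℂ G V) (g : G)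
    (p : Submodule ℂ V) :
    finrank ℂ (p.map (ρ g)) = finrank ℂ p :=
  (Submodule.equivMapOfInjective (ρ g) (rho_inj ρ g) p).finrank_eq.symm

/-- some translate of an invariant subspace is not killed by a nonzero linear map -/
theorem exists_translate {ρ : Representation ℂ G V} (hρ : Irr ρ) {p : Submodule ℂ V}
    (hp : p ≠ ⊥) {f : V →ₗ[ℂ] W} (hf : f ≠ 0) : ∃ g : G, ∃ v ∈ p, f (ρ g v) ≠ 0 := by
  by_contra hcon
  push Not at hcon
  have hI : Inv ρ (⨆ g : G, p.map (ρ g)) := by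
    intro g v hv
    have : (⨆ g : G, p.map (ρ g)) ≤ (⨆ g : G, p.map (ρ g)).comap (ρ g) := by
      refine iSup_le fun g' => ?_
      rintro _ ⟨v, hv, rfl⟩
      refine Submodule.mem_iSup_of_mem (g * g') ⟨v, hv, ?_⟩
      exact rho_mul ρ g g' v
    exact this hv
  rcases hρ.2 _ hI with h | h
  · apply hp
    rw [eq_bot_iff, ← h]
    intro v hv
    exact Submodule.mem_iSup_of_mem 1 ⟨v, hv, by simp⟩
  · apply hf
    rw [← LinearMap.ker_eq_top, eq_top_iff, ← h]
    refine iSup_le fun g => ?_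
    rintro _ ⟨v, hv, rfl⟩
    exact hcon g v hv

theorem finrank_minInv_eq [Finite G] [FiniteDimensional ℂ V] [M.Normal]
    {ρ : Representation ℂ G V} (hρ : Irr ρ)
    {p r : Submodule ℂ V} (hp : MinInv (rs M ρ) p) (hr : MinInv (rs M ρ) r) :
    finrank ℂ p = finrank ℂ r := by
  obtain ⟨e, he, h1, h2⟩ := maschke (rs M ρ) r hr.2.1
  have he0 : e ≠ 0 := by
    rintro rfl
    apply hr.1
    rw [eq_bot_iff]
    intro v hv
    have := h2 v hv
    simp at this
    simp [← this]
  obtain ⟨g, v, hv, hg⟩ := exists_translate hρ hp.1 he0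
  have hpg := minInv_map hp g
  let f : (p.map (ρ g)) →ₗ[ℂ] r := LinearMap.codRestrict r (e ∘ₗ (p.map (ρ g)).subtype)
    (fun v => h1 _)
  have hf : IsMap (res _ _ hpg.2.1) (res _ _ hr.2.1) f := by
    intro m v
    apply Subtype.ext
    exact he m v
  have hf0 : f ≠ 0 := by
    intro h
    exact hg (congrArg Subtype.val (LinearMap.congr_fun h ⟨ρ g v, v, hv, rfl⟩))
  have := (LinearEquiv.ofBijective f ((irr_res hpg).map_bij (irr_res hr) hf hf0)).finrank_eq
  rw [← this, finrank_map_rho]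

theorem Over.minInv {ρ : Representation ℂ G V} {σ : Representation ℂ M W} (hσ : Irr σ)
    (h : Over M ρ σ) [FiniteDimensional ℂ W] :
    ∃ p : Submodule ℂ V, MinInv (rs M ρ) p ∧ finrank ℂ p = finrank ℂ W := by
  obtain ⟨f, hf, h0⟩ := h
  exact ⟨_, minInv_range hσ hf h0, LinearMap.finrank_range_of_inj (hσ.map_inj hf h0)⟩

theorem Over.dvd [Finite G] [FiniteDimensional ℂ V] [FiniteDimensional ℂ W] [M.Normal]
    {ρ : Representation ℂ G V} {σ : Representation ℂ M W}
    (hρ : Irr ρ) (hσ : Irr σ) (h : Over M ρ σ) : finrank ℂ W ∣ finrank ℂ V := by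
  obtain ⟨p, hp, hpW⟩ := h.minInv hσ
  obtain ⟨ι, _, π, a1, a2, a3, a4, a5⟩ := decomp _ V (rs M ρ) rfl
  rw [← sum_finrank π a2 a4]
  refine Finset.dvd_sum fun i _ => ?_
  rw [finrank_minInv_eq hρ (a5 i) hp, hpW]

/-- the conjugation action on linear maps -/
def homRep {V' : Type} [AddCommGroup V'] [Module ℂ V'] (ρ : Representation ℂ G V)
    (ρ' : Representation ℂ G V') : Representation ℂ G (V →ₗ[ℂ] V') := Representation.linHom ρ ρ'

theorem homRep_apply {V' : Type} [AddCommGroup V'] [Module ℂ V'] (ρ : Representation ℂ G V)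
    (ρ' : Representation ℂ G V') (g : G) (f : V →ₗ[ℂ] V') (v : V) :
    homRep ρ ρ' g f v = ρ' g (f (ρ g⁻¹ v)) := rfl

/-- the space of `M`-maps -/
def HomM (M : Subgroup G) {V' : Type} [AddCommGroup V'] [Module ℂ V'] (ρ : Representation ℂ G V)
    (ρ' : Representation ℂ G V') : Submodule ℂ (V →ₗ[ℂ] V') where
  carrier := {f | IsMap (rs M ρ) (rs M ρ') f}
  add_mem' := by
    intro a b ha hb m v
    simp only [LinearMap.add_apply, map_add]
    rw [ha m v, hb m v]
  zero_mem' := by intro m v; simp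
  smul_mem' := by
    intro c a ha m v
    simp only [LinearMap.smul_apply, map_smul]
    rw [ha m v]

theorem HomM_inv [M.Normal] {V' : Type} [AddCommGroup V'] [Module ℂ V'] (ρ : Representation ℂ G V)
    (ρ' : Representation ℂ G V') : Inv (homRep ρ ρ') (HomM M ρ ρ') := by
  intro g f hf m v
  simp only [homRep_apply]
  have h1 : g⁻¹ * m * g ∈ M := by
    have := Subgroup.Normal.conj_mem (H := M) inferInstance m m.2 g⁻¹
    simpa using this
  have h2 : ρ g⁻¹ (ρ m v) = ρ (g⁻¹ * m * g) (ρ g⁻¹ v) := by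
    rw [← rho_mul, ← rho_mul]; congr 2; group
  change ρ' g (f (ρ g⁻¹ (ρ m v))) = ρ' m (ρ' g (f (ρ g⁻¹ v)))
  have h3 := hf ⟨_, h1⟩ (ρ g⁻¹ v)
  change f (ρ (g⁻¹ * m * g) (ρ g⁻¹ v)) = ρ' (g⁻¹ * m * g) (f (ρ g⁻¹ v)) at h3
  rw [h2, h3, ← rho_mul, ← rho_mul]
  congr 2
  group

theorem exists_eigen_map [Finite G] [FiniteDimensional ℂ V] [M.Normal]
    (hab : ∀ a b : G, a * b * a⁻¹ * b⁻¹ ∈ M) {V' : Type} [AddCommGroup V'] [Module ℂ V']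
    [FiniteDimensional ℂ V'] {ρ : Representation ℂ G V} {ρ' : Representation ℂ G V'}
    {f : V →ₗ[ℂ] V'} (hf : IsMap (rs M ρ) (rs M ρ') f) (h0 : f ≠ 0) :
    ∃ e : V →ₗ[ℂ] V', e ≠ 0 ∧ ∀ g, ∃ c : ℂ, ∀ v, ρ' g (e (ρ g⁻¹ v)) = c • e v := by
  have hne : HomM M ρ ρ' ≠ ⊥ := by
    intro h
    have : f ∈ HomM M ρ ρ' := hf
    rw [h] at this
    exact h0 (by simpa using this)
  obtain ⟨E, hE, hmin⟩ := exists_minInv (homRep ρ ρ') _ (HomM_inv (M := M) ρ ρ') hne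
  have hirr := irr_res hmin
  have := hirr.1
  obtain ⟨e, he⟩ := exists_ne (0 : E)
  refine ⟨e, fun h => he (Subtype.ext h), fun g => ?_⟩
  have hm : IsMap (res _ E hmin.2.1) (res _ E hmin.2.1) (res _ E hmin.2.1 g) := by
    intro a x
    apply Subtype.ext
    simp only [res_coe]
    ext v
    have h3 := hE x.2 ⟨_, hab g a⟩ (ρ g⁻¹ (ρ a⁻¹ v))
    change (x : V →ₗ[ℂ] V') (ρ (g * a * g⁻¹ * a⁻¹) _) = ρ' (g * a * g⁻¹ * a⁻¹) _ at h3
    have hx : ∀ k, (x : V →ₗ[ℂ] V') (ρ k v) = ρ' k ((x : V →ₗ[ℂ] V') v) → True := fun _ _ => trivial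
    simp only [homRep_apply]
    have h4 := hE x.2 ⟨_, hab g⁻¹ a⁻¹⟩ (ρ a⁻¹ (ρ g⁻¹ v))
    change (x : V →ₗ[ℂ] V') (ρ (g⁻¹ * a⁻¹ * g⁻¹⁻¹ * a⁻¹⁻¹) _) =
      ρ' (g⁻¹ * a⁻¹ * g⁻¹⁻¹ * a⁻¹⁻¹) _ at h4
    have h5 : ρ (g⁻¹ * a⁻¹ * g⁻¹⁻¹ * a⁻¹⁻¹) (ρ a⁻¹ (ρ g⁻¹ v)) = ρ g⁻¹ (ρ a⁻¹ v) := by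
      simp only [← rho_mul]; congr 2; group
    have h6 : ρ a⁻¹ (ρ g⁻¹ v) = ρ (a⁻¹ * g⁻¹) v := (rho_mul _ _ _ _).symm
    rw [h5] at h4
    simp only [← rho_mul] at h4 ⊢
    rw [h4, ← rho_mul]
    congr 2
    group
  obtain ⟨c, hc⟩ := hirr.schur hm
  refine ⟨c, fun v => ?_⟩
  have := congrArg Subtype.val (LinearMap.congr_fun hc e)
  simp only [res_coe] at this
  exact LinearMap.congr_fun this v

theorem eigen_map_bij {V' : Type} [AddCommGroup V'] [Module ℂ V']
    {ρ : Representation ℂ G V} {ρ' : Representation ℂ G V'}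
    (hρ : Irr ρ) (hρ' : Irr ρ') {e : V →ₗ[ℂ] V'} (h0 : e ≠ 0)
    (h : ∀ g, ∃ c : ℂ, ∀ v, ρ' g (e (ρ g⁻¹ v)) = c • e v) : Function.Bijective e := by
  have key : ∀ g, ∃ c : ℂ, ∀ v, e (ρ g v) = c • ρ' g (e v) := by
    intro g
    obtain ⟨c, hc⟩ := h g⁻¹
    refine ⟨c, fun v => ?_⟩
    have := congrArg (ρ' g) (hc v)
    rw [rho_rho_inv, inv_inv, map_smul] at this
    exact this
  constructor
  · rcases hρ.2 (LinearMap.ker e) (by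
      intro g v hv
      obtain ⟨c, hc⟩ := key g
      rw [LinearMap.mem_ker] at *
      rw [hc, hv]; simp) with h1 | h1
    · exact LinearMap.ker_eq_bot.1 h1
    · exact absurd (LinearMap.ker_eq_top.1 h1) h0
  · rcases hρ'.2 (LinearMap.range e) (by
      rintro g _ ⟨v, rfl⟩
      obtain ⟨c, hc⟩ := h g
      refine ⟨c • ρ g v, ?_⟩
      rw [map_smul, ← hc, rho_inv_rho]) with h1 | h1
    · exact absurd (LinearMap.range_eq_bot.1 h1) h0
    · exact LinearMap.range_eq_top.1 h1

theorem finrank_eq_of_map [Finite G] [FiniteDimensional ℂ V] [M.Normal]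
    (hab : ∀ a b : G, a * b * a⁻¹ * b⁻¹ ∈ M) {V' : Type} [AddCommGroup V'] [Module ℂ V']
    [FiniteDimensional ℂ V'] {ρ : Representation ℂ G V} {ρ' : Representation ℂ G V'}
    (hρ : Irr ρ) (hρ' : Irr ρ')
    {f : V →ₗ[ℂ] V'} (hf : IsMap (rs M ρ) (rs M ρ') f) (h0 : f ≠ 0) :
    finrank ℂ V = finrank ℂ V' := by
  obtain ⟨e, he, h⟩ := exists_eigen_map hab hf h0
  exact (LinearEquiv.ofBijective e (eigen_map_bij hρ hρ' he h)).finrank_eq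

theorem Over.finrank_eq [Finite G] [FiniteDimensional ℂ V] [FiniteDimensional ℂ W] [M.Normal]
    (hab : ∀ a b : G, a * b * a⁻¹ * b⁻¹ ∈ M) {V' : Type} [AddCommGroup V'] [Module ℂ V']
    [FiniteDimensional ℂ V'] {ρ : Representation ℂ G V} {ρ' : Representation ℂ G V'}
    {σ : Representation ℂ M W} (hρ : Irr ρ) (hρ' : Irr ρ') (hσ : Irr σ)
    (h : Over M ρ σ) (h' : Over M ρ' σ) : finrank ℂ V = finrank ℂ V' := by
  obtain ⟨f, hf, h0⟩ := h
  obtain ⟨f', hf', h0'⟩ := h'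
  obtain ⟨e, he, hef⟩ := retract_map hσ hf h0
  refine finrank_eq_of_map hab hρ hρ' (hf'.comp he) ?_
  intro h
  apply h0'
  ext w
  have := LinearMap.congr_fun h (f w)
  have h2 := LinearMap.congr_fun hef w
  simp at this h2
  rwa [h2] at this

end clifford

section coind

variable {G : Type} [Group G] (K : Subgroup G)
  {W : Type} [AddCommGroup W] [Module ℂ W]

/-- the coinduced space -/
def coindS (σ : Representation ℂ K W) : Submodule ℂ (G → W) where
  carrier := {φ | ∀ (k : K) (g : G), φ (k * g) = σ k (φ g)}
  add_mem' := by intro a b ha hb k g; simp [ha k g, hb k g]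
  zero_mem' := by intro k g; simp
  smul_mem' := by intro c a ha k g; simp [ha k g]

/-- the coinduced representation -/
def coind (σ : Representation ℂ K W) : Representation ℂ G (coindS K σ) where
  toFun x := 
    { toFun := fun φ => ⟨fun g => φ.1 (g * x), fun k g => by
        have := φ.2 k (g * x)
        rw [← mul_assoc] at this
        exact this⟩
      map_add' := fun _ _ => rfl
      map_smul' := fun _ _ => rfl }
  map_one' := by ext φ g; simp
  map_mul' a b := by ext φ g; simp [mul_assoc]

theorem coind_apply (σ : Representation ℂ K W) (x g : G) (φ : coindS K σ) :
    (coind K σ x φ).1 g = φ.1 (g * x) := rfl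

instance [Finite G] [FiniteDimensional ℂ W] (σ : Representation ℂ K W) :
    FiniteDimensional ℂ (coindS K σ) := by infer_instance

theorem finrank_coind [Finite G] [FiniteDimensional ℂ W] (σ : Representation ℂ K W) :
    finrank ℂ (coindS K σ) = K.index * finrank ℂ W := by
  classical
  let Q := Quotient (QuotientGroup.rightRel K)
  have hk : ∀ g : G, g * (Quotient.out (Quotient.mk (QuotientGroup.rightRel K) g))⁻¹ ∈ K := by
    intro g
    have := Quotient.mk_out (s := QuotientGroup.rightRel K) g
    exact QuotientGroup.rightRel_apply.1 this
  let e : coindS K σ ≃ₗ[ℂ] (Q → W) :=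
    { toFun := fun φ q => φ.1 q.out
      map_add' := fun _ _ => rfl
      map_smul' := fun _ _ => rfl
      invFun := fun ψ => ⟨fun g => σ ⟨_, hk g⟩ (ψ (Quotient.mk _ g)), fun k g => by
        have h1 : Quotient.mk (QuotientGroup.rightRel K) (k * g) = Quotient.mk _ g := by
          apply Quotient.sound
          change (QuotientGroup.rightRel K) _ _
          rw [QuotientGroup.rightRel_apply]
          simp
        have hkk : (⟨_, hk (k * g)⟩ : K) = k * ⟨_, hk g⟩ := by
          apply Subtype.ext
          simp [h1, mul_assoc]
        change σ ⟨_, hk (k * g)⟩ (ψ (Quotient.mk _ (k * g))) = σ k (σ ⟨_, hk g⟩ (ψ (Quotient.mk _ g)))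
        rw [hkk, h1, rho_mul]⟩
      left_inv := fun φ => by
        apply Subtype.ext
        funext g
        have := φ.2 ⟨_, hk g⟩ (Quotient.out (Quotient.mk (QuotientGroup.rightRel K) g))
        simp only [inv_mul_cancel_right] at this
        exact this.symm
      right_inv := fun ψ => by
        funext q
        have h1 : Quotient.mk (QuotientGroup.rightRel K) q.out = q := Quotient.out_eq q
        change σ ⟨_, hk q.out⟩ (ψ (Quotient.mk _ q.out)) = ψ q
        have h2 : (⟨_, hk q.out⟩ : K) = 1 := by
          apply Subtype.ext
          change q.out * (Quotient.out (Quotient.mk (QuotientGroup.rightRel K) q.out))⁻¹ = 1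
          rw [h1]; simp
        rw [h2, h1]; simp }
  have : Finite Q := Quotient.finite _
  have := Fintype.ofFinite Q
  rw [e.finrank_eq, Module.finrank_pi_fintype]
  simp only [Finset.sum_const, Finset.card_univ, smul_eq_mul]
  congr 1
  rw [Subgroup.index, ← Nat.card_eq_fintype_card]
  exact Nat.card_congr (QuotientGroup.quotientRightRelEquivQuotientLeftRel K)

/-- evaluation at one -/
def ev1 (σ : Representation ℂ K W) : coindS K σ →ₗ[ℂ] W where
  toFun φ := φ.1 1
  map_add' _ _ := rfl
  map_smul' _ _ := rfl

theorem ev1_map (σ : Representation ℂ K W) : IsMap (rs K (coind K σ)) σ (ev1 K σ) := by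
  intro k φ
  have := φ.2 k 1
  change φ.1 (1 * k) = σ k (φ.1 1)
  rw [← this]; simp

theorem ev1_ne (σ : Representation ℂ K W) (p : Submodule ℂ (coindS K σ)) (hp : Inv (coind K σ) p)
    (h0 : p ≠ ⊥) : (ev1 K σ).domRestrict p ≠ 0 := by
  intro h
  apply h0
  rw [eq_bot_iff]
  intro φ hφ
  rw [Submodule.mem_bot]
  apply Subtype.ext
  funext g
  have := LinearMap.congr_fun h ⟨_, hp g φ hφ⟩
  change φ.1 (1 * g) = 0 at this
  simpa using this

variable {K}

theorem exists_over [Finite G] [FiniteDimensional ℂ W] {σ : Representation ℂ K W} (hσ : Irr σ) :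
    ∃ (V : Type) (_ : AddCommGroup V) (_ : Module ℂ V) (_ : FiniteDimensional ℂ V)
      (ρ : Representation ℂ G V), Irr ρ ∧ Over K ρ σ := by
  have hnt := hσ.1
  have : Nontrivial (coindS K σ) := by
    have h1 : 0 < finrank ℂ (coindS K σ) := by
      rw [finrank_coind]
      exact Nat.mul_pos (Nat.pos_of_ne_zero Subgroup.index_ne_zero_of_finite) finrank_pos
    exact nontrivial_of_finrank_pos h1
  obtain ⟨p, -, hp⟩ := exists_minInv (coind K σ) ⊤ (inv_top _) top_ne_bot
  have h1 : IsMap (V := p) (rs K (res _ p hp.2.1)) σ ((ev1 K σ).domRestrict p) := by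
    intro k φ
    exact ev1_map K σ k φ.1
  obtain ⟨e, he, hee⟩ := section_map hσ h1 (ev1_ne K σ p hp.2.1 hp.1)
  exact ⟨p, inferInstance, inferInstance, inferInstance, res _ p hp.2.1, irr_res hp, e, he,
    section_ne (V := p) (W := W) hee⟩

theorem Over.dvd_index [Finite G] [FiniteDimensional ℂ W] [K.Normal]
    (hab : ∀ a b : G, a * b * a⁻¹ * b⁻¹ ∈ K) {V : Type} [AddCommGroup V] [Module ℂ V]
    [FiniteDimensional ℂ V] {ρ : Representation ℂ G V} {σ : Representation ℂ K W}
    (hρ : Irr ρ) (hσ : Irr σ) (h : Over K ρ σ) :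
    finrank ℂ V ∣ K.index * finrank ℂ W := by
  have hnt := hσ.1
  obtain ⟨ι, _, π, a1, a2, a3, a4, a5⟩ := decomp _ _ (coind K σ) rfl
  rw [← finrank_coind K σ, ← sum_finrank π a2 a4]
  refine Finset.dvd_sum fun i _ => ?_
  have hp := a5 i
  have h1 : IsMap (rs K (res _ _ hp.2.1)) σ ((ev1 K σ).domRestrict (LinearMap.range (π i))) := by
    intro k φ
    exact ev1_map K σ k φ.1
  obtain ⟨e, he, hee⟩ := section_map hσ h1 (ev1_ne K σ _ hp.2.1 hp.1)
  rw [Over.finrank_eq hab hρ (irr_res hp) hσ h ⟨e, he, section_ne (V := LinearMap.range (π i)) (W := W) hee⟩]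

end coind

end B1

namespace B1

open Module TensorProduct

section tensor

variable {H : Type} [Group H] {X E : Type} [AddCommGroup X] [Module ℂ X] [FiniteDimensional ℂ X]
  [AddCommGroup E] [Module ℂ E] [FiniteDimensional ℂ E]

/-- contraction with a functional on the right factor -/
noncomputable def ctr (l : E →ₗ[ℂ] ℂ) : X ⊗[ℂ] E →ₗ[ℂ] X :=
  (TensorProduct.rid ℂ X).toLinearMap ∘ₗ TensorProduct.map LinearMap.id l

@[simp] theorem ctr_tmul (l : E →ₗ[ℂ] ℂ) (x : X) (e : E) : ctr l (x ⊗ₜ[ℂ] e) = l e • x := by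
  simp [ctr]

theorem ctr_ext {z z' : X ⊗[ℂ] E} (h : ∀ l : E →ₗ[ℂ] ℂ, ctr l z = ctr l z') : z = z' := by
  classical
  let b := Module.finBasis ℂ E
  have key : ∀ z : X ⊗[ℂ] E, z = ∑ i, (ctr (b.coord i) z) ⊗ₜ[ℂ] b i := by
    intro z
    induction z using TensorProduct.induction_on with
    | zero => simp
    | tmul x e =>
      simp only [ctr_tmul, Basis.coord_apply, TensorProduct.smul_tmul]
      rw [← TensorProduct.tmul_sum, b.sum_repr]
    | add a c ha hc =>
      conv_lhs => rw [ha, hc]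
      simp [TensorProduct.add_tmul, Finset.sum_add_distrib]
  rw [key z, key z']
  exact Finset.sum_congr rfl fun i _ => by rw [h]

theorem ctr_map (l : E →ₗ[ℂ] ℂ) (f : X →ₗ[ℂ] X) (z : X ⊗[ℂ] E) :
    ctr l (TensorProduct.map f LinearMap.id z) = f (ctr l z) := by
  induction z using TensorProduct.induction_on with
  | zero => simp
  | tmul x e => simp
  | add a c ha hc => simp [ha, hc]

theorem tensor_right {θ : Representation ℂ H X} (hθ : Irr θ) {φ : X ⊗[ℂ] E →ₗ[ℂ] X ⊗[ℂ] E}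
    (h : ∀ n z, φ (TensorProduct.map (θ n) LinearMap.id z) =
      TensorProduct.map (θ n) LinearMap.id (φ z)) :
    ∃ ψ : E →ₗ[ℂ] E, φ = TensorProduct.map LinearMap.id ψ := by
  have := hθ.1
  obtain ⟨x0, hx0⟩ := exists_ne (0 : X)
  obtain ⟨ξ, hξ⟩ := Module.Projective.exists_dual_ne_zero ℂ hx0
  -- scalar components
  have hsc : ∀ (l : E →ₗ[ℂ] ℂ) (e : E), ∃ c : ℂ, ∀ x, ctr l (φ (x ⊗ₜ e)) = c • x := by
    intro l e
    let f : X →ₗ[ℂ] X := ctr l ∘ₗ φ ∘ₗ (TensorProduct.mk ℂ X E).flip e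
    have hf : IsMap θ θ f := by
      intro n x
      have := h n (x ⊗ₜ e)
      simp only [TensorProduct.map_tmul, LinearMap.id_apply] at this
      simp only [f, LinearMap.comp_apply, LinearMap.flip_apply, TensorProduct.mk_apply]
      rw [this, ctr_map]
    obtain ⟨c, hc⟩ := hθ.schur hf
    exact ⟨c, fun x => by simpa [f] using LinearMap.congr_fun hc x⟩
  let ev : X ⊗[ℂ] E →ₗ[ℂ] E := (TensorProduct.lid ℂ E).toLinearMap ∘ₗ
    TensorProduct.map ((ξ x0)⁻¹ • ξ) LinearMap.id
  have hev : ∀ (l : E →ₗ[ℂ] ℂ) z, l (ev z) = (ξ x0)⁻¹ * ξ (ctr l z) := by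
    intro l z
    induction z using TensorProduct.induction_on with
    | zero => simp
    | tmul x e => simp [ev]; ring
    | add a c ha hc => simp [ha, hc, mul_add]
  refine ⟨ev ∘ₗ φ ∘ₗ (TensorProduct.mk ℂ X E x0), ?_⟩
  apply TensorProduct.ext'
  intro x e
  apply ctr_ext
  intro l
  obtain ⟨c, hc⟩ := hsc l e
  simp only [TensorProduct.map_tmul, LinearMap.comp_apply, TensorProduct.mk_apply,
    LinearMap.id_apply, ctr_tmul]
  rw [hev, hc, hc, map_smul, smul_eq_mul]
  congr 1
  field_simp

theorem tensor_left {α : Representation ℂ H E} (hα : Irr α) {φ : X ⊗[ℂ] E →ₗ[ℂ] X ⊗[ℂ] E}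
    (h : ∀ n z, φ (TensorProduct.map LinearMap.id (α n) z) =
      TensorProduct.map LinearMap.id (α n) (φ z)) :
    ∃ ψ : X →ₗ[ℂ] X, φ = TensorProduct.map ψ LinearMap.id := by
  let c := TensorProduct.comm ℂ X E
  have hc : ∀ (f : E →ₗ[ℂ] E) z, c (TensorProduct.map LinearMap.id f z) =
      TensorProduct.map f LinearMap.id (c z) := by
    intro f z
    induction z using TensorProduct.induction_on with
    | zero => simp
    | tmul x e => simp [c]
    | add a b ha hb => simp only [map_add, ha, hb]
  have hcs : ∀ (f : E →ₗ[ℂ] E) z, c.symm (TensorProduct.map f LinearMap.id z) =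
      TensorProduct.map LinearMap.id f (c.symm z) := by
    intro f z
    apply c.injective
    rw [hc]; simp
  obtain ⟨ψ, hψ⟩ := tensor_right (X := E) (E := X) hα
    (φ := c.toLinearMap ∘ₗ φ ∘ₗ c.symm.toLinearMap) (by
      intro n z
      simp only [LinearMap.comp_apply, LinearEquiv.coe_coe]
      rw [hcs, h, hc])
  refine ⟨ψ, ?_⟩
  apply TensorProduct.ext'
  intro x e
  have := LinearMap.congr_fun hψ (e ⊗ₜ x)
  simp only [LinearMap.comp_apply, LinearEquiv.coe_coe, TensorProduct.map_tmul,
    LinearMap.id_apply] at this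
  have h2 := congrArg c.symm this
  rw [LinearEquiv.symm_apply_apply] at h2
  simpa [c] using h2

end tensor

section perf

variable {G : Type} [Group G] {N M : Subgroup G} (hNM : N ≤ M)
  {W W' : Type} [AddCommGroup W] [Module ℂ W] [AddCommGroup W'] [Module ℂ W']

/-- restriction from `M` to `N` -/
abbrev rn (σ : Representation ℂ M W) : Representation ℂ N W := σ.comp (Subgroup.inclusion hNM)

/-- no nontrivial linear characters of `M/N` -/
def Perf : Prop := ∀ κ : M →* ℂˣ, (∀ n (hn : n ∈ N), κ ⟨n, hNM hn⟩ = 1) → κ = 1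

variable {hNM}

theorem Perf.isMap [N.Normal] [FiniteDimensional ℂ W] (hp : Perf hNM)
    {σ : Representation ℂ M W} {σ' : Representation ℂ M W'} (h : Irr (rn hNM σ))
    (h' : Irr (rn hNM σ')) {f : W →ₗ[ℂ] W'} (hf : IsMap (rn hNM σ) (rn hNM σ') f) :
    IsMap σ σ' f := by
  by_cases h0 : f = 0
  · subst h0; intro m v; simp
  have h1 : ∀ m : M, ∃ c : ℂ, σ' m ∘ₗ f ∘ₗ σ m⁻¹ = c • f := by
    intro m
    refine h.schur2 h' hf ?_ h0
    intro n v
    have hn : (m : G)⁻¹ * n * m ∈ N := by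
      have := Subgroup.Normal.conj_mem (H := N) inferInstance n n.2 (m : G)⁻¹
      simpa using this
    have h3 := hf ⟨_, hn⟩ (σ m⁻¹ v)
    have e1 : (Subgroup.inclusion hNM ⟨_, hn⟩ : M) = m⁻¹ * Subgroup.inclusion hNM n * m := by
      apply Subtype.ext; simp
    simp only [rn, MonoidHom.comp_apply, e1, ← rho_mul, LinearMap.comp_apply] at h3 ⊢
    rw [show m⁻¹ * Subgroup.inclusion hNM n = m⁻¹ * Subgroup.inclusion hNM n * m * m⁻¹ by group,
      h3, ← rho_mul]
    congr 2
    group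
  choose c hc using h1
  obtain ⟨w, hw⟩ : ∃ w, f w ≠ 0 := by
    by_contra hcon
    push Not at hcon
    exact h0 (LinearMap.ext hcon)
  have hc' : ∀ m v, σ' m (f v) = c m • f (σ m v) := by
    intro m v
    have := LinearMap.congr_fun (hc m) (σ m v)
    simpa [rho_inv_rho] using this
  let k : M →* ℂ :=
    { toFun := c
      map_one' := by
        have := hc' 1 w
        simp only [map_one, Module.End.one_apply] at this
        have h2 : (c 1 - 1) • f w = 0 := by rw [sub_smul, ← this]; simp
        rcases smul_eq_zero.1 h2 with h3 | h3
        · exact sub_eq_zero.1 h3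
        · exact absurd h3 hw
      map_mul' := by
        intro a b
        have h1 := hc' (a * b) (σ (a * b)⁻¹ w)
        rw [rho_rho_inv, rho_mul σ' a b, hc' b, map_smul, hc' a, ← rho_mul, ← rho_mul] at h1
        simp only [mul_inv_rev] at h1
        rw [show a * b * (b⁻¹ * a⁻¹) = 1 by group] at h1
        simp only [map_one, Module.End.one_apply, smul_smul] at h1
        have h2 : (c (a * b) - c a * c b) • f w = 0 := by
          rw [sub_smul, ← h1, mul_comm (c a)]; simp
        rcases smul_eq_zero.1 h2 with h3 | h3
        · exact sub_eq_zero.1 h3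
        · exact absurd h3 hw }
  have hk := hp k.toHomUnits (by
    intro n hn
    ext
    have h2 := hf ⟨n, hn⟩ w
    change c ⟨n, hNM hn⟩ = 1
    have h3 := hc' ⟨n, hNM hn⟩ w
    change f (σ ⟨n, hNM hn⟩ w) = σ' ⟨n, hNM hn⟩ (f w) at h2
    have h4 : f (σ ⟨n, hNM hn⟩ w) ≠ 0 := by
      rw [h2]
      intro h5
      exact hw (rho_inj σ' _ (by rw [h5, map_zero]))
    rw [← h2] at h3
    have h2 : (c ⟨n, hNM hn⟩ - 1) • f (σ ⟨n, hNM hn⟩ w) = 0 := by rw [sub_smul, ← h3]; simp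
    rcases smul_eq_zero.1 h2 with h3 | h3
    · exact sub_eq_zero.1 h3
    · exact absurd h3 h4)
  intro m v
  have h1 : c m = 1 := by
    have := congrArg (fun κ : M →* ℂˣ => (κ m : ℂ)) hk
    simpa [k] using this
  rw [hc' m v, h1, one_smul]

/-- all `M`-constituents are `N`-irreducible if one is -/
theorem minInv_N [Finite G] [N.Normal] [M.Normal] {V : Type} [AddCommGroup V] [Module ℂ V]
    [FiniteDimensional ℂ V]
    {ρ : Representation ℂ G V} (hρ : Irr ρ) {p r : Submodule ℂ V} (hp : MinInv (rs M ρ) p)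
    (hpN : MinInv (rs N ρ) p) (hr : MinInv (rs M ρ) r) (hNM : N ≤ M) : MinInv (rs N ρ) r := by
  obtain ⟨e, he, h1, h2⟩ := maschke (rs M ρ) r hr.2.1
  have he0 : e ≠ 0 := by
    rintro rfl
    apply hr.1
    rw [eq_bot_iff]
    intro v hv
    have := h2 v hv
    simp at this
    simp [← this]
  obtain ⟨g, v, hv, hg⟩ := exists_translate hρ hp.1 he0
  have hpg := minInv_map hp g
  have hpgN := minInv_map hpN g
  let f : (p.map (ρ g)) →ₗ[ℂ] r := LinearMap.codRestrict r (e ∘ₗ (p.map (ρ g)).subtype)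
    (fun v => h1 _)
  have hf : IsMap (res _ _ hpg.2.1) (res _ _ hr.2.1) f := by
    intro m v
    apply Subtype.ext
    exact he m v
  have hf0 : f ≠ 0 := by
    intro h
    exact hg (congrArg Subtype.val (LinearMap.congr_fun h ⟨ρ g v, v, hv, rfl⟩))
  have hrN : Inv (rs N ρ) r := fun n v hv => hr.2.1 ⟨n, hNM n.2⟩ v hv
  refine minInv_of_irr_res hrN ?_
  refine Irr.equiv (LinearEquiv.ofBijective f ((irr_res hpg).map_bij (irr_res hr) hf hf0)) ?_
    (irr_res hpgN)
  intro n v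
  exact hf ⟨n, hNM n.2⟩ v

/-- `N`-endomorphisms commute with `M` -/
theorem Perf.end_isMap [Finite G] [N.Normal] [M.Normal] (hperf : Perf hNM)
    {V : Type} [AddCommGroup V] [Module ℂ V] [FiniteDimensional ℂ V]
    {ρ : Representation ℂ G V} (hρ : Irr ρ) {σ : Representation ℂ M W}
    (hσ : Irr (rn hNM σ)) (ho : Over M ρ σ) {f : V →ₗ[ℂ] V} (hf : IsMap (rs N ρ) (rs N ρ) f) :
    IsMap (rs M ρ) (rs M ρ) f := by
  obtain ⟨i, hi, hi0⟩ := ho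
  have hσM : Irr σ := ⟨hσ.1, fun p hp => hσ.2 p fun n v hv => hp _ v hv⟩
  have hp := minInv_range hσM hi hi0
  have hiN : IsMap (rn hNM σ) (rs N ρ) i := fun n v => hi ⟨n, hNM n.2⟩ v
  have hpN := minInv_range hσ hiN hi0
  obtain ⟨ι, _, π, a1, a2, a3, a4, a5⟩ := decomp _ V (rs M ρ) rfl
  have hN := fun i => minInv_N hρ hp hpN (a5 i) hNM
  have key : ∀ i j, IsMap (rs M ρ) (rs M ρ) (π j ∘ₗ f ∘ₗ π i) := by
    intro i j
    let F : LinearMap.range (π i) →ₗ[ℂ] LinearMap.range (π j) :=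
      LinearMap.codRestrict _ (π j ∘ₗ f ∘ₗ (LinearMap.range (π i)).subtype) (fun v => ⟨_, rfl⟩)
    have hF := hperf.isMap (σ := res _ _ (a5 i).2.1) (σ' := res _ _ (a5 j).2.1)
      (irr_res (hN i)) (irr_res (hN j)) (f := F) (by
        intro n v
        apply Subtype.ext
        have h1 := hf n v
        have h2 := a1 j ⟨n, hNM n.2⟩ (f v)
        change π j (f (ρ n v)) = ρ n (π j (f v))
        change f (ρ n v) = ρ n (f v) at h1
        rw [h1]
        exact h2)
    intro m v
    have h1 := congrArg Subtype.val (hF m ⟨π i v, v, rfl⟩)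
    change π j (f (ρ m (π i v))) = ρ m (π j (f (π i v))) at h1
    have h2 := a1 i m v
    change π j (f (π i (ρ m v))) = ρ m (π j (f (π i v)))
    change π i (ρ m v) = ρ m (π i v) at h2
    rw [h2, h1]
  have hfs : ∀ v, f v = ∑ j, ∑ i, π j (f (π i v)) := by
    intro v
    have e1 : ∀ v, ∑ i, π i v = v := by
      intro v
      simpa using LinearMap.congr_fun a2 v
    conv_lhs => rw [← e1 (f v)]
    refine Finset.sum_congr rfl fun j _ => ?_
    conv_lhs => rw [← e1 v]
    simp
  intro m v
  rw [hfs, hfs, map_sum]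
  refine Finset.sum_congr rfl fun j _ => ?_
  rw [map_sum]
  exact Finset.sum_congr rfl fun i _ => key i j m v

/-- Lemma T -/
theorem Perf.tprod_irr [Finite G] [N.Normal] [M.Normal] (hperf : Perf hNM)
    {V A : Type} [AddCommGroup V] [Module ℂ V] [FiniteDimensional ℂ V]
    [AddCommGroup A] [Module ℂ A] [FiniteDimensional ℂ A]
    {ρ : Representation ℂ G V} (hρ : Irr ρ) {σ : Representation ℂ M W}
    (hσ : Irr (rn hNM σ)) (ho : Over M ρ σ) {α : Representation ℂ G A}
    (hα : Irr (rs M α)) (hαN : ∀ n ∈ N, α n = 1) : Irr (ρ.tprod α) := by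
  have := hρ.1
  have := hα.1
  have hnt : Nontrivial (V ⊗[ℂ] A) := by
    apply nontrivial_of_finrank_pos (R := ℂ)
    rw [Module.finrank_tensorProduct]
    exact Nat.mul_pos finrank_pos finrank_pos
  refine irr_of_end _ fun φ hφ => ?_
  have h1 : ∀ (m : M) (z : V ⊗[ℂ] A), φ (TensorProduct.map (ρ m) LinearMap.id z) =
      TensorProduct.map (ρ m) LinearMap.id (φ z) := by
    intro m z
    induction z using TensorProduct.induction_on with
    | zero => simp
    | add a b ha hb => simp only [map_add, ha, hb]
    | tmul v a =>
      apply ctr_ext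
      intro l
      let f : V →ₗ[ℂ] V := ctr l ∘ₗ φ ∘ₗ (TensorProduct.mk ℂ V A).flip a
      have hf : IsMap (rs N ρ) (rs N ρ) f := by
        intro n x
        have := hφ n (x ⊗ₜ a)
        simp only [Representation.tprod_apply, TensorProduct.map_tmul, hαN n n.2,
          Module.End.one_apply] at this
        change ctr l (φ ((ρ n x) ⊗ₜ a)) = ρ n (ctr l (φ (x ⊗ₜ a)))
        rw [this, ← ctr_map]
        rfl
      have h2 := hperf.end_isMap hρ hσ ho hf m v
      change ctr l (φ ((ρ m v) ⊗ₜ a)) = ρ m (ctr l (φ (v ⊗ₜ a))) at h2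
      rw [ctr_map, ← h2]
      simp
  have h2 : ∀ (m : M) (z : V ⊗[ℂ] A), φ (TensorProduct.map LinearMap.id (rs M α m) z) =
      TensorProduct.map LinearMap.id (rs M α m) (φ z) := by
    intro m z
    have e1 : ∀ w : V ⊗[ℂ] A, TensorProduct.map LinearMap.id (rs M α m) w =
        TensorProduct.map (ρ (m⁻¹ : M)) LinearMap.id (ρ.tprod α m w) := by
      intro w
      rw [Representation.tprod_apply, ← LinearMap.comp_apply, ← TensorProduct.map_comp]
      congr 2
      ext v
      change v = ρ ((m : G)⁻¹) (ρ m v)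
      rw [rho_inv_rho]
    rw [e1, e1, h1, hφ]
  obtain ⟨ψ, rfl⟩ := tensor_left hα h2
  obtain ⟨a, ha⟩ := exists_ne (0 : A)
  obtain ⟨l, hl⟩ := Module.Projective.exists_dual_ne_zero ℂ ha
  have h3 : IsMap ρ ρ ψ := by
    intro g v
    have h4 := hφ g (v ⊗ₜ α g⁻¹ a)
    simp only [Representation.tprod_apply, TensorProduct.map_tmul, LinearMap.id_apply,
      rho_rho_inv] at h4
    have h5 := congrArg (ctr l) h4
    simp only [ctr_tmul] at h5
    exact smul_right_injective _ hl h5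
  obtain ⟨c, hc⟩ := hρ.schur h3
  refine ⟨c, ?_⟩
  rw [hc]
  apply TensorProduct.ext'
  intro v a
  simp [TensorProduct.smul_tmul']

/-- In case of index two: if the constituents are `G`-invariant, `σ` extends. -/
theorem Perf.index_two [Finite G] [N.Normal] [M.Normal] (hperf : Perf hNM)
    {V : Type} [AddCommGroup V] [Module ℂ V] [FiniteDimensional ℂ V] [FiniteDimensional ℂ W]
    {ρ : Representation ℂ G V} (hρ : Irr ρ) {σ : Representation ℂ M W}
    (hσ : Irr (rn hNM σ)) (ho : Over M ρ σ) (h2 : M.index = 2)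
    (hinv : ∀ g : G, ∃ A : W →ₗ[ℂ] W, A ≠ 0 ∧ ∀ (n n' : N) (w : W), (n' : G) = g * n * g⁻¹ →
      A (rn hNM σ n w) = rn hNM σ n' (A w)) : finrank ℂ V = finrank ℂ W := by
  have ho' := ho
  obtain ⟨f, hf, hf0⟩ := ho
  have hσM : Irr σ := ⟨hσ.1, fun p hp => hσ.2 p fun n v hv => hp _ v hv⟩
  have hfinj := hσM.map_inj hf hf0
  have hp := minInv_range hσM hf hf0
  by_cases hall : ∀ g, (LinearMap.range f).map (ρ g) ≤ LinearMap.range f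
  · rcases hρ.2 (LinearMap.range f) (fun g v hv => hall g ⟨v, hv, rfl⟩) with h | h
    · exact absurd (LinearMap.range_eq_bot.1 h) hf0
    · have := (LinearEquiv.ofBijective f ⟨hfinj, LinearMap.range_eq_top.1 h⟩).finrank_eq
      exact this.symm
  exfalso
  push Not at hall
  obtain ⟨g, hg⟩ := hall
  have hgM : g ∉ M := by
    intro hgM
    apply hg
    rintro _ ⟨_, ⟨w, rfl⟩, rfl⟩
    exact ⟨σ ⟨g, hgM⟩ w, hf ⟨g, hgM⟩ w⟩
  have hgg : g * g ∈ M := by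
    rw [Subgroup.mul_mem_iff_of_index_two h2]
  have hcase : ∀ x : G, x ∈ M ∨ ∃ m ∈ M, x = g * m := by
    intro x
    by_cases hx : x ∈ M
    · exact Or.inl hx
    · right
      refine ⟨g⁻¹ * x, ?_, by group⟩
      rw [Subgroup.mul_mem_iff_of_index_two h2]
      simp [hx, hgM]
  -- conjugation by g on M-endomorphisms
  let cj : (V →ₗ[ℂ] V) → (V →ₗ[ℂ] V) := fun T => ρ g ∘ₗ T ∘ₗ ρ g⁻¹
  have hcjM : ∀ T, IsMap (rs M ρ) (rs M ρ) T → IsMap (rs M ρ) (rs M ρ) (cj T) := by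
    intro T hT
    exact HomM_inv (M := M) ρ ρ g T hT
  have hcjcj : ∀ T, IsMap (rs M ρ) (rs M ρ) T → cj (cj T) = T := by
    intro T hT
    ext v
    have := hT ⟨g * g, hgg⟩ (ρ g⁻¹ (ρ g⁻¹ v))
    change T (ρ (g * g) (ρ g⁻¹ (ρ g⁻¹ v))) = ρ (g * g) (T (ρ g⁻¹ (ρ g⁻¹ v))) at this
    change ρ g (ρ g (T (ρ g⁻¹ (ρ g⁻¹ v)))) = T v
    rw [← rho_mul, ← this]
    simp only [← rho_mul]
    simp
  have hminus : ∀ T, IsMap (rs M ρ) (rs M ρ) T → cj T = -T → ¬ Function.Bijective T → T = 0 := by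
    intro T hT hcT hb
    by_contra h0
    apply hb
    refine eigen_map_bij hρ hρ h0 fun x => ?_
    rcases hcase x with hx | ⟨m, hm, rfl⟩
    · refine ⟨1, fun v => ?_⟩
      have := hT ⟨x, hx⟩ (ρ x⁻¹ v)
      change T (ρ x (ρ x⁻¹ v)) = ρ x (T (ρ x⁻¹ v)) at this
      rw [← this, rho_rho_inv, one_smul]
    · refine ⟨-1, fun v => ?_⟩
      have := hT ⟨m, hm⟩ (ρ (g * m)⁻¹ v)
      change T (ρ m (ρ (g * m)⁻¹ v)) = ρ m (T (ρ (g * m)⁻¹ v)) at this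
      rw [rho_mul, ← this, ← rho_mul]
      have h3 := LinearMap.congr_fun hcT v
      change ρ g (T (ρ g⁻¹ v)) = - T v at h3
      rw [show m * (g * m)⁻¹ = g⁻¹ by group, h3]
      simp
  have hplus : ∀ T, IsMap (rs M ρ) (rs M ρ) T → cj T = T → ∃ c : ℂ, T = c • LinearMap.id := by
    intro T hT hcT
    apply hρ.schur
    intro x v
    rcases hcase x with hx | ⟨m, hm, rfl⟩
    · exact hT ⟨x, hx⟩ v
    · have := hT ⟨m, hm⟩ v
      change T (ρ m v) = ρ m (T v) at this
      have h3 := LinearMap.congr_fun hcT (ρ g (ρ m v))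
      change ρ g (T (ρ g⁻¹ (ρ g (ρ m v)))) = T (ρ g (ρ m v)) at h3
      rw [rho_mul, rho_mul, ← this, ← h3, rho_inv_rho]
  have hadd : ∀ T S, cj (T + S) = cj T + cj S := by
    intro T S; ext v; simp [cj]
  have hsub : ∀ T S, cj (T - S) = cj T - cj S := by
    intro T S; ext v; simp [cj]
  have hsm : ∀ (c : ℂ) T, cj (c • T) = c • cj T := by
    intro T S; ext v; simp [cj]
  have hMadd : ∀ T S, IsMap (rs M ρ) (rs M ρ) T → IsMap (rs M ρ) (rs M ρ) S →
    IsMap (rs M ρ) (rs M ρ) (T + S) := fun T S a b => (HomM M ρ ρ).add_mem a b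
  have hMsm : ∀ (c : ℂ) T, IsMap (rs M ρ) (rs M ρ) T →
    IsMap (rs M ρ) (rs M ρ) (c • T) := fun c T a => (HomM M ρ ρ).smul_mem c a
  have := hρ.1
  have hDD : ∀ D D', IsMap (rs M ρ) (rs M ρ) D → cj D = -D → IsMap (rs M ρ) (rs M ρ) D' →
      cj D' = -D' → D ∘ₗ D' = D' ∘ₗ D := by
    intro D D' h1 h2 h3 h4
    by_cases hb : Function.Bijective D
    · let e := LinearEquiv.ofBijective D hb
      obtain ⟨c, hc⟩ := Module.End.exists_eigenvalue (e.symm.toLinearMap ∘ₗ D' : Module.End ℂ V)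
      obtain ⟨v, hv⟩ := hc.exists_hasEigenvector
      have hv1 := hv.apply_eq_smul
      have hv2 : D' v = c • D v := by
        have := congrArg e hv1
        simp at this
        exact this
      have h5 : D' - c • D = 0 := by
        apply hminus _ (h3.sub (hMsm c D h1))
        · rw [hsub, hsm, h2, h4]; ext v; simp; abel
        · intro hbb
          apply hv.2
          apply hbb.1
          simp [hv2]
      rw [sub_eq_zero.1 h5]
      ext v; simp
    · rw [hminus D h1 h2 hb]; ext v; simp
  have hcomm : ∀ T S, IsMap (rs M ρ) (rs M ρ) T → IsMap (rs M ρ) (rs M ρ) S →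
      ∀ v, T (S v) = S (T v) := by
    intro T S hT hS v
    obtain ⟨c, hc⟩ := hplus (T + cj T) (hMadd _ _ hT (hcjM T hT)) (by
      rw [hadd, hcjcj T hT, add_comm])
    obtain ⟨d, hd⟩ := hplus (S + cj S) (hMadd _ _ hS (hcjM S hS)) (by
      rw [hadd, hcjcj S hS, add_comm])
    have h5 := hDD (T - cj T) (S - cj S) (hT.sub (hcjM T hT)) (by
      rw [hsub, hcjcj T hT]; abel) (hS.sub (hcjM S hS)) (by rw [hsub, hcjcj S hS]; abel)
    have hT2 : ∀ w, (T - cj T) w = (2 : ℂ) • T w - c • w := by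
      intro w
      have := LinearMap.congr_fun hc w
      simp only [LinearMap.add_apply, LinearMap.smul_apply, LinearMap.id_apply] at this
      rw [LinearMap.sub_apply, ← this, two_smul]; abel
    have hS2 : ∀ w, (S - cj S) w = (2 : ℂ) • S w - d • w := by
      intro w
      have := LinearMap.congr_fun hd w
      simp only [LinearMap.add_apply, LinearMap.smul_apply, LinearMap.id_apply] at this
      rw [LinearMap.sub_apply, ← this, two_smul]; abel
    have h6 := LinearMap.congr_fun h5 v
    simp only [LinearMap.comp_apply, hT2, hS2, map_sub, map_smul] at h6
    have h7 : (4 : ℂ) • T (S v) = (4 : ℂ) • S (T v) := by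
      rw [← sub_eq_zero] at h6 ⊢
      rw [← h6]
      module
    exact smul_right_injective V (by norm_num : (4 : ℂ) ≠ 0) h7
  -- the contradiction
  obtain ⟨A, hA0, hA⟩ := hinv g⁻¹
  obtain ⟨e, he, hef⟩ := retract_map hσM hf hf0
  let F : W →ₗ[ℂ] V := ρ g ∘ₗ f ∘ₗ A
  have hFN : IsMap (rn hNM σ) (rs N ρ) F := by
    intro n w
    have hn : g⁻¹ * n * g ∈ N := by
      have := Subgroup.Normal.conj_mem (H := N) inferInstance n n.2 g⁻¹
      simpa using this
    have h3 := hA n ⟨_, hn⟩ w (by simp)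
    change ρ g (f (A _)) = ρ n (ρ g (f (A w)))
    rw [h3]
    have h4 := hf ⟨g⁻¹ * n * g, hNM hn⟩ (A w)
    change f (σ _ _) = ρ (g⁻¹ * n * g) _ at h4
    change ρ g (f (σ ⟨g⁻¹ * n * g, hNM hn⟩ _)) = _
    rw [h4, ← rho_mul, ← rho_mul]
    congr 2
    group
  have heN : IsMap (rs N ρ) (rn hNM σ) e := fun n v => he ⟨n, hNM n.2⟩ v
  have hFe := hperf.end_isMap hρ hσ ho' (hFN.comp heN)
  have hfe : IsMap (rs M ρ) (rs M ρ) (f ∘ₗ e) := hf.comp he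
  have hef' : ∀ w, e (f w) = w := fun w => LinearMap.congr_fun hef w
  have hFF : ∀ w, F w = f (e (F w)) := by
    intro w
    have := hcomm _ _ hFe hfe (f w)
    simp only [LinearMap.comp_apply, hef'] at this
    exact this
  obtain ⟨w, hw⟩ : ∃ w, A w ≠ 0 := by
    by_contra hcon
    push Not at hcon
    exact hA0 (LinearMap.ext hcon)
  have hpg := minInv_map hp g
  have hinf : Inv (rs M ρ) (LinearMap.range f ⊓ (LinearMap.range f).map (ρ g)) := fun m v hv =>
    ⟨hp.2.1 m v hv.1, hpg.2.1 m v hv.2⟩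
  have hmem : F w ∈ LinearMap.range f ⊓ (LinearMap.range f).map (ρ g) :=
    ⟨⟨_, (hFF w).symm⟩, ⟨f (A w), ⟨_, rfl⟩, rfl⟩⟩
  rcases hpg.2.2 _ inf_le_right hinf with h | h
  · rw [h, Submodule.mem_bot] at hmem
    have h3 : f (A w) = 0 := rho_inj ρ g (by rw [map_zero]; exact hmem)
    exact hw (hfinj (by rw [h3, map_zero]))
  · exact hg (by rw [← h]; exact inf_le_left)

end perf

section quot

variable {G : Type} [Group G] [Finite G] {N : Subgroup G} [N.Normal]
  {V : Type} [AddCommGroup V] [Module ℂ V] [FiniteDimensional ℂ V]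

theorem mem_quot_of_trivial {ρ : Representation ℂ G V} (hρ : Irr ρ) (h : ∀ n ∈ N, ρ n = 1) :
    finrank ℂ V ∈ charDegrees (G ⧸ N) := by
  refine mem_charDegrees (QuotientGroup.lift N ρ h) ⟨hρ.1, fun p hp => hρ.2 p fun g v hv => ?_⟩
  exact hp (QuotientGroup.mk g) v hv

theorem mem_quot_of_fixed {ρ : Representation ℂ G V} (hρ : Irr ρ) {v : V} (hv : v ≠ 0)
    (h : ∀ n ∈ N, ρ n v = v) : finrank ℂ V ∈ charDegrees (G ⧸ N) := by
  apply mem_quot_of_trivial hρ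
  let p : Submodule ℂ V :=
    { carrier := {v | ∀ n ∈ N, ρ n v = v}
      add_mem' := by intro a b ha hb n hn; rw [map_add, ha n hn, hb n hn]
      zero_mem' := by intro n _; simp
      smul_mem' := by intro c a ha n hn; rw [map_smul, ha n hn] }
  rcases hρ.2 p (by
    intro g w hw n hn
    have h1 : g⁻¹ * n * g ∈ N := by
      have := Subgroup.Normal.conj_mem (H := N) inferInstance n hn g⁻¹
      simpa using this
    have h2 := hw _ h1
    rw [← rho_mul, show n * g = g * (g⁻¹ * n * g) by group, rho_mul, h2]) with h1 | h1
  · exact absurd ((Submodule.mem_bot ℂ).1 (h1 ▸ (show v ∈ p from h))) hv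
  · intro n hn
    ext w
    have : w ∈ p := by rw [h1]; trivial
    exact this n hn

theorem quot_subset : charDegrees (G ⧸ N) ⊆ charDegrees G := by
  rintro n ⟨V, hV, rfl⟩
  have h := (simple_iff_irr V).1 hV
  refine mem_charDegrees (V.ρ.comp (QuotientGroup.mk' N)) ⟨h.1, fun p hp => h.2 p fun g v hv => ?_⟩
  obtain ⟨g, rfl⟩ := QuotientGroup.mk_surjective g
  exact hp g v hv

/-- If `θ` extends to a linear character of `G`, the degrees over `θ` are degrees of `G/N`. -/
theorem mem_quot_of_linear {Y X : Type} [AddCommGroup Y] [Module ℂ Y] [FiniteDimensional ℂ Y]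
    [AddCommGroup X] [Module ℂ X]
    {ρ : Representation ℂ G V} (hρ : Irr ρ) {χ : Representation ℂ G Y} (h1 : finrank ℂ Y = 1)
    {θ : Representation ℂ N X} (hθ : Irr θ) (ho : Over N ρ θ) (ho' : Over N χ θ) :
    finrank ℂ V ∈ charDegrees (G ⧸ N) := by
  obtain ⟨f, hf, hf0⟩ := ho
  obtain ⟨e, he, he0⟩ := ho'
  have hex : ∀ g, ∃ c : ℂ, ∀ y, χ g y = c • y := by
    intro g
    obtain ⟨y, hy⟩ := finrank_eq_one_iff'.1 h1
    obtain ⟨c, hc⟩ := hy.2 (χ g y)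
    refine ⟨c, fun z => ?_⟩
    obtain ⟨d, rfl⟩ := hy.2 z
    rw [map_smul, ← hc, smul_comm]
  choose c hc using hex
  have : Nontrivial Y := nontrivial_of_finrank_pos (R := ℂ) (by rw [h1]; norm_num)
  obtain ⟨y, hy⟩ := exists_ne (0 : Y)
  have hinj : ∀ a b : ℂ, a • y = b • y → a = b := fun a b h => smul_left_injective ℂ hy h
  have c1 : c 1 = 1 := hinj _ _ (by rw [← hc]; simp)
  have cm : ∀ a b, c (a * b) = c a * c b := by
    intro a b
    apply hinj
    rw [← hc, rho_mul, hc b, map_smul, hc a, smul_smul, mul_comm]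
  let ρ' : Representation ℂ G V :=
    { toFun := fun g => c g⁻¹ • ρ g
      map_one' := by simp [c1]
      map_mul' := fun a b => by
        ext v
        simp [cm, smul_smul, mul_comm] }
  have hcne : ∀ g, c g ≠ 0 := by
    intro g h
    have := cm g g⁻¹
    rw [mul_inv_cancel, c1, h, zero_mul] at this
    exact one_ne_zero this
  have hρ' : Irr ρ' := by
    refine ⟨hρ.1, fun p hp => hρ.2 p fun g v hv => ?_⟩
    have := p.smul_mem (c g⁻¹)⁻¹ (hp g v hv)
    change (c g⁻¹)⁻¹ • (c g⁻¹ • ρ g v) ∈ p at this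
    rwa [smul_smul, inv_mul_cancel₀ (hcne _), one_smul] at this
  obtain ⟨x, hx⟩ : ∃ x, f x ≠ 0 := by
    by_contra hcon
    push Not at hcon
    exact hf0 (LinearMap.ext hcon)
  refine mem_quot_of_fixed hρ' hx fun n hn => ?_
  have h2 : θ ⟨n, hn⟩ x = c n • x := by
    apply hθ.map_inj he he0
    rw [he, map_smul]
    exact hc n (e x)
  have h3 := hf ⟨n, hn⟩ x
  change f _ = ρ n (f x) at h3
  change c n⁻¹ • ρ n (f x) = f x
  rw [← h3, h2, map_smul, smul_smul, ← cm]
  simp [c1]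

end quot

end B1

namespace B1
open Module

section SLdefs
variable {F : Type} [Field F]

abbrev SL (F : Type) [Field F] : Type := Matrix.SpecialLinearGroup (Fin 2) F

def sX (u : F) : SL F := ⟨!![1, u; 0, 1], by simp⟩
def sY (v : F) : SL F := ⟨!![1, 0; v, 1], by simp⟩
def sH (t : Fˣ) : SL F := ⟨!![(t : F), 0; 0, ((t⁻¹ : Fˣ) : F)], by simp⟩
def sW (t : Fˣ) : SL F := ⟨!![0, (t : F); -((t⁻¹ : Fˣ) : F), 0], by simp⟩

theorem sl_ext {a b : SL F} (h00 : a.1 0 0 = b.1 0 0) (h01 : a.1 0 1 = b.1 0 1)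
    (h10 : a.1 1 0 = b.1 1 0) (h11 : a.1 1 1 = b.1 1 1) : a = b := by
  apply Subtype.ext
  ext i j
  fin_cases i <;> fin_cases j <;> assumption

theorem sl_mul00 (a b : SL F) : (a * b).1 0 0 = a.1 0 0 * b.1 0 0 + a.1 0 1 * b.1 1 0 := by
  simp [Matrix.mul_apply, Fin.sum_univ_two]
theorem sl_mul01 (a b : SL F) : (a * b).1 0 1 = a.1 0 0 * b.1 0 1 + a.1 0 1 * b.1 1 1 := by
  simp [Matrix.mul_apply, Fin.sum_univ_two]
theorem sl_mul10 (a b : SL F) : (a * b).1 1 0 = a.1 1 0 * b.1 0 0 + a.1 1 1 * b.1 1 0 := by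
  simp [Matrix.mul_apply, Fin.sum_univ_two]
theorem sl_mul11 (a b : SL F) : (a * b).1 1 1 = a.1 1 0 * b.1 0 1 + a.1 1 1 * b.1 1 1 := by
  simp [Matrix.mul_apply, Fin.sum_univ_two]
theorem sX_e00 (u : F) : (sX u).1 0 0 = 1 := by simp [sX]
theorem sX_e01 (u : F) : (sX u).1 0 1 = u := by simp [sX]
theorem sX_e10 (u : F) : (sX u).1 1 0 = 0 := by simp [sX]
theorem sX_e11 (u : F) : (sX u).1 1 1 = 1 := by simp [sX]
theorem sY_e00 (u : F) : (sY u).1 0 0 = 1 := by simp [sY]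
theorem sY_e01 (u : F) : (sY u).1 0 1 = 0 := by simp [sY]
theorem sY_e10 (u : F) : (sY u).1 1 0 = u := by simp [sY]
theorem sY_e11 (u : F) : (sY u).1 1 1 = 1 := by simp [sY]
theorem sH_e00 (t : Fˣ) : (sH t).1 0 0 = (t : F) := by simp [sH]
theorem sH_e01 (t : Fˣ) : (sH t).1 0 1 = 0 := by simp [sH]
theorem sH_e10 (t : Fˣ) : (sH t).1 1 0 = 0 := by simp [sH]
theorem sH_e11 (t : Fˣ) : (sH t).1 1 1 = ((t : F))⁻¹ := by simp [sH]
theorem sW_e00 (t : Fˣ) : (sW t).1 0 0 = 0 := by simp [sW]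
theorem sW_e01 (t : Fˣ) : (sW t).1 0 1 = (t : F) := by simp [sW]
theorem sW_e10 (t : Fˣ) : (sW t).1 1 0 = -((t : F))⁻¹ := by simp [sW]
theorem sW_e11 (t : Fˣ) : (sW t).1 1 1 = 0 := by simp [sW]
theorem sl_one00 : (1 : SL F).1 0 0 = 1 := by simp
theorem sl_one01 : (1 : SL F).1 0 1 = 0 := by simp
theorem sl_one10 : (1 : SL F).1 1 0 = 0 := by simp
theorem sl_one11 : (1 : SL F).1 1 1 = 1 := by simp
attribute [local simp] sl_mul00 sl_mul01 sl_mul10 sl_mul11 sX_e00 sX_e01 sX_e10 sX_e11 sY_e00 sY_e01 sY_e10 sY_e11 sH_e00 sH_e01 sH_e10 sH_e11 sW_e00 sW_e01 sW_e10 sW_e11 sl_one00 sl_one01 sl_one10 sl_one11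
theorem sX_add (u v : F) : sX (u + v) = sX u * sX v := by
  apply sl_ext <;> simp [add_comm]
theorem sX_zero : sX (0 : F) = 1 := by
  apply sl_ext <;> simp
theorem sX_neg (u : F) : sX (-u) = (sX u)⁻¹ := by
  apply eq_inv_of_mul_eq_one_left
  rw [← sX_add, neg_add_cancel, sX_zero]
theorem sH_mul (s t : Fˣ) : sH (s * t) = sH s * sH t := by
  apply sl_ext <;> simp [mul_comm]
theorem sH_one : sH (1 : Fˣ) = 1 := by
  apply sl_ext <;> simp
theorem sH_inv (t : Fˣ) : sH (t⁻¹) = (sH t)⁻¹ := by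
  apply eq_inv_of_mul_eq_one_left
  rw [← sH_mul, inv_mul_cancel, sH_one]
theorem sH_sX (t : Fˣ) (u : F) : sH t * sX u * (sH t)⁻¹ = sX (t ^ 2 * u) := by
  rw [mul_inv_eq_iff_eq_mul]
  apply sl_ext <;> simp
  field_simp
theorem sH_sW (t s : Fˣ) : sH t * sW s = sW (t * s) := by
  apply sl_ext <;> simp
  ring
theorem sW_sH (t s : Fˣ) : sW s * sH t = sW (t⁻¹ * s) := by
  apply sl_ext <;> simp
  · ring
theorem sW_sW (s t : Fˣ) : sW s * sW t = sH (-(s * t⁻¹)) := by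
  apply sl_ext <;> simp
  ring
theorem sW_inv (t : Fˣ) : (sW t)⁻¹ = sW (-t) := by
  rw [inv_eq_iff_mul_eq_one, sW_sW]
  convert sH_one
  simp
theorem sW_sX (t : Fˣ) (u : F) : sW t * sX u * (sW t)⁻¹ = sY (-((t⁻¹ : Fˣ) : F) ^ 2 * u) := by
  rw [mul_inv_eq_iff_eq_mul]
  apply sl_ext <;> simp
  field_simp
theorem sW_eq (t : Fˣ) : sX (t : F) * sY (-((t⁻¹ : Fˣ) : F)) * sX (t : F) = sW t := by
  apply sl_ext <;> simp

theorem bruhat1 (g : SL F) (h : g.1 1 0 = 0) :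
    ∃ (a : F) (t : Fˣ), g = sX a * sH t := by
  have hd := g.2
  rw [Matrix.det_fin_two, h, mul_zero, sub_zero] at hd
  have h0 : g.1 0 0 ≠ 0 := by intro h0; rw [h0, zero_mul] at hd; exact zero_ne_one hd
  have h1 : (g.1 0 0)⁻¹ = g.1 1 1 := inv_eq_of_mul_eq_one_right hd
  refine ⟨g.1 0 1 * g.1 0 0, Units.mk0 _ h0, ?_⟩
  apply sl_ext <;> simp [h, h1]
  rw [mul_assoc, hd, mul_one]

theorem bruhat2 (g : SL F) (h : g.1 1 0 ≠ 0) :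
    ∃ (a b : F) (t : Fˣ), g = sX a * sW t * sX b := by
  have hd := g.2
  rw [Matrix.det_fin_two] at hd
  refine ⟨g.1 0 0 / g.1 1 0, g.1 1 1 / g.1 1 0, -(Units.mk0 _ h)⁻¹, ?_⟩
  apply sl_ext <;> simp
  all_goals field_simp
  linear_combination -hd

theorem sX_inj {a b : F} (h : sX a = sX b) : a = b := by
  have := congrArg (fun g : SL F => g.1 0 1) h
  simpa using this
end SLdefs

/-- a central extension of SL2 with chosen lifts -/
structure CE (F Γ : Type) [Field F] [Group Γ] where
  ρ : Γ →* SL F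
  L : SL F → Γ
  hL : ∀ g, ρ (L g) = g
  hc : ∀ z, ρ z = 1 → ∀ γ, z * γ = γ * z

namespace CE
variable {F Γ : Type} [Field F] [Group Γ] (c : CE F Γ)

theorem same {a b : Γ} (h : c.ρ a = c.ρ b) : ∃ z, a = b * z ∧ ∀ γ, z * γ = γ * z :=
  ⟨b⁻¹ * a, by group, c.hc _ (by rw [map_mul, map_inv, h, inv_mul_cancel])⟩

def act (g : SL F) (γ : Γ) : Γ := c.L g * γ * (c.L g)⁻¹

theorem act_eq {a : Γ} {g : SL F} (h : c.ρ a = g) (γ : Γ) : c.act g γ = a * γ * a⁻¹ := by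
  obtain ⟨z, hz, hz'⟩ := c.same (a := a) (b := c.L g) (by rw [c.hL, h])
  rw [hz, act]
  simp only [mul_inv_rev]
  rw [mul_assoc (c.L g) z γ, hz' γ]; group

theorem act_rho (a γ : Γ) : c.act (c.ρ a) γ = a * γ * a⁻¹ := c.act_eq rfl γ

theorem act_mul (g h : SL F) (γ : Γ) : c.act (g * h) γ = c.act g (c.act h γ) := by
  rw [c.act_eq (a := c.L g * c.L h) (by simp [c.hL])]
  simp only [act]; group

theorem act_one (γ : Γ) : c.act 1 γ = γ := by
  rw [c.act_eq (a := 1) (by simp)]; group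

theorem act_mm (g : SL F) (γ δ : Γ) : c.act g (γ * δ) = c.act g γ * c.act g δ := by
  simp only [act]; group

theorem act_inv (g : SL F) (γ : Γ) : c.act g γ⁻¹ = (c.act g γ)⁻¹ := by
  simp only [act]; group

theorem rho_act (g : SL F) (γ : Γ) : c.ρ (c.act g γ) = g * c.ρ γ * g⁻¹ := by
  simp [act, c.hL]

theorem act_central (g : SL F) {z : Γ} (hz : c.ρ z = 1) : c.act g z = z := by
  rw [act, ← c.hc z hz]; group

def cm (g h : SL F) : Γ := c.L g * c.L h * (c.L g)⁻¹ * (c.L h)⁻¹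

theorem cm_eq {a b : Γ} {g h : SL F} (ha : c.ρ a = g) (hb : c.ρ b = h) :
    c.cm g h = a * b * a⁻¹ * b⁻¹ := by
  obtain ⟨z, hz, hz'⟩ := c.same (a := b) (b := c.L h) (by rw [c.hL, hb])
  rw [← c.act_eq ha, cm, hz, c.act_mm]
  have h1 : c.act g z = z := by rw [act, ← hz']; group
  rw [h1, act]; group

theorem cm_eq' {b : Γ} {g h : SL F} (hb : c.ρ b = h) : c.cm g h = c.act g b * b⁻¹ := by
  rw [c.cm_eq (c.hL g) hb, act]

theorem rho_cm (g h : SL F) : c.ρ (c.cm g h) = g * h * g⁻¹ * h⁻¹ := by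
  simp [cm, c.hL]

theorem act_cm (k g h : SL F) : c.act k (c.cm g h) = c.cm (k * g * k⁻¹) (k * h * k⁻¹) := by
  rw [c.cm_eq (g := k * g * k⁻¹) (h := k * h * k⁻¹) (a := c.act k (c.L g)) (b := c.act k (c.L h))
    (by simp [c.rho_act, c.hL]) (by simp [c.rho_act, c.hL])]
  simp only [cm, act]; group

theorem cm_mul (g h k : SL F) : c.cm g (h * k) = c.cm g h * c.act h (c.cm g k) := by
  rw [c.cm_eq (a := c.L g) (b := c.L h * c.L k) (c.hL g) (by simp [c.hL])]
  simp only [cm, act]; group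

theorem mul_cm (g h k : SL F) : c.cm (g * h) k = c.act g (c.cm h k) * c.cm g k := by
  rw [c.cm_eq (a := c.L g * c.L h) (b := c.L k) (by simp [c.hL]) (c.hL k)]
  simp only [cm, act]; group

theorem cm_self (g : SL F) : c.cm g g = 1 := by simp [cm]

/-- the pairing on U -/
def bb (u v : F) : Γ := c.cm (sX u) (sX v)

theorem rho_bb (u v : F) : c.ρ (c.bb u v) = 1 := by
  rw [bb, rho_cm, ← sX_add, add_comm, sX_add]; group

theorem bb_add_right (u v v' : F) : c.bb u (v + v') = c.bb u v * c.bb u v' := by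
  rw [bb, sX_add, cm_mul]
  congr 1
  exact c.act_central _ (c.rho_bb u v')

theorem bb_add_left (u u' v : F) : c.bb (u + u') v = c.bb u v * c.bb u' v := by
  rw [bb, sX_add, mul_cm]
  have : c.act (sX u) (c.cm (sX u') (sX v)) = c.cm (sX u') (sX v) :=
    c.act_central _ (c.rho_bb u' v)
  rw [this]
  exact (c.hc _ (c.rho_bb u v) _).symm

theorem bb_sq (t : Fˣ) (u v : F) : c.bb (t ^ 2 * u) (t ^ 2 * v) = c.bb u v := by
  have := c.act_cm (sH t) (sX u) (sX v)
  rw [sH_sX, sH_sX] at this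
  rw [bb, ← this]
  exact c.act_central _ (c.rho_bb u v)

theorem bb_zero_right (u : F) : c.bb u 0 = 1 := by
  have := c.bb_add_right u 0 0
  simpa using this

theorem bb_trivial_of (a r s : F) (ha : a ≠ 0) (ha1 : a + 1 ≠ 0) (hs : s ^ 2 = a)
    (hr : r ^ 2 = a + 1) (hk : a ^ 2 + a + 1 ≠ 0) (u v : F) : c.bb u v = 1 := by
  have hs0 : s ≠ 0 := by rintro rfl; apply ha; rw [← hs]; simp
  have hr0 : r ≠ 0 := by rintro rfl; apply ha1; rw [← hr]; simp
  have e1 : ∀ u v, c.bb (a * u) v = c.bb u (a⁻¹ * v) := by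
    intro u v
    have := c.bb_sq (Units.mk0 s hs0) u (a⁻¹ * v)
    rw [← this, Units.val_mk0, hs, mul_inv_cancel_left₀ ha]
  have e2 : ∀ u v, c.bb ((a + 1) * u) v = c.bb u ((a + 1)⁻¹ * v) := by
    intro u v
    have := c.bb_sq (Units.mk0 r hr0) u ((a + 1)⁻¹ * v)
    rw [← this, Units.val_mk0, hr, mul_inv_cancel_left₀ ha1]
  have e3 : ∀ u v, c.bb u ((a⁻¹ + 1) * v) = c.bb u ((a + 1)⁻¹ * v) := by
    intro u v
    rw [← e2, add_mul, add_mul, one_mul, one_mul, bb_add_left, bb_add_right, e1]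
  have e4 : ∀ u v, c.bb u ((a⁻¹ + 1 - (a + 1)⁻¹) * v) = 1 := by
    intro u v
    have h := c.bb_add_right u ((a⁻¹ + 1 - (a + 1)⁻¹) * v) ((a + 1)⁻¹ * v)
    rw [← add_mul, sub_add_cancel, e3] at h
    exact (mul_eq_right.1 h.symm)
  have hk' : a⁻¹ + 1 - (a + 1)⁻¹ ≠ 0 := by
    have : a⁻¹ + 1 - (a + 1)⁻¹ = (a ^ 2 + a + 1) / (a * (a + 1)) := by field_simp; ring
    rw [this]
    exact div_ne_zero hk (mul_ne_zero ha ha1)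
  have := e4 u ((a⁻¹ + 1 - (a + 1)⁻¹)⁻¹ * v)
  rwa [mul_inv_cancel_left₀ hk'] at this

theorem bb_nsmul_left (n : ℕ) (u v : F) : c.bb (n • u) v = c.bb u v ^ n := by
  induction n with
  | zero =>
    have := c.bb_add_left 0 0 v
    simpa using this
  | succ n ih => rw [succ_nsmul, bb_add_left, ih, pow_succ]
theorem bb_nsmul_right (n : ℕ) (u v : F) : c.bb u (n • v) = c.bb u v ^ n := by
  induction n with
  | zero => simp [bb_zero_right]
  | succ n ih => rw [succ_nsmul, bb_add_right, ih, pow_succ]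

theorem bb_trivial_prime [Fintype F] (hp : (Fintype.card F).Prime) (u v : F) : c.bb u v = 1 := by
  have key : ∀ u : F, ∃ n : ℕ, u = n • (1 : F) := by
    intro u
    have := Fact.mk hp
    have hcard : Nat.card F = Fintype.card F := Nat.card_eq_fintype_card
    obtain ⟨n, hn⟩ := mem_powers_of_prime_card (G := Multiplicative F) (p := Fintype.card F)
      (g := Multiplicative.ofAdd 1) (g' := Multiplicative.ofAdd u)
      (by rw [← hcard]; rfl) (by
        intro h
        exact one_ne_zero (α := F) (Multiplicative.ofAdd.injective h))
    exact ⟨n, (Multiplicative.ofAdd.injective hn).symm⟩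
  obtain ⟨n, rfl⟩ := key u
  obtain ⟨m, rfl⟩ := key v
  rw [bb_nsmul_left, bb_nsmul_right, bb, cm_self]; simp

open Polynomial in
theorem exists_good [Fintype F] (h7 : 7 ≤ Fintype.card F) (h9 : Fintype.card F ≠ 9)
    (hp : ¬ (Fintype.card F).Prime) :
    ∃ a r s : F, a ≠ 0 ∧ a + 1 ≠ 0 ∧ s ^ 2 = a ∧ r ^ 2 = a + 1 ∧ a ^ 2 + a + 1 ≠ 0 := by
  by_cases h2 : ringChar F = 2
  · have hsq : ∀ a : F, ∃ b, b ^ 2 = a := by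
      intro a
      obtain ⟨b, hb⟩ := FiniteField.isSquare_of_char_two h2 a
      exact ⟨b, by rw [hb, sq]⟩
    let P : F[X] := X * (X + 1) * (X ^ 2 + X + 1)
    have hdeg : P.natDegree ≤ 4 := by
      simp only [P]; compute_degree
    have hP : P ≠ 0 := by
      have h1 : (X + 1 : F[X]) ≠ 0 := by
        rw [show (X + 1 : F[X]) = X + C 1 by simp]; exact X_add_C_ne_zero 1
      have h2 : (X ^ 2 + X + 1 : F[X]) ≠ 0 := by
        intro h
        have := congrArg (eval 0) h
        simp at this
      exact mul_ne_zero (mul_ne_zero X_ne_zero h1) h2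
    obtain ⟨a, ha⟩ := Polynomial.exists_eval_ne_zero_of_natDegree_lt_card P hP (by
      rw [Cardinal.mk_fintype]
      exact_mod_cast lt_of_le_of_lt hdeg (by omega))
    simp only [P, eval_mul, eval_X, eval_add, eval_one, eval_pow] at ha
    obtain ⟨s, hs⟩ := hsq a
    obtain ⟨r, hr⟩ := hsq (a + 1)
    exact ⟨a, r, s, left_ne_zero_of_mul (left_ne_zero_of_mul ha),
      right_ne_zero_of_mul (left_ne_zero_of_mul ha), hs, hr, right_ne_zero_of_mul ha⟩
  · have hodd : Fintype.card F % 2 = 1 := FiniteField.odd_card_of_char_ne_two h2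
    have h15 : 15 ≤ Fintype.card F := by
      by_contra hlt
      push Not at hlt
      interval_cases h : Fintype.card F <;> first | omega | (exact hp (by norm_num))
    have h20 : (2 : F) ≠ 0 := Ring.two_ne_zero h2
    let P : F[X] := X * (X ^ 4 - 1) * ((1 - X ^ 2) ^ 4 + 4 * X ^ 2 * (1 - X ^ 2) ^ 2 + 16 * X ^ 4)
    have hdeg : P.natDegree ≤ 13 := by
      simp only [P]; compute_degree
    have hP : P ≠ 0 := by
      have h1 : (X ^ 4 - 1 : F[X]) ≠ 0 := by
        intro h
        have := congrArg (eval 0) h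
        simp at this
      have h2 : ((1 - X ^ 2) ^ 4 + 4 * X ^ 2 * (1 - X ^ 2) ^ 2 + 16 * X ^ 4 : F[X]) ≠ 0 := by
        intro h
        have := congrArg (eval 0) h
        simp at this
      exact mul_ne_zero (mul_ne_zero X_ne_zero h1) h2
    obtain ⟨v, hv⟩ := Polynomial.exists_eval_ne_zero_of_natDegree_lt_card P hP (by
      rw [Cardinal.mk_fintype]
      exact_mod_cast lt_of_le_of_lt hdeg (by omega))
    simp only [P, eval_mul, eval_X, eval_add, eval_one, eval_pow, eval_sub, eval_ofNat] at hv
    have v0 := left_ne_zero_of_mul (left_ne_zero_of_mul hv)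
    have v1 := right_ne_zero_of_mul (left_ne_zero_of_mul hv)
    have v2 := right_ne_zero_of_mul hv
    refine ⟨((v⁻¹ - v) / 2) ^ 2, (v⁻¹ + v) / 2, (v⁻¹ - v) / 2, ?_, ?_, rfl, ?_, ?_⟩
    · intro h
      have h := pow_eq_zero_iff (two_ne_zero) |>.1 h
      apply v1
      field_simp at h
      linear_combination (-1 - v ^ 2) * h
    · intro h
      apply v1
      field_simp at h
      have h' : (v ^ 2 + 1) ^ 2 = 0 := by linear_combination h
      have h'' := pow_eq_zero_iff (two_ne_zero) |>.1 h'
      linear_combination (v ^ 2 - 1) * h''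
    · field_simp; ring
    · intro h
      apply v2
      field_simp at h
      linear_combination h

theorem bb_trivial [Fintype F] (h7 : 7 ≤ Fintype.card F) (h9 : Fintype.card F ≠ 9) (u v : F) :
    c.bb u v = 1 := by
  by_cases hp : (Fintype.card F).Prime
  · exact c.bb_trivial_prime hp u v
  · obtain ⟨a, r, s, h⟩ := exists_good h7 h9 hp
    exact c.bb_trivial_of a r s h.1 h.2.1 h.2.2.1 h.2.2.2.1 h.2.2.2.2 u v
end CE
end B1

namespace B1
open Module

structure CE2 (F Γ : Type) [Field F] [Group Γ] extends CE F Γ where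
  t0 : Fˣ
  ht0 : (t0 : F) ^ 2 - 1 ≠ 0
  hb : ∀ u v, toCE.bb u v = 1
  cyc : ∃ g : Fˣ, ∀ t : Fˣ, ∃ n : ℕ, t = g ^ n

namespace CE2
variable {F Γ : Type} [Field F] [Group Γ] (c : CE2 F Γ)

theorem act_X {u v : F} {b : Γ} (hb : c.ρ b = sX v) : c.act (sX u) b = b := by
  have h1 := c.cm_eq' (g := sX u) hb
  have h2 := c.hb u v
  rw [CE.bb, h1] at h2
  exact mul_inv_eq_one.1 h2

def x (u : F) : Γ := c.cm (sH c.t0) (sX (u / ((c.t0 : F) ^ 2 - 1)))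

theorem rho_x (u : F) : c.ρ (c.x u) = sX u := by
  rw [x, CE.rho_cm, sH_sX, ← sX_neg, ← sX_add]
  congr 1
  have := c.ht0
  field_simp
  ring

theorem x_add (u v : F) : c.x (u + v) = c.x u * c.x v := by
  rw [x, add_div, sX_add, CE.cm_mul]
  congr 1
  exact c.act_X (c.rho_x v)

theorem x_zero : c.x 0 = 1 := by
  have := c.x_add 0 0
  simpa using this

theorem x_neg (u : F) : c.x (-u) = (c.x u)⁻¹ := by
  apply eq_inv_of_mul_eq_one_left
  rw [← x_add, neg_add_cancel, x_zero]

theorem H_x (t : Fˣ) (u : F) : c.act (sH t) (c.x u) = c.x (t ^ 2 * u) := by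
  rw [x, CE.act_cm, sH_sX, ← sH_mul, mul_comm, sH_mul, x]
  congr 2
  · group
  · ring_nf

def y (v : F) : Γ := c.act (sW 1) (c.x (-v))

theorem rho_y (v : F) : c.ρ (c.y v) = sY v := by
  rw [y, CE.rho_act, rho_x, sW_sX]; simp

theorem y_add (u v : F) : c.y (u + v) = c.y u * c.y v := by
  rw [y, neg_add, x_add, CE.act_mm]; rfl

theorem y_neg (u : F) : c.y (-u) = (c.y u)⁻¹ := by
  rw [y, x_neg, CE.act_inv]; rfl

theorem W1_x (u : F) : c.act (sW 1) (c.x u) = c.y (-u) := by rw [y, neg_neg]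

theorem W1_y (v : F) : c.act (sW 1) (c.y v) = c.x (-v) := by
  rw [y, ← CE.act_mul, sW_sW, H_x]; simp

theorem H_y (t : Fˣ) (v : F) : c.act (sH t) (c.y v) = c.y (((t⁻¹ : Fˣ) : F) ^ 2 * v) := by
  rw [y, ← CE.act_mul, sH_sW, show t * 1 = (t⁻¹)⁻¹ * 1 by simp, ← sW_sH, CE.act_mul, H_x, W1_x]
  simp

theorem W_x (t : Fˣ) (u : F) : c.act (sW t) (c.x u) = c.y (-(((t⁻¹ : Fˣ) : F) ^ 2 * u)) := by
  rw [show sW t = sH t * sW 1 by rw [sH_sW, mul_one], CE.act_mul, W1_x, H_y, mul_neg]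

theorem W_y (t : Fˣ) (v : F) : c.act (sW t) (c.y v) = c.x (-((t : F) ^ 2 * v)) := by
  rw [show sW t = sH t * sW 1 by rw [sH_sW, mul_one], CE.act_mul, W1_y, H_x, mul_neg]

def w (t : Fˣ) : Γ := c.x t * c.y (-((t⁻¹ : Fˣ) : F)) * c.x t

theorem rho_w (t : Fˣ) : c.ρ (c.w t) = sW t := by
  rw [w, map_mul, map_mul, rho_x, rho_y, sW_eq]

theorem w_x (t : Fˣ) (u : F) : c.w t * c.x u = c.y (-(((t⁻¹ : Fˣ) : F) ^ 2 * u)) * c.w t := by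
  rw [← W_x, c.act_eq (c.rho_w t)]; group

theorem w_y (t : Fˣ) (u : F) : c.w t * c.y u = c.x (-((t : F) ^ 2 * u)) * c.w t := by
  rw [← W_y, c.act_eq (c.rho_w t)]; group

theorem w_inv (t : Fˣ) : (c.w t)⁻¹ = c.w (-t) := by
  have : ((-t)⁻¹ : Fˣ) = -(t⁻¹) := by rw [inv_neg]
  simp only [w, mul_inv_rev, this, Units.val_neg, y_neg, x_neg, neg_neg, inv_inv, mul_assoc]

theorem w_eq (t : Fˣ) : c.w t = c.y (-((t⁻¹ : Fˣ) : F)) * c.x t * c.y (-((t⁻¹ : Fˣ) : F)) := by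
  have h := c.w_x t t
  have e : (((t⁻¹ : Fˣ) : F) ^ 2 * t) = ((t⁻¹ : Fˣ) : F) := by
    simp [sq, mul_assoc]
  rw [e] at h
  have : c.w t * c.x t = (c.y (-((t⁻¹ : Fˣ) : F)) * c.x t * c.y (-((t⁻¹ : Fˣ) : F))) * c.x t := by
    rw [h, w]; group
  exact mul_right_cancel this

theorem W1_w (s : Fˣ) : c.act (sW 1) (c.w s) = c.w s⁻¹ := by
  rw [c.w_eq s⁻¹, w, CE.act_mm, CE.act_mm, W1_x, W1_y]
  simp

theorem H_w (t s : Fˣ) : c.act (sH t) (c.w s) = c.w (t ^ 2 * s) := by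
  rw [w, CE.act_mm, CE.act_mm, H_x, H_y, w]
  simp [mul_comm]

def h (t : Fˣ) : Γ := c.w t * (c.w 1)⁻¹

theorem rho_h (t : Fˣ) : c.ρ (c.h t) = sH t := by
  rw [h, map_mul, map_inv, rho_w, rho_w, sW_inv, sW_sW]; simp

theorem h_w1 (t : Fˣ) : c.h t * c.w 1 = c.w t := by rw [h]; group

theorem h_one : c.h 1 = 1 := by simp [h]

theorem H_h (s t : Fˣ) : c.act (sH s) (c.h t) = c.h t := by
  obtain ⟨g, hg⟩ := c.cyc
  obtain ⟨m, rfl⟩ := hg s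
  obtain ⟨n, rfl⟩ := hg t
  have hp : ∀ k : ℕ, sH (g ^ k) = sH g ^ k := by
    intro k
    induction k with
    | zero => simp [sH_one]
    | succ k ih => rw [pow_succ, sH_mul, ih, pow_succ]
  obtain ⟨z, hz, hz'⟩ := c.same (a := c.h (g ^ n)) (b := c.L (sH g) ^ n) (by
    rw [rho_h, map_pow, c.hL, hp])
  rw [c.act_eq (a := c.L (sH g) ^ m) (by rw [map_pow, c.hL, hp]), hz, mul_assoc, mul_assoc, hz',
    ← mul_assoc, ← mul_assoc, ← pow_add, add_comm, pow_add]
  group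

theorem h_sq (t s : Fˣ) : c.h (t ^ 2 * s) = c.h s * c.h (t ^ 2) := by
  have h1 := c.H_h t s
  rw [h, CE.act_mm, CE.act_inv, H_w, H_w, mul_one] at h1
  have h2 : c.h s = c.w (t ^ 2 * s) * (c.w (t ^ 2))⁻¹ := h1.symm
  rw [h2, h, h]; group

theorem h_comm (s t : Fˣ) : c.h s * c.h t = c.h t * c.h s := by
  have h1 := c.H_h s t
  rw [c.act_eq (c.rho_h s)] at h1
  exact mul_inv_eq_iff_eq_mul.1 h1

theorem w_sum (u v : Fˣ) (huv : (u : F) + v = 1) : c.w u * (c.w 1)⁻¹ * c.w v = c.w (u * v) := by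
  have hy : ∀ t : Fˣ, c.y (-((t⁻¹ : Fˣ) : F)) = c.x (-t) * c.w t * c.x (-t) := by
    intro t; rw [w, x_neg]; group
  have h1 : c.y (-((u⁻¹ : Fˣ) : F)) * c.y (-((v⁻¹ : Fˣ) : F)) = c.y (-(((u * v)⁻¹ : Fˣ) : F)) := by
    rw [← y_add]
    congr 1
    push_cast
    field_simp
    linear_combination -huv
  rw [hy, hy, hy] at h1
  have h2 : c.x (-u) * c.x (-v) = c.y (-1) * c.w (-1) * c.y (-1) := by
    rw [← x_add, ← neg_add, huv, w_eq, inv_neg, inv_one, Units.val_neg, Units.val_one, neg_neg, y_neg]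
    group
  have h3 : c.w u * c.y (-1) = c.x ((u : F) ^ 2) * c.w u := by rw [w_y]; simp
  have h4 : c.y (-1) * c.w v = c.w v * c.x ((v : F) ^ 2) := by
    rw [w_x]; simp
  have h5 : c.x (-u) * c.w u * c.x (-u) * (c.x (-v) * c.w v * c.x (-v))
      = c.x (-(u * v)) * (c.w u * (c.w 1)⁻¹ * c.w v) * c.x (-(u * v)) := by
    calc _ = c.x (-u) * c.w u * (c.x (-u) * c.x (-v)) * c.w v * c.x (-v) := by group
      _ = c.x (-u) * (c.w u * c.y (-1)) * c.w (-1) * (c.y (-1) * c.w v) * c.x (-v) := by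
        rw [h2]; group
      _ = (c.x (-u) * c.x ((u : F) ^ 2)) * (c.w u * (c.w 1)⁻¹ * c.w v) *
          (c.x ((v : F) ^ 2) * c.x (-v)) := by rw [h3, h4, w_inv]; group
      _ = _ := by
        rw [← x_add, ← x_add]
        congr 3
        · congr 1; linear_combination (u : F) * huv
        · linear_combination (v : F) * huv
  rw [h5] at h1
  push_cast at h1
  exact mul_left_cancel (mul_right_cancel h1)

theorem h_sum (u v : Fˣ) (huv : (u : F) + v = 1) : c.h u * c.h v = c.h (u * v) := by
  rw [h, h, h, ← c.w_sum u v huv]; group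

theorem h_mul [Fintype F] (s t : Fˣ) : c.h (s * t) = c.h s * c.h t := by
  by_cases hs : IsSquare s
  · obtain ⟨r, rfl⟩ := hs
    rw [← sq, h_sq, h_comm]
  by_cases ht : IsSquare t
  · obtain ⟨r, rfl⟩ := ht
    rw [← sq, mul_comm, h_sq]
  have hs' : ¬ IsSquare (s : F) := by
    rintro ⟨r, hr⟩
    have hr0 : r ≠ 0 := by rintro rfl; simp at hr
    exact hs ⟨Units.mk0 r hr0, by ext; simpa using hr⟩
  have h2 : ringChar F ≠ 2 := fun h2 => hs' (FiniteField.isSquare_of_char_two h2 _)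
  obtain ⟨a, b, hab⟩ := FiniteField.exists_root_sum_quadratic (R := F)
    (f := Polynomial.X ^ 2) (g := Polynomial.X ^ 2 - Polynomial.C ((s⁻¹ : Fˣ) : F))
    (by compute_degree!) (by compute_degree!) (FiniteField.odd_card_of_char_ne_two h2)
  simp only [Polynomial.eval_pow, Polynomial.eval_X, Polynomial.eval_sub, Polynomial.eval_C] at hab
  have hab' : (s : F) * a ^ 2 + s * b ^ 2 = 1 := by
    have : (s : F) * ((s⁻¹ : Fˣ) : F) = 1 := by simp
    linear_combination (s : F) * hab + this
  have hsq : ∀ z : F, (s : F) * z ^ 2 ≠ 1 := by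
    intro z hz
    have hz0 : z ≠ 0 := by rintro rfl; simp at hz
    apply hs'
    refine ⟨z⁻¹, ?_⟩
    field_simp
    exact hz
  have ha0 : a ≠ 0 := by rintro rfl; apply hsq b; simpa using hab'
  have hb0 : b ≠ 0 := by rintro rfl; apply hsq a; simpa using hab'
  set A := Units.mk0 a ha0
  set B := Units.mk0 b hb0
  have h3 := c.h_sum (s * A ^ 2) (s * B ^ 2) (by simpa [A, B] using hab')
  have hst : ∃ r : Fˣ, t = r ^ 2 * s := by
    -- product of nonsquares is a square
    have ht' : ¬ IsSquare (t : F) := by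
      rintro ⟨r, hr⟩
      have hr0 : r ≠ 0 := by rintro rfl; simp at hr
      exact ht ⟨Units.mk0 r hr0, by ext; simpa using hr⟩
    obtain ⟨g, hg⟩ := c.cyc
    obtain ⟨m, hm⟩ := hg s
    obtain ⟨n, hn⟩ := hg t
    have hmo : Odd m := by
      rw [← Nat.not_even_iff_odd]
      rintro ⟨k, rfl⟩
      exact hs ⟨g ^ k, by rw [hm, pow_add]⟩
    have hno : Odd n := by
      rw [← Nat.not_even_iff_odd]
      rintro ⟨k, rfl⟩
      exact ht ⟨g ^ k, by rw [hn, pow_add]⟩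
    obtain ⟨k, rfl⟩ := hmo
    obtain ⟨l, rfl⟩ := hno
    refine ⟨g ^ l * (g ^ k)⁻¹, ?_⟩
    rw [hm, hn]
    rw [mul_pow, inv_pow, ← pow_mul, ← pow_mul, pow_succ, pow_succ, mul_comm l 2, mul_comm k 2]
    group
  obtain ⟨r, rfl⟩ := hst
  -- everything in terms of h s
  have e1 : ∀ z : Fˣ, c.h (s * z ^ 2) = c.h s * c.h (z ^ 2) := by
    intro z; rw [mul_comm, h_sq]
  have e2 : ∀ y z : Fˣ, c.h (y ^ 2 * z ^ 2) = c.h (y ^ 2) * c.h (z ^ 2) := by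
    intro y z; rw [h_sq, h_comm]
  have h4 : c.h (s * s) = c.h s * c.h s := by
    have e3 : c.h (s * A ^ 2 * (s * B ^ 2)) = c.h (s * s) * (c.h (A ^ 2) * c.h (B ^ 2)) := by
      rw [show s * A ^ 2 * (s * B ^ 2) = (A * B) ^ 2 * (s * s) by rw [mul_pow, mul_mul_mul_comm, mul_comm],
        h_sq, mul_pow, e2]
    rw [e1, e1, e3] at h3
    have e4 : c.h s * c.h (A ^ 2) * (c.h s * c.h (B ^ 2))
        = c.h s * c.h s * (c.h (A ^ 2) * c.h (B ^ 2)) := by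
      rw [mul_assoc, ← mul_assoc (c.h (A ^ 2)), c.h_comm (A ^ 2) s]; group
    rw [e4] at h3
    exact (mul_right_cancel h3).symm
  rw [show s * (r ^ 2 * s) = r ^ 2 * (s * s) by rw [mul_left_comm], h_sq, h_sq, h4, mul_assoc]

theorem w1_h (t : Fˣ) : c.w 1 * c.h t = c.w t⁻¹ := by
  rw [← W1_w, c.act_eq (c.rho_w 1), h]; group

section
variable [Fintype F]

theorem h_neg_one : c.h (-1) = (c.w 1)⁻¹ * (c.w 1)⁻¹ := by
  rw [h, ← w_inv]

theorem w1_four : (c.w 1 * c.w 1) * (c.w 1 * c.w 1) = 1 := by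
  have h1 := c.h_mul (-1) (-1)
  rw [neg_mul_neg, one_mul, h_one, h_neg_one] at h1
  have h2 := congrArg (fun z => z⁻¹) h1
  simp only [inv_one, mul_inv_rev, inv_inv] at h2
  exact h2.symm

theorem w1_w (t : Fˣ) : c.w 1 * c.w t = c.h (-t⁻¹) := by
  have h1 : c.w 1 * c.w t = c.w t⁻¹ * c.w 1 := by
    rw [← W1_w, c.act_eq (c.rho_w 1)]; group
  have h3 : c.w 1 * c.w 1 = (c.w 1)⁻¹ * (c.w 1)⁻¹ := by
    rw [← mul_inv_rev]
    exact eq_inv_of_mul_eq_one_left c.w1_four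
  rw [h1, ← c.h_w1, mul_assoc, h3, ← h_neg_one, ← h_mul]
  simp

theorem h_w (r t : Fˣ) : c.h r * c.w t = c.w (r * t) := by
  rw [← c.h_w1 t, ← mul_assoc, ← h_mul, h_w1]

theorem h_x (t : Fˣ) (u : F) : c.h t * c.x u = c.x (t ^ 2 * u) * c.h t := by
  rw [← H_x, c.act_eq (c.rho_h t)]; group

theorem w1_x_w (α t : Fˣ) : c.w 1 * c.x α * c.w t =
    c.x (-((α⁻¹ : Fˣ) : F)) * c.w (-(α⁻¹ * t)) * c.x (-((t : F) ^ 2 * ((α⁻¹ : Fˣ) : F))) := by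
  have h1 : c.x α = c.y ((α⁻¹ : Fˣ) : F) * c.w α * c.y ((α⁻¹ : Fˣ) : F) := by
    rw [w_eq, y_neg]; group
  have h2 : c.y ((α⁻¹ : Fˣ) : F) * c.w t = c.w t * c.x (-((t : F) ^ 2 * ((α⁻¹ : Fˣ) : F))) := by
    rw [w_x]; simp
  have h3 : c.w 1 * c.y ((α⁻¹ : Fˣ) : F) = c.x (-((α⁻¹ : Fˣ) : F)) * c.w 1 := by
    rw [w_y]; simp
  rw [h1]
  calc _ = (c.w 1 * c.y ((α⁻¹ : Fˣ) : F)) * c.w α * (c.y ((α⁻¹ : Fˣ) : F) * c.w t) := by group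
    _ = c.x (-((α⁻¹ : Fˣ) : F)) * ((c.w 1 * c.w α) * c.w t) * c.x (-((t : F) ^ 2 * ((α⁻¹ : Fˣ) : F))) := by
      rw [h2, h3]; group
    _ = _ := by rw [w1_w, h_w, neg_mul]

/-- normal forms -/
def NF : Set Γ := {γ | (∃ a t, γ = c.x a * c.h t) ∨ ∃ a t b, γ = c.x a * c.w t * c.x b}

theorem x_NF (u : F) {γ : Γ} (h : γ ∈ c.NF) : c.x u * γ ∈ c.NF := by
  rcases h with ⟨a, t, rfl⟩ | ⟨a, t, b, rfl⟩
  · exact Or.inl ⟨u + a, t, by rw [x_add]; group⟩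
  · exact Or.inr ⟨u + a, t, b, by rw [x_add]; group⟩

theorem w_NF {γ : Γ} (h : γ ∈ c.NF) : c.w 1 * γ ∈ c.NF := by
  rcases h with ⟨a, t, rfl⟩ | ⟨a, t, b, rfl⟩
  · refine Or.inr ⟨0, t⁻¹, ((t⁻¹ : Fˣ) : F) ^ 2 * a, ?_⟩
    have := c.h_x t (((t⁻¹ : Fˣ) : F) ^ 2 * a)
    have e : (t : F) ^ 2 * (((t⁻¹ : Fˣ) : F) ^ 2 * a) = a := by
      rw [← mul_assoc, ← mul_pow]; simp
    rw [e] at this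
    rw [← this, ← mul_assoc, w1_h, x_zero, one_mul]
  · by_cases ha : a = 0
    · subst ha
      have := c.h_x (-t⁻¹) b
      rw [← w1_w] at this
      exact Or.inl ⟨((-t⁻¹ : Fˣ) : F) ^ 2 * b, -t⁻¹, by rw [x_zero, one_mul, ← mul_assoc, this, w1_w]⟩
    · 
      have := c.w1_x_w (Units.mk0 a ha) t
      exact Or.inr ⟨_, _, _, by
        rw [← mul_assoc, ← mul_assoc, show a = ((Units.mk0 a ha : Fˣ) : F) from rfl, this,
          mul_assoc, ← x_add]⟩

def Δ : Subgroup Γ := Subgroup.closure (Set.range c.x ∪ {c.w 1})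

theorem Δ_NF {γ : Γ} (h : γ ∈ c.Δ) : γ ∈ c.NF := by
  refine Subgroup.closure_induction_left (p := fun γ _ => γ ∈ c.NF) ?_ ?_ ?_ h
  · exact Or.inl ⟨0, 1, by simp [x_zero, h_one]⟩
  · rintro z (⟨u, rfl⟩ | hz) y _ hy
    · exact c.x_NF u hy
    · rw [Set.mem_singleton_iff.1 hz]; exact c.w_NF hy
  · rintro z (⟨u, rfl⟩ | hz) y _ hy
    · rw [← x_neg]; exact c.x_NF _ hy
    · rw [Set.mem_singleton_iff.1 hz, show (c.w 1)⁻¹ = c.w 1 * c.w 1 * c.w 1 by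
        rw [inv_eq_iff_mul_eq_one, ← c.w1_four]; group, mul_assoc, mul_assoc]
      exact c.w_NF (c.w_NF (c.w_NF hy))

theorem NF_inj {γ : Γ} (h : γ ∈ c.NF) (h1 : c.ρ γ = 1) : γ = 1 := by
  rcases h with ⟨a, t, rfl⟩ | ⟨a, t, b, rfl⟩
  · rw [map_mul, rho_x, rho_h] at h1
    have e00 := congrArg (fun g : SL F => g.1 0 0) h1
    have e01 := congrArg (fun g : SL F => g.1 0 1) h1
    simp [sl_mul00, sl_mul01, sX_e00, sX_e01, sH_e00, sH_e01, sH_e10, sH_e11] at e00 e01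
    subst e00
    subst e01
    rw [x_zero, h_one, one_mul]
  · rw [map_mul, map_mul, rho_x, rho_x, rho_w] at h1
    have e10 := congrArg (fun g : SL F => g.1 1 0) h1
    simp [sl_mul10, sl_mul11, sX_e00, sX_e01, sX_e10, sX_e11, sW_e00, sW_e01, sW_e10, sW_e11] at e10

theorem x_mem (u : F) : c.x u ∈ c.Δ := Subgroup.subset_closure (Or.inl ⟨u, rfl⟩)
theorem w1_mem : c.w 1 ∈ c.Δ := Subgroup.subset_closure (Or.inr rfl)
theorem y_mem (v : F) : c.y v ∈ c.Δ := by
  rw [y, c.act_eq (c.rho_w 1)]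
  exact mul_mem (mul_mem c.w1_mem (c.x_mem _)) (inv_mem c.w1_mem)
theorem w_mem (t : Fˣ) : c.w t ∈ c.Δ := mul_mem (mul_mem (c.x_mem _) (c.y_mem _)) (c.x_mem _)
theorem h_mem (t : Fˣ) : c.h t ∈ c.Δ := mul_mem (c.w_mem _) (inv_mem c.w1_mem)

theorem splits : ∃ s : SL F →* Γ, ∀ g, c.ρ (s g) = g := by
  let r : c.Δ →* SL F := c.ρ.comp c.Δ.subtype
  have hinj : Function.Injective r := by
    rw [injective_iff_map_eq_one]
    intro a ha
    exact Subtype.ext (c.NF_inj (c.Δ_NF a.2) ha)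
  have hsurj : Function.Surjective r := by
    intro g
    by_cases h : g.1 1 0 = 0
    · obtain ⟨a, t, rfl⟩ := bruhat1 g h
      exact ⟨⟨c.x a * c.h t, mul_mem (c.x_mem _) (c.h_mem _)⟩, by
        show c.ρ (c.x a * c.h t) = _
        rw [map_mul, rho_x, rho_h]⟩
    · obtain ⟨a, b, t, rfl⟩ := bruhat2 g h
      exact ⟨⟨c.x a * c.w t * c.x b, mul_mem (mul_mem (c.x_mem _) (c.w_mem _)) (c.x_mem _)⟩, by
        show c.ρ (c.x a * c.w t * c.x b) = _
        rw [map_mul, map_mul, rho_x, rho_x, rho_w]⟩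
  let e := MulEquiv.ofBijective r ⟨hinj, hsurj⟩
  refine ⟨c.Δ.subtype.comp e.symm.toMonoidHom, fun g => ?_⟩
  exact e.apply_symm_apply g
end
end CE2

theorem split_SL {F Γ : Type} [Field F] [Fintype F] [Group Γ] (h7 : 7 ≤ Fintype.card F)
    (h9 : Fintype.card F ≠ 9) (ρ : Γ →* SL F) (hs : Function.Surjective ρ)
    (hc : ∀ z, ρ z = 1 → ∀ γ, z * γ = γ * z) : ∃ s : SL F →* Γ, ∀ g, ρ (s g) = g := by
  classical
  choose L hL using hs
  let c : CE F Γ := ⟨ρ, L, hL, hc⟩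
  have ht : ∃ t : F, t * (t ^ 2 - 1) ≠ 0 := by
    obtain ⟨t, ht⟩ := Polynomial.exists_eval_ne_zero_of_natDegree_lt_card
      (Polynomial.X * (Polynomial.X ^ 2 - 1) : Polynomial F) (by
        apply mul_ne_zero Polynomial.X_ne_zero
        intro h
        have := congrArg (Polynomial.eval 0) h
        simp at this) (by
      have : (Polynomial.X * (Polynomial.X ^ 2 - 1) : Polynomial F).natDegree ≤ 3 := by
        compute_degree
      rw [Cardinal.mk_fintype]
      exact_mod_cast lt_of_le_of_lt this (by omega))
    exact ⟨t, by simpa using ht⟩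
  obtain ⟨t, ht⟩ := ht
  have cyc : ∃ g : Fˣ, ∀ t : Fˣ, ∃ n : ℕ, t = g ^ n := by
    obtain ⟨g, hg⟩ := IsCyclic.exists_generator (α := Fˣ)
    refine ⟨g, fun t => ?_⟩
    obtain ⟨n, hn⟩ := (mem_powers_iff_mem_zpowers).2 (hg t)
    exact ⟨n, hn.symm⟩
  let c2 : CE2 F Γ := { c with
    t0 := Units.mk0 t (left_ne_zero_of_mul ht)
    ht0 := right_ne_zero_of_mul ht
    hb := c.bb_trivial h7 h9
    cyc := cyc }
  exact c2.splits
end B1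

namespace B1
open Module

/-- descend a representation along a surjection -/
theorem descend {A B V : Type} [Group A] [Group B] [AddCommGroup V] [Module ℂ V] (π : A →* B)
    (hπ : Function.Surjective π) (α : Representation ℂ A V) (h : ∀ a, π a = 1 → α a = 1) :
    ∃ β : Representation ℂ B V, ∀ a, β (π a) = α a := by
  choose s hs using hπ
  have key : ∀ a b, π a = π b → α a = α b := by
    intro a b hab
    have h1 := h (a * b⁻¹) (by rw [map_mul, map_inv, hab, mul_inv_cancel])
    calc α a = α (a * b⁻¹) * α b := by rw [← map_mul]; group
      _ = α b := by rw [h1, one_mul]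
  refine ⟨{ toFun := fun b => α (s b), map_one' := ?_, map_mul' := ?_ }, ?_⟩
  · rw [key (s 1) 1 (by rw [hs, map_one]), map_one]
  · intro a b
    rw [← map_mul]
    exact key _ _ (by rw [map_mul, hs, hs, hs])
  · intro a
    exact key _ _ (hs _)

theorem irr_of_pullback {A B V : Type} [Group A] [Group B] [AddCommGroup V] [Module ℂ V]
    {π : A →* B} {α : Representation ℂ A V} {β : Representation ℂ B V} (h : ∀ a, β (π a) = α a)
    (hα : Irr α) : Irr β :=
  ⟨hα.1, fun p hp => hα.2 p (fun a v hv => by rw [← h]; exact hp _ v hv)⟩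

theorem irr_pullback {A B V : Type} [Group A] [Group B] [AddCommGroup V] [Module ℂ V]
    {π : A →* B} (hπ : Function.Surjective π) {α : Representation ℂ A V} {β : Representation ℂ B V}
    (h : ∀ a, β (π a) = α a) (hβ : Irr β) : Irr α :=
  ⟨hβ.1, fun p hp => hβ.2 p (fun b v hv => by
    obtain ⟨a, rfl⟩ := hπ b
    rw [h]; exact hp _ v hv)⟩

structure Stp (G F : Type) [Group G] [Field F] where
  N : Subgroup G
  M : Subgroup G
  hN : N.Normal
  hM : M.Normal
  hNM : N ≤ M
  φ : M →* PSL2 F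
  hφ : Function.Surjective φ
  hk : ∀ m : M, φ m = 1 ↔ (m : G) ∈ N

attribute [instance] Stp.hN Stp.hM

namespace Stp
variable {G F : Type} [Group G] [Field F] (S : Stp G F)

def Mt : Subgroup (S.M × SL F) :=
  MonoidHom.eqLocus (S.φ.comp (MonoidHom.fst _ _)) ((QuotientGroup.mk' _).comp (MonoidHom.snd _ _))

theorem mem_Mt (x : S.M × SL F) : x ∈ S.Mt ↔ S.φ x.1 = (x.2 : PSL2 F) := Iff.rfl

def pm : S.Mt →* S.M := (MonoidHom.fst _ _).comp S.Mt.subtype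
def pg : S.Mt →* SL F := (MonoidHom.snd _ _).comp S.Mt.subtype

theorem pm_surj : Function.Surjective S.pm := by
  intro m
  obtain ⟨g, hg⟩ := QuotientGroup.mk_surjective (S.φ m)
  exact ⟨⟨(m, g), (S.mem_Mt _).2 hg.symm⟩, rfl⟩
theorem pg_surj : Function.Surjective S.pg := by
  intro g
  obtain ⟨m, hm⟩ := S.hφ (g : PSL2 F)
  exact ⟨⟨(m, g), (S.mem_Mt _).2 hm⟩, rfl⟩

def iN : S.N →* S.Mt where
  toFun n := ⟨(⟨n, S.hNM n.2⟩, 1), (S.mem_Mt _).2 (by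
    rw [(S.hk _).2 n.2]; rfl)⟩
  map_one' := rfl
  map_mul' a b := by
    apply Subtype.ext
    apply Prod.ext
    · rfl
    · show (1 : SL F) = 1 * 1
      rw [one_mul]

theorem pg_iN (n : S.N) : S.pg (S.iN n) = 1 := rfl
theorem pm_iN (n : S.N) : ((S.pm (S.iN n) : S.M) : G) = n := rfl

theorem Mt_ext {a b : S.Mt} (h1 : S.pm a = S.pm b) (h2 : S.pg a = S.pg b) : a = b :=
  Subtype.ext (Prod.ext h1 h2)

theorem eq_iN {a : S.Mt} (h : S.pg a = 1) : ∃ n, a = S.iN n := by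
  have h1 : S.φ (S.pm a) = (S.pg a : PSL2 F) := a.2
  rw [h] at h1
  have h2 : S.φ (S.pm a) = 1 := h1
  exact ⟨⟨_, (S.hk _).1 h2⟩, S.Mt_ext rfl h⟩

def cn (g : G) : S.N →* S.N := (MulAut.conjNormal g : MulAut S.N).toMonoidHom
theorem cn_coe (g : G) (n : S.N) : ((S.cn g n : S.N) : G) = g * n * g⁻¹ := MulAut.conjNormal_apply g n

theorem iN_conj (a : S.Mt) (n : S.N) : a * S.iN n * a⁻¹ = S.iN (S.cn (S.pm a) n) := by
  apply S.Mt_ext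
  · apply Subtype.ext
    simp only [map_mul, map_inv, Subgroup.coe_mul, pm_iN, cn_coe, Subgroup.coe_inv]
  · simp only [map_mul, map_inv, pg_iN]; group

instance : S.iN.range.Normal := ⟨by
  rintro _ ⟨n, rfl⟩ a
  exact ⟨S.cn (S.pm a) n, (S.iN_conj a n).symm⟩⟩

variable {X : Type} [AddCommGroup X] [Module ℂ X]

def InvRep (θ : Representation ℂ S.N X) : Prop :=
  ∀ m : S.M, ∃ A : X →ₗ[ℂ] X, A ≠ 0 ∧ ∀ n x, A (θ n x) = θ (S.cn m n) (A x)

theorem cn_surj (g : G) : Function.Surjective (S.cn g) := (MulAut.conjNormal g : MulAut S.N).surjective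

theorem invRep_equiv {θ : Representation ℂ S.N X} (hθ : Irr θ) (h : S.InvRep θ) (m : S.M) :
    ∃ A : X ≃ₗ[ℂ] X, ∀ n x, A (θ n x) = θ (S.cn m n) (A x) := by
  obtain ⟨A, hA0, hA⟩ := h m
  have h1 : Irr (θ.comp (S.cn m)) := irr_pullback (S.cn_surj m) (β := θ) (fun a => rfl) hθ
  have h2 : IsMap θ (θ.comp (S.cn m)) A := hA
  have h3 := Irr.map_bij hθ h1 h2 hA0
  exact ⟨LinearEquiv.ofBijective A h3, hA⟩

theorem extend [Fintype F] [Finite G] [FiniteDimensional ℂ X] (h7 : 7 ≤ Fintype.card F)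
    (h9 : Fintype.card F ≠ 9) {θ : Representation ℂ S.N X} (hθ : Irr θ) (h : S.InvRep θ) :
    ∃ Θ : Representation ℂ S.Mt X, ∀ n, Θ (S.iN n) = θ n := by
  let R : Subgroup (S.Mt × (X ≃ₗ[ℂ] X)) :=
    { carrier := {r | ∀ n x, r.2 (θ n x) = θ (S.cn (S.pm r.1) n) (r.2 x)}
      one_mem' := by
        intro n x
        have : S.cn (S.pm (1 : S.Mt)) n = n := by
          apply Subtype.ext; rw [cn_coe]; simp
        show θ n x = _
        rw [Prod.fst_one, this]; rfl
      mul_mem' := by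
        intro a b ha hb n x
        have : S.cn (S.pm (a.1 * b.1)) n = S.cn (S.pm a.1) (S.cn (S.pm b.1) n) := by
          apply Subtype.ext; simp only [cn_coe, map_mul, Subgroup.coe_mul]; group
        show a.2 (b.2 _) = _
        rw [hb, ha, Prod.fst_mul, this]; rfl
      inv_mem' := by
        intro a ha n x
        have : S.cn (S.pm a.1) (S.cn (S.pm (a.1)⁻¹) n) = n := by
          apply Subtype.ext; simp only [cn_coe, map_inv, Subgroup.coe_inv]; group
        have h2 := ha (S.cn (S.pm (a.1)⁻¹) n) (a.2.symm x)
        rw [this, LinearEquiv.apply_symm_apply] at h2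
        show a.2.symm _ = θ (S.cn (S.pm (a.1)⁻¹) n) (a.2.symm x)
        rw [← h2, LinearEquiv.symm_apply_apply] }
  -- θ as equivs
  let te : S.N → (X ≃ₗ[ℂ] X) := fun n =>
    LinearEquiv.ofLinear (θ n) (θ n⁻¹) (by ext x; simp [rho_rho_inv]) (by ext x; simp [rho_inv_rho])
  have te_ap : ∀ n x, te n x = θ n x := fun n x => rfl
  let j : S.N →* R :=
    { toFun := fun n => ⟨(S.iN n, te n), by
        intro k x
        show θ n (θ k x) = θ _ (θ n x)
        rw [← rho_mul, ← rho_mul]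
        congr 2
        apply Subtype.ext; rw [Subgroup.coe_mul, Subgroup.coe_mul, cn_coe, pm_iN]; group⟩
      map_one' := by
        apply Subtype.ext; apply Prod.ext
        · exact map_one S.iN
        · ext x; show θ 1 x = x; simp
      map_mul' := by
        intro a b
        apply Subtype.ext; apply Prod.ext
        · exact map_mul S.iN a b
        · ext x; exact rho_mul θ a b x }
  have hjn : j.range.Normal := ⟨by
    rintro _ ⟨n, rfl⟩ r
    refine ⟨S.cn (S.pm r.1.1) n, ?_⟩
    apply Subtype.ext; apply Prod.ext
    · exact (S.iN_conj r.1.1 n).symm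
    · ext x
      have := r.2 n (r.1.2.symm x)
      rw [LinearEquiv.apply_symm_apply] at this
      exact this.symm⟩
  let ρ0 : R →* SL F := S.pg.comp ((MonoidHom.fst _ _).comp R.subtype)
  have hker : j.range ≤ ρ0.ker := by
    rintro _ ⟨n, rfl⟩
    exact S.pg_iN n
  let ρ : (R ⧸ j.range) →* SL F := QuotientGroup.lift j.range ρ0 hker
  have hs : Function.Surjective ρ := by
    intro g
    obtain ⟨a, rfl⟩ := S.pg_surj g
    obtain ⟨A, hA⟩ := S.invRep_equiv hθ h (S.pm a)
    exact ⟨QuotientGroup.mk ⟨(a, A), hA⟩, rfl⟩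
  have hc : ∀ z, ρ z = 1 → ∀ γ, z * γ = γ * z := by
    intro z hz γ
    obtain ⟨r, rfl⟩ := QuotientGroup.mk_surjective z
    obtain ⟨t, rfl⟩ := QuotientGroup.mk_surjective γ
    obtain ⟨n, hn⟩ := S.eq_iN (a := r.1.1) hz
    -- r * j n⁻¹ is scalar
    have h1 : (QuotientGroup.mk r : R ⧸ j.range) = QuotientGroup.mk (r * j n⁻¹) := by
      rw [QuotientGroup.eq]
      exact ⟨n⁻¹, by group⟩
    rw [h1, ← QuotientGroup.mk_mul, ← QuotientGroup.mk_mul]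
    congr 1
    set r' := r * j n⁻¹ with hr'
    have h2 : r'.1.1 = 1 := by
      show r.1.1 * S.iN n⁻¹ = 1
      rw [hn, map_inv, mul_inv_cancel]
    have h3 : IsMap θ θ (r'.1.2 : X →ₗ[ℂ] X) := by
      intro k x
      have := r'.2 k x
      rw [h2] at this
      have e : S.cn (S.pm (1 : S.Mt)) k = k := by
        apply Subtype.ext; rw [cn_coe]; simp
      rw [e] at this
      exact this
    obtain ⟨c, hc⟩ := hθ.schur h3
    have hc' : ∀ x, r'.1.2 x = c • x := fun x => LinearMap.congr_fun hc x
    apply Subtype.ext; apply Prod.ext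
    · show r'.1.1 * t.1.1 = t.1.1 * r'.1.1
      rw [h2, one_mul, mul_one]
    · ext x
      show r'.1.2 (t.1.2 x) = t.1.2 (r'.1.2 x)
      rw [hc', hc', map_smul]
  obtain ⟨s, hs'⟩ := split_SL h7 h9 ρ hs hc
  have hex : ∀ a : S.Mt, ∃ A : X ≃ₗ[ℂ] X, ∃ hA : (a, A) ∈ R,
      (QuotientGroup.mk (⟨(a, A), hA⟩ : R) : R ⧸ j.range) = s (S.pg a) := by
    intro a
    obtain ⟨r, hr⟩ := QuotientGroup.mk_surjective (s (S.pg a))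
    have h1 : S.pg r.1.1 = S.pg a := by
      rw [← hs' (S.pg a), ← hr]; rfl
    obtain ⟨n, hn⟩ := S.eq_iN (a := r.1.1⁻¹ * a) (by rw [map_mul, map_inv, h1, inv_mul_cancel])
    have h2 : (r * j n).1.1 = a := by
      show r.1.1 * S.iN n = a
      rw [← hn]; group
    refine ⟨(r * j n).1.2, ?_, ?_⟩
    · have := (r * j n).2
      rw [← h2]; exact this
    · rw [← hr, QuotientGroup.eq]
      refine ⟨n⁻¹, ?_⟩
      have e : (⟨(a, (r * j n).1.2), by rw [← h2]; exact (r * j n).2⟩ : R) = r * j n :=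
        Subtype.ext (Prod.ext h2.symm rfl)
      rw [e]; simp
  have huniq : ∀ (a : S.Mt) (A B : X ≃ₗ[ℂ] X) (hA : (a, A) ∈ R) (hB : (a, B) ∈ R),
      (QuotientGroup.mk (⟨(a, A), hA⟩ : R) : R ⧸ j.range) = QuotientGroup.mk (⟨(a, B), hB⟩ : R) →
      A = B := by
    intro a A B hA hB he
    rw [QuotientGroup.eq] at he
    obtain ⟨n, hn⟩ := he
    have h1 : S.iN n = a⁻¹ * a := congrArg (fun r : R => r.1.1) hn
    have h2 : te n = A⁻¹ * B := congrArg (fun r : R => r.1.2) hn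
    rw [inv_mul_cancel] at h1
    have h3 : n = 1 := by
      apply Subtype.ext
      rw [← pm_iN, h1]; simp
    have h4 : A⁻¹ * B = 1 := by
      rw [← h2, h3]; ext x; show θ 1 x = x; simp
    exact (inv_mul_eq_one.1 h4)
  choose A hAR hA using hex
  refine ⟨{ toFun := fun a => (A a : X →ₗ[ℂ] X), map_one' := ?_, map_mul' := ?_ }, ?_⟩
  · have := huniq 1 (A 1) 1 (hAR 1) R.one_mem (by rw [hA, map_one, map_one]; rfl)
    rw [this]; rfl
  · intro a b
    have := huniq (a * b) (A (a * b)) (A a * A b) (hAR _) (R.mul_mem (hAR a) (hAR b)) (by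
      rw [hA, map_mul, map_mul, ← hA a, ← hA b]; rfl)
    rw [this]; rfl
  · intro n
    have := huniq (S.iN n) (A (S.iN n)) (te n) (hAR _) (j n).2 (by
      rw [hA, pg_iN, map_one]
      symm
      exact (QuotientGroup.eq_one_iff _).2 ⟨n, rfl⟩)
    show ((A (S.iN n) : X ≃ₗ[ℂ] X) : X →ₗ[ℂ] X) = θ n
    rw [this]; rfl
end Stp
end B1

namespace B1
open Module TensorProduct

theorem tmul_zero {X E : Type} [AddCommGroup X] [Module ℂ X] [AddCommGroup E] [Module ℂ E]
    {x : X} {y : E} (h : x ⊗ₜ[ℂ] y = 0) : x = 0 ∨ y = 0 := by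
  by_contra hc
  push Not at hc
  obtain ⟨f, hf⟩ := Module.Projective.exists_dual_ne_zero ℂ hc.1
  have := congrArg (fun z => TensorProduct.lid ℂ E (TensorProduct.map f LinearMap.id z)) h
  simp [hc.2, hf] at this

namespace Stp
variable {G F : Type} [Group G] [Field F] (S : Stp G F)

theorem center_eq {z : SL F} (h : z ∈ Subgroup.center (SL F)) : z = 1 ∨ z = sH (-1) := by
  rw [Matrix.SpecialLinearGroup.mem_center_iff] at h
  obtain ⟨r, hr, hz⟩ := h
  simp only [Fintype.card_fin] at hr
  have e : ∀ i j, z.1 i j = if i = j then r else 0 := by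
    intro i j
    have := congrFun (congrFun hz i) j
    rw [← this, Matrix.scalar_apply, Matrix.diagonal_apply]
  rcases mul_self_eq_one_iff.1 ((sq r).symm.trans hr) with rfl | rfl
  · left; apply sl_ext <;> simp [e]
  · right; apply sl_ext <;> simp [e, sH_e00, sH_e01, sH_e10, sH_e11]

theorem zz_center : sH (-1 : Fˣ) ∈ Subgroup.center (SL F) := by
  rw [Subgroup.mem_center_iff]
  intro g
  apply sl_ext <;> simp [sl_mul00, sl_mul01, sl_mul10, sl_mul11, sH_e00, sH_e01, sH_e10, sH_e11]

theorem zz_sq : sH (-1 : Fˣ) * sH (-1) = 1 := by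
  rw [← sH_mul]; simp [sH_one]

def z0 : S.Mt := ⟨(1, sH (-1)), (S.mem_Mt _).2 (by
  rw [map_one]
  exact ((QuotientGroup.eq_one_iff _).2 zz_center).symm)⟩

theorem pm_z0 : S.pm S.z0 = 1 := rfl
theorem pg_z0 : S.pg S.z0 = sH (-1) := rfl

theorem ker_pm {a : S.Mt} (h : S.pm a = 1) : a = 1 ∨ a = S.z0 := by
  have h1 : S.φ (S.pm a) = (S.pg a : PSL2 F) := a.2
  rw [h, map_one] at h1
  have h2 := (QuotientGroup.eq_one_iff _).1 h1.symm
  rcases center_eq h2 with h3 | h3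
  · left; exact S.Mt_ext (h.trans (map_one _).symm) (h3.trans (map_one _).symm)
  · right; exact S.Mt_ext (h.trans S.pm_z0.symm) h3

theorem z0_iN (n : S.N) : S.z0 * S.iN n = S.iN n * S.z0 := by
  apply S.Mt_ext
  · rw [map_mul, map_mul, pm_z0, one_mul, mul_one]
  · rw [map_mul, map_mul, pg_iN, one_mul, mul_one]

theorem z0_sq : S.z0 * S.z0 = 1 := by
  apply S.Mt_ext
  · rw [map_mul, pm_z0, one_mul, map_one]
  · rw [map_mul, pg_z0, zz_sq, map_one]

variable {X : Type} [AddCommGroup X] [Module ℂ X] [FiniteDimensional ℂ X]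
variable {E : Type} [AddCommGroup E] [Module ℂ E] [FiniteDimensional ℂ E]
variable {E' : Type} [AddCommGroup E'] [Module ℂ E'] [FiniteDimensional ℂ E']
variable {V : Type} [AddCommGroup V] [Module ℂ V] [FiniteDimensional ℂ V]
variable {V' : Type} [AddCommGroup V'] [Module ℂ V'] [FiniteDimensional ℂ V']

noncomputable abbrev Tt (Θ : Representation ℂ S.Mt X) (ε : Representation ℂ (SL F) E) :
    Representation ℂ S.Mt (X ⊗[ℂ] E) := Θ.tprod (ε.comp S.pg)

theorem Tt_apply (Θ : Representation ℂ S.Mt X) (ε : Representation ℂ (SL F) E) (a : S.Mt) :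
    S.Tt Θ ε a = TensorProduct.map (Θ a) (ε (S.pg a)) := rfl

/-- `Θ` extends `θ`. -/
def Ext (θ : Representation ℂ S.N X) (Θ : Representation ℂ S.Mt X) : Prop := ∀ n, Θ (S.iN n) = θ n

theorem Tt_irr [Finite G] [Finite F] {θ : Representation ℂ S.N X} (hθ : Irr θ) {Θ : Representation ℂ S.Mt X}
    (hΘ : S.Ext θ Θ) {ε : Representation ℂ (SL F) E} (hε : Irr ε) : Irr (S.Tt Θ ε) := by
  have := hθ.1
  have := hε.1
  have : Nontrivial (X ⊗[ℂ] E) := by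
    apply Module.nontrivial_of_finrank_pos (R := ℂ)
    rw [Module.finrank_tensorProduct]
    exact Nat.mul_pos Module.finrank_pos Module.finrank_pos
  have : Finite (SL F) := Subtype.finite
  apply irr_of_end
  intro T hT
  have h1 : ∀ (n : S.N) (z : X ⊗[ℂ] E), T ((TensorProduct.map (θ n) LinearMap.id) z) =
      (TensorProduct.map (θ n) LinearMap.id) (T z) := by
    intro n z
    have := hT (S.iN n) z
    rw [Tt_apply, hΘ, pg_iN, map_one] at this
    exact this
  obtain ⟨ψ, rfl⟩ := tensor_right hθ h1
  have h2 : IsMap ε ε ψ := by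
    intro g e
    obtain ⟨a, rfl⟩ := S.pg_surj g
    obtain ⟨x, hx⟩ := exists_ne (0 : X)
    have h3 := hT a (Θ a⁻¹ x ⊗ₜ e)
    rw [Tt_apply] at h3
    simp only [TensorProduct.map_tmul, LinearMap.id_apply, rho_rho_inv] at h3
    have h4 : x ⊗ₜ[ℂ] (ψ (ε (S.pg a) e) - ε (S.pg a) (ψ e)) = 0 := by
      rw [TensorProduct.tmul_sub, h3, sub_self]
    rcases tmul_zero h4 with h5 | h5
    · exact absurd h5 hx
    · exact sub_eq_zero.1 h5
  obtain ⟨c, rfl⟩ := hε.schur h2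
  refine ⟨c, ?_⟩
  rw [TensorProduct.map_smul_right, TensorProduct.map_id]

/-- `ρ` lies over `Θ ⊗ ε`. -/
def Ty (Θ : Representation ℂ S.Mt X) (ε : Representation ℂ (SL F) E) (ρ : Representation ℂ G V) : Prop :=
  ∃ σ : Representation ℂ S.M (X ⊗[ℂ] E), (∀ a, σ (S.pm a) = S.Tt Θ ε a) ∧ Over S.M ρ σ

theorem exists_sigma {Θ : Representation ℂ S.Mt X} {ε : Representation ℂ (SL F) E}
    (h : S.Tt Θ ε S.z0 = 1) :
    ∃ σ : Representation ℂ S.M (X ⊗[ℂ] E), ∀ a, σ (S.pm a) = S.Tt Θ ε a := by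
  apply descend _ S.pm_surj
  intro a ha
  rcases S.ker_pm ha with rfl | rfl
  · exact map_one _
  · exact h

theorem exists_rho [Finite G] [Finite F] {θ : Representation ℂ S.N X} (hθ : Irr θ)
    {Θ : Representation ℂ S.Mt X} (hΘ : S.Ext θ Θ) {ε : Representation ℂ (SL F) E} (hε : Irr ε)
    (h : S.Tt Θ ε S.z0 = 1) :
    ∃ (V : Type) (_ : AddCommGroup V) (_ : Module ℂ V) (_ : FiniteDimensional ℂ V)
      (ρ : Representation ℂ G V), Irr ρ ∧ S.Ty Θ ε ρ := by
  obtain ⟨σ, hσ⟩ := S.exists_sigma h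
  have hi : Irr σ := irr_of_pullback hσ (S.Tt_irr hθ hΘ hε)
  obtain ⟨V, i1, i2, i3, ρ, h1, h2⟩ := exists_over hi
  exact ⟨V, i1, i2, i3, ρ, h1, σ, hσ, h2⟩

theorem Ty.over {S : Stp G F} [Finite G] [Finite F] {θ : Representation ℂ S.N X} (hθ : Irr θ)
    {Θ : Representation ℂ S.Mt X} (hΘ : S.Ext θ Θ) {ε : Representation ℂ (SL F) E} (hε : Irr ε)
    {ρ : Representation ℂ G V} (h : S.Ty Θ ε ρ) : Over S.N ρ θ := by
  obtain ⟨σ, hσ, f, hf, hf0⟩ := h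
  have hi : Irr σ := irr_of_pullback hσ (S.Tt_irr hθ hΘ hε)
  have hinj := hi.map_inj hf hf0
  have := hθ.1
  have := hε.1
  obtain ⟨e, he⟩ := exists_ne (0 : E)
  obtain ⟨x, hx⟩ := exists_ne (0 : X)
  refine ⟨f ∘ₗ (TensorProduct.mk ℂ X E).flip e, ?_, ?_⟩
  · intro n x
    have h1 := hf (S.pm (S.iN n)) (x ⊗ₜ e)
    rw [hσ, Tt_apply, hΘ, pg_iN, map_one] at h1
    exact h1
  · intro h0
    have h1 := LinearMap.congr_fun h0 x
    have h2 : f (x ⊗ₜ e) = 0 := h1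
    rw [← map_zero f] at h2
    rcases tmul_zero (hinj h2) with h5 | h5
    · exact hx h5
    · exact he h5

theorem Ty.dvd {S : Stp G F} [Finite G] [Finite F] {θ : Representation ℂ S.N X} (hθ : Irr θ)
    {Θ : Representation ℂ S.Mt X} (hΘ : S.Ext θ Θ) {ε : Representation ℂ (SL F) E} (hε : Irr ε)
    {ρ : Representation ℂ G V} (hρ : Irr ρ) (h : S.Ty Θ ε ρ) :
    finrank ℂ X * finrank ℂ E ∣ finrank ℂ V := by
  obtain ⟨σ, hσ, ho⟩ := h
  have hi : Irr σ := irr_of_pullback hσ (S.Tt_irr hθ hΘ hε)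
  have := Over.dvd hρ hi ho
  rwa [Module.finrank_tensorProduct] at this

theorem Ty.dvd_index {S : Stp G F} [Finite G] [Finite F] (hab : ∀ a b : G, a * b * a⁻¹ * b⁻¹ ∈ S.M)
    {θ : Representation ℂ S.N X} (hθ : Irr θ)
    {Θ : Representation ℂ S.Mt X} (hΘ : S.Ext θ Θ) {ε : Representation ℂ (SL F) E} (hε : Irr ε)
    {ρ : Representation ℂ G V} (hρ : Irr ρ) (h : S.Ty Θ ε ρ) :
    finrank ℂ V ∣ S.M.index * (finrank ℂ X * finrank ℂ E) := by
  obtain ⟨σ, hσ, ho⟩ := h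
  have hi : Irr σ := irr_of_pullback hσ (S.Tt_irr hθ hΘ hε)
  have := Over.dvd_index hab hρ hi ho
  rwa [Module.finrank_tensorProduct] at this

theorem Ty.congr {S : Stp G F} [Finite G] [Finite F] {θ : Representation ℂ S.N X} (hθ : Irr θ)
    {Θ : Representation ℂ S.Mt X} (hΘ : S.Ext θ Θ) {ε : Representation ℂ (SL F) E} (hε : Irr ε)
    {ε' : Representation ℂ (SL F) E'} {ρ : Representation ℂ G V} (h : S.Ty Θ ε ρ)
    (e : E' ≃ₗ[ℂ] E) (he : ∀ g v, e (ε' g v) = ε g (e v)) : S.Ty Θ ε' ρ := by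
  obtain ⟨σ, hσ, f, hf, hf0⟩ := h
  let E1 : X ⊗[ℂ] E' ≃ₗ[ℂ] X ⊗[ℂ] E := TensorProduct.congr (LinearEquiv.refl ℂ X) e
  have hE : ∀ a z, E1 (S.Tt Θ ε' a z) = S.Tt Θ ε a (E1 z) := by
    intro a z
    induction z with
    | zero => simp
    | tmul x y => simp [E1, Tt_apply, he]
    | add x y hx hy => rw [map_add, map_add, map_add, map_add, hx, hy]
  obtain ⟨σ', hσ'⟩ := S.exists_sigma (Θ := Θ) (ε := ε') (by
    ext1
    · ext x y
      have h1 := hE S.z0 (x ⊗ₜ y)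
      rw [← hσ, pm_z0, map_one] at h1
      exact E1.injective h1)
  refine ⟨σ', hσ', f ∘ₗ E1.toLinearMap, ?_, ?_⟩
  · intro m z
    obtain ⟨a, rfl⟩ := S.pm_surj m
    have := hf (S.pm a) (E1 z)
    rw [hσ, ← hE, ← hσ'] at this
    exact this
  · intro h0
    apply hf0
    ext1; ext x y
    have := LinearMap.congr_fun h0 (E1.symm (x ⊗ₜ y))
    simpa using this

theorem Ty.finrank_eq {S : Stp G F} [Finite G] [Finite F] (hab : ∀ a b : G, a * b * a⁻¹ * b⁻¹ ∈ S.M)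
    {θ : Representation ℂ S.N X} (hθ : Irr θ)
    {Θ : Representation ℂ S.Mt X} (hΘ : S.Ext θ Θ) {ε : Representation ℂ (SL F) E} (hε : Irr ε)
    {ρ : Representation ℂ G V} (hρ : Irr ρ) (h : S.Ty Θ ε ρ)
    {ρ' : Representation ℂ G V'} (hρ' : Irr ρ') (h' : S.Ty Θ ε ρ') :
    finrank ℂ V = finrank ℂ V' := by
  obtain ⟨σ, hσ, ho⟩ := h
  obtain ⟨σ', hσ', ho'⟩ := h'
  have hi : Irr σ := irr_of_pullback hσ (S.Tt_irr hθ hΘ hε)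
  have : σ = σ' := by
    ext1 m
    obtain ⟨a, rfl⟩ := S.pm_surj m
    rw [hσ, hσ']
  subst this
  exact Over.finrank_eq hab hρ hρ' hi ho ho'

theorem exists_ty [Finite G] [Finite F] {θ : Representation ℂ S.N X} (hθ : Irr θ)
    {Θ : Representation ℂ S.Mt X} (hΘ : S.Ext θ Θ) {ρ : Representation ℂ G V} (hρ : Irr ρ)
    (ho : Over S.N ρ θ) :
    ∃ (E : Type) (_ : AddCommGroup E) (_ : Module ℂ E) (_ : FiniteDimensional ℂ E)
      (ε : Representation ℂ (SL F) E), Irr ε ∧ S.Ty Θ ε ρ := by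
  let ρt : Representation ℂ S.Mt V := ρ.comp (S.M.subtype.comp S.pm)
  let H := HomM S.iN.range Θ ρt
  have hH : H ≠ ⊥ := by
    obtain ⟨f, hf, hf0⟩ := ho
    intro hb
    apply hf0
    have : f ∈ H := by
      rintro ⟨_, n, rfl⟩ x
      have := hf n x
      rw [← hΘ] at this
      exact this
    rw [hb] at this
    exact (Submodule.mem_bot ℂ).1 this
  obtain ⟨E, hEH, hE⟩ := exists_minInv (homRep Θ ρt) H (HomM_inv Θ ρt) hH
  have hEi := irr_res hE
  obtain ⟨ε, hε⟩ := descend S.pg S.pg_surj (V := E) (res (homRep Θ ρt) E hE.2.1) (by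
    intro a ha
    obtain ⟨n, rfl⟩ := S.eq_iN ha
    ext1 f
    apply Subtype.ext
    rw [res_coe]
    ext x
    rw [homRep_apply]
    have h1 : (f : X →ₗ[ℂ] V) ∈ H := hEH f.2
    have h2 := h1 ⟨S.iN n, n, rfl⟩ (Θ (S.iN n)⁻¹ x)
    change f.1 (Θ (S.iN n) (Θ (S.iN n)⁻¹ x)) = ρt (S.iN n) (f.1 (Θ (S.iN n)⁻¹ x)) at h2
    rw [rho_rho_inv] at h2
    exact h2.symm)
  have hεi : Irr ε := irr_of_pullback (V := E) hε hEi
  have hT := S.Tt_irr hθ hΘ hεi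
  let ev : X ⊗[ℂ] E →ₗ[ℂ] V := TensorProduct.lift (LinearMap.flip (E.subtype))
  have hev_ap : ∀ x (f : E), ev (x ⊗ₜ f) = f.1 x := fun x f => rfl
  have hev : IsMap (S.Tt Θ ε) ρt ev := by
    intro a z
    induction z with
    | zero => simp
    | tmul x f =>
      rw [Tt_apply, TensorProduct.map_tmul, hev_ap, hev_ap, hε, res_coe, homRep_apply, rho_inv_rho]
    | add x y hx hy => simp only [map_add, hx, hy]
  have hev0 : ev ≠ 0 := by
    intro h0
    apply hE.1
    rw [Submodule.eq_bot_iff]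
    intro f hf
    ext x
    exact LinearMap.congr_fun h0 (x ⊗ₜ ⟨f, hf⟩)
  have hinj := hT.map_inj hev hev0
  obtain ⟨σ, hσ⟩ := S.exists_sigma (Θ := Θ) (ε := ε) (by
    ext1; ext x y
    apply hinj
    have := hev S.z0 (x ⊗ₜ y)
    have h2 : ρt S.z0 = 1 := by
      show ρ ((S.pm S.z0 : S.M) : G) = 1
      rw [pm_z0]; simp
    rw [h2] at this
    exact this)
  refine ⟨E, inferInstance, inferInstance, inferInstance, ε, hεi, σ, hσ, ev, ?_, hev0⟩
  intro m z
  obtain ⟨a, rfl⟩ := S.pm_surj m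
  rw [hσ]
  exact hev a z

/-- the central element acts on X by a sign -/
theorem exists_sign {θ : Representation ℂ S.N X} (hθ : Irr θ)
    {Θ : Representation ℂ S.Mt X} (hΘ : S.Ext θ Θ) :
    ∃ c : ℂ, (c = 1 ∨ c = -1) ∧ Θ S.z0 = c • LinearMap.id := by
  obtain ⟨c, hc⟩ := hθ.schur (f := Θ S.z0) (by
    intro n x
    rw [← hΘ, ← rho_mul, z0_iN, rho_mul])
  refine ⟨c, ?_, hc⟩
  have := hθ.1
  obtain ⟨x, hx⟩ := exists_ne (0 : X)
  have h1 : Θ (S.z0 * S.z0) x = x := by rw [z0_sq]; simp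
  rw [rho_mul, hc] at h1
  simp only [LinearMap.smul_apply, LinearMap.id_apply, smul_smul] at h1
  have h2 : (c * c - 1) • x = 0 := by rw [sub_smul, h1]; simp
  have h3 : c * c = 1 := by
    rcases smul_eq_zero.1 h2 with h | h
    · exact sub_eq_zero.1 h
    · exact absurd h hx
  exact mul_self_eq_one_iff.1 h3

theorem Tt_z0 {Θ : Representation ℂ S.Mt X} {ε : Representation ℂ (SL F) E} {c : ℂ}
    (hc : c = 1 ∨ c = -1) (h : Θ S.z0 = c • LinearMap.id) (h' : ε (sH (-1)) = c • LinearMap.id) :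
    S.Tt Θ ε S.z0 = 1 := by
  rw [Tt_apply, h, pg_z0, h', TensorProduct.map_smul_left, TensorProduct.map_smul_right,
    TensorProduct.map_id, smul_smul, mul_self_eq_one_iff.2 hc, one_smul]; rfl

theorem Ty.sign {S : Stp G F} [Nontrivial X] {Θ : Representation ℂ S.Mt X} {ε : Representation ℂ (SL F) E}
    {ρ : Representation ℂ G V} (hT : S.Ty Θ ε ρ) {c : ℂ}
    (hc : c = 1 ∨ c = -1) (h : Θ S.z0 = c • LinearMap.id) : ε (sH (-1)) = c • LinearMap.id := by
  obtain ⟨σ, hσ, -⟩ := hT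
  have h1 := hσ S.z0
  rw [pm_z0, map_one, Tt_apply, h, pg_z0] at h1
  ext e
  obtain ⟨x, hx⟩ := exists_ne (0 : X)
  have h2 := LinearMap.congr_fun h1 (x ⊗ₜ e)
  simp only [TensorProduct.map_tmul, Module.End.one_apply, LinearMap.smul_apply,
    LinearMap.id_apply, TensorProduct.smul_tmul] at h2
  have h3 : x ⊗ₜ[ℂ] (e - c • ε (sH (-1)) e) = 0 := by
    rw [TensorProduct.tmul_sub, ← h2, sub_self]
  rcases tmul_zero h3 with h5 | h5
  · exact absurd h5 hx
  · have h6 := sub_eq_zero.1 h5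
    simp only [LinearMap.smul_apply, LinearMap.id_apply]
    conv_rhs => rw [h6, smul_smul, mul_self_eq_one_iff.2 hc, one_smul]
end Stp
end B1

namespace B1
open Module

section ey
variable {F : Type} [Field F] [Fintype F] (ψ : AddChar F ℂ)
variable {E : Type} [AddCommGroup E] [Module ℂ E] [FiniteDimensional ℂ E]
variable {E' : Type} [AddCommGroup E'] [Module ℂ E'] [FiniteDimensional ℂ E']
variable (ρ : Representation ℂ (SL F) E)

/-- projection onto the `ψ(y·)`-eigenspace of the unipotent group -/
noncomputable def ey (y : F) : E →ₗ[ℂ] E :=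
  ((Fintype.card F : ℂ)⁻¹) • ∑ u : F, ψ (-(y * u)) • ρ (sX u)

theorem ey_apply (y : F) (v : E) :
    ey ψ ρ y v = ((Fintype.card F : ℂ)⁻¹) • ∑ u : F, ψ (-(y * u)) • ρ (sX u) v := by
  simp [ey, LinearMap.sum_apply]

theorem qne : (Fintype.card F : ℂ) ≠ 0 := by exact_mod_cast Fintype.card_ne_zero

theorem psi_neg (x : F) : ψ (-x) * ψ x = 1 := by
  rw [← AddChar.map_add_eq_mul]; simp

theorem X_ey (y u : F) (v : E) : ρ (sX u) (ey ψ ρ y v) = ψ (y * u) • ey ψ ρ y v := by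
  rw [ey_apply, map_smul, smul_comm (ψ (y * u)) ((Fintype.card F : ℂ)⁻¹), map_sum, Finset.smul_sum (r := ψ (y * u))]
  congr 1
  refine Fintype.sum_equiv (Equiv.addLeft u) _ _ fun x => ?_
  rw [map_smul, ← rho_mul, ← sX_add, smul_smul, ← AddChar.map_add_eq_mul]
  simp only [Equiv.coe_addLeft]
  congr 2; ring

theorem ey_X (y u : F) (v : E) : ey ψ ρ y (ρ (sX u) v) = ψ (y * u) • ey ψ ρ y v := by
  rw [← X_ey, ey_apply, ey_apply, map_smul, map_sum]
  congr 1
  refine Finset.sum_congr rfl fun x _ => ?_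
  rw [map_smul, ← rho_mul, ← rho_mul, ← sX_add, ← sX_add, add_comm]

theorem sum_psi (hψ : ψ.IsPrimitive) [DecidableEq F] (b : F) :
    ∑ u : F, ψ (u * b) = if b = 0 then (Fintype.card F : ℂ) else 0 := by
  rw [AddChar.sum_mulShift b hψ]; split_ifs <;> simp

theorem ey_of_eig (hψ : ψ.IsPrimitive) [DecidableEq F] {z : F} {v : E}
    (h : ∀ u, ρ (sX u) v = ψ (z * u) • v) (y : F) :
    ey ψ ρ y v = if y = z then v else 0 := by
  rw [ey_apply]
  have : ∀ u : F, ψ (-(y * u)) • ρ (sX u) v = ψ (u * (z - y)) • v := by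
    intro u
    rw [h, smul_smul, ← AddChar.map_add_eq_mul]
    congr 2; ring
  simp_rw [this]
  rw [← Finset.sum_smul, sum_psi ψ hψ]
  by_cases hy : y = z
  · subst hy; simp only [sub_self, if_true]; rw [smul_smul, inv_mul_cancel₀ qne, one_smul]
  · rw [if_neg hy, if_neg (fun h => hy (sub_eq_zero.1 h).symm)]; simp

theorem ey_ey (hψ : ψ.IsPrimitive) [DecidableEq F] (y z : F) (v : E) :
    ey ψ ρ y (ey ψ ρ z v) = if y = z then ey ψ ρ z v else 0 :=
  ey_of_eig ψ ρ hψ (fun u => X_ey ψ ρ z u v) y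

theorem ey_idem (hψ : ψ.IsPrimitive) (y : F) : ey ψ ρ y ∘ₗ ey ψ ρ y = ey ψ ρ y := by
  classical
  ext v
  rw [LinearMap.comp_apply, ey_ey ψ ρ hψ, if_pos rfl]

theorem sum_ey (hψ : ψ.IsPrimitive) : ∑ y, ey ψ ρ y = LinearMap.id := by
  classical
  ext v
  rw [LinearMap.sum_apply]
  simp_rw [ey_apply]
  rw [← Finset.smul_sum, Finset.sum_comm]
  have : ∀ u : F, ∑ y : F, ψ (-(y * u)) • ρ (sX u) v =
      if u = 0 then (Fintype.card F : ℂ) • v else 0 := by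
    intro u
    rw [← Finset.sum_smul]
    have h1 : ∀ y : F, ψ (-(y * u)) = ψ (y * (-u)) := fun y => by rw [mul_neg]
    simp_rw [h1]
    rw [sum_psi ψ hψ]
    by_cases hu : u = 0
    · subst hu; simp [sX_zero]
    · simp [hu]
  simp_rw [this]
  rw [Finset.sum_ite_eq' Finset.univ (0 : F)]
  simp only [Finset.mem_univ, if_true, LinearMap.id_apply]
  rw [smul_smul, inv_mul_cancel₀ qne, one_smul]

theorem H_ey (t : Fˣ) (y : F) (v : E) :
    ρ (sH t) (ey ψ ρ y v) = ey ψ ρ (y / (t : F) ^ 2) (ρ (sH t) v) := by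
  rw [ey_apply, ey_apply, map_smul, map_sum]
  congr 1
  have ht : (t : F) ^ 2 ≠ 0 := pow_ne_zero _ t.ne_zero
  refine Fintype.sum_equiv (Equiv.mulLeft₀ ((t : F) ^ 2) ht) _ _ fun u => ?_
  simp only [Equiv.mulLeft₀_apply]
  rw [map_smul, ← rho_mul, ← rho_mul]
  congr 2
  · congr 1
    field_simp
  · rw [← sH_sX]; simp

variable {ρ} in
theorem ey_map {ρ' : Representation ℂ (SL F) E'} {f : E →ₗ[ℂ] E'} (hf : IsMap ρ ρ' f) (y : F) (v : E) :
    f (ey ψ ρ y v) = ey ψ ρ' y (f v) := by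
  rw [ey_apply, ey_apply, map_smul, map_sum]
  congr 1
  refine Finset.sum_congr rfl fun u _ => ?_
  rw [map_smul, hf]

noncomputable def mm (y : F) : ℕ := finrank ℂ (LinearMap.range (ey ψ ρ y))

theorem mm_sq (t : Fˣ) (y : F) : mm ψ ρ (y * (t : F) ^ 2) = mm ψ ρ y := by
  have key : ∀ (s : Fˣ) (z : F), mm ψ ρ z ≤ mm ψ ρ (z / (s : F) ^ 2) := by
    intro s z
    have : (LinearMap.range (ey ψ ρ z)).map (ρ (sH s)) ≤ LinearMap.range (ey ψ ρ (z / (s : F) ^ 2)) := by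
      rintro _ ⟨_, ⟨v, rfl⟩, rfl⟩
      exact ⟨_, (H_ey ψ ρ s z v).symm⟩
    have h2 := Submodule.finrank_mono this
    rwa [finrank_map_rho] at h2
  have ht : (t : F) ≠ 0 := t.ne_zero
  apply le_antisymm
  · have := key t (y * (t : F) ^ 2)
    rwa [mul_div_assoc, div_self (pow_ne_zero _ ht), mul_one] at this
  · have := key t⁻¹ y
    simpa [div_eq_mul_inv] using this

theorem sum_mm (hψ : ψ.IsPrimitive) : ∑ y, mm ψ ρ y = finrank ℂ E :=
  sum_finrank _ (sum_ey ψ ρ hψ) (ey_idem ψ ρ hψ)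

theorem two_dim (hψ : ψ.IsPrimitive) (hodd : ringChar F ≠ 2) {k : F} (hk : ¬ IsSquare k) :
    2 * finrank ℂ E = 2 * mm ψ ρ 0 + (Fintype.card F - 1) * (mm ψ ρ 1 + mm ψ ρ k) := by
  classical
  have hk0 : k ≠ 0 := by rintro rfl; exact hk ⟨0, by simp⟩
  have h1 : ∀ y : F, (2 * mm ψ ρ y : ℤ) = if y = 0 then (2 * mm ψ ρ 0 : ℤ) else
      ((mm ψ ρ 1 + mm ψ ρ k : ℤ) + quadraticChar F y * (mm ψ ρ 1 - mm ψ ρ k)) := by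
    intro y
    by_cases hy : y = 0
    · simp [hy]
    rw [if_neg hy]
    by_cases hs : IsSquare y
    · rw [(quadraticChar_one_iff_isSquare hy).2 hs]
      obtain ⟨r, hr⟩ := hs
      have hr0 : r ≠ 0 := by rintro rfl; simp at hr; exact hy hr
      have := mm_sq ψ ρ (Units.mk0 r hr0) 1
      rw [one_mul, Units.val_mk0, sq, ← hr] at this
      rw [this]; ring
    · rw [quadraticChar_neg_one_iff_not_isSquare.2 hs]
      have h3 : IsSquare (y / k) := by
        have h4 : quadraticChar F (y / k) = 1 := by
          have h5 : quadraticChar F (y / k) * quadraticChar F k = quadraticChar F y := by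
            rw [← map_mul, div_mul_cancel₀ _ hk0]
          rw [quadraticChar_neg_one_iff_not_isSquare.2 hs, quadraticChar_neg_one_iff_not_isSquare.2 hk] at h5
          linarith
        exact (quadraticChar_one_iff_isSquare (div_ne_zero hy hk0)).1 h4
      obtain ⟨r, hr⟩ := h3
      have hr0 : r ≠ 0 := by
        rintro rfl
        rw [mul_zero, div_eq_zero_iff] at hr
        tauto
      have := mm_sq ψ ρ (Units.mk0 r hr0) k
      rw [Units.val_mk0, sq, ← hr, mul_div_cancel₀ _ hk0] at this
      rw [this]; ring
  have h2 : ∑ y, (2 * mm ψ ρ y : ℤ) = 2 * finrank ℂ E := by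
    rw [← Finset.mul_sum, ← sum_mm ψ ρ hψ]; push_cast; rfl
  rw [Finset.sum_congr rfl fun y _ => h1 y] at h2
  have h3 : ∀ y : F, (if y = 0 then (2 * mm ψ ρ 0 : ℤ) else
      ((mm ψ ρ 1 + mm ψ ρ k : ℤ) + quadraticChar F y * (mm ψ ρ 1 - mm ψ ρ k))) =
      (mm ψ ρ 1 + mm ψ ρ k : ℤ) + quadraticChar F y * (mm ψ ρ 1 - mm ψ ρ k) +
      if y = 0 then (2 * mm ψ ρ 0 - (mm ψ ρ 1 + mm ψ ρ k) : ℤ) else 0 := by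
    intro y
    by_cases hy : y = 0
    · simp [hy]
    · simp [hy]
  rw [Finset.sum_congr rfl fun y _ => h3 y] at h2
  rw [Finset.sum_add_distrib, Finset.sum_add_distrib, ← Finset.sum_mul,
    quadraticChar_sum_zero hodd, Finset.sum_ite_eq' Finset.univ (0 : F)] at h2
  simp only [Finset.sum_const, Finset.card_univ, Finset.mem_univ, if_true, nsmul_eq_mul] at h2
  have hc : 1 ≤ Fintype.card F := Fintype.card_pos
  zify [hc]
  linarith

theorem mem_range_ey (hψ : ψ.IsPrimitive) {y : F} {v : E} (h : v ∈ LinearMap.range (ey ψ ρ y)) :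
    ey ψ ρ y v = v := by
  classical
  obtain ⟨w, rfl⟩ := h
  rw [ey_ey ψ ρ hψ, if_pos rfl]

theorem range_of_X {v : E} (hψ : ψ.IsPrimitive) (h : ∀ u, ρ (sX u) v = v) : ey ψ ρ 0 v = v := by
  classical
  rw [ey_of_eig ψ ρ hψ (z := 0) (by intro u; simp [h]), if_pos rfl]

theorem X_of_range {v : E} (h : ey ψ ρ 0 v = v) (u : F) : ρ (sX u) v = v := by
  rw [← h, X_ey]; simp

end ey
end B1

namespace B1
open Module

section eig
variable {F : Type} [Field F] [Fintype F] (ψ : AddChar F ℂ)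
variable {E : Type} [AddCommGroup E] [Module ℂ E] [FiniteDimensional ℂ E]
variable {ρ : Representation ℂ (SL F) E}

theorem fsl (v : E) : finrank ℂ (Submodule.span ℂ {v}) ≤ 1 := by
  by_cases h : v = 0
  · rw [h, Submodule.span_zero_singleton, finrank_bot]; exact zero_le_one
  · rw [finrank_span_singleton h]

/-- Borel eigenvector -/
structure Eig (ρ : Representation ℂ (SL F) E) (v : E) (l : Fˣ → ℂ) : Prop where
  ne : v ≠ 0
  X : ∀ u, ρ (sX u) v = v
  H : ∀ t, ρ (sH t) v = l t • v

theorem Eig.mul {v : E} {l : Fˣ → ℂ} (h : Eig ρ v l) (s t : Fˣ) : l (s * t) = l s * l t := by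
  have h1 := h.H (s * t)
  rw [sH_mul, rho_mul, h.H t, map_smul, h.H s, smul_smul] at h1
  have := smul_left_injective ℂ h.ne h1
  rw [mul_comm (l s)]; exact this.symm

theorem Eig.one {v : E} {l : Fˣ → ℂ} (h : Eig ρ v l) : l 1 = 1 := by
  have h1 := h.H 1
  rw [sH_one, map_one] at h1
  have : (1 : ℂ) • v = l 1 • v := by rw [one_smul]; exact h1
  exact (smul_left_injective ℂ h.ne this).symm

theorem Eig.l_ne {v : E} {l : Fˣ → ℂ} (h : Eig ρ v l) (t : Fˣ) : l t ≠ 0 := by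
  intro h0
  have := h.mul t t⁻¹
  rw [mul_inv_cancel, h.one, h0, zero_mul] at this
  exact one_ne_zero this

theorem exists_eig (hψ : ψ.IsPrimitive) (h : 0 < mm ψ ρ 0) : ∃ v l, Eig ρ v l := by
  obtain ⟨g, hg⟩ := IsCyclic.exists_generator (α := Fˣ)
  let p := LinearMap.range (ey ψ ρ 0)
  have hmap : ∀ x ∈ p, ρ (sH g) x ∈ p := by
    rintro _ ⟨x, rfl⟩
    rw [H_ey]; simp only [zero_div]
    exact ⟨_, rfl⟩
  have : Nontrivial p := Module.nontrivial_of_finrank_pos (R := ℂ) h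
  obtain ⟨μ, hμ⟩ := Module.End.exists_eigenvalue ((ρ (sH g)).restrict hmap)
  obtain ⟨v, hv⟩ := hμ.exists_hasEigenvector
  have h1 : ρ (sH g) v.1 = μ • v.1 := congrArg Subtype.val hv.apply_eq_smul
  have h2 : ∀ t : Fˣ, ∃ c : ℂ, ρ (sH t) v.1 = c • v.1 := by
    intro t
    obtain ⟨n, rfl⟩ := (mem_powers_iff_mem_zpowers).2 (hg t)
    refine ⟨μ ^ n, ?_⟩
    induction n with
    | zero => simp [sH_one]
    | succ n ih =>
      simp only at ih ⊢
      rw [pow_succ, sH_mul, rho_mul, h1, map_smul, ih, smul_smul, pow_succ, mul_comm]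
  choose l hl using h2
  refine ⟨v.1, l, ?_, ?_, hl⟩
  · intro h0; exact hv.2 (Subtype.ext h0)
  · exact X_of_range ψ ρ (mem_range_ey ψ ρ hψ v.2)

theorem orbit_span {G : Type} [Group G] {ρ : Representation ℂ G E} (hρ : Irr ρ) {v : E} (hv : v ≠ 0) (P : Submodule ℂ E)
    (h : ∀ g, ρ g v ∈ P) : P = ⊤ := by
  let Q := Submodule.span ℂ (Set.range fun g => ρ g v)
  have hQ : Inv ρ Q := by
    intro g x hx
    have : Q ≤ Q.comap (ρ g) := by
      rw [Submodule.span_le]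
      rintro _ ⟨k, rfl⟩
      apply Submodule.subset_span
      exact ⟨g * k, by simp only [rho_mul]⟩
    exact this hx
  have hle : Q ≤ P := by
    rw [Submodule.span_le]
    rintro _ ⟨k, rfl⟩
    exact h k
  rcases hρ.2 Q hQ with h0 | h0
  · exfalso
    have : v ∈ Q := Submodule.subset_span ⟨1, by simp⟩
    rw [h0, Submodule.mem_bot] at this
    exact hv this
  · rw [eq_top_iff, ← h0]; exact hle

variable {v : E} {l : Fˣ → ℂ}

theorem Eig.W (h : Eig ρ v l) (t : Fˣ) : ρ (sW t) v = l t⁻¹ • ρ (sW 1) v := by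
  have : sW t = sW 1 * sH t⁻¹ := by rw [sW_sH]; simp
  rw [this, rho_mul, h.H, map_smul]

theorem Eig.cell (h : Eig ρ v l) (g : SL F) : (g.1 1 0 = 0 ∧ ∃ t, ρ g v = l t • v) ∨
    (g.1 1 0 ≠ 0 ∧ ∃ t a, ρ g v = l t • ρ (sX a) (ρ (sW 1) v)) := by
  by_cases hg : g.1 1 0 = 0
  · obtain ⟨a, t, rfl⟩ := bruhat1 g hg
    exact Or.inl ⟨hg, t, by rw [rho_mul, h.H, map_smul, h.X]⟩
  · obtain ⟨a, b, t, rfl⟩ := bruhat2 g hg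
    exact Or.inr ⟨hg, t⁻¹, a, by rw [rho_mul, rho_mul, h.X, h.W, map_smul]⟩

theorem Eig.span (h : Eig ρ v l) (hρ : Irr ρ) (P : Submodule ℂ E) (h1 : v ∈ P)
    (h2 : ∀ u, ρ (sX u) (ρ (sW 1) v) ∈ P) : P = ⊤ := by
  apply orbit_span hρ h.ne
  intro g
  rcases h.cell g with ⟨-, t, ht⟩ | ⟨-, t, a, ht⟩
  · rw [ht]; exact P.smul_mem _ h1
  · rw [ht]; exact P.smul_mem _ (h2 a)

theorem Eig.ey0 (h : Eig ρ v l) (hψ : ψ.IsPrimitive) : ey ψ ρ 0 v = v := range_of_X ψ ρ hψ h.X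

theorem Eig.eyn (h : Eig ρ v l) (hψ : ψ.IsPrimitive) {y : F} (hy : y ≠ 0) : ey ψ ρ y v = 0 := by
  classical
  rw [ey_of_eig ψ ρ hψ (z := 0) (by intro u; simp [h.X]), if_neg hy]

theorem Eig.range_le (h : Eig ρ v l) (hρ : Irr ρ) (y : F) : LinearMap.range (ey ψ ρ y) ≤
    Submodule.span ℂ {ey ψ ρ y v, ey ψ ρ y (ρ (sW 1) v)} := by
  rintro _ ⟨x, rfl⟩
  have := h.span hρ ((Submodule.span ℂ {ey ψ ρ y v, ey ψ ρ y (ρ (sW 1) v)}).comap (ey ψ ρ y))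
    (Submodule.subset_span (by simp)) (fun u => by
      rw [Submodule.mem_comap, ey_X]
      exact Submodule.smul_mem _ _ (Submodule.subset_span (by simp)))
  have h2 : x ∈ (⊤ : Submodule ℂ E) := trivial
  rw [← this] at h2
  exact h2

theorem Eig.range_le' (h : Eig ρ v l) (hψ : ψ.IsPrimitive) (hρ : Irr ρ) {y : F} (hy : y ≠ 0) :
    LinearMap.range (ey ψ ρ y) ≤ Submodule.span ℂ {ey ψ ρ y (ρ (sW 1) v)} := by
  have := h.range_le ψ hρ y
  rw [h.eyn ψ hψ hy, Submodule.span_insert_zero] at this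
  exact this

theorem Eig.mm_le (h : Eig ρ v l) (hψ : ψ.IsPrimitive) (hρ : Irr ρ) {y : F} (hy : y ≠ 0) :
    mm ψ ρ y ≤ 1 :=
  (Submodule.finrank_mono (h.range_le' ψ hψ hρ hy)).trans (fsl _)

theorem Eig.mm0_le (h : Eig ρ v l) (hρ : Irr ρ) : mm ψ ρ 0 ≤ 2 := by
  classical
  refine (Submodule.finrank_mono (h.range_le ψ hρ 0)).trans ?_
  have := finrank_span_finset_le_card (R := ℂ) ({ey ψ ρ 0 v, ey ψ ρ 0 (ρ (sW 1) v)} : Finset E)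
  rw [Finset.coe_insert, Finset.coe_singleton] at this
  exact this.trans Finset.card_le_two

theorem Eig.mm0_pos (h : Eig ρ v l) (hψ : ψ.IsPrimitive) : 0 < mm ψ ρ 0 := by
  have : Nontrivial (LinearMap.range (ey ψ ρ 0)) :=
    ⟨⟨⟨v, ⟨v, h.ey0 ψ hψ⟩⟩, 0, fun h0 => h.ne (congrArg Subtype.val h0)⟩⟩
  exact finrank_pos

theorem WXW (u : Fˣ) : sW 1 * sX (u : F) * sW 1 =
    sX (((-u⁻¹ : Fˣ)) : F) * sW (-u⁻¹) * sX ((-u⁻¹ : Fˣ) : F) := by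
  apply sl_ext <;> simp [sl_mul00, sl_mul01, sl_mul10, sl_mul11, sX_e00, sX_e01, sX_e10, sX_e11, sW_e00, sW_e01, sW_e10, sW_e11]

theorem Eig.WX (h : Eig ρ v l) (u : Fˣ) : ρ (sW 1) (ρ (sX (u : F)) (ρ (sW 1) v)) =
    l (-u) • ρ (sX ((-u⁻¹ : Fˣ) : F)) (ρ (sW 1) v) := by
  rw [← rho_mul, ← rho_mul, WXW, rho_mul, rho_mul, h.X, h.W, map_smul]
  simp [inv_neg]

theorem Eig.WW (h : Eig ρ v l) : ρ (sW 1) (ρ (sW 1) v) = l (-1) • v := by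
  rw [← rho_mul, sW_sW, ← h.H]; simp

theorem sum_units [DecidableEq F] {A : Type} [AddCommMonoid A] (f : F → A) : ∑ u, f u = f 0 + ∑ u : Fˣ, f u := by
  rw [← Finset.add_sum_erase Finset.univ f (Finset.mem_univ 0)]
  congr 1
  refine (Finset.sum_bij (fun (u : Fˣ) _ => (u : F)) ?_ ?_ ?_ ?_).symm
  · intro u _; simp
  · intro a _ b _ hab; exact Units.ext hab
  · intro b hb; exact ⟨Units.mk0 b (Finset.ne_of_mem_erase hb), Finset.mem_univ _, rfl⟩
  · intro u _; rfl

theorem Eig.mm0_one (h : Eig ρ v l) (hψ : ψ.IsPrimitive) (hρ : Irr ρ) {y : F}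
    (h0 : ey ψ ρ y (ρ (sW 1) v) = 0) : mm ψ ρ 0 = 1 := by
  classical
  apply le_antisymm _ (h.mm0_pos ψ hψ)
  have h1 : ∀ P : Submodule ℂ E, (∀ u, ρ (sX u) (ρ (sW 1) v) ∈ P) → P = ⊤ := by
    intro P hP
    apply h.span hρ P _ hP
    rw [ey_apply] at h0
    have h2 := (smul_eq_zero.1 h0).resolve_left (inv_ne_zero qne)
    have h3 := congrArg (ρ (sW 1)) h2
    rw [map_sum, map_zero, sum_units] at h3
    have h4 := eq_neg_of_add_eq_zero_left h3
    rw [sX_zero, map_one, map_smul, Module.End.one_apply, h.WW] at h4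
    have h5 : ψ (-(y * 0)) • l (-1) • v ∈ P := by
      rw [h4]
      apply P.neg_mem
      apply P.sum_mem
      intro u _
      rw [map_smul, h.WX]
      exact P.smul_mem _ (P.smul_mem _ (hP _))
    simp only [mul_zero, neg_zero, AddChar.map_zero_eq_one, one_smul] at h5
    exact (P.smul_mem_iff (h.l_ne _)).1 h5
  have h2 : LinearMap.range (ey ψ ρ 0) ≤ Submodule.span ℂ {ey ψ ρ 0 (ρ (sW 1) v)} := by
    rintro _ ⟨x, rfl⟩
    have := h1 ((Submodule.span ℂ {ey ψ ρ 0 (ρ (sW 1) v)}).comap (ey ψ ρ 0)) (fun u => by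
      rw [Submodule.mem_comap, ey_X]
      exact Submodule.smul_mem _ _ (Submodule.subset_span (by simp)))
    have h2 : x ∈ (⊤ : Submodule ℂ E) := trivial
    rw [← this] at h2
    exact h2
  exact (Submodule.finrank_mono h2).trans (fsl _)

theorem mm_zero_iff {y : F} : mm ψ ρ y = 0 ↔ ey ψ ρ y = 0 := by
  rw [mm, Submodule.finrank_eq_zero, LinearMap.range_eq_bot]

theorem Eig.mm0_one' (h : Eig ρ v l) (hψ : ψ.IsPrimitive) (hρ : Irr ρ) {y : F}
    (h0 : mm ψ ρ y = 0) : mm ψ ρ 0 = 1 := by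
  rw [mm_zero_iff] at h0
  exact h.mm0_one ψ hψ hρ (y := y) (by rw [h0]; rfl)

/-- when `mm 0 = 1`, fixed vectors are multiples of `v` -/
theorem Eig.mult (h : Eig ρ v l) (hψ : ψ.IsPrimitive) (h1 : mm ψ ρ 0 = 1) (x : E) :
    ∃ c : ℂ, ey ψ ρ 0 x = c • v := by
  obtain ⟨c, hc⟩ := (finrank_eq_one_iff_of_nonzero' (⟨v, v, h.ey0 ψ hψ⟩ : LinearMap.range (ey ψ ρ 0))
    (fun h0 => h.ne (congrArg Subtype.val h0))).1 h1 ⟨_, x, rfl⟩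
  exact ⟨c, (congrArg Subtype.val hc).symm⟩

theorem trace_idem (π : E →ₗ[ℂ] E) (hi : π ∘ₗ π = π) :
    LinearMap.trace ℂ E π = (finrank ℂ (LinearMap.range π) : ℂ) := by
  refine LinearMap.IsProj.trace (p := LinearMap.range π) ⟨fun v => ⟨v, rfl⟩, ?_⟩
  rintro _ ⟨v, rfl⟩
  exact LinearMap.congr_fun hi v

theorem Eig.trace_H (h : Eig ρ v l) (hψ : ψ.IsPrimitive) (h1 : mm ψ ρ 0 = 1) {t : Fˣ}
    (ht : t ^ 2 ≠ 1) : LinearMap.trace ℂ E (ρ (sH t)) = l t := by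
  classical
  have e1 : ρ (sH t) = ∑ y, ρ (sH t) * ey ψ ρ y := by
    rw [← Finset.mul_sum, sum_ey ψ ρ hψ]; rfl
  rw [e1, map_sum, Finset.sum_eq_single (0 : F)]
  · have e2 : ρ (sH t) * ey ψ ρ 0 = l t • ey ψ ρ 0 := by
      ext x
      obtain ⟨c, hc⟩ := h.mult ψ hψ h1 x
      change ρ (sH t) (ey ψ ρ 0 x) = l t • ey ψ ρ 0 x
      rw [hc, map_smul, h.H, smul_comm]
    rw [e2, map_smul, trace_idem _ (ey_idem ψ ρ hψ 0)]
    change l t • ((mm ψ ρ 0 : ℕ) : ℂ) = _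
    rw [h1]; simp
  · intro y _ hy
    have e3 : ρ (sH t) * ey ψ ρ y = (ρ (sH t) * ey ψ ρ y) * ey ψ ρ y := by
      rw [mul_assoc]; congr 1; exact (ey_idem ψ ρ hψ y).symm
    rw [e3, LinearMap.trace_mul_comm]
    have e4 : ey ψ ρ y * (ρ (sH t) * ey ψ ρ y) = 0 := by
      ext x
      change ey ψ ρ y (ρ (sH t) (ey ψ ρ y x)) = 0
      rw [H_ey, ey_ey ψ ρ hψ, if_neg]
      intro h0
      have ht0 : (t : F) ^ 2 ≠ 0 := pow_ne_zero _ t.ne_zero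
      rw [eq_div_iff ht0] at h0
      have h2 : (t : F) ^ 2 = 1 := mul_left_cancel₀ hy (by rw [h0, mul_one])
      exact ht (Units.ext (by push_cast; exact h2))
    rw [e4, map_zero]
  · simp

theorem Eig.sq (h : Eig ρ v l) (hψ : ψ.IsPrimitive) (h1 : mm ψ ρ 0 = 1) (t : Fˣ) :
    l t * l t = 1 := by
  by_cases ht : t ^ 2 = 1
  · rw [← h.mul, ← pow_two, ht, h.one]
  · have ht' : (t⁻¹) ^ 2 ≠ 1 := by
      intro h0; apply ht; rw [inv_pow, inv_eq_one] at h0; exact h0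
    have e1 := h.trace_H ψ hψ h1 ht
    have e2 := h.trace_H ψ hψ h1 ht'
    have e3 : sH t⁻¹ = sW 1 * sH t * (sW 1)⁻¹ := by
      rw [eq_mul_inv_iff_mul_eq, sH_sW, sW_sH]
    have e4 : LinearMap.trace ℂ E (ρ (sH t⁻¹)) = LinearMap.trace ℂ E (ρ (sH t)) := by
      rw [e3, map_mul, LinearMap.trace_mul_comm, ← map_mul]
      congr 2; group
    have e5 : l t = l t⁻¹ := by rw [← e1, ← e2, e4]
    have e6 := h.mul t t⁻¹
    rw [mul_inv_cancel, h.one, ← e5] at e6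
    exact e6.symm

theorem Eig.steinberg (h : Eig ρ v l) (hψ : ψ.IsPrimitive) (h1 : mm ψ ρ 0 = 1) 
    (h2 : ∀ y, y ≠ 0 → ey ψ ρ y (ρ (sW 1) v) ≠ 0) :
    (∀ t, l t = 1) ∧ ey ψ ρ 0 (ρ (sW 1) v) = (-(Fintype.card F : ℂ)⁻¹) • v := by
  classical
  obtain ⟨κ, hκ⟩ := h.mult ψ hψ h1 (ρ (sW 1) v)
  set q : ℂ := (Fintype.card F : ℂ) with hq
  have hq0 : q ≠ 0 := qne
  have e1 : ∑ u, ρ (sX u) (ρ (sW 1) v) = (q * κ) • v := by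
    have := hκ
    rw [ey_apply] at this
    simp only [zero_mul, neg_zero, AddChar.map_zero_eq_one, one_smul] at this
    rw [mul_smul, ← this, smul_smul, mul_inv_cancel₀ hq0, one_smul]
  have e2 : l (-1) • v + ∑ r : Fˣ, l r⁻¹ • ρ (sX (r : F)) (ρ (sW 1) v) = (q * κ) • ρ (sW 1) v := by
    have e3 := congrArg (ρ (sW 1)) e1
    rw [map_sum, map_smul, sum_units, sX_zero, map_one, Module.End.one_apply, h.WW] at e3
    rw [← e3]
    congr 1
    refine (Fintype.sum_equiv ((Equiv.inv Fˣ).trans (Equiv.neg Fˣ)) _ _ fun u => ?_).symm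
    rw [h.WX]
    simp [inv_neg]
  have e3 : ∀ y, y ≠ 0 → ∑ r : Fˣ, l r⁻¹ * ψ (y * r) = q * κ := by
    intro y hy
    have e4 := congrArg (ey ψ ρ y) e2
    rw [map_add, map_smul, h.eyn ψ hψ hy, smul_zero, zero_add, map_sum, map_smul] at e4
    simp_rw [map_smul, ey_X, smul_smul] at e4
    rw [← Finset.sum_smul] at e4
    exact smul_left_injective ℂ (h2 y hy) e4
  have hκ0 : κ ≠ 0 := by
    intro h0
    have e4 := congrArg (ey ψ ρ 0) e2
    rw [map_add, map_smul, h.ey0 ψ hψ, map_sum, map_smul] at e4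
    simp_rw [map_smul, ey_X, hκ, h0] at e4
    simp at e4
    rcases e4 with e4 | e4
    · exact h.l_ne _ e4
    · exact h.ne e4
  have hl : ∀ t, l t = 1 := by
    intro s
    have e4 := e3 (s : F) s.ne_zero
    have e5 : ∑ r : Fˣ, l r⁻¹ * ψ (s * r) = l s * ∑ r : Fˣ, l r⁻¹ * ψ (1 * r) := by
      rw [Finset.mul_sum]
      refine Fintype.sum_equiv (Equiv.mulLeft s) _ _ fun r => ?_
      rw [← mul_assoc, ← h.mul]
      simp
    rw [e5, e3 1 one_ne_zero] at e4
    exact mul_right_cancel₀ (mul_ne_zero hq0 hκ0) (by rw [e4, one_mul])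
  refine ⟨hl, ?_⟩
  have e4 := e3 1 one_ne_zero
  simp_rw [hl, one_mul] at e4
  have e5 := sum_psi ψ hψ 1
  rw [sum_units, if_neg one_ne_zero] at e5
  simp only [mul_one, AddChar.map_zero_eq_one] at e5
  rw [e4] at e5
  rw [hκ]
  congr 1
  field_simp
  linear_combination e5

end eig
end B1

namespace B1
open Module

theorem common_eig {E : Type} [AddCommGroup E] [Module ℂ E] [FiniteDimensional ℂ E] {κ : Type}
    (O : κ → E →ₗ[ℂ] E) : ∀ (n : ℕ) (p : Submodule ℂ E), finrank ℂ p = n → p ≠ ⊥ →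
    (∀ k, ∀ x ∈ p, O k x ∈ p) → (∀ k k', ∀ x ∈ p, O k (O k' x) = O k' (O k x)) →
    ∃ v ∈ p, v ≠ 0 ∧ ∀ k, ∃ c : ℂ, O k v = c • v := by
  intro n
  induction n using Nat.strong_induction_on with
  | _ n ih =>
  intro p hn h0 hs hc
  by_cases hall : ∀ k, ∃ c : ℂ, ∀ x ∈ p, O k x = c • x
  · obtain ⟨v, hv, hv0⟩ := Submodule.exists_mem_ne_zero_of_ne_bot h0
    exact ⟨v, hv, hv0, fun k => (hall k).imp fun c h => h v hv⟩
  · push Not at hall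
    obtain ⟨k, hk⟩ := hall
    have : Nontrivial p := (Submodule.nontrivial_iff_ne_bot).2 h0
    obtain ⟨μ, hμ⟩ := Module.End.exists_eigenvalue ((O k).restrict (hs k))
    obtain ⟨v, hv⟩ := hμ.exists_hasEigenvector
    have h1 : O k v.1 = μ • v.1 := congrArg Subtype.val hv.apply_eq_smul
    let r := p ⊓ LinearMap.ker (O k - μ • LinearMap.id)
    have hr : ∀ x, x ∈ r ↔ x ∈ p ∧ O k x = μ • x := by
      intro x
      rw [Submodule.mem_inf, LinearMap.mem_ker, LinearMap.sub_apply, sub_eq_zero]; rfl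
    have hlt : r < p := by
      refine lt_of_le_of_ne inf_le_left fun h => ?_
      obtain ⟨x, hx, hx2⟩ := hk μ
      rw [← h] at hx
      exact hx2 ((hr x).1 hx).2
    obtain ⟨w, hw, hw0, hwc⟩ := ih (finrank ℂ r) (hn ▸ Submodule.finrank_lt_finrank_of_lt hlt) r rfl
      (by
        intro h
        have : v.1 ∈ r := (hr _).2 ⟨v.2, h1⟩
        rw [h, Submodule.mem_bot] at this
        exact hv.2 (Subtype.ext this))
      (by
        intro k' x hx
        rw [hr] at hx ⊢
        refine ⟨hs k' x hx.1, ?_⟩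
        rw [hc k k' x hx.1, hx.2, map_smul])
      (fun k k' x hx => hc k k' x ((hr x).1 hx).1)
    exact ⟨w, ((hr w).1 hw).1, hw0, hwc⟩

section cls
variable {F : Type} [Field F] [Fintype F] (ψ : AddChar F ℂ)
variable {E : Type} [AddCommGroup E] [Module ℂ E] [FiniteDimensional ℂ E]
variable {ρ : Representation ℂ (SL F) E}

theorem bruhat2' (g : SL F) (h : g.1 1 0 ≠ 0) :
    g = sX (g.1 0 0 / g.1 1 0) * sW (-(Units.mk0 _ h)⁻¹) * sX (g.1 1 1 / g.1 1 0) := by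
  have hd := g.2
  rw [Matrix.det_fin_two] at hd
  apply sl_ext <;> simp [sl_mul00, sl_mul01, sl_mul10, sl_mul11, sX_e00, sX_e01, sX_e10, sX_e11, sW_e00, sW_e01, sW_e10, sW_e11] <;> field_simp
  linear_combination -hd

theorem e_cell (y : F) (v : E) {g g' : SL F} (h : g.1 1 0 ≠ 0) (h1 : g.1 1 0 = g'.1 1 0)
    (h2 : g.1 0 0 + g.1 1 1 = g'.1 0 0 + g'.1 1 1) :
    ey ψ ρ y (ρ g (ey ψ ρ y v)) = ey ψ ρ y (ρ g' (ey ψ ρ y v)) := by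
  have key : ∀ (g : SL F) (h : g.1 1 0 ≠ 0), ey ψ ρ y (ρ g (ey ψ ρ y v)) =
    ψ (y * ((g.1 0 0 + g.1 1 1) / g.1 1 0)) • ey ψ ρ y (ρ (sW (-(Units.mk0 _ h)⁻¹)) (ey ψ ρ y v)) := by
    intro g h
    conv_lhs => rw [bruhat2' g h]
    rw [rho_mul, rho_mul, X_ey, map_smul, map_smul, map_smul, ey_X, smul_smul, ← AddChar.map_add_eq_mul]
    congr 2
    field_simp; ring
  have h' : g'.1 1 0 ≠ 0 := h1 ▸ h
  rw [key g h, key g' h']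
  congr 3
  · rw [h1, h2]
  · rw [show Units.mk0 _ h = Units.mk0 _ h' from Units.ext h1]

theorem Irr.center (hρ : Irr ρ) : ∃ c : ℂ, ρ (sH (-1)) = c • LinearMap.id := by
  apply hρ.schur
  intro g v
  rw [← rho_mul, ← rho_mul, Subgroup.mem_center_iff.1 Stp.zz_center g]

theorem e_H (hψ : ψ.IsPrimitive) {y : F} (hy : y ≠ 0) {t : Fˣ} (ht : t ^ 2 ≠ 1) (v : E) :
    ey ψ ρ y (ρ (sH t) (ey ψ ρ y v)) = 0 := by
  classical
  rw [H_ey, ey_ey ψ ρ hψ, if_neg]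
  intro h0
  have ht0 : (t : F) ^ 2 ≠ 0 := pow_ne_zero _ t.ne_zero
  rw [eq_div_iff ht0] at h0
  have h2 : (t : F) ^ 2 = 1 := mul_left_cancel₀ hy (by rw [h0, mul_one])
  exact ht (Units.ext (by push_cast; exact h2))

theorem e_comm (hψ : ψ.IsPrimitive) {y : F} (hy : y ≠ 0) (s t : Fˣ) (v : E) :
    ey ψ ρ y (ρ (sW t) (ey ψ ρ y (ρ (sW s) (ey ψ ρ y v)))) =
    ey ψ ρ y (ρ (sW s) (ey ψ ρ y (ρ (sW t) (ey ψ ρ y v)))) := by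
  have key : ∀ s t : Fˣ, ey ψ ρ y (ρ (sW t) (ey ψ ρ y (ρ (sW s) (ey ψ ρ y v)))) =
      ((Fintype.card F : ℂ)⁻¹) • ∑ u : F, ψ (-(y * u)) •
        ey ψ ρ y (ρ (sW t * sX u * sW s) (ey ψ ρ y v)) := by
    intro s t
    rw [ey_apply ψ ρ y (ρ (sW s) (ey ψ ρ y v))]
    simp only [map_smul, map_sum, rho_mul]
  rw [key, key]
  congr 1
  refine Finset.sum_congr rfl fun u _ => ?_
  congr 1
  by_cases hu : u = 0
  · subst hu
    rw [sX_zero, mul_one, mul_one, sW_sW, sW_sW]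
    by_cases hst : (-(t * s⁻¹)) ^ 2 = 1
    · have : -(t * s⁻¹) = -(s * t⁻¹) := by
        rw [neg_sq, sq] at hst
        rw [eq_inv_of_mul_eq_one_left hst, mul_inv_rev, inv_inv]
      rw [this]
    · rw [e_H ψ hψ hy hst, e_H ψ hψ hy]
      intro h0; apply hst
      rw [neg_sq] at h0 ⊢
      have : t * s⁻¹ = (s * t⁻¹)⁻¹ := by rw [mul_inv_rev, inv_inv]
      rw [this, inv_pow, h0, inv_one]
  · apply e_cell
    · simp [sl_mul00, sl_mul01, sl_mul10, sl_mul11, sX_e00, sX_e01, sX_e10, sX_e11, sW_e00, sW_e01, sW_e10, sW_e11, hu]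
    · simp [sl_mul00, sl_mul01, sl_mul10, sl_mul11, sX_e00, sX_e01, sX_e10, sX_e11, sW_e00, sW_e01, sW_e10, sW_e11]
      ring
    · simp [sl_mul00, sl_mul01, sl_mul10, sl_mul11, sX_e00, sX_e01, sX_e10, sX_e11, sW_e00, sW_e01, sW_e10, sW_e11]
      ring

theorem mm_le_one (hψ : ψ.IsPrimitive) (hρ : Irr ρ) {y : F} (hy : y ≠ 0) : mm ψ ρ y ≤ 1 := by
  classical
  by_cases h0 : LinearMap.range (ey ψ ρ y) = ⊥
  · rw [mm, h0, finrank_bot]; exact zero_le_one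
  obtain ⟨v, hv, hv0, hvc⟩ := common_eig (fun t : Fˣ => ey ψ ρ y ∘ₗ ρ (sW t)) _ _ rfl h0
    (fun k x _ => ⟨_, rfl⟩) (by
      rintro s t _ ⟨x, rfl⟩
      exact e_comm ψ hψ hy t s x)
  have hev : ey ψ ρ y v = v := mem_range_ey ψ ρ hψ hv
  have htop : (Submodule.span ℂ {v}).comap (ey ψ ρ y) = ⊤ := by
    apply orbit_span hρ hv0
    intro g
    rw [Submodule.mem_comap, Submodule.mem_span_singleton]
    by_cases hg : g.1 1 0 = 0
    · obtain ⟨a, t, rfl⟩ := bruhat1 g hg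
      rw [rho_mul, ey_X, ← hev]
      by_cases ht : t ^ 2 = 1
      · have : ∃ c : ℂ, ρ (sH t) = c • LinearMap.id := by
          rcases (mul_self_eq_one_iff (a := (t : F))).1 (by
            rw [← sq, ← Units.val_pow_eq_pow_val, ht, Units.val_one]) with h | h
          · have : t = 1 := Units.ext h
            rw [this, sH_one, map_one]; exact ⟨1, by rw [one_smul]; rfl⟩
          · have : t = -1 := Units.ext h
            rw [this]; exact Irr.center hρ
        obtain ⟨c, hc⟩ := this
        refine ⟨ψ (y * a) * c, ?_⟩
        rw [hc, LinearMap.smul_apply, LinearMap.id_apply, map_smul, hev, hev, smul_smul]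
      · refine ⟨0, ?_⟩
        rw [e_H ψ hψ hy ht, smul_zero, zero_smul]
    · obtain ⟨a, b, t, rfl⟩ := bruhat2 g hg
      obtain ⟨c, hc⟩ := hvc t
      have hX : ρ (sX b) v = ψ (y * b) • v := by rw [← hev, X_ey]
      refine ⟨ψ (y * b) * (ψ (y * a) * c), ?_⟩
      rw [rho_mul, rho_mul, hX, map_smul, map_smul, map_smul, ey_X, mul_smul, mul_smul, ← hc]
      rfl
  have hle : LinearMap.range (ey ψ ρ y) ≤ Submodule.span ℂ {v} := by
    rintro _ ⟨x, rfl⟩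
    have : x ∈ (⊤ : Submodule ℂ E) := trivial
    rw [← htop] at this
    exact this
  exact (Submodule.finrank_mono hle).trans (fsl v)

/-- numerical classification -/
theorem cls (hψ : ψ.IsPrimitive) (hρ : Irr ρ) {k : F} (hk : ¬ IsSquare k) :
    mm ψ ρ 0 ≤ 2 ∧ mm ψ ρ 1 ≤ 1 ∧ mm ψ ρ k ≤ 1 ∧ (mm ψ ρ 0 = 2 → mm ψ ρ 1 = 1 ∧ mm ψ ρ k = 1) := by
  have hk0 : k ≠ 0 := by rintro rfl; exact hk ⟨0, by simp⟩
  have h1 := mm_le_one ψ hψ hρ (one_ne_zero (α := F))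
  have h2 := mm_le_one ψ hψ hρ hk0
  rcases Nat.eq_zero_or_pos (mm ψ ρ 0) with h0 | h0
  · refine ⟨by omega, h1, h2, by omega⟩
  · obtain ⟨v, l, hv⟩ := exists_eig ψ hψ h0
    refine ⟨hv.mm0_le ψ hρ, h1, h2, fun h3 => ⟨?_, ?_⟩⟩
    · by_contra hc
      have := hv.mm0_one' ψ hψ hρ (y := 1) (by omega)
      omega
    · by_contra hc
      have := hv.mm0_one' ψ hψ hρ (y := k) (by omega)
      omega

/-- SL₂ is perfect -/
theorem sl_perfect (h5 : 4 ≤ Nat.card F) {A : Type} [CommGroup A] (κ : SL F →* A) : κ = 1 := by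
  classical
  have ht : ∃ t : Fˣ, t ^ 2 ≠ 1 := by
    by_contra hc
    push Not at hc
    have h1 : (Finset.univ : Finset F) ⊆ {0, 1, -1} := by
      intro x _
      by_cases hx : x = 0
      · simp [hx]
      · have h2 := congrArg Units.val (hc (Units.mk0 x hx))
        simp only [Units.val_pow_eq_pow_val, Units.val_mk0, Units.val_one] at h2
        rcases mul_self_eq_one_iff.1 ((sq x).symm.trans h2) with h | h <;> simp [h]
    have h2 := Finset.card_le_card h1
    have h3 : ({0, 1, -1} : Finset F).card ≤ 3 := Finset.card_le_three
    rw [Finset.card_univ, ← Nat.card_eq_fintype_card] at h2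
    omega
  obtain ⟨t, ht⟩ := ht
  have ht1 : (t : F) ^ 2 - 1 ≠ 0 := by
    intro h; apply ht; exact Units.ext (by push_cast; exact sub_eq_zero.1 h)
  have hX : ∀ u, κ (sX u) = 1 := by
    intro u
    have h1 := congrArg κ (sH_sX t (u / ((t : F) ^ 2 - 1)))
    rw [map_mul, map_mul, map_inv, mul_comm, ← mul_assoc, inv_mul_cancel, one_mul] at h1
    have h2 : (t : F) ^ 2 * (u / ((t : F) ^ 2 - 1)) = u + u / ((t : F) ^ 2 - 1) := by
      field_simp; ring
    rw [h2, sX_add, map_mul] at h1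
    exact right_eq_mul.1 h1
  have hY : ∀ v, κ (sY v) = 1 := by
    intro v
    have h1 := congrArg κ (sW_sX 1 (-v))
    rw [map_mul, map_mul, map_inv, hX, mul_one, mul_inv_cancel] at h1
    simpa using h1.symm
  have hW : ∀ t, κ (sW t) = 1 := by
    intro t; rw [← sW_eq, map_mul, map_mul, hX, hY]; simp
  have hH : ∀ t, κ (sH t) = 1 := by
    intro t
    have := sW_sW (-t) 1
    simp only [inv_one, mul_one, neg_neg] at this
    rw [← this, map_mul, hW, hW, one_mul]
  ext g
  by_cases hg : g.1 1 0 = 0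
  · obtain ⟨a, t, rfl⟩ := bruhat1 g hg
    rw [map_mul, hX, hH]; simp
  · obtain ⟨a, b, t, rfl⟩ := bruhat2 g hg
    rw [map_mul, map_mul, hX, hX, hW]; simp

theorem det_one (h5 : 4 ≤ Nat.card F) (g : SL F) : LinearMap.det (ρ g) = 1 := by
  let κ : SL F →* ℂˣ := MonoidHom.toHomUnits ((LinearMap.det (A := ℂ) (M := E)).comp ρ)
  have := congrArg (fun f : SL F →* ℂˣ => ((f g : ℂˣ) : ℂ)) (sl_perfect h5 κ)
  simpa [κ] using this

theorem even_of_neg (h5 : 4 ≤ Nat.card F) (h : ρ (sH (-1)) = (-1 : ℂ) • LinearMap.id) :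
    Even (finrank ℂ E) := by
  have h1 := det_one (ρ := ρ) h5 (sH (-1))
  rw [h, LinearMap.det_smul, LinearMap.det_id, mul_one] at h1
  by_contra hc
  rw [Nat.not_even_iff_odd] at hc
  rw [hc.neg_one_pow] at h1
  norm_num at h1

theorem trivial_of_one (h5 : 4 ≤ Nat.card F) (h : finrank ℂ E = 1) (g : SL F) : ρ g = 1 := by
  obtain ⟨v, hv, hs⟩ := finrank_eq_one_iff'.1 h
  obtain ⟨c, hc⟩ := hs (ρ g v)
  have h1 : ρ g = c • LinearMap.id := by
    ext x
    obtain ⟨d, rfl⟩ := hs x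
    rw [map_smul, ← hc, LinearMap.smul_apply, LinearMap.id_apply, smul_comm]
  have h2 := det_one (ρ := ρ) h5 g
  rw [h1, LinearMap.det_smul, LinearMap.det_id, mul_one, h, pow_one] at h2
  rw [h1, h2, one_smul]; rfl

end cls
end B1

namespace B1
open Module

theorem irr_of_finrank_one {G V : Type} [Group G] [AddCommGroup V] [Module ℂ V] [FiniteDimensional ℂ V]
    (ρ : Representation ℂ G V) (h : finrank ℂ V = 1) : Irr ρ := by
  have hnt : Nontrivial V := nontrivial_of_finrank_pos (R := ℂ) (by omega)
  refine ⟨hnt, fun p _ => ?_⟩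
  have h1 := Submodule.finrank_le p
  rcases Nat.eq_zero_or_pos (finrank ℂ p) with h0 | h0
  · left; exact Submodule.finrank_eq_zero.1 h0
  · right; exact Submodule.eq_top_of_finrank_eq (by omega)

/-- one dimensional representation -/
def lin {K : Type} [Group K] (κ : K →* ℂ) : Representation ℂ K ℂ where
  toFun g := κ g • LinearMap.id
  map_one' := by rw [map_one, one_smul]; rfl
  map_mul' a b := by
    ext
    simp [mul_comm]

theorem lin_apply {K : Type} [Group K] (κ : K →* ℂ) (g : K) (z : ℂ) : lin κ g z = κ g * z := rfl

theorem exists_psi (F : Type) [Field F] [Fintype F] : ∃ ψ : AddChar F ℂ, ψ.IsPrimitive := by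
  obtain ⟨ψ, h⟩ := (AddChar.exists_apply_ne_zero (a := (1 : F))).2 one_ne_zero
  refine ⟨ψ, AddChar.IsPrimitive.of_ne_one ?_⟩
  rintro rfl
  exact h rfl

section S4
variable {F : Type} [Field F] [Fintype F]
variable {E : Type} [AddCommGroup E] [Module ℂ E] [FiniteDimensional ℂ E]
variable {ρ : Representation ℂ (SL F) E}

theorem card_odd (hodd : ringChar F ≠ 2) : Fintype.card F % 2 = 1 := FiniteField.odd_card_of_char_ne_two hodd

theorem dims (hodd : ringChar F ≠ 2) (hρ : Irr ρ) : finrank ℂ E = 1 ∨ finrank ℂ E = Fintype.card F ∨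
    finrank ℂ E = Fintype.card F + 1 ∨ finrank ℂ E + 1 = Fintype.card F ∨ 
    2 * finrank ℂ E = Fintype.card F + 1 ∨ 2 * finrank ℂ E + 1 = Fintype.card F := by
  obtain ⟨ψ, hψ⟩ := exists_psi F
  obtain ⟨k, hk⟩ := FiniteField.exists_nonsquare hodd
  obtain ⟨h1, h2, h3, h4⟩ := cls ψ hψ hρ hk
  have h5 := two_dim ψ ρ hψ hodd hk
  have h6 := hρ.1
  have h7 : 0 < finrank ℂ E := finrank_pos
  have h8 : 2 < Fintype.card F := by
    have := card_odd hodd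
    have := Fintype.one_lt_card (α := F)
    omega
  generalize mm ψ ρ 0 = a at *
  generalize mm ψ ρ 1 = b at *
  generalize mm ψ ρ k = c at *
  interval_cases a <;> interval_cases b <;> interval_cases c <;> omega

theorem mm_all (ψ : AddChar F ℂ) (hodd : ringChar F ≠ 2) {k : F} (hk : ¬ IsSquare k) {y : F} (hy : y ≠ 0) : mm ψ ρ y = mm ψ ρ 1 ∨ mm ψ ρ y = mm ψ ρ k := by
  have hk0 : k ≠ 0 := by rintro rfl; exact hk ⟨0, by simp⟩
  by_cases h : IsSquare y
  · obtain ⟨t, rfl⟩ := h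
    have ht : t ≠ 0 := by rintro rfl; simp at hy
    left
    have := mm_sq ψ ρ (Units.mk0 t ht) 1
    rw [← this]; simp [sq]
  · right
    classical
    have h1 : IsSquare (y / k) := by
      have e1 := (quadraticChar_neg_one_iff_not_isSquare).2 h
      have e2 := (quadraticChar_neg_one_iff_not_isSquare).2 hk
      have h3 : quadraticChar F (y * k) = 1 := by rw [map_mul, e1, e2]; rfl
      have h4 := (quadraticChar_one_iff_isSquare (mul_ne_zero hy hk0)).1 h3
      obtain ⟨r, hr⟩ := h4
      exact ⟨r / k, by field_simp; rw [hr, sq]⟩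
    obtain ⟨t, ht⟩ := h1
    have ht0 : t ≠ 0 := by
      rintro rfl
      rw [mul_zero, div_eq_zero_iff] at ht
      tauto
    have := mm_sq ψ ρ (Units.mk0 t ht0) k
    rw [← this]
    congr 1
    rw [Units.val_mk0, sq, ← ht]; field_simp

theorem dim_q (ψ : AddChar F ℂ) (hψ : ψ.IsPrimitive) (hodd : ringChar F ≠ 2) (h5 : 5 ≤ Fintype.card F) (hρ : Irr ρ) (h : finrank ℂ E = Fintype.card F) :
    mm ψ ρ 0 = 1 ∧ ∀ y, y ≠ 0 → mm ψ ρ y = 1 := by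
  obtain ⟨k, hk⟩ := FiniteField.exists_nonsquare hodd
  obtain ⟨h1, h2, h3, h4⟩ := cls ψ hψ hρ hk
  have h6 := two_dim ψ ρ hψ hodd hk
  have key : mm ψ ρ 0 = 1 ∧ mm ψ ρ 1 = 1 ∧ mm ψ ρ k = 1 := by
    generalize mm ψ ρ 0 = a at *
    generalize mm ψ ρ 1 = b at *
    generalize mm ψ ρ k = c at *
    interval_cases a <;> interval_cases b <;> interval_cases c <;> omega
  refine ⟨key.1, fun y hy => ?_⟩
  rcases mm_all (ρ := ρ) ψ hodd hk hy with h | h <;> omega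

theorem st_data (ψ : AddChar F ℂ) (hψ : ψ.IsPrimitive) (hρ : Irr ρ) 
    (h0 : mm ψ ρ 0 = 1) (h1 : ∀ y, y ≠ 0 → mm ψ ρ y = 1) :
    ∃ v : E, Eig ρ v (fun _ => 1) ∧ ey ψ ρ 0 (ρ (sW 1) v) = (-(Fintype.card F : ℂ)⁻¹) • v := by
  obtain ⟨v, l, hv⟩ := exists_eig (ρ := ρ) ψ hψ (by omega)
  obtain ⟨a, b⟩ := hv.steinberg ψ hψ h0 (by
    intro y hy h2
    have h3 := hv.range_le' ψ hψ hρ hy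
    rw [h2] at h3
    have h4 := Submodule.finrank_mono h3
    rw [Submodule.span_zero_singleton, finrank_bot] at h4
    have := h1 y hy
    rw [mm] at this; omega)
  refine ⟨v, ⟨hv.ne, hv.X, fun t => by rw [hv.H, a]⟩, b⟩

open Classical in
/-- spherical function -/
noncomputable def Phi (g : SL F) : ℝ := if g.1 1 0 = 0 then 1 else -(Fintype.card F : ℝ)⁻¹

theorem Phi_inv (g : SL F) : Phi g⁻¹ = Phi g := by
  have : (g⁻¹).1 1 0 = - g.1 1 0 := by
    change (Matrix.adjugate g.1) 1 0 = _
    rw [Matrix.adjugate_fin_two]; simp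
  unfold Phi
  by_cases h : g.1 1 0 = 0
  · rw [if_pos h, if_pos (by rw [this, h, neg_zero])]
  · rw [if_neg h, if_neg (by rw [this]; exact neg_ne_zero.2 h)]

theorem Phi_st {ψ : AddChar F ℂ} (hψ : ψ.IsPrimitive) {v : E} (hv : Eig ρ v (fun _ => 1))
    (h : ey ψ ρ 0 (ρ (sW 1) v) = (-(Fintype.card F : ℂ)⁻¹) • v) (g : SL F) :
    ey ψ ρ 0 (ρ g v) = (Phi g : ℂ) • v := by
  rcases hv.cell g with ⟨h0, t, h1⟩ | ⟨h0, t, a, h1⟩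
  · rw [h1, Phi, if_pos h0, one_smul, hv.ey0 ψ hψ]; simp
  · rw [h1, Phi, if_neg h0, one_smul, ey_X, h]; simp

theorem st_unique (hodd : ringChar F ≠ 2) (h5 : 5 ≤ Fintype.card F) (hρ : Irr ρ) (h : finrank ℂ E = Fintype.card F)
    {E' : Type} [AddCommGroup E'] [Module ℂ E'] [FiniteDimensional ℂ E'] {ρ' : Representation ℂ (SL F) E'}
    (hρ' : Irr ρ') (h' : finrank ℂ E' = Fintype.card F) : ∃ f : E →ₗ[ℂ] E', IsMap ρ ρ' f ∧ f ≠ 0 := by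
  obtain ⟨ψ, hψ⟩ := exists_psi F
  classical
  obtain ⟨a0, a1⟩ := dim_q ψ hψ hodd h5 hρ h
  obtain ⟨b0, b1⟩ := dim_q ψ hψ hodd h5 hρ' h'
  obtain ⟨v, hv, hvW⟩ := st_data ψ hψ hρ a0 a1
  obtain ⟨w, hw, hwW⟩ := st_data ψ hψ hρ' b0 b1
  obtain ⟨l, hl⟩ := Module.Projective.exists_dual_ne_zero ℂ hv.ne
  let f0 : E →ₗ[ℂ] E' := ((l v)⁻¹ • (l ∘ₗ ey ψ ρ 0)).smulRight w
  have hf0 : ∀ g, f0 (ρ g v) = (Phi g : ℂ) • w := by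
    intro g
    simp only [f0, LinearMap.smulRight_apply, LinearMap.smul_apply, LinearMap.comp_apply]
    rw [Phi_st hψ hv hvW, map_smul]
    congr 1
    simp only [smul_eq_mul]
    field_simp
  refine ⟨avg ρ ρ' f0, avg_isMap _ _ _, fun h0 => ?_⟩
  have h1 : ey ψ ρ' 0 (avg ρ ρ' f0 v) = 0 := by rw [h0]; simp
  have h2 : avg ρ ρ' f0 v = (Fintype.card (SL F) : ℂ)⁻¹ • ∑ g : SL F, (Phi g : ℂ) • ρ' g w := by
    rw [avg]
    simp only [LinearMap.smul_apply, LinearMap.sum_apply, LinearMap.comp_apply, hf0, map_smul, Phi_inv]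
  rw [h2, map_smul, map_sum] at h1
  simp only [map_smul, Phi_st hψ hw hwW, smul_smul] at h1
  rw [← Finset.sum_smul, smul_smul] at h1
  have h3 := (smul_eq_zero.1 h1).resolve_right hw.ne
  rcases mul_eq_zero.1 h3 with h4 | h4
  · exact inv_ne_zero (Nat.cast_ne_zero.2 Fintype.card_ne_zero) h4
  · have h5 : (0 : ℝ) < ∑ g : SL F, Phi g * Phi g := by
      apply Finset.sum_pos' (fun g _ => mul_self_nonneg _)
      refine ⟨1, Finset.mem_univ _, ?_⟩
      have : Phi (1 : SL F) = 1 := by simp [Phi]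
      rw [this]; norm_num
    apply h5.ne'
    exact_mod_cast h4

end S4
end B1

namespace B1
open Module

section S5
variable {F : Type} [Field F]

/-- Borel subgroup -/
def Bor (F : Type) [Field F] : Subgroup (SL F) where
  carrier := {g | g.1 1 0 = 0}
  one_mem' := by simp
  mul_mem' {a b} ha hb := by
    change (a * b).1 1 0 = 0
    have h1 : a.1 1 0 = 0 := ha
    have h2 : b.1 1 0 = 0 := hb
    rw [sl_mul10, h1, h2]; simp
  inv_mem' {a} ha := by
    have h1 : a.1 1 0 = 0 := ha
    change (Matrix.adjugate a.1) 1 0 = _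
    rw [Matrix.adjugate_fin_two]; simp [h1]

theorem mem_Bor {g : SL F} : g ∈ Bor F ↔ g.1 1 0 = 0 := Iff.rfl

/-- plus/minus U -/
def KU (F : Type) [Field F] : Subgroup (SL F) where
  carrier := {g | g.1 1 0 = 0 ∧ g.1 0 0 * g.1 0 0 = 1}
  one_mem' := by simp
  mul_mem' {a b} ha hb := by
    obtain ⟨h1, h2⟩ := ha
    obtain ⟨h3, h4⟩ := hb
    change (a * b).1 1 0 = 0 ∧ (a * b).1 0 0 * (a * b).1 0 0 = 1
    rw [sl_mul10, sl_mul00, h1, h3]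
    refine ⟨by ring, ?_⟩
    linear_combination h4 * (a.1 0 0 * a.1 0 0) + h2
  inv_mem' {a} ha := by
    obtain ⟨h1, h2⟩ := ha
    have hd := a.2
    rw [Matrix.det_fin_two, h1] at hd
    have h3 : a.1 1 1 = a.1 0 0 := by linear_combination a.1 0 0 * hd - a.1 1 1 * h2
    change (Matrix.adjugate a.1) 1 0 = _ ∧ (Matrix.adjugate a.1) 0 0 * (Matrix.adjugate a.1) 0 0 = 1
    rw [Matrix.adjugate_fin_two]; simp [h1, h3, h2]

theorem KU_11 {g : SL F} (h : g ∈ KU F) : g.1 1 1 = g.1 0 0 := by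
  obtain ⟨h1, h2⟩ := h
  have hd := g.2
  rw [Matrix.det_fin_two, h1] at hd
  linear_combination g.1 0 0 * hd - g.1 1 1 * h2

theorem Bor_ne {g : SL F} (h : g ∈ Bor F) : g.1 0 0 ≠ 0 := by
  intro h0
  have hd := g.2
  rw [Matrix.det_fin_two, mem_Bor.1 h, h0] at hd
  simp at hd

/-- character of Borel -/
noncomputable def kB (l : MulChar F ℂ) : Bor F →* ℂ where
  toFun g := l (g.1.1 0 0)
  map_one' := by simp
  map_mul' a b := by
    change l ((a.1 * b.1).1 0 0) = _
    rw [sl_mul00, mem_Bor.1 b.2, mul_zero, add_zero, map_mul]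

open Classical in
/-- sign -/
noncomputable def sg (c : ℂ) (x : F) : ℂ := if x = 1 then 1 else c

theorem sg_one (c : ℂ) : sg c (1 : F) = 1 := if_pos rfl

theorem sg_mul {c : ℂ} (hc : c * c = 1) {a b : F} (ha : a * a = 1) (hb : b * b = 1) :
    sg c (a * b) = sg c a * sg c b := by
  unfold sg
  rcases mul_self_eq_one_iff.1 ha with h1 | h1 <;> rcases mul_self_eq_one_iff.1 hb with h2 | h2 <;>
    rw [h1, h2] <;> by_cases h3 : (-1 : F) = 1 <;> simp [h3, hc]

/-- character of `KU` -/
noncomputable def kK (ψ : AddChar F ℂ) (c : ℂ) (hc : c * c = 1) : KU F →* ℂ where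
  toFun g := ψ (g.1.1 0 1 * g.1.1 0 0) * sg c (g.1.1 0 0)
  map_one' := by simp [sg_one]
  map_mul' a b := by
    have h11 := KU_11 b.2
    have ha2 := a.2.2
    have hb1 := b.2.1
    have hb2 := b.2.2
    have h00 : (a * b).1.1 0 0 = a.1.1 0 0 * b.1.1 0 0 := by
      change (a.1 * b.1).1 0 0 = _
      rw [sl_mul00, hb1, mul_zero, add_zero]
    have h01 : (a * b).1.1 0 1 = a.1.1 0 0 * b.1.1 0 1 + a.1.1 0 1 * b.1.1 0 0 := by
      change (a.1 * b.1).1 0 1 = _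
      rw [sl_mul01, h11]
    rw [h00, h01, sg_mul hc ha2 hb2]
    have e1 : (a.1.1 0 0 * b.1.1 0 1 + a.1.1 0 1 * b.1.1 0 0) * (a.1.1 0 0 * b.1.1 0 0) =
      a.1.1 0 1 * a.1.1 0 0 + b.1.1 0 1 * b.1.1 0 0 := by
      linear_combination (b.1.1 0 1 * b.1.1 0 0) * ha2 + a.1.1 0 1 * a.1.1 0 0 * hb2
    rw [e1, AddChar.map_add_eq_mul]; ring

variable [Fintype F]

theorem exists_chars (hodd : ringChar F ≠ 2) (h7 : 7 ≤ Fintype.card F) {c : ℂ} (hc : c = 1 ∨ c = -1) :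
    ∃ l : MulChar F ℂ, l (-1) = c ∧ ∃ t : Fˣ, l t * l t ≠ 1 := by
  classical
  have hq := card_odd hodd
  obtain ⟨χ, hχ⟩ := MulChar.exists_mulChar_orderOf F (R := ℂ) (dvd_refl (Fintype.card F - 1))
    (Complex.isPrimitiveRoot_exp (Fintype.card F - 1) (by omega))
  have hpow : ∀ n, 0 < n → n < Fintype.card F - 1 → ∃ t : Fˣ, χ t ^ n ≠ 1 := by
    intro n hn hn2
    by_contra hall
    push Not at hall
    have : χ ^ n = 1 := by
      ext t
      rw [MulChar.pow_apply_coe, hall, MulChar.one_apply_coe]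
    have h2 := orderOf_le_of_pow_eq_one hn this
    omega
  have hm : χ (-1) = -1 := by
    have h1 : χ (-1) * χ (-1) = 1 := by rw [← map_mul]; simp
    rcases mul_self_eq_one_iff.1 h1 with h | h
    · exfalso
      obtain ⟨t, ht⟩ := hpow (Fintype.card F / 2) (by omega) (by omega)
      apply ht
      rw [← map_pow]
      rcases FiniteField.pow_dichotomy hodd t.ne_zero with h2 | h2
      · rw [h2, map_one]
      · rw [h2, h]
    · exact h
  rcases hc with rfl | rfl
  · refine ⟨χ ^ 2, ?_, ?_⟩
    · have := MulChar.pow_apply_coe χ 2 (-1)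
      simp only [Units.val_neg, Units.val_one] at this
      rw [this, hm]; norm_num
    · obtain ⟨t, ht⟩ := hpow 4 (by omega) (by omega)
      refine ⟨t, ?_⟩
      rw [MulChar.pow_apply_coe, ← pow_add]; exact ht
  · refine ⟨χ, hm, ?_⟩
    obtain ⟨t, ht⟩ := hpow 2 (by omega) (by omega)
    exact ⟨t, by rw [← sq]; exact ht⟩

theorem exists_principal (hodd : ringChar F ≠ 2) (h7 : 7 ≤ Fintype.card F) {c : ℂ} (hc : c = 1 ∨ c = -1) :
    ∃ (V : Type) (_ : AddCommGroup V) (_ : Module ℂ V) (_ : FiniteDimensional ℂ V)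
      (ρ : Representation ℂ (SL F) V), Irr ρ ∧ finrank ℂ V = Fintype.card F + 1 ∧ ρ (sH (-1)) = c • LinearMap.id := by
  obtain ⟨l, hl, t, ht⟩ := exists_chars hodd h7 hc
  obtain ⟨V, _, _, _, ρ, hρ, f, hf, hf0⟩ := exists_over (K := Bor F) (irr_of_finrank_one (lin (kB l)) (by simp))
  refine ⟨V, _, _, ‹_›, ρ, hρ, ?_⟩
  have hv : f 1 ≠ 0 := by
    intro h0
    apply hf0
    ext
    simp [h0]
  have key : ∀ g : SL F, g.1 1 0 = 0 → ρ g (f 1) = l (g.1 0 0) • f 1 := by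
    intro g hg
    have := hf ⟨g, hg⟩ 1
    rw [lin_apply, mul_one] at this
    change _ = ρ g (f 1) at this
    rw [← this]
    have h2 : kB l ⟨g, hg⟩ = l (g.1 0 0) • (1 : ℂ) := by rw [smul_eq_mul, mul_one]; rfl
    rw [h2, map_smul]
  have hE : Eig ρ (f 1) (fun t => l t) := by
    refine ⟨hv, fun u => ?_, fun t => ?_⟩
    · rw [key _ (sX_e10 u), sX_e00, map_one, one_smul]
    · rw [key _ (sH_e10 t), sH_e00]
  obtain ⟨ψ, hψ⟩ := exists_psi F
  obtain ⟨k, hk⟩ := FiniteField.exists_nonsquare hodd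
  obtain ⟨h1, h2, h3, h4⟩ := cls ψ hψ hρ hk
  have h5 := two_dim ψ ρ hψ hodd hk
  constructor
  · have h0 := hE.mm0_pos ψ hψ
    have h6 : mm ψ ρ 0 ≠ 1 := fun h => ht (hE.sq ψ hψ h t)
    have h8 : mm ψ ρ 0 = 2 := by omega
    obtain ⟨h9, h10⟩ := h4 h8
    rw [h8, h9, h10] at h5
    omega
  · obtain ⟨d, hd⟩ := Irr.center hρ
    have := hE.H (-1)
    rw [hd] at this
    have h6 := smul_left_injective ℂ hv this
    rw [hd, h6]
    simp [hl]

theorem card_SL : Fintype.card F * (Fintype.card F - 1) * (Fintype.card F + 1) ≤ Nat.card (SL F) := by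
  classical
  let f : (F × Fˣ) ⊕ (F × Fˣ × F) → SL F := Sum.elim (fun x => sX x.1 * sH x.2) (fun x => sX x.1 * sW x.2.1 * sX x.2.2)
  have hf : Function.Injective f := by
    have e1 : ∀ x : F × Fˣ, (sX x.1 * sH x.2).1 1 0 = 0 := by
      intro x; simp [sl_mul10, sX_e10, sH_e10]
    have e2 : ∀ x : F × Fˣ × F, (sX x.1 * sW x.2.1 * sX x.2.2).1 1 0 = -((x.2.1⁻¹ : Fˣ) : F) := by
      intro x; simp [sl_mul10, sl_mul11, sX_e10, sX_e11, sX_e00, sW_e10, sW_e11]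
    rintro (⟨a, t⟩ | ⟨a, t, b⟩) (⟨a', t'⟩ | ⟨a', t', b'⟩) h
    · have h : sX a * sH t = sX a' * sH t' := h
      have h0 : (t : F) = t' := by
        have := congrArg (fun g : SL F => g.1 0 0) h
        simpa [sl_mul00, sX_e00, sX_e01, sH_e00, sH_e10] using this
      have h0 := Units.ext h0
      subst h0
      rw [sX_inj (mul_right_cancel h)]
    · exfalso
      have h : sX a * sH t = sX a' * sW t' * sX b' := h
      have h1 := e1 (a, t)
      have h2 := e2 (a', t', b')
      dsimp only at h1 h2
      rw [h, h2] at h1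
      exact (t'⁻¹).ne_zero (neg_eq_zero.1 h1)
    · exfalso
      have h : sX a * sW t * sX b = sX a' * sH t' := h
      have h1 := e1 (a', t')
      have h2 := e2 (a, t, b)
      dsimp only at h1 h2
      rw [← h, h2] at h1
      exact (t⁻¹).ne_zero (neg_eq_zero.1 h1)
    · have h : sX a * sW t * sX b = sX a' * sW t' * sX b' := h
      have h1 := e2 (a', t', b')
      have h2 := e2 (a, t, b)
      dsimp only at h1 h2
      rw [h, h1] at h2
      have h0 := inv_injective (Units.ext (neg_injective h2))
      subst h0
      have h3 : a = a' := by
        have := congrArg (fun g : SL F => g.1 0 0) h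
        simpa [sl_mul00, sl_mul01, sX_e00, sX_e01, sX_e10, sW_e00, sW_e10] using this
      subst h3
      rw [sX_inj (mul_left_cancel h)]
  have := Nat.card_le_card_of_injective f hf
  rw [Nat.card_eq_fintype_card] at this
  simp only [Fintype.card_sum, Fintype.card_prod, Fintype.card_units] at this
  refine le_trans (le_of_eq ?_) this
  ring

theorem card_KU : Nat.card (KU F) ≤ 2 * Fintype.card F := by
  classical
  let f : KU F → Bool × F := fun g => (decide (g.1.1 0 0 = 1), g.1.1 0 1)
  have hf : Function.Injective f := by
    intro g h hgh
    have h1 := KU_11 g.2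
    have h2 := KU_11 h.2
    obtain ⟨g, hg1, hg2⟩ := g
    obtain ⟨h, hh1, hh2⟩ := h
    simp only [f, Prod.mk.injEq, decide_eq_decide] at hgh
    obtain ⟨e1, e2⟩ := hgh
    have e3 : g.1 0 0 = h.1 0 0 := by
      rcases mul_self_eq_one_iff.1 hg2 with a | a <;> rcases mul_self_eq_one_iff.1 hh2 with b | b
      · rw [a, b]
      · rw [a, e1.1 a]
      · rw [b, e1.2 b]
      · rw [a, b]
    apply Subtype.ext
    exact sl_ext e3 e2 (hg1.trans hh1.symm) (h1.trans (e3.trans h2.symm))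
  have := Nat.card_le_card_of_injective f hf
  rw [Nat.card_eq_fintype_card (α := Bool × F)] at this
  simpa [Fintype.card_prod] using this

theorem KU_index : Fintype.card F * Fintype.card F ≤ 2 * (KU F).index + 1 := by
  have h1 := card_SL (F := F)
  have h2 := card_KU (F := F)
  have h3 := (KU F).card_mul_index
  have h0 : 0 < Fintype.card F := Fintype.card_pos
  rw [← h3] at h1
  have h4 := h1.trans (Nat.mul_le_mul_right _ h2)
  have h5 : Fintype.card F * ((Fintype.card F - 1) * (Fintype.card F + 1)) ≤ Fintype.card F * (2 * (KU F).index) := by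
    refine le_trans (le_of_eq (by ring)) (h4.trans (le_of_eq (by ring)))
  have h6 := Nat.le_of_mul_le_mul_left h5 h0
  obtain ⟨n, hn⟩ : ∃ n, Fintype.card F = n + 1 := ⟨_, (Nat.succ_pred_eq_of_pos h0).symm⟩
  rw [hn] at h6 ⊢
  simp only [Nat.add_sub_cancel] at h6
  nlinarith

end S5
end B1

namespace B1
open Module

section S6
variable {F : Type} [Field F] [Fintype F] {ψ : AddChar F ℂ}

theorem mm_res (hψ : ψ.IsPrimitive) {V : Type} [AddCommGroup V] [Module ℂ V] [FiniteDimensional ℂ V]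
    (R : Representation ℂ (SL F) V) {ι : Type} [Fintype ι] (π : ι → V →ₗ[ℂ] V)
    (h1 : ∀ i, IsMap R R (π i)) (h2 : ∑ i, π i = LinearMap.id) (h4 : ∀ i, π i ∘ₗ π i = π i)
    (h5 : ∀ i, Inv R (LinearMap.range (π i))) (y : F) :
    ∑ i, mm ψ (res R _ (h5 i)) y = mm ψ R y := by
  have e1 : ∀ i, (ey ψ R y ∘ₗ π i) ∘ₗ (ey ψ R y ∘ₗ π i) = ey ψ R y ∘ₗ π i := by
    intro i
    ext x
    simp only [LinearMap.comp_apply]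
    rw [ey_map ψ (h1 i), ← LinearMap.comp_apply (ey ψ R y) (ey ψ R y), ey_idem ψ R hψ,
      ← LinearMap.comp_apply (π i) (π i), h4]
  have e2 : ∀ i, mm ψ (res R _ (h5 i)) y = finrank ℂ (LinearMap.range (ey ψ R y ∘ₗ π i)) := by
    intro i
    have : LinearMap.range (ey ψ R y ∘ₗ π i) =
        (LinearMap.range (ey ψ (res R _ (h5 i)) y)).map (LinearMap.range (π i)).subtype := by
      ext x
      constructor
      · rintro ⟨z, rfl⟩
        refine ⟨ey ψ (res R _ (h5 i)) y ⟨π i z, z, rfl⟩, ⟨_, rfl⟩, ?_⟩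
        rw [ey_map ψ (IsMap.subtype R _ (h5 i))]; rfl
      · rintro ⟨_, ⟨⟨_, z, rfl⟩, rfl⟩, rfl⟩
        refine ⟨z, ?_⟩
        rw [ey_map ψ (IsMap.subtype R _ (h5 i))]; rfl
    rw [this, mm]
    exact (LinearEquiv.finrank_eq (Submodule.equivMapOfInjective _ (Submodule.subtype_injective _) _))
  have e3 : ey ψ R y = ∑ i, ey ψ R y ∘ₗ π i := by
    ext x
    rw [LinearMap.sum_apply]
    simp only [LinearMap.comp_apply]
    rw [← map_sum, ← LinearMap.sum_apply, h2]; rfl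
  have e4 := trace_idem _ (ey_idem ψ R hψ y)
  rw [e3, map_sum] at e4
  simp only [trace_idem _ (e1 _)] at e4
  rw [← e3] at e4
  simp only [e2]
  exact_mod_cast e4

variable (ψ) {c : ℂ} (hc : c * c = 1)

/-- induced module -/
noncomputable abbrev II := coindS (KU F) (lin (kK ψ c hc))
/-- induced representation -/
noncomputable abbrev IR : Representation ℂ (SL F) (II ψ hc) := coind (KU F) (lin (kK ψ c hc))

variable {ψ} {hc}

theorem II_X (φ : II ψ hc) (a : F) (g : SL F) : φ.1 (sX a * g) = ψ a * φ.1 g := by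
  have hm : sX a ∈ KU F := ⟨sX_e10 a, by rw [sX_e00, mul_one]⟩
  have := φ.2 ⟨sX a, hm⟩ g
  rw [lin_apply] at this
  rw [this]
  congr 1
  change ψ ((sX a).1 0 1 * (sX a).1 0 0) * sg c ((sX a).1 0 0) = ψ a
  rw [sX_e00, sX_e01, sg_one, mul_one, mul_one]

theorem II_Z (hodd : ringChar F ≠ 2) (φ : II ψ hc) (g : SL F) : φ.1 (sH (-1) * g) = c * φ.1 g := by
  have hm : sH (-1 : Fˣ) ∈ KU F := ⟨sH_e10 _, by rw [sH_e00]; simp⟩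
  have := φ.2 ⟨sH (-1), hm⟩ g
  rw [lin_apply] at this
  rw [this]
  congr 1
  change ψ ((sH (-1)).1 0 1 * (sH (-1)).1 0 0) * sg c ((sH (-1)).1 0 0) = c
  rw [sH_e01, sH_e00, zero_mul, AddChar.map_zero_eq_one, one_mul, sg, if_neg]
  rw [Units.val_neg, Units.val_one]
  exact Ring.neg_one_ne_one_of_char_ne_two hodd

theorem II_det (hψ : ψ.IsPrimitive) {y : F} {φ : II ψ hc} (h : ∀ g u, φ.1 (g * sX u) = ψ (y * u) * φ.1 g)
    (hW : ∀ t, φ.1 (sW t) = 0) (hH : ∀ t : Fˣ, (t : F) ^ 2 = y → φ.1 (sH t) = 0) : φ = 0 := by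
  classical
  apply Subtype.ext
  funext g
  change φ.1 g = 0
  by_cases hg : g.1 1 0 = 0
  · obtain ⟨a, t, rfl⟩ := bruhat1 g hg
    rw [II_X]
    by_cases ht : (t : F) ^ 2 = y
    · rw [hH t ht, mul_zero]
    · by_contra hne
      have h0 : φ.1 (sH t) ≠ 0 := right_ne_zero_of_mul hne
      have h3 : ∀ u, ψ (u * ((t : F) ^ 2 - y)) = 1 := by
        intro u
        have h1 := h (sH t) u
        have h2 : sH t * sX u = sX (t ^ 2 * u) * sH t := by rw [← sH_sX]; group
        rw [h2, II_X] at h1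
        have h4 := mul_right_cancel₀ h0 h1
        have h5 : u * ((t : F) ^ 2 - y) = t ^ 2 * u + -(y * u) := by ring
        rw [h5, AddChar.map_add_eq_mul, h4, mul_comm, psi_neg]
      have h6 := sum_psi ψ hψ ((t : F) ^ 2 - y)
      rw [if_neg (sub_ne_zero.2 ht)] at h6
      simp only [h3] at h6
      simp at h6
  · obtain ⟨a, b, t, rfl⟩ := bruhat2 g hg
    rw [h, II_X, hW]; simp

theorem II_ey {y : F} {φ : II ψ hc} (h : φ ∈ LinearMap.range (ey ψ (IR ψ hc) y)) (g : SL F) (u : F) :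
    φ.1 (g * sX u) = ψ (y * u) * φ.1 g := by
  obtain ⟨x, rfl⟩ := h
  exact congrArg (fun z : II ψ hc => z.1 g) (X_ey ψ (IR ψ hc) y u x)

/-- units mod sign -/
abbrev DD (F : Type) [Field F] := Fˣ ⧸ Subgroup.zpowers (-1 : Fˣ)

theorem card_DD (hodd : ringChar F ≠ 2) : 2 * Nat.card (DD F) + 1 = Fintype.card F := by
  classical
  have h1 := (Subgroup.zpowers (-1 : Fˣ)).card_mul_index
  have h2 : Nat.card (Subgroup.zpowers (-1 : Fˣ)) = 2 := by
    rw [Nat.card_zpowers]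
    apply orderOf_eq_prime
    · simp
    · intro h
      exact Ring.neg_one_ne_one_of_char_ne_two hodd (by simpa using congrArg Units.val h)
  rw [h2, Nat.card_eq_fintype_card, Fintype.card_units] at h1
  have : (Subgroup.zpowers (-1 : Fˣ)).index = Nat.card (DD F) := rfl
  have := Fintype.card_pos (α := F)
  omega

theorem W_out (hodd : ringChar F ≠ 2) {φ : II ψ hc} (h : ∀ d : DD F, φ.1 (sW d.out) = 0) (t : Fˣ) :
    φ.1 (sW t) = 0 := by
  have h1 := QuotientGroup.mk_out_eq_mul (Subgroup.zpowers (-1 : Fˣ)) t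
  obtain ⟨⟨z, hz⟩, h2⟩ := h1
  dsimp only at h2
  have h3 := h (QuotientGroup.mk t)
  rw [h2] at h3
  obtain ⟨n, rfl⟩ := Subgroup.mem_zpowers_iff.1 hz
  rcases Int.even_or_odd n with hn | hn
  · rw [hn.neg_one_zpow, mul_one] at h3; exact h3
  · rw [hn.neg_one_zpow, mul_comm, ← sH_sW, II_Z hodd] at h3
    exact (mul_eq_zero.1 h3).resolve_left (fun h0 => by rw [h0] at hc; simp at hc)

theorem mm_II_0 (hψ : ψ.IsPrimitive) (hodd : ringChar F ≠ 2) : mm ψ (IR ψ hc) 0 ≤ Nat.card (DD F) := by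
  have := Fintype.ofFinite (DD F)
  let L : II ψ hc →ₗ[ℂ] (DD F → ℂ) :=
    { toFun := fun φ d => φ.1 (sW d.out), map_add' := fun _ _ => rfl, map_smul' := fun _ _ => rfl }
  have hL : Function.Injective (L.domRestrict (LinearMap.range (ey ψ (IR ψ hc) 0))) := by
    rintro ⟨φ₁, hφ₁⟩ ⟨φ₂, hφ₂⟩ h0
    apply Subtype.ext
    apply sub_eq_zero.1
    have hφ := Submodule.sub_mem _ hφ₁ hφ₂
    change L φ₁ = L φ₂ at h0
    rw [← sub_eq_zero, ← map_sub] at h0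
    change φ₁ - φ₂ = 0
    generalize φ₁ - φ₂ = φ at *
    refine II_det hψ (II_ey hφ) (W_out hodd fun d => congrFun h0 d) ?_
    intro t ht
    exact absurd (pow_eq_zero_iff (two_ne_zero)|>.1 ht) t.ne_zero
  have := LinearMap.finrank_le_finrank_of_injective hL
  rw [Module.finrank_fintype_fun_eq_card, ← Nat.card_eq_fintype_card] at this
  exact this

theorem mm_II_1 (hψ : ψ.IsPrimitive) (hodd : ringChar F ≠ 2) : mm ψ (IR ψ hc) 1 ≤ Nat.card (DD F) + 1 := by
  have := Fintype.ofFinite (DD F)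
  let L : II ψ hc →ₗ[ℂ] (Option (DD F) → ℂ) :=
    { toFun := fun φ d => φ.1 (d.elim 1 fun d => sW d.out)
      map_add' := fun _ _ => rfl, map_smul' := fun _ _ => rfl }
  have hL : Function.Injective (L.domRestrict (LinearMap.range (ey ψ (IR ψ hc) 1))) := by
    rintro ⟨φ₁, hφ₁⟩ ⟨φ₂, hφ₂⟩ h0
    apply Subtype.ext
    apply sub_eq_zero.1
    have hφ := Submodule.sub_mem _ hφ₁ hφ₂
    change L φ₁ = L φ₂ at h0
    rw [← sub_eq_zero, ← map_sub] at h0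
    change φ₁ - φ₂ = 0
    generalize φ₁ - φ₂ = φ at *
    refine II_det hψ (II_ey hφ) (W_out hodd fun d => congrFun h0 (some d)) ?_
    have h1 : φ.1 1 = 0 := congrFun h0 none
    intro t ht
    rcases mul_self_eq_one_iff.1 ((sq (t : F)).symm.trans ht) with h | h
    · rw [show t = 1 from Units.ext h, sH_one, h1]
    · rw [show t = -1 from Units.ext h, ← mul_one (sH (-1 : Fˣ)), II_Z hodd, h1, mul_zero]
  have := LinearMap.finrank_le_finrank_of_injective hL
  rw [Module.finrank_fintype_fun_eq_card, Fintype.card_option, ← Nat.card_eq_fintype_card] at this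
  exact this

theorem II_B (hψ : ψ.IsPrimitive) {φ : II ψ hc} (hX : ∀ u, IR ψ hc (sX u) φ = φ) (hH : ∀ t, IR ψ hc (sH t) φ = φ)
    (h : φ.1 (sW 1) = 0) : φ = 0 := by
  apply II_det hψ (y := 0)
  · intro g u
    rw [zero_mul, AddChar.map_zero_eq_one, one_mul]
    exact congrArg (fun z : II ψ hc => z.1 g) (hX u)
  · intro t
    have e : sW t = sW 1 * sH t⁻¹ := by rw [sW_sH]; simp
    have := congrArg (fun z : II ψ hc => z.1 (sW 1)) (hH t⁻¹)
    rw [e, ← h]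
    exact this
  · intro t ht
    exact absurd (pow_eq_zero_iff (two_ne_zero)|>.1 ht) t.ne_zero

theorem II_b {p : Submodule ℂ (II ψ hc)} (hp : MinInv (IR ψ hc) p) : 0 < mm (E := p) ψ (res _ p hp.2.1) 1 := by
  by_contra h0
  have h1 : mm (E := p) ψ (res _ p hp.2.1) 1 = 0 := by omega
  rw [mm_zero_iff] at h1
  apply ev1_ne (KU F) _ p hp.2.1 hp.1
  ext x
  have h2 := ey_map ψ (IsMap.subtype _ p hp.2.1) 1 x
  rw [h1, LinearMap.zero_apply, map_zero] at h2
  change (0 : II ψ hc) = ey ψ (IR ψ hc) 1 x.1 at h2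
  rw [ey_apply] at h2
  have h3 := (smul_eq_zero.1 h2.symm).resolve_left (inv_ne_zero qne)
  have h4 := congrArg (ev1 (KU F) (lin (kK ψ c hc))) h3
  rw [map_sum, map_zero] at h4
  have h5 : ∀ u, ev1 (KU F) (lin (kK ψ c hc)) (ψ (-(1 * u)) • IR ψ hc (sX u) x.1) = x.1.1 1 := by
    intro u
    rw [map_smul, smul_eq_mul]
    change ψ (-(1 * u)) * x.1.1 (1 * sX u) = _
    have := II_X x.1 u 1
    rw [mul_one] at this
    rw [one_mul, one_mul, this, ← mul_assoc, psi_neg, one_mul]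
  simp only [h5] at h4
  rw [Finset.sum_const, Finset.card_univ, nsmul_eq_mul] at h4
  exact (mul_eq_zero.1 h4).resolve_left qne

theorem exists_discrete (hodd : ringChar F ≠ 2) (h7 : 7 ≤ Fintype.card F) {c : ℂ} (hc : c = 1 ∨ c = -1) :
    ∃ (V : Type) (_ : AddCommGroup V) (_ : Module ℂ V) (_ : FiniteDimensional ℂ V)
      (ρ : Representation ℂ (SL F) V), Irr ρ ∧ finrank ℂ V + 1 = Fintype.card F ∧ ρ (sH (-1)) = c • LinearMap.id := by
  classical
  have hcc : c * c = 1 := by rcases hc with rfl | rfl <;> norm_num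
  obtain ⟨ψ, hψ⟩ := exists_psi F
  obtain ⟨k, hk⟩ := FiniteField.exists_nonsquare hodd
  obtain ⟨ι, _, π, h1, h2, h3, h4, h5⟩ := decomp _ _ (IR ψ hcc) rfl
  let r := fun i => res (IR ψ hcc) _ (h5 i).2.1
  have hr : ∀ i, Irr (r i) := fun i => irr_res (h5 i)
  have hz : ∀ i, r i (sH (-1)) = c • LinearMap.id := by
    intro i
    ext x g
    change x.1.1 (g * sH (-1)) = c * x.1.1 g
    rw [← II_Z hodd, Subgroup.mem_center_iff.1 Stp.zz_center g]
  by_cases hex : ∃ i, mm ψ (r i) 0 = 0 ∧ mm ψ (r i) k = 1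
  · obtain ⟨i, e0, ek⟩ := hex
    refine ⟨LinearMap.range (π i), inferInstance, inferInstance, inferInstance, r i, hr i, ?_, hz i⟩
    have e1 := mm_le_one ψ hψ (hr i) (one_ne_zero (α := F))
    have e2 : 0 < mm (E := LinearMap.range (π i)) ψ (r i) 1 := II_b (h5 i)
    have e3 := two_dim (E := LinearMap.range (π i)) ψ (r i) hψ hodd hk
    rw [e0, ek, le_antisymm e1 e2] at e3
    omega
  · exfalso
    push Not at hex
    let s : ι → ℕ := fun i => if mm ψ (r i) 0 = 1 ∧ mm ψ (r i) k = 1 then 1 else 0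
    have hs : ∑ i, s i ≤ 1 := by
      rw [Finset.sum_ite, Finset.sum_const_zero, add_zero, Finset.sum_const, smul_eq_mul, mul_one]
      rw [Finset.card_le_one]
      have st : ∀ i, mm ψ (r i) 0 = 1 ∧ mm ψ (r i) k = 1 → ∃ x : II ψ hcc, x ∈ LinearMap.range (π i) ∧
          x ≠ 0 ∧ (∀ u, IR ψ hcc (sX u) x = x) ∧ (∀ t, IR ψ hcc (sH t) x = x) := by
        rintro i ⟨e0, ek⟩
        have e1 := mm_le_one ψ hψ (hr i) (one_ne_zero (α := F))
        have e2 : 0 < mm (E := LinearMap.range (π i)) ψ (r i) 1 := II_b (h5 i)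
        obtain ⟨v, hv, -⟩ := st_data ψ hψ (hr i) e0 (by
          intro y hy
          rcases mm_all (E := LinearMap.range (π i)) (ρ := r i) ψ hodd hk hy with h | h <;> omega)
        refine ⟨v.1, v.2, fun h => hv.ne (Subtype.ext h), fun u => congrArg Subtype.val (hv.X u), fun t => ?_⟩
        have := hv.H t
        rw [one_smul] at this
        exact congrArg Subtype.val this
      intro i hi j hj
      rw [Finset.mem_filter] at hi hj
      by_contra hij
      obtain ⟨x, hx, x0, xX, xH⟩ := st i hi.2
      obtain ⟨z, ⟨z', rfl⟩, z0, zX, zH⟩ := st j hj.2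
      have hz1 : (π j z').1 (sW 1) ≠ 0 := fun h => z0 (II_B hψ zX zH h)
      have hw : (π j z').1 (sW 1) • x - x.1 (sW 1) • (π j z') = 0 := by
        refine II_B hψ ?_ ?_ ?_
        · intro u; rw [map_sub, map_smul, map_smul, xX, zX]
        · intro u; rw [map_sub, map_smul, map_smul, xH, zH]
        · change (π j z').1 (sW 1) * x.1 (sW 1) - x.1 (sW 1) * (π j z').1 (sW 1) = 0
          ring
      have hw2 := congrArg (π i) hw
      obtain ⟨x', rfl⟩ := hx
      rw [map_sub, map_smul, map_smul, map_zero, ← LinearMap.comp_apply, ← LinearMap.comp_apply, h4, h3 i j hij,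
        LinearMap.zero_apply, smul_zero, sub_zero] at hw2
      exact x0 ((smul_eq_zero.1 hw2).resolve_left hz1)
    have hle : ∀ i, 2 * mm ψ (r i) k ≤ mm ψ (r i) 0 + s i := by
      intro i
      obtain ⟨c1, c2, c3, c4⟩ := cls ψ hψ (hr i) hk
      have := hex i
      simp only [s]
      split_ifs <;> omega
    have S0 := mm_res hψ (IR ψ hcc) π h1 h2 h4 (fun i => (h5 i).2.1) 0
    have Sk := mm_res hψ (IR ψ hcc) π h1 h2 h4 (fun i => (h5 i).2.1) k
    have B0 := mm_II_0 (hc := hcc) hψ hodd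
    have B1 := mm_II_1 (hc := hcc) hψ hodd
    have HS := Finset.sum_le_sum (fun i (_ : i ∈ Finset.univ) => hle i)
    rw [← Finset.mul_sum, Finset.sum_add_distrib] at HS
    have S0' : ∑ i, mm ψ (r i) 0 = mm ψ (IR ψ hcc) 0 := S0
    have Sk' : ∑ i, mm ψ (r i) k = mm ψ (IR ψ hcc) k := Sk
    rw [S0', Sk'] at HS
    have TD := two_dim ψ (IR ψ hcc) hψ hodd hk
    have hfi : finrank ℂ (II ψ hcc) = (KU F).index := by rw [finrank_coind]; simp
    have hI := KU_index (F := F)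
    have hD := card_DD hodd
    rw [hfi] at TD
    generalize mm ψ (IR ψ hcc) 0 = a at *
    generalize mm ψ (IR ψ hcc) 1 = b at *
    generalize mm ψ (IR ψ hcc) k = b' at *
    generalize Nat.card (DD F) = d at *
    generalize (KU F).index = n at *
    rw [← hD] at hI TD h7
    clear hD
    simp only [Nat.add_sub_cancel] at TD
    have : b + b' ≤ 2 * d := by omega
    have h9 : 2 * d * (b + b') ≤ 2 * d * (2 * d) := Nat.mul_le_mul_left _ this
    nlinarith

end S6
end B1

namespace B1
open Module

noncomputable section
open Pointwise
variable {F : Type} [Field F]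

def uX : Multiplicative F →* SL F where
  toFun u := sX u.toAdd
  map_one' := sX_zero
  map_mul' a b := sX_add _ _

theorem card_SL' [Fintype F] : Nat.card (SL F) = Fintype.card F * ((Fintype.card F - 1) * (Fintype.card F + 1)) := by
  classical
  apply le_antisymm
  · let f : (F × Fˣ) ⊕ (F × Fˣ × F) → SL F := Sum.elim (fun x => sX x.1 * sH x.2) (fun x => sX x.1 * sW x.2.1 * sX x.2.2)
    have hf : Function.Surjective f := by
      intro g
      by_cases h : g.1 1 0 = 0
      · obtain ⟨a, t, rfl⟩ := bruhat1 g h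
        exact ⟨Sum.inl (a, t), rfl⟩
      · obtain ⟨a, b, t, rfl⟩ := bruhat2 g h
        exact ⟨Sum.inr (a, t, b), rfl⟩
    have := Nat.card_le_card_of_surjective f hf
    refine this.trans (le_of_eq ?_)
    rw [Nat.card_eq_fintype_card]
    simp only [Fintype.card_sum, Fintype.card_prod, Fintype.card_units]
    ring
  · rw [← mul_assoc]; exact card_SL

def Ub (F : Type) [Field F] : Subgroup (PSL2 F) := ((uX (F := F)).range).map (QuotientGroup.mk' _)

theorem mem_Ub {x : PSL2 F} : x ∈ Ub F ↔ ∃ u : F, ((sX u : SL F) : PSL2 F) = x := by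
  constructor
  · rintro ⟨_, ⟨u, rfl⟩, rfl⟩
    exact ⟨u.toAdd, rfl⟩
  · rintro ⟨u, rfl⟩
    exact ⟨_, ⟨Multiplicative.ofAdd u, rfl⟩, rfl⟩

theorem index_uX [Fintype F] : (uX (F := F)).range.index = (Fintype.card F - 1) * (Fintype.card F + 1) := by
  have h := (uX (F := F)).range.card_mul_index
  have h1 : Nat.card (uX (F := F)).range = Fintype.card F := by
    have : Function.Injective (uX (F := F)) := fun a b h => Multiplicative.toAdd.injective (sX_inj h)
    rw [← Nat.card_congr (MonoidHom.ofInjective this).toEquiv, Nat.card_congr Multiplicative.toAdd, Nat.card_eq_fintype_card]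
  rw [card_SL', h1] at h
  exact Nat.eq_of_mul_eq_mul_left Fintype.card_pos h

theorem sX_pow (u : F) (n : ℕ) : sX u ^ n = sX (n * u) := by
  induction n with
  | zero => simp [sX_zero]
  | succ n ih => rw [pow_succ, ih, ← sX_add]; congr 1; push_cast; ring

theorem ub_pgroup [Fintype F] : IsPGroup (ringChar F) (Ub F) := by
  rintro ⟨x, hx⟩
  refine ⟨1, ?_⟩
  apply Subtype.ext
  rw [Subgroup.coe_pow, Subgroup.coe_one]
  obtain ⟨u, hu⟩ := mem_Ub.1 hx
  change x ^ (ringChar F ^ 1) = 1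
  rw [← hu, pow_one, ← QuotientGroup.mk_pow, sX_pow, CharP.cast_eq_zero, zero_mul, sX_zero]
  rfl

theorem prime_char [Fintype F] : (ringChar F).Prime := by
  obtain ⟨n, hn, h⟩ := FiniteField.card F (ringChar F)
  exact hn

theorem not_dvd_ub [Fintype F] : ¬ ringChar F ∣ (Ub F).index := by
  intro h
  have h1 := h.trans (Subgroup.index_map_dvd _ (QuotientGroup.mk'_surjective _))
  obtain ⟨n, hn, hc⟩ := FiniteField.card F (ringChar F)
  rw [index_uX] at h1
  have hd : ringChar F ∣ Fintype.card F := by rw [hc]; exact dvd_pow_self _ n.ne_zero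
  have hpos : 0 < Fintype.card F := Fintype.card_pos
  rcases (Nat.Prime.dvd_mul hn).1 h1 with h2 | h2
  · have := Nat.dvd_sub hd h2
    rw [Nat.sub_sub_self hpos] at this
    exact hn.one_lt.ne' (Nat.dvd_one.1 this)
  · have := (Nat.dvd_add_right hd).1 h2
    exact hn.one_lt.ne' (Nat.dvd_one.1 this)

abbrev Om (F : Type) [Field F] : Type := Sylow (ringChar F) (PSL2 F)

def Pinf (F : Type) [Field F] [Fintype F] : Om F :=
  haveI : Fact (ringChar F).Prime := ⟨prime_char⟩
  IsPGroup.toSylow (ub_pgroup (F := F)) not_dvd_ub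

theorem Pinf_coe [Fintype F] : ((Pinf F : Om F) : Subgroup (PSL2 F)) = Ub F := rfl

variable [Fintype F]

def Pt (g : SL F) : Om F := MulAut.conj (g : PSL2 F) • Pinf F

theorem Pt_smul (s g : SL F) : MulAut.conj (s : PSL2 F) • Pt g = Pt (s * g) := by
  rw [Pt, smul_smul, ← map_mul]; rfl

theorem Pt_one : Pt (1 : SL F) = Pinf F := by
  rw [Pt]
  have : ((1 : SL F) : PSL2 F) = 1 := rfl
  rw [this, map_one, one_smul]

theorem Pt_surj (P : Om F) : ∃ g : SL F, Pt g = P := by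
  haveI : Fact (ringChar F).Prime := ⟨prime_char⟩
  obtain ⟨x, hx⟩ := MulAction.exists_smul_eq (PSL2 F) (Pinf F) P
  obtain ⟨g, rfl⟩ := QuotientGroup.mk_surjective x
  exact ⟨g, by rw [Pt, ← Sylow.smul_def, hx]⟩

theorem mem_Pt {g : SL F} {x : PSL2 F} : x ∈ Pt g ↔ ∃ u : F, ((g * sX u * g⁻¹ : SL F) : PSL2 F) = x := by
  have h : x ∈ Pt g ↔ x ∈ MulAut.conj (g : PSL2 F) • Ub F := by
    rw [← Pinf_coe, ← Sylow.pointwise_smul_def]; rfl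
  rw [h, Subgroup.mem_smul_pointwise_iff_exists]
  constructor
  · rintro ⟨_, hs, rfl⟩
    obtain ⟨u, rfl⟩ := mem_Ub.1 hs
    exact ⟨u, rfl⟩
  · rintro ⟨u, rfl⟩
    exact ⟨_, mem_Ub.2 ⟨u, rfl⟩, rfl⟩

theorem mk_eq {a b : SL F} (h : (a : PSL2 F) = b) : a = b ∨ a = b * sH (-1) := by
  have h1 := QuotientGroup.eq.1 h.symm
  rcases Stp.center_eq h1 with h2 | h2
  · left; exact (inv_mul_eq_one.1 h2).symm
  · right; rw [← h2]; group

theorem mk_zz (a : SL F) : ((a * sH (-1) : SL F) : PSL2 F) = a := by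
  apply (QuotientGroup.eq.2 _).symm
  rw [inv_mul_cancel_left]; exact Stp.zz_center

theorem Pt_inf {g : SL F} : Pt g = Pinf F ↔ g.1 1 0 = 0 := by
  constructor
  · intro h
    have h1 : ((g * sX 1 * g⁻¹ : SL F) : PSL2 F) ∈ Pt g := mem_Pt.2 ⟨1, rfl⟩
    rw [h] at h1
    obtain ⟨u, hu⟩ := mem_Ub.1 (h1 : _ ∈ Ub F)
    rcases mk_eq hu.symm with h2 | h2
    · rw [mul_inv_eq_iff_eq_mul] at h2
      have e := congrArg (fun g : SL F => g.1 1 1) h2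
      simp only [sl_mul11, sX_e01, sX_e11, sX_e10] at e
      linear_combination e
    · rw [mul_inv_eq_iff_eq_mul] at h2
      have e := congrArg (fun g : SL F => g.1 1 1) h2
      have e' := congrArg (fun g : SL F => g.1 1 0) h2
      simp only [sl_mul11, sl_mul10, sX_e00, sX_e01, sX_e11, sX_e10, sH_e00, sH_e01, sH_e10, sH_e11] at e e'
      simp at e e'
      by_contra h0
      have h3 : (2 : F) * g.1 1 0 = 0 := by linear_combination e'
      have h4 : (2 : F) = 0 := by
        rcases mul_eq_zero.1 h3 with h | h
        · exact h
        · exact absurd h h0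
      apply h0
      linear_combination e - g.1 1 1 * h4
  · intro h
    obtain ⟨a, t, rfl⟩ := bruhat1 g h
    apply Sylow.ext
    ext x
    have hx : x ∈ (Pinf F : Subgroup (PSL2 F)) ↔ x ∈ Ub F := Iff.rfl
    rw [hx, mem_Ub]
    refine mem_Pt.trans ?_
    have key : ∀ u : F, sX a * sH t * sX u * (sX a * sH t)⁻¹ = sX (t ^ 2 * u) := by
      intro u
      have : sX a * sH t * sX u * (sX a * sH t)⁻¹ = sX a * (sH t * sX u * (sH t)⁻¹) * (sX a)⁻¹ := by group
      rw [this, sH_sX, ← sX_neg, ← sX_add, ← sX_add]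
      congr 1; ring
    constructor
    · rintro ⟨u, rfl⟩
      exact ⟨t ^ 2 * u, by rw [key]⟩
    · rintro ⟨u, rfl⟩
      refine ⟨(t ^ 2 : F)⁻¹ * u, ?_⟩
      rw [key, mul_inv_cancel_left₀ (pow_ne_zero _ t.ne_zero)]

theorem Pt_eq {g h : SL F} : Pt g = Pt h ↔ (h⁻¹ * g).1 1 0 = 0 := by
  rw [← Pt_inf, ← Pt_smul h⁻¹ g]
  constructor
  · intro e
    rw [e, Pt_smul, inv_mul_cancel, Pt_one]
  · intro e
    have := congrArg (fun P => MulAut.conj (h : PSL2 F) • P) e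
    simp only [Pt_smul] at this
    rw [mul_inv_cancel_left] at this
    rw [this]; rfl

/-- the opposite point -/
def Po (a : F) : Om F := Pt (sX a * sW 1)

theorem Po_ne (a : F) : Po a ≠ Pinf F := by
  rw [Po, Ne, Pt_inf]
  simp [sl_mul10, sX_e10, sX_e11, sW_e10]

theorem Po_surj {P : Om F} (h : P ≠ Pinf F) : ∃ a, Po a = P := by
  obtain ⟨g, rfl⟩ := Pt_surj P
  rw [Ne, Pt_inf] at h
  obtain ⟨a, b, t, rfl⟩ := bruhat2 g h
  refine ⟨a, ?_⟩
  rw [Po, Pt_eq]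
  have : (sX a * sW t * sX b)⁻¹ * (sX a * sW 1) = (sX b)⁻¹ * ((sW t)⁻¹ * sW 1) := by group
  rw [this, sW_inv, sW_sW, ← sX_neg]
  simp [sl_mul10, sX_e10, sX_e11, sH_e10]

theorem Po_smul (b a : F) : MulAut.conj ((sX b : SL F) : PSL2 F) • Po a = Po (b + a) := by
  rw [Po, Pt_smul, ← mul_assoc, ← sX_add]; rfl

theorem Po_inj {a b : F} (h : Po a = Po b) : a = b := by
  rw [Po, Po, Pt_eq] at h
  have : (sX b * sW 1)⁻¹ * (sX a * sW 1) = (sW 1)⁻¹ * sX (a - b) * sW 1 := by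
    rw [sub_eq_neg_add, sX_add, sX_neg]; group
  rw [this, sW_inv] at h
  simp [sl_mul10, sl_mul11, sX_e10, sX_e11, sX_e01, sX_e00, sW_e10, sW_e11, sW_e00, sW_e01] at h
  exact (sub_eq_zero.1 h).symm

theorem card_Om : Nat.card (Om F) = Fintype.card F + 1 := by
  classical
  let f : Option F → Om F := fun o => o.elim (Pinf F) Po
  have hf : Function.Bijective f := by
    constructor
    · rintro (_ | a) (_ | b) h
      · rfl
      · exact absurd h.symm (Po_ne b)
      · exact absurd h (Po_ne a)
      · rw [Po_inj h]
    · intro P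
      by_cases h : P = Pinf F
      · exact ⟨none, h.symm⟩
      · obtain ⟨a, ha⟩ := Po_surj h
        exact ⟨some a, ha⟩
  rw [← Nat.card_congr (Equiv.ofBijective f hf), Nat.card_eq_fintype_card, Fintype.card_option]

end
end B1

namespace B1
open Module

noncomputable section
section Perm
variable {Γ Ω : Type} [Group Γ] [Finite Γ] [MulAction Γ Ω] [Fintype Ω]

def permRep (Γ Ω : Type) [Group Γ] [MulAction Γ Ω] : Representation ℂ Γ (Ω → ℂ) where
  toFun g := { toFun := fun f P => f (g⁻¹ • P), map_add' := fun _ _ => rfl, map_smul' := fun _ _ => rfl }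
  map_one' := by ext; simp
  map_mul' a b := by ext; simp [mul_smul]

theorem permRep_apply (g : Γ) (f : Ω → ℂ) (P : Ω) : permRep Γ Ω g f P = f (g⁻¹ • P) := rfl

def sumF (Ω : Type) [Fintype Ω] : (Ω → ℂ) →ₗ[ℂ] ℂ := ∑ P, LinearMap.proj P

theorem sumF_apply (f : Ω → ℂ) : sumF Ω f = ∑ P, f P := by simp [sumF]

abbrev Zs (Ω : Type) [Fintype Ω] : Submodule ℂ (Ω → ℂ) := LinearMap.ker (sumF Ω)

theorem mem_Zs {f : Ω → ℂ} : f ∈ Zs Ω ↔ ∑ P, f P = 0 := by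
  rw [LinearMap.mem_ker, sumF_apply]

theorem Zs_inv : Inv (permRep Γ Ω) (Zs Ω) := by
  intro g f hf
  rw [mem_Zs] at hf ⊢
  rw [← hf]
  exact Equiv.sum_comp (MulAction.toPerm g⁻¹) f

theorem finrank_Zs (P : Ω) : finrank ℂ (Zs Ω) + 1 = Fintype.card Ω := by
  classical
  have h := (sumF Ω).finrank_range_add_finrank_ker
  have h1 : LinearMap.range (sumF Ω) = ⊤ := by
    rw [LinearMap.range_eq_top]
    intro c
    refine ⟨Pi.single P c, ?_⟩
    rw [sumF_apply]; simp
  rw [h1, finrank_top, finrank_self] at h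
  rw [finrank_fintype_fun_eq_card] at h
  rw [add_comm]; exact h

theorem perm_irr (M : Subgroup Γ) (o : Ω) (h1 : ∀ P, ∃ m ∈ M, m • P = o)
    (h2 : ∀ P Q : Ω, P ≠ o → Q ≠ o → ∃ m ∈ M, m • o = o ∧ m • P = Q)
    (p : Submodule ℂ (Ω → ℂ)) (hp : p ≤ Zs Ω) (hi : ∀ m ∈ M, ∀ f ∈ p, permRep Γ Ω m f ∈ p)
    (h0 : p ≠ ⊥) : p = Zs Ω := by
  classical
  obtain ⟨f, hf, hf0⟩ := Submodule.exists_mem_ne_zero_of_ne_bot h0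
  obtain ⟨P, hP⟩ := Function.ne_iff.1 hf0
  obtain ⟨m, hm, hmP⟩ := h1 P
  let f1 := permRep Γ Ω m f
  have hf1 : f1 ∈ p := hi m hm f hf
  have hf1o : f1 o ≠ 0 := by
    change f (m⁻¹ • o) ≠ 0
    rw [← hmP, inv_smul_smul]; exact hP
  let H : Subgroup Γ := M ⊓ MulAction.stabilizer Γ o
  haveI : Fintype H := Fintype.ofFinite _
  let f2 := ∑ h : H, permRep Γ Ω h f1
  have hf2 : f2 ∈ p := Submodule.sum_mem _ fun h _ => hi _ h.2.1 _ hf1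
  have e2 : ∀ P, f2 P = ∑ h : H, f1 ((h : Γ)⁻¹ • P) := by
    intro P
    simp only [f2, Finset.sum_apply]
    rfl
  have e3 : f2 o ≠ 0 := by
    rw [e2]
    have : ∀ h : H, f1 ((h : Γ)⁻¹ • o) = f1 o := by
      intro h
      have : (h : Γ) • o = o := h.2.2
      congr 1
      rw [inv_smul_eq_iff, this]
    simp only [this, Finset.sum_const, nsmul_eq_mul]
    refine mul_ne_zero ?_ hf1o
    exact Nat.cast_ne_zero.2 (Finset.card_pos.2 ⟨1, Finset.mem_univ _⟩).ne'
  have e4 : ∀ P Q : Ω, P ≠ o → Q ≠ o → f2 Q = f2 P := by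
    intro P Q hP hQ
    obtain ⟨k, hk, hko, hkP⟩ := h2 P Q hP hQ
    let k' : H := ⟨k, hk, hko⟩
    rw [e2, e2]
    refine Fintype.sum_equiv (Equiv.mulLeft k'⁻¹) _ _ fun h => ?_
    congr 1
    rw [← hkP, smul_smul]
    congr 1
    simp [k']
  let n : ℂ := Fintype.card Ω
  let e : Ω → Ω → ℂ := fun P Q => n * (if Q = P then 1 else 0) - 1
  have hn : n ≠ 0 := Nat.cast_ne_zero.2 (Fintype.card_pos_iff.2 ⟨o⟩).ne'
  have hfs := mem_Zs.1 (hp hf2)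
  have heo : e o ∈ p := by
    have hex : ∃ B : ℂ, ∀ Q, Q ≠ o → f2 Q = B := by
      by_cases h : ∃ Q, Q ≠ o
      · obtain ⟨Q, hQ⟩ := h
        exact ⟨f2 Q, fun R hR => e4 Q R hQ hR⟩
      · push Not at h
        exact ⟨0, fun Q hQ => absurd (h Q) hQ⟩
    obtain ⟨B, hB⟩ := hex
    have e5 : ∀ Q, f2 Q = B + (f2 o - B) * (if Q = o then 1 else 0) := by
      intro Q
      by_cases h : Q = o
      · subst h; simp
      · simp [h, hB Q h]
    have e6 : n * B + (f2 o - B) = 0 := by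
      rw [Finset.sum_congr rfl (fun Q _ => e5 Q), Finset.sum_add_distrib, ← Finset.mul_sum] at hfs
      simpa [n] using hfs
    have hB0 : B ≠ 0 := by
      rintro rfl
      apply e3; simpa using e6
    have : e o = (-B)⁻¹ • f2 := by
      funext Q
      rw [Pi.smul_apply, smul_eq_mul, e5 Q]
      have : f2 o - B = - (n * B) := by linear_combination e6
      rw [this]
      simp only [e]
      field_simp
      ring
    rw [this]
    exact p.smul_mem _ hf2
  have heP : ∀ P, e P ∈ p := by
    intro P
    obtain ⟨m, hm, hmP⟩ := h1 P
    have := hi m⁻¹ (M.inv_mem hm) _ heo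
    convert this using 1
    funext Q
    rw [permRep_apply]
    have : (m⁻¹⁻¹ • Q = o) ↔ Q = P := by
      rw [inv_inv, ← hmP]; exact (MulAction.injective m).eq_iff
    simp only [e, this]
  refine le_antisymm hp fun z hz => ?_
  have hz0 := mem_Zs.1 hz
  have : z = n⁻¹ • ∑ P, z P • e P := by
    funext Q
    simp only [Pi.smul_apply, Finset.sum_apply, smul_eq_mul, e]
    have : ∀ P, z P * (n * (if Q = P then 1 else 0) - 1) = n * (if Q = P then z P else 0) - z P := by
      intro P; split_ifs <;> ring
    simp only [this, Finset.sum_sub_distrib, ← Finset.mul_sum, hz0, Finset.sum_ite_eq, Finset.mem_univ, if_true, sub_zero]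
    rw [inv_mul_cancel_left₀ hn]
  rw [this]
  exact p.smul_mem _ (Submodule.sum_mem _ fun P _ => p.smul_mem _ (heP P))

theorem perm_irr' (M : Subgroup Γ) (o o' : Ω) (hoo : o' ≠ o) (h1 : ∀ P, ∃ m ∈ M, m • P = o)
    (h2 : ∀ P Q : Ω, P ≠ o → Q ≠ o → ∃ m ∈ M, m • o = o ∧ m • P = Q) :
    Irr (rs M (res (permRep Γ Ω) (Zs Ω) Zs_inv)) := by
  classical
  constructor
  · refine ⟨⟨⟨Pi.single o 1 - Pi.single o' 1, ?_⟩, 0, ?_⟩⟩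
    · rw [mem_Zs]; simp
    · intro h
      have := congrFun (congrArg Subtype.val h) o
      simp [hoo.symm] at this
  · intro p hp
    by_cases h0 : p = ⊥
    · left; exact h0
    right
    have h := perm_irr (Γ := Γ) M o h1 h2 (p.map (Zs Ω).subtype) (Submodule.map_subtype_le _ _) (by
      rintro m hm _ ⟨f, hf, rfl⟩
      exact ⟨_, hp ⟨m, hm⟩ f hf, rfl⟩) (by
      intro h; apply h0
      apply Submodule.map_injective_of_injective (Submodule.injective_subtype (Zs Ω))
      rw [h, Submodule.map_bot])
    apply Submodule.map_injective_of_injective (Submodule.injective_subtype (Zs Ω))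
    rw [h, Submodule.map_top, Submodule.range_subtype]
end Perm
end
end B1

namespace B1
open Module
noncomputable section
namespace Stp
variable {G F : Type} [Group G] [Field F] (S : Stp G F)

/-- conjugation of an element of `M` by an element of `G` -/
def cm (g : G) (m : S.M) : S.M := ⟨g * m * g⁻¹, S.hM.conj_mem _ m.2 g⟩

theorem cm_coe (g : G) (m : S.M) : (S.cm g m : G) = g * m * g⁻¹ := rfl
theorem cm_mul (g : G) (m m' : S.M) : S.cm g (m * m') = S.cm g m * S.cm g m' :=
  Subtype.ext (by simp [cm_coe])
theorem cm_cm (g h : G) (m : S.M) : S.cm (g * h) m = S.cm g (S.cm h m) :=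
  Subtype.ext (by simp [cm_coe, mul_assoc])

theorem phi_eq {m m' : S.M} : S.φ m = S.φ m' ↔ ((m⁻¹ * m' : S.M) : G) ∈ S.N := by
  rw [← S.hk, map_mul, map_inv, inv_mul_eq_one]

theorem phi_cm {m m' : S.M} (g : G) (h : S.φ m = S.φ m') : S.φ (S.cm g m) = S.φ (S.cm g m') := by
  rw [phi_eq] at h ⊢
  have := S.hN.conj_mem _ h g
  convert this using 1
  simp [cm_coe, mul_assoc]

def li (x : PSL2 F) : S.M := (S.hφ x).choose
theorem phi_li (x : PSL2 F) : S.φ (S.li x) = x := (S.hφ x).choose_spec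

def cj0 (g : G) (x : PSL2 F) : PSL2 F := S.φ (S.cm g (S.li x))

theorem cj0_phi (g : G) (m : S.M) : S.cj0 g (S.φ m) = S.φ (S.cm g m) :=
  S.phi_cm g (S.phi_li _)

theorem cj0_mul (g h : G) (x : PSL2 F) : S.cj0 (g * h) x = S.cj0 g (S.cj0 h x) := by
  obtain ⟨m, rfl⟩ := S.hφ x
  rw [cj0_phi, cj0_phi, cj0_phi, cm_cm]

theorem cj0_one (x : PSL2 F) : S.cj0 1 x = x := by
  obtain ⟨m, rfl⟩ := S.hφ x
  rw [cj0_phi]; congr 1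
  exact Subtype.ext (by simp [cm_coe])

def cj : G →* MulAut (PSL2 F) where
  toFun g := { toFun := S.cj0 g, invFun := S.cj0 g⁻¹,
               left_inv := fun x => by rw [← cj0_mul, inv_mul_cancel, cj0_one]
               right_inv := fun x => by rw [← cj0_mul, mul_inv_cancel, cj0_one]
               map_mul' := fun x y => by
                obtain ⟨m, rfl⟩ := S.hφ x
                obtain ⟨m', rfl⟩ := S.hφ y
                rw [← map_mul, cj0_phi, cj0_phi, cj0_phi, cm_mul, map_mul] }
  map_one' := by ext x; exact S.cj0_one x
  map_mul' g h := by ext x; exact S.cj0_mul g h x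

theorem cj_phi (g : G) (m : S.M) : S.cj g (S.φ m) = S.φ (S.cm g m) := S.cj0_phi g m

theorem cj_M (m : S.M) : S.cj m = MulAut.conj (S.φ m) := by
  ext x
  obtain ⟨m', rfl⟩ := S.hφ x
  rw [cj_phi, MulAut.conj_apply, ← map_inv, ← map_mul, ← map_mul]
  rfl

theorem cj_N {g : G} (h : g ∈ S.N) : S.cj g = 1 := by
  have := S.cj_M ⟨g, S.hNM h⟩
  rw [(S.hk ⟨g, S.hNM h⟩).2 h, map_one] at this
  exact this

variable [Fintype F]

theorem perf (hF : 4 ≤ Fintype.card F) : Perf S.hNM := by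
  intro κ hκ
  have h1 : ∀ m m' : S.M, S.φ m = S.φ m' → κ m = κ m' := by
    intro m m' h
    have h2 := hκ _ (S.phi_eq.1 h)
    have h3 : κ (m⁻¹ * m') = 1 := h2
    rw [map_mul, map_inv, inv_mul_eq_one] at h3
    exact h3
  let κ' : SL F →* ℂˣ :=
    { toFun := fun s => κ (S.li (s : PSL2 F))
      map_one' := by rw [h1 _ 1, map_one]; rw [phi_li, map_one]; rfl
      map_mul' := fun a b => by
        rw [← map_mul]; apply h1
        rw [map_mul, phi_li, phi_li, phi_li]; rfl }
  have h2 := sl_perfect (by rwa [Nat.card_eq_fintype_card]) κ'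
  ext m
  obtain ⟨s, hs⟩ := QuotientGroup.mk_surjective (S.φ m)
  have h3 := DFunLike.congr_fun h2 s
  have h4 : κ' s = κ m := h1 _ _ (by rw [phi_li, ← hs])
  rw [← h4, h3]; rfl

theorem om_trans (P : Om F) : ∃ m ∈ S.M, S.cj m • P = Pinf F := by
  obtain ⟨g, rfl⟩ := Pt_surj P
  obtain ⟨m, hm⟩ := S.hφ ((g⁻¹ : SL F) : PSL2 F)
  refine ⟨m, m.2, ?_⟩
  rw [cj_M, hm, Pt_smul, inv_mul_cancel, Pt_one]

theorem om_trans2 (P Q : Om F) (hP : P ≠ Pinf F) (hQ : Q ≠ Pinf F) :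
    ∃ m ∈ S.M, S.cj m • Pinf F = Pinf F ∧ S.cj m • P = Q := by
  obtain ⟨a, rfl⟩ := Po_surj hP
  obtain ⟨b, rfl⟩ := Po_surj hQ
  obtain ⟨m, hm⟩ := S.hφ ((sX (b - a) : SL F) : PSL2 F)
  refine ⟨m, m.2, ?_, ?_⟩
  · rw [cj_M, hm, ← Pt_one, Pt_smul, Pt_one, Pt_inf, mul_one, sX_e10]
  · rw [cj_M, hm, Po_smul, sub_add_cancel]

theorem exists_St [Finite G] : ∃ (V : Type) (_ : AddCommGroup V) (_ : Module ℂ V) (_ : FiniteDimensional ℂ V)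
    (α : Representation ℂ G V), finrank ℂ V = Fintype.card F ∧ Irr (rs S.M α) ∧ ∀ n ∈ S.N, α n = 1 := by
  classical
  letI : MulAction G (Om F) := MulAction.compHom (Om F) S.cj
  haveI : Finite (Om F) := Nat.finite_of_card_ne_zero (by rw [card_Om]; omega)
  letI : Fintype (Om F) := Fintype.ofFinite _
  refine ⟨Zs (Om F), inferInstance, inferInstance, inferInstance, res (permRep G (Om F)) _ Zs_inv, ?_, ?_, ?_⟩
  · have := finrank_Zs (Pinf F)
    rw [← Nat.card_eq_fintype_card, card_Om] at this
    omega
  · exact perm_irr' S.M (Pinf F) (Po 0) (Po_ne 0) S.om_trans S.om_trans2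
  · intro n hn
    ext v : 1
    apply Subtype.ext
    rw [res_coe]
    funext P
    rw [permRep_apply]
    have : n⁻¹ • P = P := by
      change S.cj n⁻¹ • P = P
      rw [S.cj_N (S.N.inv_mem hn), one_smul]
    rw [this]; rfl

end Stp
end
end B1

namespace B1
open Module
noncomputable section
namespace Stp
variable {G F : Type} [Group G] [Field F] [Fintype F] (S : Stp G F)

theorem Po_zero : Po (0 : F) = Pt (sW 1) := by rw [Po, sX_zero, one_mul]

theorem mem_Po {x : PSL2 F} : x ∈ Po (0 : F) ↔ ∃ v : F, ((sY v : SL F) : PSL2 F) = x := by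
  rw [Po_zero, mem_Pt]
  constructor
  · rintro ⟨u, rfl⟩
    exact ⟨_, by rw [sW_sX]⟩
  · rintro ⟨v, rfl⟩
    refine ⟨-v, ?_⟩
    rw [sW_sX]; simp

theorem mem_Pinf {x : PSL2 F} : x ∈ Pinf F ↔ ∃ u : F, ((sX u : SL F) : PSL2 F) = x := mem_Ub

def T : Subgroup G where
  carrier := {g | S.cj g • Pinf F = Pinf F ∧ S.cj g • Po (0 : F) = Po 0}
  one_mem' := by simp
  mul_mem' := by
    rintro a b ⟨h1, h2⟩ ⟨h3, h4⟩
    refine ⟨?_, ?_⟩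
    · rw [map_mul, mul_smul, h3, h1]
    · rw [map_mul, mul_smul, h4, h2]
  inv_mem' := by
    rintro a ⟨h1, h2⟩
    refine ⟨?_, ?_⟩
    · rw [map_inv, inv_smul_eq_iff, h1]
    · rw [map_inv, inv_smul_eq_iff, h2]

theorem mem_T {g : G} : g ∈ S.T ↔ S.cj g • Pinf F = Pinf F ∧ S.cj g • Po (0 : F) = Po 0 := Iff.rfl

theorem exists_T (g : G) : ∃ m ∈ S.M, m * g ∈ S.T := by
  obtain ⟨m, hm, h⟩ := S.om_trans (S.cj g • Pinf F)
  rw [smul_smul, ← map_mul] at h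
  have h0 : S.cj (m * g) • Po (0 : F) ≠ Pinf F := by
    intro h'
    rw [← h] at h'
    exact Po_ne 0 (smul_left_cancel _ h')
  obtain ⟨m', hm', h1, h2⟩ := S.om_trans2 _ _ h0 (Po_ne 0)
  refine ⟨m' * m, S.M.mul_mem hm' hm, ?_, ?_⟩
  · rw [mul_assoc, map_mul, mul_smul, h, h1]
  · rw [mul_assoc, map_mul, mul_smul, h2]

theorem smul_mem {α : MulAut (PSL2 F)} {P : Om F} {x : PSL2 F} (h : x ∈ P) : α x ∈ α • P := by
  have : α • x ∈ ((α • P : Om F) : Subgroup (PSL2 F)) := by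
    rw [Sylow.pointwise_smul_def]
    exact Subgroup.smul_mem_pointwise_smul _ _ _ h
  exact this

theorem exists_f (g : S.T) (u : F) : ∃ v : F, S.cj g ((sX u : SL F) : PSL2 F) = ((sX v : SL F) : PSL2 F) := by
  have h : S.cj g ((sX u : SL F) : PSL2 F) ∈ S.cj g • Pinf F := smul_mem (mem_Pinf.2 ⟨u, rfl⟩)
  rw [g.2.1] at h
  obtain ⟨v, hv⟩ := mem_Pinf.1 h
  exact ⟨v, hv.symm⟩

theorem exists_fy (g : S.T) (u : F) : ∃ v : F, S.cj g ((sY u : SL F) : PSL2 F) = ((sY v : SL F) : PSL2 F) := by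
  have h : S.cj g ((sY u : SL F) : PSL2 F) ∈ S.cj g • Po (0 : F) := smul_mem (mem_Po.2 ⟨u, rfl⟩)
  rw [g.2.2] at h
  obtain ⟨v, hv⟩ := mem_Po.1 h
  exact ⟨v, hv.symm⟩

def ff (g : S.T) (u : F) : F := (S.exists_f g u).choose
theorem ff_spec (g : S.T) (u : F) : S.cj g ((sX u : SL F) : PSL2 F) = ((sX (S.ff g u) : SL F) : PSL2 F) :=
  (S.exists_f g u).choose_spec

theorem mkX_inj {a b : F} (h : ((sX a : SL F) : PSL2 F) = ((sX b : SL F) : PSL2 F)) : a = b := by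
  rcases mk_eq h with h1 | h1
  · exact sX_inj h1
  · have e := congrArg (fun g : SL F => g.1 0 0) h1
    have e' := congrArg (fun g : SL F => g.1 0 1) h1
    simp only [sl_mul00, sl_mul01, sX_e00, sX_e01, sH_e00, sH_e01, sH_e10, sH_e11] at e e'
    simp at e e'
    rw [e', neg_eq_neg_one_mul, ← e, one_mul]

theorem ff_eq {g : S.T} {u v : F} (h : S.cj g ((sX u : SL F) : PSL2 F) = ((sX v : SL F) : PSL2 F)) : S.ff g u = v :=
  mkX_inj ((S.ff_spec g u).symm.trans h)

theorem ff_add (g : S.T) (u v : F) : S.ff g (u + v) = S.ff g u + S.ff g v := by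
  apply ff_eq
  rw [sX_add, sX_add, QuotientGroup.mk_mul, QuotientGroup.mk_mul, map_mul, ff_spec, ff_spec]

theorem ff_mul (g h : S.T) (u : F) : S.ff (g * h) u = S.ff g (S.ff h u) := by
  apply ff_eq
  rw [Subgroup.coe_mul, map_mul, MulAut.mul_apply, ff_spec, ff_spec]

theorem ff_one (u : F) : S.ff 1 u = u := by
  apply ff_eq
  simp

theorem ff_inj (g : S.T) : Function.Injective (S.ff g) := by
  intro u v h
  have := congrArg (S.ff g⁻¹) h
  rwa [← ff_mul, ← ff_mul, inv_mul_cancel, ff_one, ff_one] at this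

theorem ff_zero (g : S.T) : S.ff g 0 = 0 := by
  have := S.ff_add g 0 0
  rw [add_zero] at this
  simpa using this

theorem conj_cj (α : MulAut (PSL2 F)) (x : PSL2 F) : MulAut.conj (α x) = α * MulAut.conj x * α⁻¹ := by
  ext y; simp

theorem fix_diag {k : SL F} (h1 : MulAut.conj (k : PSL2 F) • Pinf F = Pinf F)
    (h2 : MulAut.conj (k : PSL2 F) • Po (0 : F) = Po 0) : ∃ t : Fˣ, k = sH t := by
  rw [← Pt_one, Pt_smul, Pt_one, Pt_inf, mul_one] at h1
  rw [Po_zero, Pt_smul, Pt_eq, sW_inv] at h2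
  have h3 : k.1 0 1 = 0 := by
    simp only [sl_mul10, sl_mul11, sl_mul00, sl_mul01, sW_e00, sW_e01, sW_e10, sW_e11] at h2
    simpa using h2
  obtain ⟨a, t, rfl⟩ := bruhat1 k h1
  simp only [sl_mul01, sX_e00, sX_e01, sH_e01, sH_e11] at h3
  have h4 : a = 0 := by simpa using h3
  exact ⟨t, by rw [h4, sX_zero, one_mul]⟩

theorem diag_fix (t : Fˣ) : MulAut.conj ((sH t : SL F) : PSL2 F) • Pinf F = Pinf F ∧
    MulAut.conj ((sH t : SL F) : PSL2 F) • Po (0 : F) = Po 0 := by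
  constructor
  · rw [← Pt_one, Pt_smul, Pt_one, Pt_inf, mul_one, sH_e10]
  · rw [Po_zero, Pt_smul, Pt_eq, sW_inv]
    simp [sl_mul10, sl_mul11, sl_mul00, sl_mul01, sW_e00, sW_e01, sW_e10, sW_e11, sH_e01, sH_e00, sH_e10, sH_e11]

theorem exists_s (g : S.T) (t : Fˣ) : ∃ s : Fˣ, S.cj g ((sH t : SL F) : PSL2 F) = ((sH s : SL F) : PSL2 F) := by
  obtain ⟨k, hk⟩ := QuotientGroup.mk_surjective (S.cj g ((sH t : SL F) : PSL2 F))
  obtain ⟨s, hs⟩ := fix_diag (k := k) (by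
    rw [hk, conj_cj, mul_smul, mul_smul, inv_smul_eq_iff.2 g.2.1.symm, (diag_fix t).1, g.2.1]) (by
    rw [hk, conj_cj, mul_smul, mul_smul, inv_smul_eq_iff.2 g.2.2.symm, (diag_fix t).2, g.2.2])
  exact ⟨s, by rw [← hk, hs]⟩

theorem ff_sq (g : S.T) (t : Fˣ) : ∃ s : Fˣ, ∀ u, S.ff g (t ^ 2 * u) = s ^ 2 * S.ff g u := by
  obtain ⟨s, hs⟩ := S.exists_s g t
  refine ⟨s, fun u => ?_⟩
  apply ff_eq
  rw [← sH_sX, ← sH_sX, QuotientGroup.mk_mul, QuotientGroup.mk_mul, QuotientGroup.mk_inv, map_mul, map_mul, map_inv, hs, ff_spec]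
  rfl

theorem ff_mulsq (g : S.T) (t u : F) : S.ff g (t ^ 2 * u) * S.ff g 1 = S.ff g (t ^ 2) * S.ff g u := by
  by_cases h : t = 0
  · simp [h, ff_zero]
  · obtain ⟨s, hs⟩ := S.ff_sq g (Units.mk0 t h)
    simp only [Units.val_mk0] at hs
    have := hs 1
    rw [mul_one] at this
    rw [this, hs]; ring

theorem ff_mulmul (h2 : (2 : F) ≠ 0) (g : S.T) (a u : F) : S.ff g (a * u) * S.ff g 1 = S.ff g a * S.ff g u := by
  have e : a = ((a + 1) / 2) ^ 2 + (-1) * ((a - 1) / 2) ^ 2 := by field_simp; ring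
  have hn : ∀ x, S.ff g (-1 * x) = - S.ff g x := by
    intro x
    rw [neg_one_mul, eq_neg_iff_add_eq_zero, ← ff_add, neg_add_cancel, ff_zero]
  have h1 := S.ff_mulsq g ((a + 1) / 2) u
  have h3 := S.ff_mulsq g ((a - 1) / 2) u
  have e1 : S.ff g (a * u) = S.ff g (((a + 1) / 2) ^ 2 * u) - S.ff g (((a - 1) / 2) ^ 2 * u) := by
    rw [sub_eq_add_neg, ← hn, ← ff_add]; congr 1
    nth_rw 1 [e]; ring
  have e2 : S.ff g a = S.ff g (((a + 1) / 2) ^ 2) - S.ff g (((a - 1) / 2) ^ 2) := by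
    rw [sub_eq_add_neg, ← hn, ← ff_add]; congr 1
  rw [e1, e2, sub_mul, sub_mul, h1, h3]

theorem la_ne (g : S.T) : S.ff g 1 ≠ 0 := by
  intro h
  rw [← S.ff_zero g] at h
  exact one_ne_zero (S.ff_inj g h)

end Stp
end
end B1

namespace B1
open Module
noncomputable section
namespace Stp
variable {G F : Type} [Group G] [Field F] [Fintype F] (S : Stp G F)

def sg (h2 : (2 : F) ≠ 0) (g : S.T) : F →+* F where
  toFun u := S.ff g u / S.ff g 1
  map_one' := div_self (S.la_ne g)
  map_mul' a b := by
    have := S.ff_mulmul h2 g a b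
    have h0 := S.la_ne g
    field_simp
    linear_combination this
  map_zero' := by rw [ff_zero, zero_div]
  map_add' a b := by rw [ff_add, add_div]

theorem sg_apply (h2 : (2 : F) ≠ 0) (g : S.T) (u : F) : S.sg h2 g u = S.ff g u / S.ff g 1 := rfl

theorem ff_sg (h2 : (2 : F) ≠ 0) (g : S.T) (u : F) : S.ff g u = S.sg h2 g u * S.ff g 1 := by
  rw [sg_apply, div_mul_cancel₀ _ (S.la_ne g)]

theorem sg_mul (h2 : (2 : F) ≠ 0) (g h : S.T) (u : F) : S.sg h2 (g * h) u = S.sg h2 g (S.sg h2 h u) := by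
  rw [S.sg_apply h2 (g * h), ff_mul, ff_mul, S.ff_sg h2 g, S.ff_sg h2 g (S.ff h 1), S.sg_apply h2 h, map_div₀,
    mul_div_mul_right _ _ (S.la_ne g)]

def sgE (h2 : (2 : F) ≠ 0) (g : S.T) : F ≃+* F :=
  RingEquiv.ofBijective (S.sg h2 g) (Finite.injective_iff_bijective.1 (S.sg h2 g).injective)

def sgA [Algebra (ZMod (ringChar F)) F] (h2 : (2 : F) ≠ 0) : S.T →* (F ≃ₐ[ZMod (ringChar F)] F) where
  toFun g := AlgEquiv.ofRingEquiv (f := S.sgE h2 g) (fun r => by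
    have : ((S.sg h2 g).comp (algebraMap (ZMod (ringChar F)) F)) = algebraMap (ZMod (ringChar F)) F := Subsingleton.elim _ _
    exact DFunLike.congr_fun this r)
  map_one' := by
    ext u
    change S.sg h2 1 u = u
    rw [sg_apply, ff_one, ff_one, div_one]
  map_mul' g h := by
    ext u
    exact S.sg_mul h2 g h u

theorem sgA_apply [Algebra (ZMod (ringChar F)) F] (h2 : (2 : F) ≠ 0) (g : S.T) (u : F) : S.sgA h2 g u = S.sg h2 g u := rfl

def laU (g : S.T) : Fˣ := Units.mk0 _ (S.la_ne g)

open Classical in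
def qc (F : Type) [Field F] [Fintype F] : Fˣ →* ℤˣ := (quadraticChar F).toUnitHom

theorem qc_iff (u : Fˣ) : qc F u = 1 ↔ IsSquare (u : F) := by
  classical
  rw [← quadraticChar_one_iff_isSquare u.ne_zero, ← Units.val_inj, qc, MulChar.coe_toUnitHom, Units.val_one]

theorem qc_map (e : F ≃+* F) (u v : Fˣ) (h : (v : F) = e u) : qc F v = qc F u := by
  have h1 : qc F v = 1 ↔ qc F u = 1 := by
    rw [qc_iff, qc_iff, h]
    constructor
    · intro hs
      have := hs.map e.symm
      simpa using this
    · intro hs; exact hs.map e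
  rcases Int.units_eq_one_or (qc F v) with h2 | h2 <;> rcases Int.units_eq_one_or (qc F u) with h3 | h3
  · rw [h2, h3]
  · rw [h1.1 h2] at h3; exact absurd h3 (by decide)
  · rw [h1.2 h3] at h2; exact absurd h2 (by decide)
  · rw [h2, h3]

def laH (h2 : (2 : F) ≠ 0) : S.T →* ℤˣ where
  toFun g := qc F (S.laU g)
  map_one' := by
    rw [qc_iff]
    change IsSquare (S.ff 1 1)
    rw [ff_one]; exact IsSquare.one
  map_mul' g h := by
    have e : S.laU (g * h) = S.laU g * Units.map (S.sgE h2 g : F →* F) (S.laU h) := by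
      apply Units.ext
      change S.ff (g * h) 1 = S.ff g 1 * S.sg h2 g (S.ff h 1)
      rw [ff_mul, S.ff_sg h2 g, mul_comm]
    rw [e, map_mul]
    congr 1
    exact qc_map (S.sgE h2 g) _ _ rfl

/-- the subgroup condition: trivial centraliser -/
def CT : Prop := ∀ g : G, S.cj g = 1 → g ∈ S.N

theorem fix_y (g : S.T) (hf : ∀ u, S.ff g u = u) (v : F) : S.cj g ((sY v : SL F) : PSL2 F) = ((sY v : SL F) : PSL2 F) := by
  by_cases h : v = 0
  · have : sY v = 1 := by rw [h]; apply sl_ext <;> simp [sY_e00, sY_e01, sY_e10, sY_e11]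
    rw [this, QuotientGroup.mk_one, map_one]
  let u : Fˣ := -(Units.mk0 v h)⁻¹
  have hu : -((u⁻¹ : Fˣ) : F) = v := by simp [u]
  obtain ⟨v', hv'⟩ := S.exists_fy g v
  have hx : S.cj g ((sX (u : F) : SL F) : PSL2 F) = ((sX (u : F) : SL F) : PSL2 F) := by
    rw [ff_spec, hf]
  let k : SL F := sX (u : F) * sY v' * sX (u : F)
  have hw : S.cj g ((sW u : SL F) : PSL2 F) = (k : PSL2 F) := by
    rw [← sW_eq, hu, QuotientGroup.mk_mul, QuotientGroup.mk_mul, map_mul, map_mul, hx, hv']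
    rfl
  have hP : MulAut.conj ((sW u : SL F) : PSL2 F) • Pinf F = Po 0 := by
    rw [← Pt_one, Pt_smul, Po_zero, mul_one, Pt_eq, sW_inv, sW_sW, sH_e10]
  have hk : MulAut.conj (k : PSL2 F) • Pinf F = Po 0 := by
    rw [← hw, conj_cj, mul_smul, mul_smul, inv_smul_eq_iff.2 g.2.1.symm, hP, g.2.2]
  rw [← Pt_one, Pt_smul, mul_one, Po_zero, Pt_eq, sW_inv] at hk
  have h1 : 1 + (u : F) * v' = 0 := by
    simp only [k, sl_mul10, sl_mul11, sl_mul00, sl_mul01, sW_e00, sW_e01, sW_e10, sW_e11, sX_e00, sX_e01, sX_e10, sX_e11, sY_e00, sY_e01, sY_e10, sY_e11] at hk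
    simpa using hk
  have h2 : v' = v := by
    rw [← hu]
    have := u.ne_zero
    rw [Units.val_inv_eq_inv_val]
    field_simp
    linear_combination h1
  rw [hv', h2]

theorem fix_all (g : S.T) (hf : ∀ u, S.ff g u = u) : S.cj g = 1 := by
  have hx : ∀ u : F, S.cj g ((sX u : SL F) : PSL2 F) = ((sX u : SL F) : PSL2 F) := by
    intro u; rw [ff_spec, hf]
  have hw : ∀ u : Fˣ, S.cj g ((sW u : SL F) : PSL2 F) = ((sW u : SL F) : PSL2 F) := by
    intro u
    rw [← sW_eq, QuotientGroup.mk_mul, QuotientGroup.mk_mul, map_mul, map_mul, hx, S.fix_y g hf]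
  have hh : ∀ t : Fˣ, S.cj g ((sH t : SL F) : PSL2 F) = ((sH t : SL F) : PSL2 F) := by
    intro t
    have : sH t = sW (-t) * sW 1 := by rw [sW_sW]; simp
    rw [this, QuotientGroup.mk_mul, map_mul, hw, hw]
  ext x
  obtain ⟨s, rfl⟩ := QuotientGroup.mk_surjective x
  rw [MulAut.one_apply]
  by_cases h : s.1 1 0 = 0
  · obtain ⟨a, t, rfl⟩ := bruhat1 s h
    rw [QuotientGroup.mk_mul, map_mul, hx, hh]
  · obtain ⟨a, b, t, rfl⟩ := bruhat2 s h
    rw [QuotientGroup.mk_mul, QuotientGroup.mk_mul, map_mul, map_mul, hx, hw, hx]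

theorem ker_le (hC : S.CT) [Algebra (ZMod (ringChar F)) F] (h2 : (2 : F) ≠ 0) (g : S.T) (h1 : S.sgA h2 g = 1) (h3 : S.laH h2 g = 1) :
    (g : G) ∈ S.M := by
  obtain ⟨t, ht⟩ := (qc_iff _).1 h3
  have ht : S.ff g 1 = t * t := ht
  have ht0 : t ≠ 0 := by rintro rfl; exact S.la_ne g (by rw [ht, zero_mul])
  have hf : ∀ u, S.ff g u = t ^ 2 * u := by
    intro u
    have : S.sg h2 g u = u := by rw [← sgA_apply, h1]; rfl
    rw [S.ff_sg h2, this, ht]; ring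
  obtain ⟨m, hm⟩ := S.hφ ((sH (Units.mk0 t ht0) : SL F) : PSL2 F)
  have hmT : (m : G) ∈ S.T := by
    rw [mem_T, cj_M, hm]; exact diag_fix _
  have hfm : ∀ u, S.ff ⟨m, hmT⟩ u = t ^ 2 * u := by
    intro u
    apply ff_eq
    change S.cj m _ = _
    rw [cj_M, hm, MulAut.conj_apply, ← QuotientGroup.mk_mul, ← QuotientGroup.mk_inv, ← QuotientGroup.mk_mul, sH_sX, Units.val_mk0]
  have h4 : S.cj ((⟨m, hmT⟩⁻¹ * g : S.T) : G) = 1 := by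
    apply fix_all
    intro u
    apply S.ff_inj ⟨m, hmT⟩
    rw [← ff_mul, mul_inv_cancel_left, hf, hfm]
  have h5 := S.hNM (hC _ h4)
  have h6 := S.M.mul_mem m.2 h5
  simpa using h6

theorem hab_index (hC : S.CT) (h2 : (2 : F) ≠ 0) {f : ℕ} (hf : Fintype.card F = ringChar F ^ f) :
    (∀ a b : G, a * b * a⁻¹ * b⁻¹ ∈ S.M) ∧ S.M.index ∣ 2 * f := by
  letI : Algebra (ZMod (ringChar F)) F := ZMod.algebra F (ringChar F)
  haveI : Fact (ringChar F).Prime := ⟨prime_char⟩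
  let Ψ := (S.laH h2).prod (S.sgA h2)
  have hΨ : ∀ g : S.T, Ψ g = 1 → (g : G) ∈ S.M := by
    intro g h
    have := Prod.ext_iff.1 h
    exact S.ker_le hC h2 g this.2 this.1
  have hq : ∀ g : G, ∃ t : S.T, (QuotientGroup.mk' S.M) g = (QuotientGroup.mk' S.M) t := by
    intro g
    obtain ⟨m, hm, h⟩ := S.exists_T g
    refine ⟨⟨m * g, h⟩, ?_⟩
    change _ = (QuotientGroup.mk' S.M) (m * g)
    rw [map_mul, (QuotientGroup.eq_one_iff m).2 hm |> fun h => (show QuotientGroup.mk' S.M m = 1 from h), one_mul]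
  constructor
  · intro a b
    obtain ⟨s, hs⟩ := hq a
    obtain ⟨t, ht⟩ := hq b
    have h1 : Ψ (s * t * s⁻¹ * t⁻¹) = 1 := by
      simp only [map_mul, map_inv]
      have : Ψ s * Ψ t = Ψ t * Ψ s := by
        apply Prod.ext
        · exact mul_comm _ _
        · exact IsCyclic.commutative.is_comm.comm _ _
      rw [this]; group
    have h3 := hΨ _ h1
    rw [← QuotientGroup.eq_one_iff] at h3 ⊢
    change (QuotientGroup.mk' S.M) (a * b * a⁻¹ * b⁻¹) = 1
    rw [map_mul, map_mul, map_mul, map_inv, map_inv, hs, ht]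
    exact h3
  · let κ := (QuotientGroup.mk' S.M).comp S.T.subtype
    have hκ : Function.Surjective κ := by
      intro x
      obtain ⟨g, rfl⟩ := QuotientGroup.mk'_surjective _ x
      obtain ⟨t, ht⟩ := hq g
      exact ⟨t, ht.symm⟩
    have h1 : κ.ker.index = S.M.index := by
      rw [Subgroup.index_ker, MonoidHom.range_eq_top.2 hκ]
      simp [Subgroup.index]
    have h3 : Ψ.ker ≤ κ.ker := by
      intro g hg
      exact (QuotientGroup.eq_one_iff _).2 (hΨ g hg)
    rw [← h1]
    refine (Subgroup.index_dvd_of_le h3).trans ?_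
    rw [Subgroup.index_ker]
    refine (Subgroup.card_subgroup_dvd_card _).trans ?_
    rw [Nat.card_prod, IsGalois.card_aut_eq_finrank]
    have h4 := Module.card_eq_pow_finrank (K := ZMod (ringChar F)) (V := F)
    rw [hf, ZMod.card] at h4
    rw [← Nat.pow_right_injective prime_char.two_le h4]
    simp
end Stp
end
end B1

namespace B1
open Module TensorProduct
noncomputable section
namespace Stp
variable {G F : Type} [Group G] [Field F] (S : Stp G F)
variable {X : Type} [AddCommGroup X] [Module ℂ X] [FiniteDimensional ℂ X]
variable {E : Type} [AddCommGroup E] [Module ℂ E] [FiniteDimensional ℂ E]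
variable {A : Type} [AddCommGroup A] [Module ℂ A] [FiniteDimensional ℂ A]
variable {V : Type} [AddCommGroup V] [Module ℂ V] [FiniteDimensional ℂ V]
variable {Y : Type} [AddCommGroup Y] [Module ℂ Y] [FiniteDimensional ℂ Y]
variable {S}

theorem exists_sigma0 {Θ : Representation ℂ S.Mt X} (hz : Θ S.z0 = 1) :
    ∃ σ : Representation ℂ S.M X, ∀ a, σ (S.pm a) = Θ a := by
  apply descend _ S.pm_surj
  intro a ha
  rcases S.ker_pm ha with rfl | rfl
  · exact map_one _
  · exact hz

theorem rn_sigma0 {θ : Representation ℂ S.N X} {Θ : Representation ℂ S.Mt X} (hΘ : S.Ext θ Θ)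
    {σ : Representation ℂ S.M X} (hσ : ∀ a, σ (S.pm a) = Θ a) : rn S.hNM σ = θ := by
  apply MonoidHom.ext
  intro n
  rw [← hΘ, ← hσ]; rfl

/-- the representation of SL2 attached to a representation of G trivial on N -/
theorem exists_eps {α : Representation ℂ G A} (hα : Irr (rs S.M α)) (hN : ∀ n ∈ S.N, α n = 1) :
    ∃ ε : Representation ℂ (SL F) A, Irr ε ∧ ∀ a : S.Mt, ε (S.pg a) = α (S.pm a) := by
  obtain ⟨ε, hε⟩ := descend S.pg S.pg_surj ((rs S.M α).comp S.pm) (by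
    intro a ha
    have h1 : S.φ (S.pm a) = (S.pg a : PSL2 F) := a.2
    rw [ha] at h1
    exact hN _ ((S.hk _).1 h1))
  refine ⟨ε, irr_of_pullback hε (irr_pullback S.pm_surj (fun a => rfl) hα), hε⟩

theorem ty_tprod {Θ : Representation ℂ S.Mt X} {σ : Representation ℂ S.M X} (hσ : ∀ a, σ (S.pm a) = Θ a)
    {χ : Representation ℂ G Y} (ho : Over S.M χ σ) {α : Representation ℂ G A} [Nontrivial A]
    {ε : Representation ℂ (SL F) A} (hε : ∀ a : S.Mt, ε (S.pg a) = α (S.pm a)) : S.Ty Θ ε (χ.tprod α) := by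
  obtain ⟨f, hf, hf0⟩ := ho
  refine ⟨σ.tprod (rs S.M α), fun a => ?_, TensorProduct.map f LinearMap.id, ?_, ?_⟩
  · rw [Tt_apply, hε, ← hσ]; rfl
  · intro m z
    induction z with
    | zero => simp
    | add a b ha hb => simp only [map_add, ha, hb]
    | tmul x y =>
      change f (σ m x) ⊗ₜ[ℂ] (α m y) = χ m (f x) ⊗ₜ[ℂ] (α m y)
      rw [hf m x]; rfl
  · intro h0
    obtain ⟨x, hx⟩ : ∃ x, f x ≠ 0 := by
      by_contra hc
      push Not at hc
      exact hf0 (LinearMap.ext hc)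
    obtain ⟨y, hy⟩ := exists_ne (0 : A)
    have h1 : f x ⊗ₜ[ℂ] y = 0 := LinearMap.congr_fun h0 (x ⊗ₜ y)
    rcases tmul_zero h1 with h2 | h2
    · exact hx h2
    · exact hy h2

theorem ty_one {Θ : Representation ℂ S.Mt X} {σ : Representation ℂ S.M X} (hσ : ∀ a, σ (S.pm a) = Θ a)
    {χ : Representation ℂ G Y} (ho : Over S.M χ σ) 
    {ε : Representation ℂ (SL F) E} (hε : ∀ s, ε s = 1) (h1 : finrank ℂ E = 1) : S.Ty Θ ε χ := by
  obtain ⟨f, hf, hf0⟩ := ho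
  let e : E ≃ₗ[ℂ] ℂ := LinearEquiv.ofFinrankEq _ _ (by rw [h1, finrank_self])
  let k : X ⊗[ℂ] E ≃ₗ[ℂ] X := (TensorProduct.congr (LinearEquiv.refl ℂ X) e).trans (TensorProduct.rid ℂ X)
  have hk : ∀ x y, k (x ⊗ₜ y) = e y • x := by intro x y; simp [k]
  refine ⟨σ.tprod 1, fun a => ?_, f ∘ₗ k.toLinearMap, ?_, ?_⟩
  · rw [Tt_apply, hε, ← hσ]; rfl
  · intro m z
    induction z with
    | zero => simp
    | add a b ha hb => simp only [map_add, ha, hb]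
    | tmul x y =>
      change f (k (σ m x ⊗ₜ[ℂ] y)) = χ m (f (k (x ⊗ₜ y)))
      rw [hk, hk, map_smul, map_smul, map_smul, hf m x]; rfl
  · intro h0
    apply hf0
    ext x
    have := LinearMap.congr_fun h0 (k.symm x)
    simpa using this

/-- if some `Ty` representation restricts irreducibly to `M` then `θ` is `G`-invariant -/
theorem inv_of_irr [Finite G] [Finite F] {θ : Representation ℂ S.N X} (hθ : Irr θ)
    {Θ : Representation ℂ S.Mt X} (hΘ : S.Ext θ Θ) {ε : Representation ℂ (SL F) E} (hε : Irr ε)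
    {ρ : Representation ℂ G V} (h : S.Ty Θ ε ρ) (hd : finrank ℂ V = finrank ℂ X * finrank ℂ E) (g : G) :
    ∃ B : X →ₗ[ℂ] X, B ≠ 0 ∧ ∀ (n n' : S.N) (x : X), (n' : G) = g * n * g⁻¹ → B (θ n x) = θ n' (B x) := by
  obtain ⟨σ, hσ, f, hf, hf0⟩ := h
  have hi : Irr σ := irr_of_pullback hσ (S.Tt_irr hθ hΘ hε)
  have hinj := hi.map_inj hf hf0
  let k : X ⊗[ℂ] E ≃ₗ[ℂ] V := LinearEquiv.ofInjectiveOfFinrankEq f hinj (by rw [finrank_tensorProduct, hd])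
  have hk : ∀ z, k z = f z := fun z => rfl
  have hfn : ∀ (n : S.N) z, k (TensorProduct.map (θ n) LinearMap.id z) = ρ n (k z) := by
    intro n z
    have h1 := hf (S.pm (S.iN n)) z
    rw [hσ, Tt_apply, hΘ, pg_iN, map_one] at h1
    exact h1
  have hgn : ∀ (n : S.N) v, k.symm (ρ n v) = TensorProduct.map (θ n) LinearMap.id (k.symm v) := by
    intro n v
    rw [LinearEquiv.symm_apply_eq, hfn, LinearEquiv.apply_symm_apply]
  have := hθ.1
  have := hε.1
  obtain ⟨e, he⟩ := exists_ne (0 : E)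
  obtain ⟨x, hx⟩ := exists_ne (0 : X)
  have h0 : k.symm (ρ g (k (x ⊗ₜ e))) ≠ 0 := by
    intro h0
    rw [LinearEquiv.symm_apply_eq, map_zero] at h0
    have h1 := (map_eq_zero_iff _ (rho_inj ρ g)).1 h0
    rw [LinearEquiv.map_eq_zero_iff] at h1
    rcases tmul_zero h1 with h5 | h5
    · exact hx h5
    · exact he h5
  obtain ⟨ξ, hξ⟩ : ∃ ξ : E →ₗ[ℂ] ℂ, TensorProduct.map (LinearMap.id : X →ₗ[ℂ] X) ξ (k.symm (ρ g (k (x ⊗ₜ e)))) ≠ 0 := by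
    by_contra hc
    push Not at hc
    apply h0
    let b := finBasis ℂ E
    let c := finBasis ℂ X
    apply (c.tensorProduct b).ext_elem
    rintro ⟨i, j⟩
    have h3 := congrArg (fun z => c.repr (TensorProduct.rid ℂ X z) i) (hc (b.coord j))
    have key : ∀ z : X ⊗[ℂ] E, (c.tensorProduct b).repr z (i, j) =
        c.repr (TensorProduct.rid ℂ X (TensorProduct.map LinearMap.id (b.coord j) z)) i := by
      intro z
      induction z with
      | zero => simp
      | add a b ha hb => simp only [map_add, Finsupp.add_apply, ha, hb]
      | tmul x y => simp [mul_comm]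
    rw [key, hc]
    simp
  refine ⟨(TensorProduct.rid ℂ X).toLinearMap ∘ₗ TensorProduct.map LinearMap.id ξ ∘ₗ k.symm.toLinearMap ∘ₗ ρ g ∘ₗ
    k.toLinearMap ∘ₗ (TensorProduct.mk ℂ X E).flip e, ?_, ?_⟩
  · intro h1
    have h2 := LinearMap.congr_fun h1 x
    apply hξ
    apply (TensorProduct.rid ℂ X).injective
    rw [map_zero]
    exact h2
  · intro n n' y hn
    have h1 : ∀ z, TensorProduct.rid ℂ X (TensorProduct.map LinearMap.id ξ (TensorProduct.map (θ n') LinearMap.id z))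
        = θ n' (TensorProduct.rid ℂ X (TensorProduct.map LinearMap.id ξ z)) := by
      intro z
      induction z with
      | zero => simp
      | add a b ha hb => simp only [map_add, ha, hb]
      | tmul x y => simp
    have h2 : k (θ n y ⊗ₜ e) = ρ n (k (y ⊗ₜ e)) := hfn n (y ⊗ₜ e)
    change TensorProduct.rid ℂ X (TensorProduct.map LinearMap.id ξ (k.symm (ρ g (k (θ n y ⊗ₜ e))))) =
      θ n' (TensorProduct.rid ℂ X (TensorProduct.map LinearMap.id ξ (k.symm (ρ g (k (y ⊗ₜ e))))))
    rw [h2, ← h1, ← hgn, ← rho_mul, ← rho_mul, hn, inv_mul_cancel_right]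

end Stp
end
end B1

namespace B1
open Module TensorProduct
noncomputable section
namespace Stp
variable {G F : Type} [Group G] [Field F] {S : Stp G F}
variable {X : Type} [AddCommGroup X] [Module ℂ X] [FiniteDimensional ℂ X]
variable {E : Type} [AddCommGroup E] [Module ℂ E] [FiniteDimensional ℂ E]
variable {A : Type} [AddCommGroup A] [Module ℂ A] [FiniteDimensional ℂ A]
variable {V : Type} [AddCommGroup V] [Module ℂ V] [FiniteDimensional ℂ V]

theorem irr_of_rn {θ : Representation ℂ S.N X} (hθ : Irr θ) {σ : Representation ℂ S.M X}
    (h : rn S.hNM σ = θ) : Irr σ := by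
  refine ⟨hθ.1, fun p hp => hθ.2 p ?_⟩
  intro n v hv
  rw [← h]
  exact hp _ v hv

theorem over_of_rn {θ : Representation ℂ S.N X} {σ : Representation ℂ S.M X}
    (h : rn S.hNM σ = θ) {Y : Type} [AddCommGroup Y] [Module ℂ Y] {χ : Representation ℂ G Y}
    (ho : Over S.M χ σ) : Over S.N χ θ := by
  obtain ⟨f, hf, hf0⟩ := ho
  refine ⟨f, fun n v => ?_, hf0⟩
  rw [← h]
  exact hf _ v

theorem irr_of_rs {α : Representation ℂ G A} (h : Irr (rs S.M α)) : Irr α :=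
  ⟨h.1, fun p hp => h.2 p fun m v hv => hp _ v hv⟩

variable (S) in
theorem q_mem [Finite G] [Fintype F] :
    haveI := S.hN
    Fintype.card F ∈ charDegrees (G ⧸ S.N) := by
  haveI := S.hN
  obtain ⟨A, _, _, _, α, hA, hα, hαN⟩ := S.exists_St
  have := mem_quot_of_trivial (N := S.N) (irr_of_rs hα) hαN
  rw [hA] at this
  exact this

/-- everything over a `θ` with positive sign -/
theorem plus_exists [Finite G] [Fintype F] (h4 : 4 ≤ Fintype.card F) {θ : Representation ℂ S.N X} (hθ : Irr θ)
    {Θ : Representation ℂ S.Mt X} (hΘ : S.Ext θ Θ) (hz : Θ S.z0 = 1) :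
    ∃ (σ : Representation ℂ S.M X) (Y : Type) (_ : AddCommGroup Y) (_ : Module ℂ Y) (_ : FiniteDimensional ℂ Y)
      (χ : Representation ℂ G Y) (A : Type) (_ : AddCommGroup A) (_ : Module ℂ A) (_ : FiniteDimensional ℂ A)
      (α : Representation ℂ G A), (∀ a, σ (S.pm a) = Θ a) ∧ rn S.hNM σ = θ ∧ Irr χ ∧ Over S.M χ σ ∧ Over S.N χ θ ∧
        finrank ℂ A = Fintype.card F ∧ Irr (rs S.M α) ∧ (∀ n ∈ S.N, α n = 1) ∧ Irr (χ.tprod α) ∧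
        finrank ℂ Y ∈ charDegrees G ∧ Fintype.card F * finrank ℂ Y ∈ charDegrees G := by
  haveI := S.hN
  haveI := S.hM
  obtain ⟨σ, hσ⟩ := exists_sigma0 hz
  have hr := rn_sigma0 hΘ hσ
  obtain ⟨Y, _, _, _, χ, hχ, ho⟩ := exists_over (irr_of_rn hθ hr)
  obtain ⟨A, _, _, _, α, hA, hα, hαN⟩ := S.exists_St
  have hi : Irr (χ.tprod α) := (S.perf h4).tprod_irr hχ (by rw [hr]; exact hθ) ho hα hαN
  refine ⟨σ, Y, inferInstance, inferInstance, inferInstance, χ, A, inferInstance, inferInstance, inferInstance, α, hσ, hr, hχ, ho, over_of_rn hr ho, hA, hα, hαN, hi, mem_charDegrees χ hχ, ?_⟩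
  have := mem_charDegrees _ hi
  rwa [finrank_tensorProduct, hA, mul_comm] at this

variable (S) in
theorem base_mem [Finite G] [Fintype F] (hab : ∀ a b : G, a * b * a⁻¹ * b⁻¹ ∈ S.M)
    {ε : Representation ℂ (SL F) E} (hε : Irr ε) (hs : ε (sH (-1)) = (1 : ℂ) • LinearMap.id) :
    haveI := S.hN
    ∃ k, k ∣ S.M.index ∧ finrank ℂ E * k ∈ charDegrees (G ⧸ S.N) := by
  haveI := S.hN
  let θ : Representation ℂ S.N ℂ := 1
  let Θ : Representation ℂ S.Mt ℂ := 1
  have hθ : Irr θ := irr_of_finrank_one _ (finrank_self ℂ)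
  have hΘ : S.Ext θ Θ := fun n => rfl
  have hz : Θ S.z0 = (1 : ℂ) • LinearMap.id := by rw [one_smul]; rfl
  obtain ⟨V, _, _, _, ρ, hρ, hT⟩ := S.exists_rho hθ hΘ hε (S.Tt_z0 (Or.inl rfl) hz hs)
  obtain ⟨k, hk⟩ := hT.dvd hθ hΘ hε hρ
  have h2 := hT.dvd_index hab hθ hΘ hε hρ
  rw [finrank_self, one_mul] at hk h2
  have hpos : 0 < finrank ℂ E := by
    haveI := hε.1
    exact finrank_pos
  rw [hk, mul_comm _ k] at h2
  refine ⟨k, Nat.dvd_of_mul_dvd_mul_right hpos h2, ?_⟩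
  rw [← hk]
  obtain ⟨f, hf, hf0⟩ := hT.over hθ hΘ hε
  refine mem_quot_of_fixed hρ (v := f 1) ?_ ?_
  · intro h0
    apply hf0
    ext
    simpa using h0
  · intro n hn
    have := hf ⟨n, hn⟩ 1
    exact this.symm

end Stp

/-- numerical record of a degree in `B₁` (odd `q`) -/
def Rec (D0 : Set ℕ) (q I h n : ℕ) : Prop :=
  ∃ t d y a' : ℕ, 0 < t ∧ n ∈ D0 ∧ n = t * d * y ∧ y ∣ I ∧
    (d = 1 ∨ d = q ∨ d = q + 1 ∨ d + 1 = q ∨ 2 * d = q + 1 ∨ 2 * d + 1 = q) ∧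
    a' ∈ D0 ∧ t * h ∣ a' ∧
    (Even d ∨ ∃ x ∈ D0, q * x ∈ D0 ∧ t ∣ x ∧ x ∣ I * t ∧ x ≠ 1 ∧ (d = 1 → n = x) ∧ (d = q → n = q * x) ∧
      (I ∣ 2 → (a' = t * h ∨ n = t * d) → x = t))

namespace Stp
variable {G F : Type} [Group G] [Field F] {S : Stp G F}
variable {X : Type} [AddCommGroup X] [Module ℂ X] [FiniteDimensional ℂ X]
variable {V : Type} [AddCommGroup V] [Module ℂ V] [FiniteDimensional ℂ V]

theorem recd [Finite G] [Fintype F] (hodd : ringChar F ≠ 2) (h7 : 7 ≤ Fintype.card F) (h9 : Fintype.card F ≠ 9)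
    (hab : ∀ a b : G, a * b * a⁻¹ * b⁻¹ ∈ S.M) {h : ℕ} (hh : h = Fintype.card F + 1 ∨ h + 1 = Fintype.card F)
    {θ : Representation ℂ S.N X} (hθ : Irr θ) (hinv : S.InvRep θ) {ρ : Representation ℂ G V} (hρ : Irr ρ)
    (ho : Over S.N ρ θ) (hn : haveI := S.hN; finrank ℂ V ∉ charDegrees (G ⧸ S.N)) :
    Rec (charDegrees G) (Fintype.card F) S.M.index h (finrank ℂ V) := by
  haveI := S.hN
  haveI := S.hM
  obtain ⟨Θ, hΘ⟩ := S.extend h7 h9 hθ hinv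
  obtain ⟨c, hc, hcz⟩ := S.exists_sign hθ hΘ
  obtain ⟨E, _, _, _, ε, hε, hT⟩ := S.exists_ty hθ hΘ hρ ho
  haveI := hθ.1
  haveI := hε.1
  have hXp : 0 < finrank ℂ X := finrank_pos
  have hEp : 0 < finrank ℂ E := finrank_pos
  obtain ⟨y, hy⟩ := hT.dvd hθ hΘ hε hρ
  have hy2 := hT.dvd_index hab hθ hΘ hε hρ
  rw [hy, mul_comm _ y] at hy2
  have hyI : y ∣ S.M.index := Nat.dvd_of_mul_dvd_mul_right (Nat.mul_pos hXp hEp) hy2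
  obtain ⟨H, _, _, _, η, hη, hH, hηz⟩ : ∃ (H : Type) (_ : AddCommGroup H) (_ : Module ℂ H)
      (_ : FiniteDimensional ℂ H) (η : Representation ℂ (SL F) H), Irr η ∧ finrank ℂ H = h ∧
        η (sH (-1)) = c • LinearMap.id := by
    rcases hh with hh | hh
    · obtain ⟨H, i1, i2, i3, η, hη, hH, hz⟩ := exists_principal hodd h7 hc
      exact ⟨H, i1, i2, i3, η, hη, by rw [hH, hh], hz⟩
    · obtain ⟨H, i1, i2, i3, η, hη, hH, hz⟩ := exists_discrete hodd h7 hc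
      exact ⟨H, i1, i2, i3, η, hη, by omega, hz⟩
  obtain ⟨B, _, _, _, β, hβ, hTβ⟩ := S.exists_rho hθ hΘ hη (S.Tt_z0 hc hcz hηz)
  have hB := hTβ.dvd hθ hΘ hη hβ
  rw [hH] at hB
  refine ⟨finrank ℂ X, finrank ℂ E, y, finrank ℂ B, hXp, mem_charDegrees ρ hρ, hy, hyI, dims hodd hε,
    mem_charDegrees β hβ, hB, ?_⟩
  have hsε := hT.sign hc hcz
  rcases hc with rfl | rfl
  swap
  · left
    exact even_of_neg (by rw [Nat.card_eq_fintype_card]; omega) hsε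
  right
  have hz : Θ S.z0 = 1 := by rw [hcz, one_smul]; rfl
  obtain ⟨σ, Y, _, _, _, χ, A, _, _, _, α, hσ, hr, hχ, hoM, hoN, hA, hα, hαN, hi, hYD, hqYD⟩ :=
    plus_exists (by omega) hθ hΘ hz
  haveI := hα.1
  have hσi := irr_of_rn hθ hr
  refine ⟨finrank ℂ Y, hYD, hqYD, hoM.dvd hχ hσi, hoM.dvd_index hab hχ hσi, ?_, ?_, ?_, ?_⟩
  · intro h1
    exact hn (mem_quot_of_linear hρ h1 hθ ho hoN)
  · intro h1
    have h2 : ∀ s, ε s = 1 := trivial_of_one (by rw [Nat.card_eq_fintype_card]; omega) h1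
    exact hT.finrank_eq hab hθ hΘ hε hρ hχ (ty_one hσ hoM h2 h1)
  · intro h1
    obtain ⟨ε', hε', hεα⟩ := exists_eps hα hαN
    obtain ⟨f, hf, hf0⟩ := st_unique hodd (by omega) hε h1 hε' hA
    let e := LinearEquiv.ofBijective f (hε.map_bij hε' hf hf0)
    have hT2 : S.Ty Θ ε (χ.tprod α) := (ty_tprod hσ hoM hεα).congr hθ hΘ hε' e hf
    rw [hT.finrank_eq hab hθ hΘ hε hρ hi hT2, finrank_tensorProduct, hA, mul_comm]
  · intro hI hor
    have hinv : ∀ g : G, ∃ B : X →ₗ[ℂ] X, B ≠ 0 ∧ ∀ (n n' : S.N) (x : X), (n' : G) = g * n * g⁻¹ →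
        B (θ n x) = θ n' (B x) := by
      rcases hor with h1 | h1
      · exact inv_of_irr hθ hΘ hη hTβ (by rw [h1, hH])
      · exact inv_of_irr hθ hΘ hε hT h1
    rcases (Nat.dvd_prime Nat.prime_two).1 hI with h1 | h1
    · have h2 := hoM.dvd_index hab hχ hσi
      rw [h1, one_mul] at h2
      exact Nat.dvd_antisymm h2 (hoM.dvd hχ hσi)
    · refine (S.perf (by omega)).index_two hχ (by rw [hr]; exact hθ) hoM h1 ?_
      rw [hr]
      exact hinv

/-- even characteristic -/
theorem even_case [Finite G] [Fintype F] (h2 : ringChar F = 2) (h7 : 7 ≤ Fintype.card F) (hG : TwoPrimeHypothesis G)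
    {θ : Representation ℂ S.N X} (hθ : Irr θ) (hinv : S.InvRep θ) {ρ : Representation ℂ G V} (hρ : Irr ρ)
    (ho : Over S.N ρ θ) : haveI := S.hN; finrank ℂ V ∈ charDegrees (G ⧸ S.N) := by
  haveI := S.hN
  haveI : CharP F 2 := by rw [← h2]; exact ringChar.charP F
  obtain ⟨f, hf, hcard⟩ := FiniteField.card F 2
  have hf3 : 3 ≤ (f : ℕ) := by
    by_contra hc
    have : (f : ℕ) ≤ 2 := by omega
    have := Nat.pow_le_pow_right (n := 2) (by norm_num) this
    omega
  have h9 : Fintype.card F ≠ 9 := by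
    intro h9
    have : 2 ∣ 9 := by rw [← h9, hcard]; exact dvd_pow_self 2 (by omega)
    omega
  obtain ⟨Θ, hΘ⟩ := S.extend h7 h9 hθ hinv
  have hz0 : S.z0 = 1 := by
    rcases S.ker_pm S.pm_z0 with h | h
    · exact h
    · apply Subtype.ext
      refine Prod.ext rfl ?_
      change sH (-1 : Fˣ) = 1
      have : (-1 : Fˣ) = 1 := by
        ext
        simpa using CharTwo.neg_eq (1 : F)
      rw [this]
      ext i j
      fin_cases i <;> fin_cases j <;> simp [sH]
  obtain ⟨σ, Y, _, _, _, χ, A, _, _, _, α, hσ, hr, hχ, hoM, hoN, hA, hα, hαN, hi, hYD, hqYD⟩ :=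
    plus_exists (by omega) hθ hΘ (by rw [hz0, map_one])
  apply mem_quot_of_linear hρ _ hθ ho hoN
  by_contra hne
  haveI := hχ.1
  have hYp : 0 < finrank ℂ Y := finrank_pos
  have h3 := hG _ (quot_subset S.q_mem) _ hqYD (by
    intro h
    apply hne
    have : Fintype.card F * 1 = Fintype.card F * finrank ℂ Y := by rw [mul_one]; exact h
    exact (Nat.eq_of_mul_eq_mul_left (by omega) this).symm)
  rw [Nat.gcd_eq_left (Dvd.intro _ rfl), hcard, Nat.Prime.primeFactorsList_pow Nat.prime_two,
    List.length_replicate] at h3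
  omega

end Stp
end
end B1

namespace B1

/-- the two-prime hypothesis in multiplicative form -/
def KK (D0 : Set ℕ) : Prop := ∀ a ∈ D0, ∀ b ∈ D0, ∀ u v w : ℕ, 2 ≤ u → 2 ≤ v → 2 ≤ w →
  u * v * w ∣ a → u * v * w ∣ b → a = b

theorem one_le_len {n : ℕ} (h : 2 ≤ n) : 1 ≤ n.primeFactorsList.length := by
  by_contra hc
  have : n.primeFactorsList = [] := List.length_eq_zero_iff.1 (by omega)
  rw [Nat.primeFactorsList_eq_nil] at this
  omega

theorem kk_of {D0 : Set ℕ} (h : ∀ a ∈ D0, ∀ b ∈ D0, a ≠ b → (Nat.gcd a b).primeFactorsList.length ≤ 2) : KK D0 := by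
  intro a ha b hb u v w hu hv hw h1 h2
  by_contra hne
  have h3 := h a ha b hb hne
  have hg : Nat.gcd a b ≠ 0 := by
    intro h0
    rw [Nat.gcd_eq_zero_iff] at h0
    exact hne (by rw [h0.1, h0.2])
  have h4 := (Nat.primeFactorsList_sublist_of_dvd (Nat.dvd_gcd h1 h2) hg).length_le
  have h5 := (Nat.perm_primeFactorsList_mul (a := u * v) (b := w) (by positivity) (by positivity)).length_eq
  have h6 := (Nat.perm_primeFactorsList_mul (a := u) (b := v) (by positivity) (by positivity)).length_eq
  rw [List.length_append] at h5 h6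
  have := one_le_len hu
  have := one_le_len hv
  have := one_le_len hw
  omega

theorem ncard_sub {A : Set ℕ} (h : ∀ x ∈ A, ∀ y ∈ A, x = y) : A.ncard ≤ 1 := by
  have hs : A.Subsingleton := fun x hx y hy => h x hx y hy
  haveI : Finite A := hs.finite
  exact Set.ncard_le_one_iff_subsingleton.2 hs

theorem prime_of_no {m : ℕ} (hm : 2 ≤ m) (h : ∀ u v, 2 ≤ u → 2 ≤ v → u * v = m → False) : m.Prime := by
  by_contra hc
  obtain ⟨u, ⟨v, rfl⟩, h2, h3⟩ := Nat.exists_dvd_of_not_prime2 hm hc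
  refine h u v h2 ?_ rfl
  by_contra hv
  have : v ≤ 1 := by omega
  nlinarith

structure Cfg where
  D0 : Set ℕ
  D1 : Set ℕ
  B : Set ℕ
  p : ℕ
  f : ℕ
  q : ℕ
  I : ℕ
  h : ℕ
  l : ℕ
  e : ℕ
  m : ℕ
  k0 : ℕ
  z0 : ℕ
  hp : p.Prime
  hf : 0 < f
  hq : q = p ^ f
  hI : I ∣ 2 * f
  hK : KK D0
  hsub : D1 ⊆ D0
  hqD : q ∈ D1
  hhl : (h = q + 1 ∧ l + 1 = q) ∨ (h + 1 = q ∧ l = q + 1)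
  hhe : h = 4 * e
  hlm : l = 2 * m
  hm : m % 2 = 1
  he2 : 2 ≤ e
  hm3 : 3 ≤ m
  hk : k0 ∣ I
  hkD : h * k0 ∈ D1
  hz : z0 ∣ I
  hzD : l * z0 ∈ D1
  hB : ∀ n ∈ B, n ∉ D1
  hrec : ∀ n ∈ B, Rec D0 q I h n
  N1 : e.Prime → f = 1 ∨ (f.Prime ∧ f ≠ 2)
  N2 : m.Prime → ∃ r, r.Prime ∧ (∀ s, s.Prime → s ∣ 2 * f → s = 2 ∨ s = r) ∧ (f ≤ 2 → r = 2)

namespace Cfg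
variable (C : Cfg)

theorem a_eq {n : ℕ} (hn : n ∈ C.D0) (h : C.h ∣ n) : n = C.h * C.k0 := by
  refine C.hK n hn _ (C.hsub C.hkD) 2 2 C.e le_rfl le_rfl C.he2 ?_ ?_
  · have := C.hhe; rw [this] at h; exact h
  · rw [C.hhe]; exact Dvd.intro _ rfl

theorem not_h {n : ℕ} (hn : n ∈ C.B) (hD : n ∈ C.D0) : ¬ C.h ∣ n := by
  intro h
  apply C.hB n hn
  rw [C.a_eq hD h]
  exact C.hkD

def plusx (t d n : ℕ) : Prop := ∃ x ∈ C.D0, C.q * x ∈ C.D0 ∧ x ∣ C.I * t ∧ x ≠ 1 ∧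
  (d = 1 → n = x) ∧ (d = C.q → n = C.q * x) ∧ (C.I ∣ 2 → (C.k0 = t ∨ n = t * d) → x = t)

/-- hpart -/
def Hp : Set ℕ := {n ∈ C.B | n ∈ C.D0 ∧ ∃ y, y ∣ C.I ∧ y % 2 = 1 ∧ n = 2 * C.e * y ∧ C.e.Prime}
def Lp : Set ℕ := {n ∈ C.B | n ∈ C.D0 ∧ ∃ z t y, t ∣ C.I ∧ y ∣ C.I ∧ z ∣ t * y ∧ n = C.l * z}
def Mp : Set ℕ := {n ∈ C.B | n ∈ C.D0 ∧ ∃ t y, t ∣ C.I ∧ y ∣ C.I ∧ (t * y) % 2 = 1 ∧ n = t * C.m * y ∧ C.plusx t C.m n}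
def Op : Set ℕ := {n ∈ C.B | ∃ t, t ∣ C.k0 ∧ C.plusx t 1 n}
def Qp : Set ℕ := {n ∈ C.B | ∃ t, t ∣ C.k0 ∧ C.plusx t C.q n}

theorem qodd : C.q % 2 = 1 := by
  have := C.hhl; have := C.hhe; have := C.hlm; omega

theorem cover {n : ℕ} (hn : n ∈ C.B) : n ∈ C.Hp ∨ n ∈ C.Lp ∨ n ∈ C.Mp ∨ n ∈ C.Op ∨ n ∈ C.Qp := by
  obtain ⟨t, d, y, a', ht, hnD, hnt, hy, hd, ha', hta, hor⟩ := C.hrec n hn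
  have hnh := C.not_h hn hnD
  have ha := C.a_eq ha' ((Dvd.intro_left _ rfl).trans hta)
  have hh0 : 0 < C.h := by have := C.hhe; have := C.he2; omega
  have htk : t ∣ C.k0 := by
    rw [ha, mul_comm t] at hta
    exact Nat.dvd_of_mul_dvd_mul_left hh0 hta
  have htI := htk.trans C.hk
  have hplus : ¬ Even d → C.plusx t d n := by
    intro he
    rcases hor with h1 | ⟨x, hx, hqx, -, h2, h3, h4, h5, h6⟩
    · exact absurd h1 he
    · refine ⟨x, hx, hqx, h2, h3, h4, h5, fun h7 h8 => h6 h7 ?_⟩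
      rcases h8 with h8 | h8
      · left; rw [ha, h8, mul_comm]
      · right; exact h8
  have hqo := C.qodd
  have hhl := C.hhl
  have hhe := C.hhe
  have hlm := C.hlm
  have hdd : d = 1 ∨ d = C.q ∨ d = C.h ∨ d = C.l ∨ d = 2 * C.e ∨ d = C.m := by omega
  rcases hdd with rfl | rfl | rfl | rfl | rfl | rfl
  · right; right; right; left
    exact ⟨hn, t, htk, hplus (by decide)⟩
  · right; right; right; right
    exact ⟨hn, t, htk, hplus (by rw [Nat.even_iff]; omega)⟩
  · exact absurd (by rw [hnt]; exact ⟨t * y, by ring⟩) hnh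
  · right; left
    exact ⟨hn, hnD, t * y, t, y, htI, hy, dvd_rfl, by rw [hnt]; ring⟩
  · left
    have hne : n ≠ C.h * C.k0 := fun h => C.hB n hn (h ▸ C.hkD)
    obtain ⟨k, hk⟩ := htk
    have ht1 : t = 1 := by
      by_contra ht1
      apply hne
      refine C.hK n hnD _ (C.hsub C.hkD) 2 C.e t le_rfl C.he2 (by omega) ?_ ?_
      · rw [hnt]; exact ⟨y, by ring⟩
      · rw [hhe, hk]; exact ⟨2 * k, by ring⟩
    subst ht1
    refine ⟨hn, hnD, y, hy, ?_, by rw [hnt]; ring, ?_⟩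
    · by_contra hy2
      apply hnh
      have h2 : 2 ∣ y := by omega
      obtain ⟨w, rfl⟩ := h2
      rw [hnt, hhe]; exact ⟨w, by ring⟩
    · apply prime_of_no C.he2
      intro u v hu hv huv
      apply hne
      refine C.hK n hnD _ (C.hsub C.hkD) 2 u v le_rfl hu hv ?_ ?_
      · rw [hnt, ← huv]; exact ⟨y, by ring⟩
      · rw [hhe, ← huv]; exact ⟨2 * C.k0, by ring⟩
  · by_cases hty : (t * y) % 2 = 1
    · right; right; left
      exact ⟨hn, hnD, t, y, htI, hy, hty, hnt, hplus (by have := C.hm; rw [Nat.even_iff]; omega)⟩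
    · right; left
      obtain ⟨z, hz⟩ : 2 ∣ t * y := by omega
      refine ⟨hn, hnD, z, t, y, htI, hy, ⟨2, by rw [hz]; ring⟩, ?_⟩
      rw [hnt, hlm]
      calc t * C.m * y = t * y * C.m := by ring
        _ = _ := by rw [hz]; ring

theorem hp_sub {n : ℕ} (hn : n ∈ C.Hp) : (C.f = 1 ∨ (C.f.Prime ∧ C.f ≠ 2)) ∧ (n = 2 * C.e ∨ n = 2 * C.e * C.f) := by
  obtain ⟨hB, hD, y, hy, hy2, hny, he⟩ := hn
  have hf := C.N1 he
  refine ⟨hf, ?_⟩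
  have hyf : y ∣ C.f := by
    have : Nat.Coprime y 2 := by
      rw [Nat.coprime_comm, Nat.coprime_two_left, Nat.odd_iff]; exact hy2
    exact this.dvd_of_dvd_mul_left (hy.trans C.hI)
  rcases hf with hf | hf
  · left
    rw [hf, Nat.dvd_one] at hyf
    rw [hny, hyf, mul_one]
  · rcases (Nat.dvd_prime hf.1).1 hyf with h | h
    · left; rw [hny, h, mul_one]
    · right; rw [hny, h]

theorem hp_two : C.Hp.ncard ≤ 2 := by
  have : C.Hp ⊆ {2 * C.e, 2 * C.e * C.f} := fun n hn => (C.hp_sub hn).2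
  refine (Set.ncard_le_ncard this (by simp)).trans ((Set.ncard_insert_le _ _).trans (by simp))

theorem lp_prime {n : ℕ} (hn : n ∈ C.Lp) : C.m.Prime := by
  obtain ⟨hB, hD, z, t, y, ht, hy, hz, hnz⟩ := hn
  apply prime_of_no (by have := C.hm3; omega)
  intro u v hu hv huv
  apply C.hB n hB
  have : n = C.l * C.z0 := by
    refine C.hK n hD _ (C.hsub C.hzD) 2 u v le_rfl hu hv ?_ ?_
    · rw [hnz, C.hlm, ← huv]; exact ⟨z, by ring⟩
    · rw [C.hlm, ← huv]; exact ⟨C.z0, by ring⟩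
  rw [this]; exact C.hzD

/-- degrees of the form `l z` sharing a factor -/
theorem l_eq {n n' s : ℕ} (hn : n ∈ C.D0) (hn' : n' ∈ C.D0) (hs : 2 ≤ s) (h : C.l * s ∣ n) (h' : C.l * s ∣ n') :
    n = n' := by
  rw [C.hlm] at h h'
  exact C.hK n hn n' hn' 2 C.m s le_rfl (by have := C.hm3; omega) hs h h'

theorem lp_class {n : ℕ} {r : ℕ} (hr : ∀ s, s.Prime → s ∣ 2 * C.f → s = 2 ∨ s = r) (hn : n ∈ C.Lp) :
    n = C.l ∨ C.l * 2 ∣ n ∨ C.l * r ∣ n := by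
  obtain ⟨hB, hD, z, t, y, ht, hy, hz, rfl⟩ := hn
  by_cases h1 : z = 1
  · left; rw [h1, mul_one]
  · right
    obtain ⟨s, hs, hsz⟩ := Nat.exists_prime_and_dvd h1
    have hsf : s ∣ 2 * C.f := by
      rcases hs.dvd_mul.1 (hsz.trans hz) with h | h
      · exact h.trans (ht.trans C.hI)
      · exact h.trans (hy.trans C.hI)
    rcases hr s hs hsf with h | h
    · left; rw [← h]; exact Nat.mul_dvd_mul_left _ hsz
    · right; rw [← h]; exact Nat.mul_dvd_mul_left _ hsz

theorem z_class {r : ℕ} (hr : ∀ s, s.Prime → s ∣ 2 * C.f → s = 2 ∨ s = r) :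
    C.z0 = 1 ∨ C.l * 2 ∣ C.l * C.z0 ∨ C.l * r ∣ C.l * C.z0 := by
  by_cases h1 : C.z0 = 1
  · left; exact h1
  · right
    obtain ⟨s, hs, hsz⟩ := Nat.exists_prime_and_dvd h1
    rcases hr s hs (hsz.trans (C.hz.trans C.hI)) with h | h
    · left; rw [← h]; exact Nat.mul_dvd_mul_left _ hsz
    · right; rw [← h]; exact Nat.mul_dvd_mul_left _ hsz

theorem lp_ne {n : ℕ} (hn : n ∈ C.Lp) : n ≠ C.l * C.z0 := by
  intro h
  apply C.hB n hn.1
  rw [h]; exact C.hzD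

theorem lp_two : C.Lp.ncard ≤ 2 := by
  by_cases he : C.Lp = ∅
  · rw [he]; simp
  obtain ⟨n0, hn0⟩ := Set.nonempty_iff_ne_empty.2 he
  obtain ⟨r, hrp, hr, -⟩ := C.N2 (C.lp_prime hn0)
  have hr2 := hrp.two_le
  have hz0 := C.hsub C.hzD
  have key : ∀ s t : ℕ, 2 ≤ t → (∀ n ∈ C.Lp, n = C.l ∨ C.l * t ∣ n) → C.Lp.ncard ≤ 2 := by
    intro s t ht h
    have hs : C.Lp ⊆ {C.l} ∪ {n ∈ C.Lp | C.l * t ∣ n} := by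
      intro n hn
      rcases h n hn with h | h
      · left; exact h
      · right; exact ⟨hn, h⟩
    have h1 : ({n ∈ C.Lp | C.l * t ∣ n}).ncard ≤ 1 := ncard_sub
      fun x hx y hy => C.l_eq hx.1.2.1 hy.1.2.1 ht hx.2 hy.2
    have hfin : ({n ∈ C.Lp | C.l * t ∣ n}).Finite := Set.Subsingleton.finite
      fun x hx y hy => C.l_eq hx.1.2.1 hy.1.2.1 ht hx.2 hy.2
    refine (Set.ncard_le_ncard hs ((Set.finite_singleton _).union hfin)).trans ((Set.ncard_union_le _ _).trans ?_)
    rw [Set.ncard_singleton]; omega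
  rcases C.z_class hr with h | h | h
  · have hs : C.Lp ⊆ {n ∈ C.Lp | C.l * 2 ∣ n} ∪ {n ∈ C.Lp | C.l * r ∣ n} := by
      intro n hn
      rcases C.lp_class hr hn with h1 | h1 | h1
      · exact absurd (by rw [h1, h, mul_one]) (C.lp_ne hn)
      · left; exact ⟨hn, h1⟩
      · right; exact ⟨hn, h1⟩
    have a1 : ∀ t, 2 ≤ t → ({n ∈ C.Lp | C.l * t ∣ n}).Subsingleton := fun t ht =>
      fun x hx y hy => C.l_eq hx.1.2.1 hy.1.2.1 ht hx.2 hy.2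
    refine (Set.ncard_le_ncard hs ((a1 2 le_rfl).finite.union (a1 r hr2).finite)).trans ((Set.ncard_union_le _ _).trans ?_)
    have := ncard_sub (a1 2 le_rfl)
    have := ncard_sub (a1 r hr2)
    omega
  · refine key 0 r hr2 fun n hn => ?_
    rcases C.lp_class hr hn with h1 | h1 | h1
    · exact Or.inl h1
    · exact absurd (C.l_eq hn.2.1 hz0 le_rfl h1 h) (C.lp_ne hn)
    · exact Or.inr h1
  · refine key 0 2 le_rfl fun n hn => ?_
    rcases C.lp_class hr hn with h1 | h1 | h1
    · exact Or.inl h1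
    · exact Or.inr h1
    · exact absurd (C.l_eq hn.2.1 hz0 hr2 h1 h) (C.lp_ne hn)

theorem lp_one (hf : C.f ≤ 2) : C.Lp.ncard ≤ 1 := by
  apply ncard_sub
  intro x hx y hy
  obtain ⟨r, hrp, hr, h2⟩ := C.N2 (C.lp_prime hx)
  have hr2 := h2 hf
  subst hr2
  have hz0 := C.hsub C.hzD
  have h3 : C.z0 = 1 ∨ C.l * 2 ∣ C.l * C.z0 := by have := C.z_class hr; tauto
  have h4 : x = C.l ∨ C.l * 2 ∣ x := by have := C.lp_class hr hx; tauto
  have h5 : y = C.l ∨ C.l * 2 ∣ y := by have := C.lp_class hr hy; tauto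
  rcases h4 with h4 | h4 <;> rcases h5 with h5 | h5
  · rw [h4, h5]
  · rcases h3 with h3 | h3
    · exact absurd (by rw [h4, h3, mul_one]) (C.lp_ne hx)
    · exact absurd (C.l_eq hy.2.1 hz0 le_rfl h5 h3) (C.lp_ne hy)
  · rcases h3 with h3 | h3
    · exact absurd (by rw [h5, h3, mul_one]) (C.lp_ne hy)
    · exact absurd (C.l_eq hx.2.1 hz0 le_rfl h4 h3) (C.lp_ne hx)
  · exact C.l_eq hx.2.1 hy.2.1 le_rfl h4 h5

theorem qpos : 0 < C.q := by have := C.qodd; omega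

theorem no_plus (hf : 3 ≤ C.f) {t d n : ℕ} (h : C.plusx t d n) : False := by
  obtain ⟨x, hx, hqx, h2, h3, -⟩ := h
  have hp2 := C.hp.two_le
  have hw : 2 ≤ C.p ^ (C.f - 2) := by
    calc 2 ≤ C.p := hp2
      _ = C.p ^ 1 := (pow_one _).symm
      _ ≤ _ := Nat.pow_le_pow_right (by omega) (by omega)
  have hqq : C.q = C.p * C.p * C.p ^ (C.f - 2) := by
    rw [C.hq, ← sq, ← pow_add]; congr 1; omega
  have := C.hK _ (C.hsub C.hqD) _ hqx _ _ _ hp2 hp2 hw (dvd_of_eq hqq.symm) (by rw [← hqq]; exact Dvd.intro _ rfl)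
  have h5 : C.q * x = C.q * 1 := by rw [mul_one]; exact this.symm
  exact h3 (Nat.eq_of_mul_eq_mul_left C.qpos h5)

theorem bound5 {a b c d e : ℕ} (h1 : C.Hp.ncard ≤ a) (h2 : C.Lp.ncard ≤ b) (h3 : C.Mp.ncard ≤ c)
    (h4 : C.Op.ncard ≤ d) (h5 : C.Qp.ncard ≤ e) : C.B.ncard ≤ a + b + c + d + e := by
  by_cases hfin : C.B.Finite
  · have hs : C.B ⊆ C.Hp ∪ (C.Lp ∪ (C.Mp ∪ (C.Op ∪ C.Qp))) := fun n hn => C.cover hn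
    have f1 : C.Hp.Finite := hfin.subset fun x hx => hx.1
    have f2 : C.Lp.Finite := hfin.subset fun x hx => hx.1
    have f3 : C.Mp.Finite := hfin.subset fun x hx => hx.1
    have f4 : C.Op.Finite := hfin.subset fun x hx => hx.1
    have f5 : C.Qp.Finite := hfin.subset fun x hx => hx.1
    have := Set.ncard_le_ncard hs (f1.union (f2.union (f3.union (f4.union f5))))
    have := Set.ncard_union_le C.Hp (C.Lp ∪ (C.Mp ∪ (C.Op ∪ C.Qp)))
    have := Set.ncard_union_le C.Lp (C.Mp ∪ (C.Op ∪ C.Qp))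
    have := Set.ncard_union_le C.Mp (C.Op ∪ C.Qp)
    have := Set.ncard_union_le C.Op C.Qp
    omega
  · rw [Set.Infinite.ncard hfin]; omega

theorem empty_of {A : Set ℕ} (h : ∀ x ∈ A, False) : A.ncard ≤ 0 := by
  have : A = ∅ := Set.eq_empty_iff_forall_notMem.2 h
  rw [this]; simp

theorem case3 (hf : 3 ≤ C.f) : C.B.ncard ≤ 4 := by
  refine C.bound5 (a := 2) (b := 2) (c := 0) (d := 0) (e := 0) C.hp_two C.lp_two (empty_of ?_) (empty_of ?_) (empty_of ?_)
  · rintro n ⟨-, -, t, y, -, -, -, -, h⟩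
    exact C.no_plus hf h
  · rintro n ⟨-, t, -, h⟩
    exact C.no_plus hf h
  · rintro n ⟨-, t, -, h⟩
    exact C.no_plus hf h

theorem odd_one {t : ℕ} (h : t ∣ 4) (h2 : t % 2 = 1) : t = 1 := by
  have := Nat.le_of_dvd (by norm_num) h
  interval_cases t <;> omega

theorem case2 (hf : C.f = 2) : C.B.ncard ≤ 4 := by
  have hI4 : C.I ∣ 4 := by have := C.hI; rwa [hf] at this
  have hx2 : ∀ {t x : ℕ}, t ∣ C.k0 → x ∣ C.I * t → x ≠ 1 → 2 ∣ x := by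
    intro t x ht hx h1
    obtain ⟨s, hs, hsx⟩ := Nat.exists_prime_and_dvd h1
    have h2 : s ∣ 4 := by
      rcases hs.dvd_mul.1 (hsx.trans hx) with h | h
      · exact h.trans hI4
      · exact h.trans (ht.trans (C.hk.trans hI4))
    have : s = 2 := by
      have h3 : s ∣ 2 ^ 2 := h2
      exact (Nat.prime_dvd_prime_iff_eq hs Nat.prime_two).1 (hs.dvd_of_dvd_pow h3)
    rw [← this]; exact hsx
  have hqq : C.q = C.p * C.p := by rw [C.hq, hf, sq]
  have huniq : ∀ {x x' : ℕ}, C.q * x ∈ C.D0 → C.q * x' ∈ C.D0 → 2 ∣ x → 2 ∣ x' → x = x' := by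
    intro x x' h h' h2 h2'
    have := C.hK _ h _ h' C.p C.p 2 C.hp.two_le C.hp.two_le le_rfl (by rw [← hqq]; exact Nat.mul_dvd_mul_left _ h2)
      (by rw [← hqq]; exact Nat.mul_dvd_mul_left _ h2')
    exact Nat.eq_of_mul_eq_mul_left C.qpos this
  refine C.bound5 (a := 0) (b := 1) (c := 1) (d := 1) (e := 1) (empty_of ?_) (C.lp_one hf.le) (ncard_sub ?_) (ncard_sub ?_)
    (ncard_sub ?_)
  · intro n hn
    have := (C.hp_sub hn).1
    omega
  · have : ∀ n ∈ C.Mp, n = C.m := by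
      rintro n ⟨-, -, t, y, ht, hy, hty, hn, -⟩
      have h1 : t % 2 = 1 := Nat.odd_iff.1 (Nat.odd_mul.1 (Nat.odd_iff.2 hty)).1
      have h2 : y % 2 = 1 := Nat.odd_iff.1 (Nat.odd_mul.1 (Nat.odd_iff.2 hty)).2
      rw [hn, odd_one (ht.trans hI4) h1, odd_one (hy.trans hI4) h2]; ring
    intro x hx y hy
    rw [this x hx, this y hy]
  · rintro n ⟨-, t, ht, x, hx, hqx, h1, h2, h3, -⟩ n' ⟨-, t', ht', x', hx', hqx', h1', h2', h3', -⟩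
    rw [h3 rfl, h3' rfl]
    exact huniq hqx hqx' (hx2 ht h1 h2) (hx2 ht' h1' h2')
  · rintro n ⟨-, t, ht, x, hx, hqx, h1, h2, -, h3, -⟩ n' ⟨-, t', ht', x', hx', hqx', h1', h2', -, h3', -⟩
    rw [h3 rfl, h3' rfl]
    rw [huniq hqx hqx' (hx2 ht h1 h2) (hx2 ht' h1' h2')]

theorem case1 (hf : C.f = 1) : C.B.ncard ≤ 4 := by
  have hI2 : C.I ∣ 2 := by have := C.hI; rwa [hf] at this
  have hx2 : ∀ {t d n x : ℕ}, t ∣ C.k0 → x ∣ C.I * t → x ≠ 1 → (C.I ∣ 2 → (C.k0 = t ∨ n = t * d) → x = t) → x = 2 := by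
    intro t d n x ht hx h1 h
    have ht2 := ht.trans (C.hk.trans hI2)
    rcases (Nat.dvd_prime Nat.prime_two).1 ht2 with h3 | h3
    · rw [h3, mul_one] at hx
      rcases (Nat.dvd_prime Nat.prime_two).1 (hx.trans hI2) with h4 | h4
      · exact absurd h4 h1
      · exact h4
    · rw [h hI2 (Or.inl ?_), h3]
      exact Nat.dvd_antisymm (by rw [h3]; exact C.hk.trans hI2) ht
  refine C.bound5 (a := 1) (b := 1) (c := 0) (d := 1) (e := 1) (ncard_sub ?_) (C.lp_one (by omega)) (empty_of ?_) (ncard_sub ?_)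
    (ncard_sub ?_)
  · have : ∀ n ∈ C.Hp, n = 2 * C.e := by
      intro n hn
      rcases (C.hp_sub hn).2 with h | h
      · exact h
      · rw [h, hf, mul_one]
    intro x hx y hy
    rw [this x hx, this y hy]
  · rintro n ⟨-, -, t, y, ht, hy, hty, hn, x, hx, hqx, h1, h2, -, -, h3⟩
    have h4 : t % 2 = 1 := Nat.odd_iff.1 (Nat.odd_mul.1 (Nat.odd_iff.2 hty)).1
    have h5 : y % 2 = 1 := Nat.odd_iff.1 (Nat.odd_mul.1 (Nat.odd_iff.2 hty)).2
    have h6 := odd_one (ht.trans (hI2.trans (by norm_num))) h4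
    have h7 := odd_one (hy.trans (hI2.trans (by norm_num))) h5
    apply h2
    rw [h3 hI2 (Or.inr (by rw [hn, h7, mul_one])), h6]
  · rintro n ⟨-, t, ht, x, hx, hqx, h1, h2, h3, -, h4⟩ n' ⟨-, t', ht', x', hx', hqx', h1', h2', h3', -, h4'⟩
    rw [h3 rfl, h3' rfl, hx2 ht h1 h2 h4, hx2 ht' h1' h2' h4']
  · rintro n ⟨-, t, ht, x, hx, hqx, h1, h2, -, h3, h4⟩ n' ⟨-, t', ht', x', hx', hqx', h1', h2', -, h3', h4'⟩
    rw [h3 rfl, h3' rfl, hx2 ht h1 h2 h4, hx2 ht' h1' h2' h4']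

theorem bound : C.B.ncard ≤ 4 := by
  have := C.hf
  have h : C.f = 1 ∨ C.f = 2 ∨ 3 ≤ C.f := by omega
  rcases h with h | h | h
  · exact C.case1 h
  · exact C.case2 h
  · exact C.case3 h

end Cfg
end B1

namespace B1

theorem pow_pred_dvd {p f s : ℕ} (h : s ∣ f) : p ^ s - 1 ∣ p ^ f - 1 := by
  obtain ⟨k, rfl⟩ := h
  have := Nat.sub_dvd_pow_sub_pow (p ^ s) 1 k
  rwa [one_pow, ← pow_mul] at this

theorem pow_succ_dvd {p f s : ℕ} (h : s ∣ f) (hf : f % 2 = 1) (hs : 0 < s) : p ^ s + 1 ∣ p ^ f + 1 := by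
  obtain ⟨k, rfl⟩ := h
  have hk : Odd k := (Nat.odd_mul.1 (Nat.odd_iff.2 hf)).2
  have := hk.nat_add_dvd_pow_add_pow (p ^ s) 1
  rwa [one_pow, ← pow_mul] at this

theorem pow_ge {p s : ℕ} (hp : 3 ≤ p) (hs : 3 ≤ s) : 27 ≤ p ^ s :=
  calc 27 = 3 ^ 3 := by norm_num
    _ ≤ p ^ 3 := Nat.pow_le_pow_left hp 3
    _ ≤ p ^ s := Nat.pow_le_pow_right (by omega) hs

theorem odd_div {p f s : ℕ} (h : s ∣ f) (hf : f % 2 = 1) : s % 2 = 1 := by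
  obtain ⟨k, rfl⟩ := h
  exact Nat.odd_iff.1 (Nat.odd_mul.1 (Nat.odd_iff.2 hf)).1

theorem pow_mod4 {p f : ℕ} (hf : f % 2 = 1) : p ^ f % 4 = if p % 2 = 1 then p % 4 else p ^ f % 4 := by
  split_ifs with h
  · obtain ⟨k, rfl⟩ : ∃ k, f = 2 * k + 1 := ⟨f / 2, by omega⟩
    have h1 : p ^ 2 % 4 = 1 := by
      have : p % 4 = 1 ∨ p % 4 = 3 := by omega
      rcases this with h | h <;> simp [Nat.pow_mod, h]
    rw [pow_succ, pow_mul, Nat.mul_mod, Nat.pow_mod, h1, one_pow]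
    simp
  · rfl

theorem pow_mod4' {p f : ℕ} (hp : p % 2 = 1) (hf : f % 2 = 1) : p ^ f % 4 = p % 4 := by
  rw [pow_mod4 hf, if_pos hp]

theorem pow_even_mod {p f : ℕ} (hp : p % 2 = 1) (hf : f % 2 = 0) : p ^ f % 8 = 1 := by
  obtain ⟨k, rfl⟩ : ∃ k, f = 2 * k := ⟨f / 2, by omega⟩
  have h1 : p ^ 2 % 8 = 1 := by
    have : p % 8 = 1 ∨ p % 8 = 3 ∨ p % 8 = 5 ∨ p % 8 = 7 := by omega
    rcases this with h | h | h | h <;> simp [Nat.pow_mod, h]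
  rw [pow_mul, Nat.pow_mod, h1, one_pow]
  norm_num


theorem n1a {p f e : ℕ} (hp : p.Prime) (hp2 : p % 2 = 1) (hf : 0 < f) (h : p ^ f = 4 * e + 1) (h9 : p ^ f ≠ 9)
    (he : e.Prime) : f = 1 ∨ (f.Prime ∧ f ≠ 2) := by
  by_cases hf2 : f % 2 = 0
  · have h8 := pow_even_mod hp2 hf2
    have : 2 ∣ e := by omega
    have := (Nat.prime_dvd_prime_iff_eq Nat.prime_two he).1 this
    omega
  have hf1 : f % 2 = 1 := by omega
  by_cases h1 : f = 1
  · exact Or.inl h1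
  right
  have hp3 : 3 ≤ p := by have := hp.two_le; omega
  have hr := Nat.minFac_prime h1
  have hrf := Nat.minFac_dvd f
  have hro := odd_div (p := p) hrf hf1
  have hr3 : 3 ≤ f.minFac := by have := hr.two_le; omega
  have hpr := pow_ge hp3 hr3
  have hm1 := pow_mod4' hp2 hro
  have hm2 := pow_mod4' hp2 hf1
  have hd : p ^ f.minFac - 1 ∣ p ^ f - 1 := pow_pred_dvd hrf
  obtain ⟨u, hu⟩ : ∃ u, p ^ f.minFac = 4 * u + 1 := ⟨p ^ f.minFac / 4, by omega⟩
  rw [hu, h, Nat.add_sub_cancel, Nat.add_sub_cancel] at hd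
  have hd2 := Nat.dvd_of_mul_dvd_mul_left (by norm_num) hd
  rcases (Nat.dvd_prime he).1 hd2 with h2 | h2
  · omega
  · have h3 : p ^ f.minFac = p ^ f := by omega
    have h4 := Nat.pow_right_injective hp.two_le h3
    rw [h4] at hr
    exact ⟨hr, by omega⟩

theorem n1b {p f e : ℕ} (hp : p.Prime) (hp2 : p % 2 = 1) (h : p ^ f + 1 = 4 * e)
    (he : e.Prime) : f = 1 ∨ (f.Prime ∧ f ≠ 2) := by
  by_cases hf2 : f % 2 = 0
  · have h8 := pow_even_mod hp2 hf2
    omega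
  have hf1 : f % 2 = 1 := by omega
  by_cases h1 : f = 1
  · exact Or.inl h1
  right
  have hp3 : 3 ≤ p := by have := hp.two_le; omega
  have hr := Nat.minFac_prime h1
  have hrf := Nat.minFac_dvd f
  have hro := odd_div (p := p) hrf hf1
  have hr3 : 3 ≤ f.minFac := by have := hr.two_le; omega
  have hpr := pow_ge hp3 hr3
  have hm1 := pow_mod4' hp2 hro
  have hm2 := pow_mod4' hp2 hf1
  have hd : p ^ f.minFac + 1 ∣ p ^ f + 1 := pow_succ_dvd hrf hf1 hr.pos
  obtain ⟨u, hu⟩ : ∃ u, p ^ f.minFac + 1 = 4 * u := ⟨(p ^ f.minFac + 1) / 4, by omega⟩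
  rw [hu, h] at hd
  have hd2 := Nat.dvd_of_mul_dvd_mul_left (by norm_num) hd
  rcases (Nat.dvd_prime he).1 hd2 with h2 | h2
  · omega
  · have h3 : p ^ f.minFac = p ^ f := by omega
    have h4 := Nat.pow_right_injective hp.two_le h3
    rw [h4] at hr
    exact ⟨hr, by omega⟩

theorem n2a {p f m : ℕ} (hp : p.Prime) (hp2 : p % 2 = 1) (hf : 0 < f) (h : p ^ f + 1 = 2 * m) (hm : m.Prime) :
    ∃ r, r.Prime ∧ (∀ s, s.Prime → s ∣ 2 * f → s = 2 ∨ s = r) ∧ (f ≤ 2 → r = 2) := by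
  refine ⟨2, Nat.prime_two, fun s hs hsf => ?_, fun _ => rfl⟩
  by_contra hc
  have hs2 : s ≠ 2 := by tauto
  have hso : Odd s := hs.odd_of_ne_two hs2
  have hsf' : s ∣ f := by
    rcases hs.dvd_mul.1 hsf with h1 | h1
    · exact absurd ((Nat.prime_dvd_prime_iff_eq hs Nat.prime_two).1 h1) hs2
    · exact h1
  obtain ⟨k, rfl⟩ := hsf'
  have hk : 0 < k := Nat.pos_of_mul_pos_left hf
  have hd := hso.nat_add_dvd_pow_add_pow (p ^ k) 1
  rw [one_pow, ← pow_mul, mul_comm k s, h] at hd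
  have hpo : p ^ k % 2 = 1 := by simp [Nat.pow_mod, hp2]
  have hp3 : 3 ≤ p := by have := hp.two_le; omega
  have hpk : 3 ≤ p ^ k := hp3.trans (Nat.le_self_pow (by omega) p)
  obtain ⟨u, hu⟩ : ∃ u, p ^ k + 1 = 2 * u := ⟨(p ^ k + 1) / 2, by omega⟩
  rw [hu] at hd
  have hd2 := Nat.dvd_of_mul_dvd_mul_left (by norm_num) hd
  rcases (Nat.dvd_prime hm).1 hd2 with h2 | h2
  · omega
  · have h3 : p ^ k = p ^ (s * k) := by omega
    have h4 := Nat.pow_right_injective hp.two_le h3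
    have := hs.two_le
    nlinarith

theorem n2b {p f m : ℕ} (hp : p.Prime) (hp2 : p % 2 = 1) (h : p ^ f = 2 * m + 1) (h4 : p ^ f % 4 = 3)
    (hm : m.Prime) :
    ∃ r, r.Prime ∧ (∀ s, s.Prime → s ∣ 2 * f → s = 2 ∨ s = r) ∧ (f ≤ 2 → r = 2) := by
  have hf1 : f % 2 = 1 := by
    by_contra hc
    have := pow_even_mod hp2 (f := f) (by omega)
    omega
  have hp3 : 3 ≤ p := by have := hp.two_le; omega
  have key : ∀ s, s.Prime → s ∣ f → s = f := by
    intro s hs hsf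
    have hso := odd_div (p := p) hsf hf1
    have hs3 : 3 ≤ s := by have := hs.two_le; omega
    have hps := pow_ge hp3 hs3
    have hd : p ^ s - 1 ∣ p ^ f - 1 := pow_pred_dvd hsf
    have hpo : p ^ s % 2 = 1 := by simp [Nat.pow_mod, hp2]
    obtain ⟨u, hu⟩ : ∃ u, p ^ s = 2 * u + 1 := ⟨p ^ s / 2, by omega⟩
    rw [hu, h, Nat.add_sub_cancel, Nat.add_sub_cancel] at hd
    have hd2 := Nat.dvd_of_mul_dvd_mul_left (by norm_num) hd
    rcases (Nat.dvd_prime hm).1 hd2 with h2 | h2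
    · omega
    · have h3 : p ^ s = p ^ f := by omega
      exact Nat.pow_right_injective hp.two_le h3
  have key2 : ∀ s, s.Prime → s ∣ 2 * f → s = 2 ∨ s ∣ f := by
    intro s hs h1
    rcases hs.dvd_mul.1 h1 with h1 | h1
    · exact Or.inl ((Nat.prime_dvd_prime_iff_eq hs Nat.prime_two).1 h1)
    · exact Or.inr h1
  by_cases h1 : f = 1
  · refine ⟨2, Nat.prime_two, fun s hs hsf => ?_, fun _ => rfl⟩
    rcases key2 s hs hsf with h2 | h2
    · exact Or.inl h2
    · rw [h1, Nat.dvd_one] at h2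
      exact absurd h2 hs.one_lt.ne'
  · have hr := Nat.minFac_prime h1
    rw [key _ hr (Nat.minFac_dvd f)] at hr
    refine ⟨f, hr, fun s hs hsf => ?_, fun h => by have := hr.two_le; omega⟩
    rcases key2 s hs hsf with h2 | h2
    · exact Or.inl h2
    · exact Or.inr (key s hs h2)

theorem combi {D0 D1 B : Set ℕ} {p f q I : ℕ} (hp : p.Prime) (hp2 : p ≠ 2) (hf : 0 < f) (hq : q = p ^ f)
    (h7 : 7 ≤ q) (h9 : q ≠ 9) (hI : I ∣ 2 * f) (hK : KK D0) (hsub : D1 ⊆ D0) (hqD : q ∈ D1)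
    (hb : ∀ h, (h = q + 1 ∨ h + 1 = q) → ∃ k, k ∣ I ∧ h * k ∈ D1) (hB : ∀ n ∈ B, n ∉ D1)
    (hrec : ∀ n ∈ B, ∀ h, (h = q + 1 ∨ h + 1 = q) → Rec D0 q I h n) : B.ncard ≤ 4 := by
  have hpo : p % 2 = 1 := Nat.odd_iff.1 (hp.odd_of_ne_two hp2)
  have hqo : q % 2 = 1 := by simp [hq, Nat.pow_mod, hpo]
  have hor : q % 4 = 1 ∨ q % 4 = 3 := by omega
  rcases hor with h4 | h4
  · obtain ⟨e, he⟩ : ∃ e, q = 4 * e + 1 := ⟨q / 4, by omega⟩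
    obtain ⟨k0, hk, hkD⟩ := hb (4 * e) (Or.inr he.symm)
    obtain ⟨z0, hz, hzD⟩ := hb (2 * (2 * e + 1)) (Or.inl (by omega))
    let C : Cfg := 
      { D0 := D0, D1 := D1, B := B, p := p, f := f, q := q, I := I, h := 4 * e, l := 2 * (2 * e + 1), e := e
        m := 2 * e + 1, k0 := k0, z0 := z0, hp := hp, hf := hf, hq := hq, hI := hI, hK := hK, hsub := hsub
        hqD := hqD, hhl := by omega, hhe := rfl, hlm := rfl, hm := by omega, he2 := by omega, hm3 := by omega
        hk := hk, hkD := hkD, hz := hz, hzD := hzD, hB := hB, hrec := fun n hn => hrec n hn _ (Or.inr he.symm)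
        N1 := n1a hp hpo hf (by rw [← hq, he]) (by rw [← hq]; exact h9)
        N2 := n2a hp hpo hf (by rw [← hq, he]; ring) }
    exact C.bound
  · obtain ⟨e, he⟩ : ∃ e, q + 1 = 4 * e := ⟨(q + 1) / 4, by omega⟩
    obtain ⟨m, hm⟩ : ∃ m, q = 2 * m + 1 := ⟨q / 2, by omega⟩
    obtain ⟨k0, hk, hkD⟩ := hb (4 * e) (Or.inl he.symm)
    obtain ⟨z0, hz, hzD⟩ := hb (2 * m) (Or.inr hm.symm)
    let C : Cfg := 
      { D0 := D0, D1 := D1, B := B, p := p, f := f, q := q, I := I, h := 4 * e, l := 2 * m, e := e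
        m := m, k0 := k0, z0 := z0, hp := hp, hf := hf, hq := hq, hI := hI, hK := hK, hsub := hsub
        hqD := hqD, hhl := by omega, hhe := rfl, hlm := rfl, hm := by omega, he2 := by omega, hm3 := by omega
        hk := hk, hkD := hkD, hz := hz, hzD := hzD, hB := hB, hrec := fun n hn => hrec n hn _ (Or.inl he.symm)
        N1 := n1b hp hpo (by rw [← hq, he])
        N2 := n2b hp hpo (by rw [← hq, hm]) (by rw [← hq, h4]) }
    exact C.bound

end B1

namespace B1
open Module

def mkStp {G F : Type} [Group G] [Field F] (N M : Subgroup G) [N.Normal] [M.Normal] (hNM : N ≤ M)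
    (i : (M.map (QuotientGroup.mk' N)) ≃* PSL2 F) : Stp G F where
  N := N
  M := M
  hN := inferInstance
  hM := inferInstance
  hNM := hNM
  φ := i.toMonoidHom.comp ((QuotientGroup.mk' N).subgroupMap M)
  hφ := i.surjective.comp ((QuotientGroup.mk' N).subgroupMap_surjective M)
  hk := by
    intro m
    change i ((QuotientGroup.mk' N).subgroupMap M m) = 1 ↔ _
    rw [map_eq_one_iff i i.injective, ← Subtype.val_inj]
    exact QuotientGroup.eq_one_iff _

theorem mkStp_CT {G F : Type} [Group G] [Field F] (N M : Subgroup G) [N.Normal] [M.Normal] (hNM : N ≤ M)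
    (i : (M.map (QuotientGroup.mk' N)) ≃* PSL2 F)
    (hcent : Subgroup.centralizer ((M.map (QuotientGroup.mk' N)) : Set (G ⧸ N)) = ⊥) :
    (mkStp N M hNM i).CT := by
  intro g hg
  change g ∈ N
  rw [← QuotientGroup.eq_one_iff, ← Subgroup.mem_bot, ← hcent, Subgroup.mem_centralizer_iff]
  rintro _ ⟨m, hm, rfl⟩
  have h1 := (mkStp N M hNM i).cj_phi g ⟨m, hm⟩
  rw [hg] at h1
  have h2 : (mkStp N M hNM i).φ ((mkStp N M hNM i).cm g ⟨m, hm⟩ * (⟨m, hm⟩ : (mkStp N M hNM i).M)⁻¹) = 1 := by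
    rw [map_mul, ← h1, map_inv]; simp
  rw [(mkStp N M hNM i).hk] at h2
  have h3 : g * m * g⁻¹ * m⁻¹ ∈ N := h2
  rw [← QuotientGroup.eq_one_iff] at h3
  have h4 : (g : G ⧸ N) * m * (g : G ⧸ N)⁻¹ * (m : G ⧸ N)⁻¹ = 1 := h3
  change (m : G ⧸ N) * g = g * m
  rw [mul_inv_eq_one, mul_inv_eq_iff_eq_mul] at h4
  exact h4.symm

theorem mkStp_inv {G F : Type} [Group G] [Finite G] [Field F] (S : Stp G F) (θ : FDRep ℂ S.N)
    (hθ : Irr θ.ρ) (hi : IsMInvariant S.M θ) : S.InvRep θ.ρ := by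
  intro m
  haveI := hθ.1
  let σ : Representation ℂ S.N θ := θ.ρ.comp (S.cn m : S.N →* S.N)
  have h0 := sum_ne_of_exists_map θ.ρ θ.ρ LinearMap.id (fun g v => rfl) (by
    intro h
    obtain ⟨v, hv⟩ := exists_ne (0 : θ)
    exact hv (LinearMap.congr_fun h v))
  have h1 : Representation.character σ = Representation.character θ.ρ := by
    funext n
    have := hi m m.2 n (by rw [← S.cn_coe]; exact (S.cn m n).2)
    exact this
  obtain ⟨A, hA, hA0⟩ := exists_map_of_sum_ne θ.ρ σ (by rw [h1]; exact h0)
  exact ⟨A, hA0, hA⟩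

theorem over_of_sum {G : Type} [Group G] [Finite G] {N : Subgroup G} (θ : FDRep ℂ N) (V : FDRep ℂ G)
    (h : (∑ᶠ x : N, V.character (x : G) * θ.character x⁻¹) ≠ 0) : Over N V.ρ θ.ρ :=
  exists_map_of_sum_ne θ.ρ (rs N V.ρ) h

theorem main {q : ℕ} (hq : 7 ≤ q) (hq9 : q ≠ 9) 
    {F : Type} [Field F] [Fintype F] (hF : Fintype.card F = q)
    {G : Type} [Group G] [Finite G] (hG : TwoPrimeHypothesis G)
    (N M : Subgroup G) [N.Normal] [M.Normal] (hNM : N ≤ M)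
    (hiso : Nonempty ((M.map (QuotientGroup.mk' N)) ≃* PSL2 F))
    (hcent : Subgroup.centralizer ((M.map (QuotientGroup.mk' N)) : Set (G ⧸ N)) = ⊥) :
    {n | ∃ θ : FDRep ℂ N, Simple θ ∧ IsMInvariant M θ ∧
      n ∈ charDegreesOver G N θ ∧ n ∉ charDegrees (G ⧸ N)}.ncard ≤ 4 := by
  obtain ⟨i⟩ := hiso
  have hCT := mkStp_CT N M hNM i hcent
  let S := mkStp N M hNM i
  by_cases h2 : ringChar F = 2
  · refine (Cfg.empty_of ?_).trans (by norm_num)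
    rintro n ⟨θ, hθ, hinv, ⟨V, hV, rfl, hs⟩, hn⟩
    rw [simple_iff_irr] at hθ hV
    exact hn (Stp.even_case (S := S) h2 (by omega) hG hθ (mkStp_inv S θ hθ hinv) hV (over_of_sum θ V hs))
  · haveI := ringChar.charP F
    obtain ⟨f, hp, hf⟩ := FiniteField.card F (ringChar F)
    have h20 : (2 : F) ≠ 0 := Ring.two_ne_zero h2
    obtain ⟨hab, hI⟩ := S.hab_index hCT h20 hf
    refine combi (D0 := charDegrees G) (D1 := charDegrees (G ⧸ N)) (I := M.index) hp h2 f.pos (hF.symm.trans hf)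
      hq hq9 hI (kk_of hG) quot_subset (hF ▸ S.q_mem) ?_ ?_ ?_
    · intro h hh
      rcases hh with hh | hh
      · obtain ⟨H, _, _, _, η, hη, hH, hz⟩ := exists_principal h2 (by omega : 7 ≤ Fintype.card F) (Or.inl rfl)
        have := S.base_mem hab hη hz
        rwa [hH, hF, ← hh] at this
      · obtain ⟨H, _, _, _, η, hη, hH, hz⟩ := exists_discrete h2 (by omega : 7 ≤ Fintype.card F) (Or.inl rfl)
        have := S.base_mem hab hη hz
        have hHh : finrank ℂ H = h := by omega
        rwa [hHh] at this
    · rintro n ⟨θ, hθ, hinv, -, hn⟩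
      exact hn
    · rintro n ⟨θ, hθ, hinv, ⟨V, hV, rfl, hs⟩, hn⟩ h hh
      rw [simple_iff_irr] at hθ hV
      subst hF
      exact Stp.recd (S := S) h2 hq hq9 hab hh hθ (mkStp_inv S θ hθ hinv) hV (over_of_sum θ V hs) hn

end B1

/-- Let `q ≥ 7`, `q ≠ 9` be a prime power and `G` a finite group satisfying the two-prime
hypothesis with normal subgroups `N ≤ M` such that `M/N ≅ PSL₂(q)` and the centralizer of
`M/N` in `G/N` is trivial.  Then the union `B₁`, over all `M`-invariant irreducible
characters `θ` of `N`, of `cd(G|θ) \ cd(G/N)`, has at most `4` elements. -/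
theorem B1_bound_psl2
    (q : ℕ) (hq : 7 ≤ q) (hq9 : q ≠ 9) (hpp : IsPrimePow q)
    (F : Type) [Field F] [Fintype F] (hF : Fintype.card F = q)
    (G : Type) [Group G] [Finite G] (hG : TwoPrimeHypothesis G)
    (N M : Subgroup G) [N.Normal] [M.Normal] (hNM : N ≤ M)
    (hiso : Nonempty ((M.map (QuotientGroup.mk' N)) ≃* PSL2 F))
    (hcent : Subgroup.centralizer ((M.map (QuotientGroup.mk' N)) : Set (G ⧸ N)) = ⊥) :
    {n | ∃ θ : FDRep ℂ N, Simple θ ∧ IsMInvariant M θ ∧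
      n ∈ charDegreesOver G N θ ∧ n ∉ charDegrees (G ⧸ N)}.ncard ≤ 4 := by
  exact B1.main hq hq9 hF hG N M hNM hiso hcent
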